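/- Let f, g ∈ ℂ[x, y, z] be squarefree polynomials with f(0) = g(0) = 0, defining complex analytic surfaces V(f), V(g) ⊆ ℂ³. If the germs of V(f) and V(g) at the origin are outer bi-Lipschitz homeomorphic, then the multiplicities agree: the least d such that the degree-d homogeneous component of f is nonzero equals the least d such that the degree-d homogeneous component of g is nonzero. -/

import Mathlib

open Filter Topology MvPolynomial

/-- The tangent cone at infinity of a subset `A` of a normed space: `v` is a tangent
vector at infinity if there are points `x i ∈ A` with `‖x i‖ → ∞` and positive reals
`t i` with `x i / t i → v`. -/
def TangentConeAtInfty {E : Type*} [NormedAddCommGroup E] [NormedSpace ℝ E]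
    (A : Set E) : Set E :=
  {v | ∃ (x : ℕ → E) (t : ℕ → ℝ), (∀ i, x i ∈ A) ∧ (∀ i, 0 < t i) ∧
    Tendsto (fun i => ‖x i‖) atTop atTop ∧
    Tendsto (fun i => (t i)⁻¹ • x i) atTop (𝓝 v)}

/-- `X` and `Y` are outer bi-Lipschitz homeomorphic at infinity: there are compact sets
`K`, `K'` and a bijection `φ : X \ K → Y \ K'` which is Lipschitz with Lipschitz inverse,
with respect to the Euclidean (outer) distance. -/
def OuterBiLipAtInfty {E F : Type*} [NormedAddCommGroup E] [NormedAddCommGroup F]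
    (X : Set E) (Y : Set F) : Prop :=
  ∃ (K : Set E) (K' : Set F) (φ : E → F),
    IsCompact K ∧ IsCompact K' ∧ Set.BijOn φ (X \ K) (Y \ K') ∧
    (∃ C > (0:ℝ), ∀ a ∈ X \ K, ∀ b ∈ X \ K, dist (φ a) (φ b) ≤ C * dist a b) ∧
    (∃ c > (0:ℝ), ∀ a ∈ X \ K, ∀ b ∈ X \ K, dist a b ≤ c * dist (φ a) (φ b))

/-- The germs `(X,0)` and `(Y,0)` are outer bi-Lipschitz homeomorphic: there are
`ε, δ > 0` and a bijection `φ : X ∩ B̄_ε(0) → Y ∩ B̄_δ(0)` with `φ 0 = 0` which is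
Lipschitz with Lipschitz inverse for the Euclidean (outer) distance. -/
def OuterBiLipGerm {E F : Type*} [NormedAddCommGroup E] [NormedAddCommGroup F]
    (X : Set E) (Y : Set F) : Prop :=
  ∃ ε > (0:ℝ), ∃ δ > (0:ℝ), ∃ φ : E → F,
    Set.BijOn φ (X ∩ Metric.closedBall 0 ε) (Y ∩ Metric.closedBall 0 δ) ∧ φ 0 = 0 ∧
    (∃ C > (0:ℝ), ∀ a ∈ X ∩ Metric.closedBall 0 ε, ∀ b ∈ X ∩ Metric.closedBall 0 ε,
      dist (φ a) (φ b) ≤ C * dist a b) ∧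
    (∃ c > (0:ℝ), ∀ a ∈ X ∩ Metric.closedBall 0 ε, ∀ b ∈ X ∩ Metric.closedBall 0 ε,
      dist a b ≤ c * dist (φ a) (φ b))

/-- The zero set in `ℂⁿ` (with the Euclidean norm) of a polynomial. -/
noncomputable def mvZeroSet {n : ℕ} (f : MvPolynomial (Fin n) ℂ) :
    Set (EuclideanSpace ℂ (Fin n)) :=
  {x | MvPolynomial.eval (x : Fin n → ℂ) f = 0}

set_option linter.unusedSectionVars false

/-! ### Cochains up to germs at the diagonal -/

section NearDiagonal

variable {α β A B : Type*} [TopologicalSpace α] [TopologicalSpace β]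
  [AddCommGroup A] [AddCommGroup B]

/-- The relation `P` holds for all sufficiently close pairs of points of `S`. -/
def NearDiag (S : Set α) (P : α → α → Prop) : Prop :=
  ∀ p ∈ S, ∀ᶠ q in 𝓝[S] p ×ˢ 𝓝[S] p, P q.1 q.2

/-- The cochain `c` is, near the diagonal of `S`, the coboundary of `b`. -/
def IsPrim (S : Set α) (c : α → α → A) (b : α → A) : Prop :=
  NearDiag S fun x y => c x y = b y - b x

/-- `c` is an Alexander–Spanier `1`-cocycle on `S`: it is locally a coboundary. -/
def IsCoc (S : Set α) (c : α → α → A) : Prop :=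
  ∀ p ∈ S, ∃ b : α → A, ∀ᶠ q in 𝓝[S] p ×ˢ 𝓝[S] p, c q.1 q.2 = b q.2 - b q.1

lemma NearDiag.and {S : Set α} {P Q : α → α → Prop} (h : NearDiag S P) (h' : NearDiag S Q) :
    NearDiag S fun x y => P x y ∧ Q x y := fun p hp => (h p hp).and (h' p hp)

lemma NearDiag.imp {S : Set α} {P Q : α → α → Prop} (h : NearDiag S P)
    (h' : ∀ x ∈ S, ∀ y ∈ S, P x y → Q x y) : NearDiag S Q := by
  intro p hp
  have h1 : ∀ᶠ q in 𝓝[S] p ×ˢ 𝓝[S] p, q ∈ S ×ˢ S :=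
    prod_mem_prod self_mem_nhdsWithin self_mem_nhdsWithin
  filter_upwards [h p hp, h1] with q hq hq1
  exact h' _ hq1.1 _ hq1.2 hq

lemma NearDiag.of_forall {S : Set α} {P : α → α → Prop} (h : ∀ x ∈ S, ∀ y ∈ S, P x y) :
    NearDiag S P :=
  NearDiag.imp (P := fun _ _ => True) (fun _ _ => by simp) fun x hx y hy _ => h x hx y hy

lemma NearDiag.mono {S T : Set α} {P : α → α → Prop} (h : NearDiag S P) (hT : T ⊆ S) :
    NearDiag T P := fun p hp =>
  (h p (hT hp)).filter_mono (Filter.prod_mono (nhdsWithin_mono _ hT) (nhdsWithin_mono _ hT))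

lemma ContinuousOn.tendsto_nhdsWithin_mapsTo {f : α → β} {S : Set α} {T : Set β}
    (hf : ContinuousOn f S) (hm : Set.MapsTo f S T) {p : α} (hp : p ∈ S) :
    Tendsto f (𝓝[S] p) (𝓝[T] (f p)) :=
  (hf p hp).tendsto_nhdsWithin hm

lemma NearDiag.comp {f : α → β} {S : Set α} {T : Set β} {P : β → β → Prop}
    (h : NearDiag T P) (hf : ContinuousOn f S) (hm : Set.MapsTo f S T) :
    NearDiag S fun x y => P (f x) (f y) := fun p hp =>
  ((hf.tendsto_nhdsWithin_mapsTo hm hp).prodMap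
    (hf.tendsto_nhdsWithin_mapsTo hm hp)).eventually (h (f p) (hm hp))

lemma NearDiag.exists_nhds {S : Set α} {P : α → α → Prop} (h : NearDiag S P) {p : α}
    (hp : p ∈ S) : ∃ U ∈ 𝓝[S] p, ∀ x ∈ U, ∀ y ∈ U, P x y :=
  eventually_prod_self_iff.1 (h p hp)

lemma NearDiag.of_nhds {S : Set α} {P : α → α → Prop}
    (h : ∀ p ∈ S, ∃ U ∈ 𝓝[S] p, ∀ x ∈ U, ∀ y ∈ U, P x y) : NearDiag S P :=
  fun p hp => eventually_prod_self_iff.2 (h p hp)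

lemma NearDiag.symm {S : Set α} {P : α → α → Prop} (h : NearDiag S P) :
    NearDiag S fun x y => P y x :=
  .of_nhds fun p hp => by
    obtain ⟨U, hU, h1⟩ := h.exists_nhds hp
    exact ⟨U, hU, fun x hx y hy => h1 y hy x hx⟩

lemma NearDiag.self {S : Set α} {P : α → α → Prop} (h : NearDiag S P) {p : α}
    (hp : p ∈ S) : P p p := by
  obtain ⟨U, hU, h1⟩ := h.exists_nhds hp
  exact h1 p (mem_of_mem_nhdsWithin hp hU) p (mem_of_mem_nhdsWithin hp hU)

lemma IsPrim.isCoc {S : Set α} {c : α → α → A} {b : α → A} (h : IsPrim S c b) : IsCoc S c :=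
  fun p hp => ⟨b, h p hp⟩

lemma IsCoc.exists_nhds {S : Set α} {c : α → α → A} (h : IsCoc S c) {p : α}
    (hp : p ∈ S) : ∃ b : α → A, ∃ U ∈ 𝓝[S] p, ∀ x ∈ U, ∀ y ∈ U, c x y = b y - b x := by
  obtain ⟨b, hb⟩ := h p hp
  exact ⟨b, eventually_prod_self_iff (r := fun x y => c x y = b y - b x).1 hb⟩

lemma IsCoc.of_nhds {S : Set α} {c : α → α → A}
    (h : ∀ p ∈ S, ∃ b : α → A, ∃ U ∈ 𝓝[S] p, ∀ x ∈ U, ∀ y ∈ U, c x y = b y - b x) :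
    IsCoc S c := fun p hp => by
  obtain ⟨b, hb⟩ := h p hp
  exact ⟨b, eventually_prod_self_iff (r := fun x y => c x y = b y - b x).2 hb⟩

lemma IsCoc.mono {S T : Set α} {c : α → α → A} (h : IsCoc S c) (hT : T ⊆ S) : IsCoc T c :=
  fun p hp => (h p (hT hp)).imp fun _ hb =>
    hb.filter_mono (Filter.prod_mono (nhdsWithin_mono _ hT) (nhdsWithin_mono _ hT))

lemma IsCoc.comp {f : α → β} {S : Set α} {T : Set β} {c : β → β → A}
    (h : IsCoc T c) (hf : ContinuousOn f S) (hm : Set.MapsTo f S T) :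
    IsCoc S fun x y => c (f x) (f y) := fun p hp => by
  obtain ⟨b, hb⟩ := h (f p) (hm hp)
  exact ⟨fun x => b (f x), ((hf.tendsto_nhdsWithin_mapsTo hm hp).prodMap
    (hf.tendsto_nhdsWithin_mapsTo hm hp)).eventually hb⟩

lemma IsCoc.map {S : Set α} {c : α → α → A} (h : IsCoc S c) (φ : A →+ B) :
    IsCoc S fun x y => φ (c x y) := fun p hp => by
  obtain ⟨b, hb⟩ := h p hp
  refine ⟨fun x => φ (b x), hb.mono fun q hq => ?_⟩
  simp [hq]

lemma IsPrim.map {S : Set α} {c : α → α → A} {b : α → A} (h : IsPrim S c b) (φ : A →+ B) :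
    IsPrim S (fun x y => φ (c x y)) fun x => φ (b x) :=
  h.imp fun x _ y _ h => by simp [h]

lemma IsPrim.comp {f : α → β} {S : Set α} {T : Set β} {c : β → β → A} {b : β → A}
    (h : IsPrim T c b) (hf : ContinuousOn f S) (hm : Set.MapsTo f S T) :
    IsPrim S (fun x y => c (f x) (f y)) fun x => b (f x) :=
  NearDiag.comp h hf hm

lemma IsCoc.add {S : Set α} {c c' : α → α → A} (h : IsCoc S c) (h' : IsCoc S c') :
    IsCoc S fun x y => c x y + c' x y := fun p hp => by
  obtain ⟨b, hb⟩ := h p hp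
  obtain ⟨b', hb'⟩ := h' p hp
  refine ⟨fun x => b x + b' x, (hb.and hb').mono fun q hq => ?_⟩
  simp only [hq.1, hq.2]; abel

lemma IsCoc.sub {S : Set α} {c c' : α → α → A} (h : IsCoc S c) (h' : IsCoc S c') :
    IsCoc S fun x y => c x y - c' x y := fun p hp => by
  obtain ⟨b, hb⟩ := h p hp
  obtain ⟨b', hb'⟩ := h' p hp
  refine ⟨fun x => b x - b' x, (hb.and hb').mono fun q hq => ?_⟩
  simp only [hq.1, hq.2]; abel

lemma IsPrim.add {S : Set α} {c c' : α → α → A} {b b' : α → A} (h : IsPrim S c b)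
    (h' : IsPrim S c' b') : IsPrim S (fun x y => c x y + c' x y) fun x => b x + b' x :=
  (NearDiag.and h h').imp fun x _ y _ h => by simp only [h.1, h.2]; abel

lemma IsPrim.sub {S : Set α} {c c' : α → α → A} {b b' : α → A} (h : IsPrim S c b)
    (h' : IsPrim S c' b') : IsPrim S (fun x y => c x y - c' x y) fun x => b x - b' x :=
  (NearDiag.and h h').imp fun x _ y _ h => by simp only [h.1, h.2]; abel

lemma isPrim_cob (S : Set α) (b : α → A) : IsPrim S (fun x y => b y - b x) b :=
  .of_forall fun _ _ _ _ => rfl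

lemma IsPrim.congr {S : Set α} {c c' : α → α → A} {b : α → A} (h : IsPrim S c b)
    (h' : NearDiag S fun x y => c' x y = c x y) : IsPrim S c' b :=
  (NearDiag.and h h').imp fun x _ y _ h => by rw [h.2, h.1]

lemma IsCoc.congr {S : Set α} {c c' : α → α → A} (h : IsCoc S c)
    (h' : NearDiag S fun x y => c' x y = c x y) : IsCoc S c' := fun p hp => by
  obtain ⟨b, hb⟩ := h p hp
  exact ⟨b, (hb.and (h' p hp)).mono fun q hq => by rw [hq.2, hq.1]⟩

lemma IsCoc.self {S : Set α} {c : α → α → A} (h : IsCoc S c) {p : α} (hp : p ∈ S) :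
    c p p = 0 := by
  obtain ⟨b, U, hU, h1⟩ := h.exists_nhds hp
  rw [h1 p (mem_of_mem_nhdsWithin hp hU) p (mem_of_mem_nhdsWithin hp hU), sub_self]

/-- Functions which are locally constant on a preconnected set are constant on it. -/
lemma NearDiag.eq_of_isPreconnected {γ : Type*} {S : Set α} (hS : IsPreconnected S) {f : α → γ}
    (h : NearDiag S fun x y => f x = f y) {x y : α} (hx : x ∈ S) (hy : y ∈ S) : f x = f y := by
  refine hS.induction₂ (fun x y => f x = f y) (fun p hp => ?_) (fun _ _ _ _ _ _ h h' => h.trans h')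
    (fun _ _ _ _ h => h.symm) hx hy
  obtain ⟨U, hU, h1⟩ := h.exists_nhds hp
  filter_upwards [hU] with q hq
  exact h1 _ (mem_of_mem_nhdsWithin hp hU) _ hq

lemma IsPrim.sub_eq_sub {S : Set α} (hS : IsPreconnected S) {c : α → α → A} {b b' : α → A}
    (h : IsPrim S c b) (h' : IsPrim S c b') {x y : α} (hx : x ∈ S) (hy : y ∈ S) :
    b y - b x = b' y - b' x := by
  have h1 : NearDiag S fun x y => b x - b' x = b y - b' y :=
    (NearDiag.and h h').imp fun x _ y _ h => by
      have := h.1.symm.trans h.2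
      rw [sub_eq_sub_iff_add_eq_add] at this ⊢
      rw [add_comm, ← this, add_comm]
  have := h1.eq_of_isPreconnected hS hx hy
  rw [sub_eq_sub_iff_add_eq_add] at this ⊢
  rw [← this, add_comm]

end NearDiagonal

section Convex

variable {E : Type*} [NormedAddCommGroup E] [NormedSpace ℝ E]

/-- A locally trivial (non-abelian) cocycle on a compact convex set is trivial. -/
lemma exists_group_primitive {G : Type*} [Group G] {K : Set E} (hK : IsCompact K)
    (hc : Convex ℝ K) {c : E → E → G}
    (h : ∀ p ∈ K, ∃ b : E → G, ∀ᶠ q in 𝓝[K] p ×ˢ 𝓝[K] p, c q.1 q.2 = (b q.1)⁻¹ * b q.2) :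
    ∃ b : E → G, NearDiag K fun x y => c x y = (b x)⁻¹ * b y := by
  classical
  rcases K.eq_empty_or_nonempty with rfl | ⟨k0, hk0⟩
  · exact ⟨fun _ => 1, fun p hp => hp.elim⟩
  have h2 : ∀ p : K, ∃ ε > 0, ∃ b : E → G, ∀ x ∈ Metric.ball p.1 ε ∩ K,
      ∀ y ∈ Metric.ball p.1 ε ∩ K, c x y = (b x)⁻¹ * b y := by
    rintro ⟨p, hp⟩
    obtain ⟨b, hb⟩ := h p hp
    obtain ⟨U, hU, h1⟩ := (eventually_prod_self_iff (r := fun x y => c x y = (b x)⁻¹ * b y)).1 hb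
    obtain ⟨ε, hε, hs⟩ := Metric.mem_nhdsWithin_iff.1 hU
    exact ⟨ε, hε, b, fun x hx y hy => h1 x (hs hx) y (hs hy)⟩
  choose ε hε b hb using h2
  obtain ⟨δ, hδ, hδ'⟩ := lebesgue_number_lemma_of_metric (c := fun p : K => Metric.ball p.1 (ε p))
    hK (fun _ => Metric.isOpen_ball)
    (fun x hx => Set.mem_iUnion.2 ⟨⟨x, hx⟩, Metric.mem_ball_self (hε _)⟩)
  have key : ∀ x ∈ K, ∃ b : E → G, ∀ y ∈ K, dist y x < δ → ∀ z ∈ K, dist z x < δ →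
      c y z = (b y)⁻¹ * b z := by
    intro x hx
    obtain ⟨i, hi⟩ := hδ' x hx
    exact ⟨b i, fun y hy hy' z hz hz' => hb i y ⟨hi hy', hy⟩ z ⟨hi hz', hz⟩⟩
  obtain ⟨M, hM⟩ := hK.isBounded.exists_norm_le
  have hM0 : 0 ≤ M := (norm_nonneg _).trans (hM k0 hk0)
  obtain ⟨N, hN⟩ := exists_nat_gt (4 * M / δ)
  have hNpos : (0 : ℝ) < N := lt_of_le_of_lt (by positivity) hN
  let pt : E → ℕ → E := fun k i => k0 + ((i : ℝ) / N) • (k - k0)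
  have hpt : ∀ k ∈ K, ∀ i ≤ N, pt k i ∈ K := fun k hk i hi => by
    refine hc.add_smul_sub_mem hk0 hk ⟨by positivity, ?_⟩
    rw [div_le_one hNpos]; exact_mod_cast hi
  have hstep : ∀ k ∈ K, ∀ i, dist (pt k (i + 1)) (pt k i) < δ / 2 := fun k hk i => by
    have : pt k (i + 1) - pt k i = ((1 : ℝ) / N) • (k - k0) := by
      simp only [pt, add_sub_add_left_eq_sub, ← sub_smul]
      congr 1; push_cast; ring
    rw [dist_eq_norm, this, norm_smul, Real.norm_of_nonneg (by positivity)]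
    have h3 : ‖k - k0‖ ≤ 2 * M := (norm_sub_le _ _).trans (by linarith [hM k hk, hM k0 hk0])
    have h4 : 4 * M < N * δ := by rwa [div_lt_iff₀ hδ] at hN
    rw [one_div, inv_mul_lt_iff₀ hNpos]
    linarith
  have hclose : ∀ k k', ∀ i ≤ N, dist (pt k' i) (pt k i) ≤ dist k' k := fun k k' i hi => by
    have : pt k' i - pt k i = ((i : ℝ) / N) • (k' - k) := by
      simp only [pt, add_sub_add_left_eq_sub, ← smul_sub]; congr 1; abel
    rw [dist_eq_norm, this, norm_smul, Real.norm_of_nonneg (by positivity), dist_eq_norm]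
    refine mul_le_of_le_one_left (norm_nonneg _) ?_
    rw [div_le_one hNpos]; exact_mod_cast hi
  let g : E → ℕ → G := fun k i => Nat.rec 1 (fun j r => r * c (pt k j) (pt k (j + 1))) i
  have main : ∀ k ∈ K, ∀ k' ∈ K, dist k' k < δ / 2 → ∀ i ≤ N,
      g k' i = g k i * c (pt k i) (pt k' i) := by
    intro k hk k' hk' hkk i
    induction i with
    | zero =>
      intro _
      obtain ⟨b, hb⟩ := key k0 hk0
      have : c k0 k0 = 1 := by
        rw [hb k0 hk0 (by simpa using hδ) k0 hk0 (by simpa using hδ)]; simp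
      simp [g, pt, this]
    | succ i ih =>
      intro hi
      have hi' : i ≤ N := by omega
      have e1 : g k' (i + 1) = g k' i * c (pt k' i) (pt k' (i + 1)) := rfl
      have e2 : g k (i + 1) = g k i * c (pt k i) (pt k (i + 1)) := rfl
      rw [e1, e2, ih hi']
      obtain ⟨b, hb⟩ := key (pt k i) (hpt k hk i hi')
      have d1 := hclose k k' i hi'
      have d2 := hstep k hk i
      have d3 := hstep k' hk' i
      have d4 : dist (pt k' (i + 1)) (pt k i) < δ :=
        (dist_triangle _ (pt k' i) _).trans_lt (by linarith)
      have d0 : dist (pt k i) (pt k i) < δ := by simpa using hδ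
      have m0 := hpt k hk i hi'
      have m1 := hpt k' hk' i hi'
      have m2 := hpt k hk (i + 1) hi
      have m3 := hpt k' hk' (i + 1) hi
      rw [hb _ m0 d0 _ m1 (by linarith), hb _ m1 (by linarith) _ m3 d4,
        hb _ m0 d0 _ m2 (by linarith), hb _ m2 (by linarith) _ m3 d4]
      group
  refine ⟨fun k => g k N, .of_nhds fun p hp => ⟨Metric.ball p (δ / 4) ∩ K,
    Filter.inter_mem (mem_nhdsWithin_of_mem_nhds (Metric.ball_mem_nhds _ (by linarith)))
      self_mem_nhdsWithin, fun x hx y hy => ?_⟩⟩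
  have hxy : dist y x < δ / 2 := by
    have := dist_triangle_right y x p
    have h3 := hx.1; have h4 := hy.1
    rw [Metric.mem_ball] at h3 h4
    linarith
  have hN1 : ∀ k, pt k N = k := fun k => by simp [pt, div_self hNpos.ne']
  change c x y = (g x N)⁻¹ * g y N
  rw [main x hx.2 y hy.2 hxy N le_rfl, hN1, hN1]
  group

lemma IsCoc.exists_isPrim {A : Type*} [AddCommGroup A] {K : Set E} (hK : IsCompact K)
    (hc : Convex ℝ K) {c : E → E → A} (h : IsCoc K c) : ∃ b, IsPrim K c b := by
  obtain ⟨b, hb⟩ := exists_group_primitive (G := Multiplicative A) hK hc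
    (c := fun x y => Multiplicative.ofAdd (c x y)) fun p hp => by
      obtain ⟨b, hb⟩ := h p hp
      refine ⟨fun x => Multiplicative.ofAdd (b x), hb.mono fun q hq => ?_⟩
      rw [hq, sub_eq_neg_add]; rfl
  refine ⟨fun x => (b x).toAdd, hb.imp fun x _ y _ h => ?_⟩
  have := congrArg Multiplicative.toAdd h
  rw [sub_eq_neg_add]; exact this

end Convex

section Product

variable {E β A : Type*} [NormedAddCommGroup E] [NormedSpace ℝ E] [TopologicalSpace β]
  [AddCommGroup A]

lemma IsCoc.exists_tube {K : Set E} (hK : IsCompact K) {S : Set β} {c : E × β → E × β → A}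
    (h : IsCoc (K ×ˢ S) c) {e : β} (he : e ∈ S) :
    ∃ U ∈ 𝓝[S] e, ∀ k ∈ K, ∃ r > 0, ∃ b : E × β → A, ∀ p ∈ (Metric.ball k r ∩ K) ×ˢ U,
      ∀ q ∈ (Metric.ball k r ∩ K) ×ˢ U, c p q = b q - b p := by
  refine hK.induction_on (p := fun s => ∃ U ∈ 𝓝[S] e, ∀ k ∈ s, ∃ r > 0, ∃ b : E × β → A,
    ∀ p ∈ (Metric.ball k r ∩ K) ×ˢ U, ∀ q ∈ (Metric.ball k r ∩ K) ×ˢ U, c p q = b q - b p)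
    ⟨S, self_mem_nhdsWithin, by simp⟩ ?_ ?_ ?_
  · rintro s t hst ⟨U, hU, hU'⟩
    exact ⟨U, hU, fun k hk => hU' k (hst hk)⟩
  · rintro s t ⟨U, hU, hU'⟩ ⟨V, hV, hV'⟩
    refine ⟨U ∩ V, Filter.inter_mem hU hV, fun k hk => ?_⟩
    rcases hk with hk | hk
    · obtain ⟨r, hr, b, hb⟩ := hU' k hk
      exact ⟨r, hr, b, fun p hp q hq => hb p ⟨hp.1, hp.2.1⟩ q ⟨hq.1, hq.2.1⟩⟩
    · obtain ⟨r, hr, b, hb⟩ := hV' k hk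
      exact ⟨r, hr, b, fun p hp q hq => hb p ⟨hp.1, hp.2.2⟩ q ⟨hq.1, hq.2.2⟩⟩
  · intro x hx
    obtain ⟨b, W, hW, hb⟩ := h.exists_nhds (p := (x, e)) ⟨hx, he⟩
    rw [nhdsWithin_prod_eq, Filter.mem_prod_iff] at hW
    obtain ⟨V0, hV0, U0, hU0, hsub⟩ := hW
    obtain ⟨ε, hε, hs⟩ := Metric.mem_nhdsWithin_iff.1 hV0
    refine ⟨Metric.ball x (ε / 2), mem_nhdsWithin_of_mem_nhds (Metric.ball_mem_nhds _ (by linarith)),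
      U0, hU0, fun k hk => ⟨ε / 2, by linarith, b, fun p hp q hq => ?_⟩⟩
    have : ∀ p ∈ (Metric.ball k (ε / 2) ∩ K) ×ˢ U0, p ∈ W := fun p hp => by
      refine hsub ⟨hs ⟨?_, hp.1.2⟩, hp.2⟩
      have h1 := hp.1.1
      rw [Metric.mem_ball] at h1 hk ⊢
      linarith [dist_triangle p.1 k x]
    exact hb p (this p hp) q (this q hq)

/-- A cocycle on `K × S`, with `K` compact convex, is the pullback of its restriction to
`{k₀} × S` up to a coboundary. -/
lemma IsCoc.exists_product {K : Set E} (hK : IsCompact K) (hc : Convex ℝ K) {S : Set β}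
    {c : E × β → E × β → A} (h : IsCoc (K ×ˢ S) c) {k0 : E} (hk0 : k0 ∈ K) :
    ∃ b : E × β → A, (∀ e, b (k0, e) = 0) ∧ NearDiag (K ×ˢ S) fun p q =>
      c p q = c (k0, p.2) (k0, q.2) + b q - b p := by
  have h1 : ∀ e, ∃ b : E → A, b k0 = 0 ∧ (e ∈ S → IsPrim K (fun x y => c (x, e) (y, e)) b) := by
    intro e
    by_cases he : e ∈ S
    · have h2 : IsCoc K fun x y => c (x, e) (y, e) :=
        h.comp (f := fun x => (x, e)) (by fun_prop) fun x hx => ⟨hx, he⟩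
      obtain ⟨b, hb⟩ := h2.exists_isPrim hK hc
      exact ⟨fun x => b x - b k0, by simp, fun _ => hb.imp fun x _ y _ h => by simp only at h ⊢; grind⟩
    · exact ⟨fun _ => 0, rfl, fun h => (he h).elim⟩
  choose b hb0 hb using h1
  refine ⟨fun p => b p.2 p.1, hb0, .of_nhds ?_⟩
  rintro ⟨k, e⟩ ⟨hk, he⟩
  obtain ⟨U, hU, hT⟩ := h.exists_tube hK he
  have hg : ∀ e' ∈ U ∩ S, ∀ e'' ∈ U ∩ S, ∀ x ∈ K, ∀ y ∈ K,
      c (x, e') (x, e'') - b e'' x + b e' x = c (y, e') (y, e'') - b e'' y + b e' y := by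
    intro e' he' e'' he'' x hx y hy
    refine NearDiag.eq_of_isPreconnected (f := fun x => c (x, e') (x, e'') - b e'' x + b e' x)
      hc.isPreconnected (.of_nhds fun k hk => ?_) hx hy
    obtain ⟨r, hr, g, hg⟩ := hT k hk
    obtain ⟨U1, hU1, h1⟩ := (hb e' he'.2).exists_nhds hk
    obtain ⟨U2, hU2, h2⟩ := (hb e'' he''.2).exists_nhds hk
    refine ⟨(Metric.ball k r ∩ K) ∩ (U1 ∩ U2), Filter.inter_mem (Filter.inter_mem
      (mem_nhdsWithin_of_mem_nhds (Metric.ball_mem_nhds _ hr)) self_mem_nhdsWithin)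
      (Filter.inter_mem hU1 hU2), fun x hx y hy => ?_⟩
    have e1 := hg (x, e') ⟨hx.1, he'.1⟩ (x, e'') ⟨hx.1, he''.1⟩
    have e2 := hg (y, e') ⟨hy.1, he'.1⟩ (y, e'') ⟨hy.1, he''.1⟩
    have e3 := hg (x, e') ⟨hx.1, he'.1⟩ (y, e') ⟨hy.1, he'.1⟩
    have e4 := hg (x, e'') ⟨hx.1, he''.1⟩ (y, e'') ⟨hy.1, he''.1⟩
    have e5 := h1 x hx.2.1 y hy.2.1
    have e6 := h2 x hx.2.2 y hy.2.2
    simp only at e5 e6 ⊢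
    grind
  obtain ⟨r, hr, g, hg'⟩ := hT k hk
  refine ⟨(Metric.ball k r ∩ K) ×ˢ (U ∩ S), ?_, ?_⟩
  · rw [nhdsWithin_prod_eq]
    exact prod_mem_prod (Filter.inter_mem (mem_nhdsWithin_of_mem_nhds
      (Metric.ball_mem_nhds _ hr)) self_mem_nhdsWithin) (Filter.inter_mem hU self_mem_nhdsWithin)
  rintro ⟨x, e'⟩ ⟨hx, he'⟩ ⟨y, e''⟩ ⟨hy, he''⟩
  simp only at hx hy he' he''
  have e1 := hg' (x, e') ⟨hx, he'.1⟩ (y, e'') ⟨hy, he''.1⟩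
  have e2 := hg e' he' e'' he'' k0 hk0 x hx.2
  have e3 := hg' (x, e') ⟨hx, he'.1⟩ (x, e'') ⟨hx, he''.1⟩
  have e4 : b e'' y - b e'' x = g (y, e'') - g (x, e'') := by
    refine IsPrim.sub_eq_sub (S := Metric.ball k r ∩ K) (c := fun x y => c (x, e'') (y, e''))
      (b := b e'') (b' := fun x => g (x, e'')) ((convex_ball _ _).inter hc).isPreconnected
      ((hb e'' he''.2).mono Set.inter_subset_right) (.of_forall fun x hx y hy => ?_) hx hy
    exact hg' _ ⟨hx, he''.1⟩ _ ⟨hy, he''.1⟩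
  rw [hb0, hb0] at e2
  simp only at e1 e2 e3 e4 ⊢
  grind

end Product

section Integral

variable {α β A B : Type*} [TopologicalSpace α] [TopologicalSpace β] [AddCommGroup A]
  [AddCommGroup B]

/-- `v` is the integral of the cochain `c` along the path `γ : [0,1] → α`. -/
def HasPathInt (c : α → α → A) (γ : ℝ → α) (v : A) : Prop :=
  ∃ b : ℝ → A, IsPrim (Set.Icc 0 1) (fun s t => c (γ s) (γ t)) b ∧ v = b 1 - b 0

lemma HasPathInt.unique {c : α → α → A} {γ : ℝ → α} {v v' : A} (h : HasPathInt c γ v)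
    (h' : HasPathInt c γ v') : v = v' := by
  obtain ⟨b, hb, rfl⟩ := h
  obtain ⟨b', hb', rfl⟩ := h'
  exact IsPrim.sub_eq_sub isPreconnected_Icc hb hb' (by simp) (by simp)

lemma IsCoc.exists_hasPathInt {S : Set α} {c : α → α → A} (h : IsCoc S c) {γ : ℝ → α}
    (hγ : ContinuousOn γ (Set.Icc 0 1)) (hm : Set.MapsTo γ (Set.Icc 0 1) S) :
    ∃ v, HasPathInt c γ v := by
  obtain ⟨b, hb⟩ := (h.comp hγ hm).exists_isPrim isCompact_Icc (convex_Icc _ _)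
  exact ⟨_, b, hb, rfl⟩

lemma HasPathInt.map {c : α → α → A} {γ : ℝ → α} {v : A} (h : HasPathInt c γ v) (φ : A →+ B) :
    HasPathInt (fun x y => φ (c x y)) γ (φ v) := by
  obtain ⟨b, hb, rfl⟩ := h
  exact ⟨_, hb.map φ, by simp⟩

lemma HasPathInt.add {c c' : α → α → A} {γ : ℝ → α} {v v' : A} (h : HasPathInt c γ v)
    (h' : HasPathInt c' γ v') : HasPathInt (fun x y => c x y + c' x y) γ (v + v') := by
  obtain ⟨b, hb, rfl⟩ := h
  obtain ⟨b', hb', rfl⟩ := h'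
  exact ⟨_, hb.add hb', by abel⟩

lemma HasPathInt.sub {c c' : α → α → A} {γ : ℝ → α} {v v' : A} (h : HasPathInt c γ v)
    (h' : HasPathInt c' γ v') : HasPathInt (fun x y => c x y - c' x y) γ (v - v') := by
  obtain ⟨b, hb, rfl⟩ := h
  obtain ⟨b', hb', rfl⟩ := h'
  exact ⟨_, hb.sub hb', by abel⟩

lemma HasPathInt.congr {S : Set α} {c c' : α → α → A} {γ : ℝ → α} {v : A}
    (h : HasPathInt c γ v) (h' : NearDiag S fun x y => c' x y = c x y)
    (hγ : ContinuousOn γ (Set.Icc 0 1)) (hm : Set.MapsTo γ (Set.Icc 0 1) S) :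
    HasPathInt c' γ v := by
  obtain ⟨b, hb, rfl⟩ := h
  exact ⟨b, hb.congr (h'.comp hγ hm), rfl⟩

lemma IsPrim.hasPathInt {S : Set α} {c : α → α → A} {b : α → A} (h : IsPrim S c b) {γ : ℝ → α}
    (hγ : ContinuousOn γ (Set.Icc 0 1)) (hm : Set.MapsTo γ (Set.Icc 0 1) S) :
    HasPathInt c γ (b (γ 1) - b (γ 0)) := ⟨_, h.comp hγ hm, rfl⟩

/-- Integrals along a continuous family of loops, parametrised by a preconnected set, agree. -/
lemma IsCoc.hasPathInt_homotopy {S : Set α} {c : α → α → A} (h : IsCoc S c) {T : Set β}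
    (hT : IsPreconnected T) {H : ℝ × β → α} (hH : ContinuousOn H (Set.Icc 0 1 ×ˢ T))
    (hm : Set.MapsTo H (Set.Icc 0 1 ×ˢ T) S) (hloop : ∀ t ∈ T, H (0, t) = H (1, t))
    {t t' : β} (ht : t ∈ T) (ht' : t' ∈ T) {v : A} (hv : HasPathInt c (fun s => H (s, t)) v) :
    HasPathInt c (fun s => H (s, t')) v := by
  obtain ⟨b, hb0, hb⟩ := (h.comp hH hm).exists_product isCompact_Icc (convex_Icc _ _) (k0 := 0)
    (by simp)
  have h1 : ∀ t ∈ T, HasPathInt c (fun s => H (s, t)) (b (1, t)) := by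
    intro t ht
    refine ⟨fun s => b (s, t), ?_, by simp [hb0]⟩
    have h2 := hb.comp (f := fun s : ℝ => (s, t)) (S := Set.Icc 0 1) (by fun_prop)
      (fun x hx => ⟨hx, ht⟩)
    refine h2.imp fun x hx y hy h3 => ?_
    simp only at h3 ⊢
    rw [h3, h.self (hm (x := (0, t)) ⟨by simp, ht⟩), zero_add]
  have h2 : NearDiag T fun t t' => b (1, t) = b (1, t') := by
    have h2 := hb.comp (f := fun t : β => ((1 : ℝ), t)) (S := T) (by fun_prop)
      (fun x hx => ⟨by simp, hx⟩)
    refine h2.imp fun x hx y hy h3 => ?_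
    simp only at h3 ⊢
    rw [← hloop x hx, ← hloop y hy, add_sub_assoc, left_eq_add, sub_eq_zero] at h3
    exact h3.symm
  rw [hv.unique (h1 t ht), h2.eq_of_isPreconnected hT ht ht']
  exact h1 t' ht'

end Integral

section Cstar

variable {β A : Type*} [TopologicalSpace β] [AddCommGroup A]

/-- A cocycle on `ℂˣ × S` whose integrals along the circles vanish is the
pullback of its restriction to `{1} × S` up to a coboundary. -/
lemma IsCoc.exists_punctured_product {S : Set β} {c : ℂ × β → ℂ × β → A}
    (h : IsCoc ({0}ᶜ ×ˢ S) c)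
    (h_int : ∀ p ∈ S, HasPathInt c (fun t => (Complex.exp (2 * Real.pi * Complex.I * t), p)) 0) :
    ∃ J : ℂ × β → A, NearDiag ({0}ᶜ ×ˢ S) fun P Q =>
      c P Q = c (1, P.2) (1, Q.2) + J Q - J P := by
  have h1 : IsCoc (Set.Icc (0 : ℝ) 1 ×ˢ ((Set.univ : Set ℂ) ×ˢ S))
      fun P Q : ℝ × ℂ × β => c (Complex.exp (P.1 * P.2.1), P.2.2) (Complex.exp (Q.1 * Q.2.1), Q.2.2) :=
    h.comp (f := fun P : ℝ × ℂ × β => (Complex.exp (P.1 * P.2.1), P.2.2)) (by fun_prop)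
      fun P hP => ⟨by simp, hP.2.2⟩
  obtain ⟨b, hb0, hb⟩ := h1.exists_product isCompact_Icc (convex_Icc _ _) (k0 := 0) (by simp)
  set G : ℂ × β → A := fun P => b (1, P) with hG
  have hGrel : NearDiag ((Set.univ : Set ℂ) ×ˢ S) fun P Q =>
      c (Complex.exp P.1, P.2) (Complex.exp Q.1, Q.2) = c (1, P.2) (1, Q.2) + G Q - G P := by
    have h2 := hb.comp (f := fun P : ℂ × β => ((1 : ℝ), P)) (S := Set.univ ×ˢ S) (by fun_prop)
      (fun x hx => ⟨by simp, hx⟩)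
    refine h2.imp fun x hx y hy h3 => ?_
    simpa using h3
  have hself : ∀ p ∈ S, c (1, p) (1, p) = 0 := fun p hp => h.self ⟨by simp, hp⟩
  have hfix : ∀ p ∈ S, NearDiag Set.univ fun x y : ℂ =>
      c (Complex.exp x, p) (Complex.exp y, p) = G (y, p) - G (x, p) := fun p hp => by
    have h2 := hGrel.comp (f := fun x : ℂ => (x, p)) (S := Set.univ) (by fun_prop)
      (fun x hx => ⟨trivial, hp⟩)
    exact h2.imp fun x _ y _ h3 => by simpa [hself p hp] using h3
  have hper1 : ∀ p ∈ S, ∀ x : ℂ, G (x + 2 * Real.pi * Complex.I, p) = G (x, p) := by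
    intro p hp x
    have h2 : NearDiag Set.univ fun x y : ℂ => G (x + 2 * Real.pi * Complex.I, p) - G (x, p) =
        G (y + 2 * Real.pi * Complex.I, p) - G (y, p) := by
      have h3 := (hfix p hp).comp (f := fun x : ℂ => x + 2 * Real.pi * Complex.I) (S := Set.univ)
        (by fun_prop) (fun x hx => trivial)
      refine (h3.and (hfix p hp)).imp fun x _ y _ h4 => ?_
      simp only [Complex.exp_add, Complex.exp_two_pi_mul_I, mul_one] at h4
      grind
    have h3 := h2.eq_of_isPreconnected isPreconnected_univ (Set.mem_univ x) (Set.mem_univ 0)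
    have h4 : HasPathInt c (fun t => (Complex.exp (2 * Real.pi * Complex.I * t), p))
        (G (2 * Real.pi * Complex.I * (1 : ℝ), p) - G (2 * Real.pi * Complex.I * (0 : ℝ), p)) := by
      refine ⟨fun t => G (2 * Real.pi * Complex.I * t, p), ?_, rfl⟩
      exact (hfix p hp).comp (f := fun t : ℝ => 2 * Real.pi * Complex.I * (t : ℂ))
        (by fun_prop) (fun x hx => trivial)
    have h5 := h4.unique (h_int p hp)
    simp only [Complex.ofReal_one, mul_one, Complex.ofReal_zero, mul_zero] at h5
    rw [zero_add, h5] at h3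
    exact sub_eq_zero.1 h3
  have hper : ∀ p ∈ S, ∀ x y : ℂ, Complex.exp x = Complex.exp y → G (x, p) = G (y, p) := by
    intro p hp x y hxy
    have hfun : Function.Periodic (fun x => G (x, p)) (2 * Real.pi * Complex.I) := hper1 p hp
    obtain ⟨n, hn⟩ := Complex.exp_eq_exp_iff_exists_int.1 hxy
    rw [hn]
    exact hfun.int_mul n y
  refine ⟨fun P => G (Complex.log P.1, P.2), ?_⟩
  rintro ⟨μ, p⟩ ⟨hμ, hp⟩
  simp only [Set.mem_compl_iff, Set.mem_singleton_iff] at hμ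
  set lam : ℂ × β → ℂ × β := fun P => (Complex.log (P.1 / μ) + Complex.log μ, P.2)
  have hlam : ∀ P : ℂ × β, P.1 ≠ 0 → Complex.exp (lam P).1 = P.1 := fun P hP => by
    simp only [lam, Complex.exp_add]
    rw [Complex.exp_log (div_ne_zero hP hμ), Complex.exp_log hμ, div_mul_cancel₀ _ hμ]
  have hcont : Tendsto lam (𝓝[{0}ᶜ ×ˢ S] (μ, p)) (𝓝[Set.univ ×ˢ S] (lam (μ, p))) := by
    refine tendsto_nhdsWithin_iff.2 ⟨?_, eventually_mem_nhdsWithin.mono fun P hP => ⟨trivial, hP.2⟩⟩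
    refine ContinuousAt.tendsto ?_ |>.mono_left nhdsWithin_le_nhds
    have : (μ, p).1 / μ ∈ Complex.slitPlane := by simp [div_self hμ]
    fun_prop (disch := first | assumption | simp [hμ])
  have h1 : ∀ᶠ q in 𝓝[{0}ᶜ ×ˢ S] (μ, p) ×ˢ 𝓝[{0}ᶜ ×ˢ S] (μ, p),
      q ∈ ({0}ᶜ ×ˢ S) ×ˢ ({0}ᶜ ×ˢ S) := prod_mem_prod self_mem_nhdsWithin self_mem_nhdsWithin
  filter_upwards [(hcont.prodMap hcont).eventually (hGrel (lam (μ, p)) ⟨trivial, hp⟩), h1]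
  rintro ⟨P, Q⟩ h2 h3
  simp only [Prod.map_fst, Prod.map_snd, hlam P h3.1.1, hlam Q h3.2.1] at h2
  simp only
  rw [hper P.2 h3.1.2 _ (lam P).1 (by rw [hlam P h3.1.1, Complex.exp_log h3.1.1]),
    hper Q.2 h3.2.2 _ (lam Q).1 (by rw [hlam Q h3.2.1, Complex.exp_log h3.2.1])]
  exact h2

lemma IsCoc.exists_isPrim_punctured {c : ℂ → ℂ → A} (h : IsCoc {0}ᶜ c)
    (h_int : HasPathInt c (fun t => Complex.exp (2 * Real.pi * Complex.I * t)) 0) :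
    ∃ J, IsPrim {0}ᶜ c J := by
  have h1 : IsCoc ({0}ᶜ ×ˢ (Set.univ : Set Unit)) fun P Q : ℂ × Unit => c P.1 Q.1 :=
    h.comp (f := Prod.fst) (by fun_prop) fun P hP => hP.1
  obtain ⟨J, hJ⟩ := h1.exists_punctured_product (fun p _ => h_int)
  refine ⟨fun x => J (x, ()), ?_⟩
  refine (hJ.comp (f := fun x : ℂ => (x, ())) (S := {0}ᶜ) (by fun_prop)
    (fun x hx => ⟨hx, trivial⟩)).imp fun x hx y hy h2 => ?_
  simpa [h.self (p := (1 : ℂ)) (by simp)] using h2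

end Cstar

section Glue

variable {α A : Type*} [PseudoMetricSpace α] [AddCommGroup A]

lemma mem_nhdsWithin_of_closure_subset {E F : Set α} (hF : closure F ∩ (E ∪ F) ⊆ F) {p : α}
    (hp : p ∈ E) (hpF : p ∉ F) : E ∈ 𝓝[E ∪ F] p := by
  have h1 : p ∉ closure F := fun h => hpF (hF ⟨h, Or.inl hp⟩)
  have h2 : (closure F)ᶜ ∈ 𝓝 p := isClosed_closure.isOpen_compl.mem_nhds h1
  filter_upwards [mem_nhdsWithin_of_mem_nhds h2, self_mem_nhdsWithin] with x hx hx'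
  exact hx'.resolve_right fun h => hx (subset_closure h)

lemma nhdsWithin_union_eq_left {E F : Set α} (hF : closure F ∩ (E ∪ F) ⊆ F) {p : α}
    (hp : p ∈ E) (hpF : p ∉ F) : 𝓝[E ∪ F] p = 𝓝[E] p :=
  le_antisymm (le_inf nhdsWithin_le_nhds
      (le_principal_iff.2 (mem_nhdsWithin_of_closure_subset hF hp hpF)))
    (nhdsWithin_mono _ Set.subset_union_left)

/-- Near-diagonal equality of cocycles can be checked on the pieces of a closed cover. -/
lemma NearDiag.eq_union {E F : Set α} (hE : closure E ∩ (E ∪ F) ⊆ E)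
    (hF : closure F ∩ (E ∪ F) ⊆ F) {c c' : α → α → A} (hc : IsCoc (E ∪ F) c)
    (hc' : IsCoc (E ∪ F) c') (h1 : NearDiag E fun x y => c x y = c' x y)
    (h2 : NearDiag F fun x y => c x y = c' x y) :
    NearDiag (E ∪ F) fun x y => c x y = c' x y := by
  intro p hp
  by_cases hpE : p ∈ E
  · by_cases hpF : p ∈ F
    · obtain ⟨b, U, hU, hb⟩ := hc.exists_nhds hp
      obtain ⟨b', U', hU', hb'⟩ := hc'.exists_nhds hp
      obtain ⟨V1, hV1, h1⟩ := h1.exists_nhds hpE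
      obtain ⟨V2, hV2, h2⟩ := h2.exists_nhds hpF
      refine (eventually_prod_self_iff (r := fun x y => c x y = c' x y)).2 ⟨U ∩ U' ∩ (V1 ∪ V2), Filter.inter_mem
        (Filter.inter_mem hU hU') (by rw [nhdsWithin_union]; exact
          ⟨mem_of_superset hV1 Set.subset_union_left, mem_of_superset hV2 Set.subset_union_right⟩),
        ?_⟩
      have key : ∀ x ∈ V1 ∪ V2, c p x = c' p x := by
        rintro x (hx | hx)
        · exact h1 p (mem_of_mem_nhdsWithin hpE hV1) x hx
        · exact h2 p (mem_of_mem_nhdsWithin hpF hV2) x hx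
      intro x hx y hy
      have p1 := mem_of_mem_nhdsWithin hp hU
      have p2 := mem_of_mem_nhdsWithin hp hU'
      have k1 := key x hx.2
      have k2 := key y hy.2
      rw [hb p p1 _ hx.1.1, hb' p p2 _ hx.1.2] at k1
      rw [hb p p1 _ hy.1.1, hb' p p2 _ hy.1.2] at k2
      rw [hb _ hx.1.1 _ hy.1.1, hb' _ hx.1.2 _ hy.1.2]
      grind
    · rw [nhdsWithin_union_eq_left hF hpE hpF]
      exact h1 p hpE
  · have hpF : p ∈ F := hp.resolve_left hpE
    rw [Set.union_comm, nhdsWithin_union_eq_left (by rwa [Set.union_comm]) hpF hpE]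
    exact h2 p hpF

/-- Mayer–Vietoris: cocycles on the pieces of a closed cover which agree on the overlap glue. -/
lemma IsCoc.exists_glue {E F : Set α} (hE : closure E ∩ (E ∪ F) ⊆ E)
    (hF : closure F ∩ (E ∪ F) ⊆ F) {c₁ c₂ : α → α → A} (h1 : IsCoc E c₁) (h2 : IsCoc F c₂)
    (h : NearDiag (E ∩ F) fun x y => c₁ x y = c₂ x y) :
    ∃ c, IsCoc (E ∪ F) c ∧ NearDiag E (fun x y => c x y = c₁ x y) ∧
      NearDiag F (fun x y => c x y = c₂ x y) := by
  classical
  have hr : ∀ x, ∃ r, (E ∩ F).Nonempty → 0 < Metric.infDist x (E ∩ F) →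
      r ∈ E ∩ F ∧ dist x r < 2 * Metric.infDist x (E ∩ F) := by
    intro x
    by_cases h : (E ∩ F).Nonempty ∧ 0 < Metric.infDist x (E ∩ F)
    · obtain ⟨r, hr⟩ := (Metric.infDist_lt_iff h.1).1
        (show Metric.infDist x (E ∩ F) < 2 * Metric.infDist x (E ∩ F) by linarith [h.2])
      exact ⟨r, fun _ _ => hr⟩
    · exact ⟨x, fun h1 h2 => (h ⟨h1, h2⟩).elim⟩
  choose r hr using hr
  set c : α → α → A := fun x y =>
    if x ∈ E ∧ y ∈ E then c₁ x y else if x ∈ F ∧ y ∈ F then c₂ x y else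
      if x ∈ E then c₁ x (r x) + c₂ (r x) y else c₂ x (r x) + c₁ (r x) y with hcdef
  have e1 : ∀ x ∈ E, ∀ y ∈ E, c x y = c₁ x y := fun x hx y hy => by simp [hcdef, hx, hy]
  refine ⟨c, fun p hp => ?_, .of_forall e1, ?_⟩
  · by_cases hpE : p ∈ E
    · by_cases hpF : p ∈ F
      · obtain ⟨b₁, U₁, hU₁, hb₁⟩ := h1.exists_nhds hpE
        obtain ⟨b₂, U₂, hU₂, hb₂⟩ := h2.exists_nhds hpF
        obtain ⟨U₃, hU₃, hb₃⟩ := h.exists_nhds (p := p) ⟨hpE, hpF⟩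
        obtain ⟨ε₁, hε₁, hs₁⟩ := Metric.mem_nhdsWithin_iff.1 hU₁
        obtain ⟨ε₂, hε₂, hs₂⟩ := Metric.mem_nhdsWithin_iff.1 hU₂
        obtain ⟨ε₃, hε₃, hs₃⟩ := Metric.mem_nhdsWithin_iff.1 hU₃
        set ε := min ε₁ (min ε₂ ε₃)
        have hε : 0 < ε := by positivity
        have q1 : ∀ x, dist x p < ε → x ∈ E → x ∈ U₁ := fun x hx hxE =>
          hs₁ ⟨lt_of_lt_of_le hx (min_le_left _ _), hxE⟩
        have q2 : ∀ x, dist x p < ε → x ∈ F → x ∈ U₂ := fun x hx hxF =>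
          hs₂ ⟨lt_of_lt_of_le hx ((min_le_right _ _).trans (min_le_left _ _)), hxF⟩
        have q3 : ∀ x, dist x p < ε → x ∈ E → x ∈ F → x ∈ U₃ := fun x hx hxE hxF =>
          hs₃ ⟨lt_of_lt_of_le hx ((min_le_right _ _).trans (min_le_right _ _)), hxE, hxF⟩
        have p0 : dist p p < ε := by simpa using hε
        have hne : (E ∩ F).Nonempty := ⟨p, hpE, hpF⟩
        have hrx : ∀ x, dist x p < ε / 3 → x ∈ E ∪ F → x ∉ E ∩ F →
            r x ∈ E ∩ F ∧ dist (r x) p < ε := by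
          intro x hx hxS hx'
          have hpos : 0 < Metric.infDist x (E ∩ F) := by
            refine lt_of_le_of_ne Metric.infDist_nonneg fun h0 => hx' ?_
            have := (Metric.mem_closure_iff_infDist_zero hne).2 h0.symm
            exact ⟨hE ⟨closure_mono Set.inter_subset_left this, hxS⟩,
              hF ⟨closure_mono Set.inter_subset_right this, hxS⟩⟩
          obtain ⟨k1, k2⟩ := hr x hne hpos
          have k3 : Metric.infDist x (E ∩ F) ≤ dist x p := Metric.infDist_le_dist_of_mem ⟨hpE, hpF⟩
          refine ⟨k1, ?_⟩
          have := dist_triangle_left (r x) p x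
          linarith
        refine ⟨fun x => if x ∈ E then b₁ x - b₁ p else b₂ x - b₂ p, ?_⟩
        set B : α → A := fun x => if x ∈ E then b₁ x - b₁ p else b₂ x - b₂ p
        have hB1 : ∀ x, x ∈ E → B x = b₁ x - b₁ p := fun x hx => by simp [B, hx]
        have hB2 : ∀ x, dist x p < ε → x ∈ F → B x = b₂ x - b₂ p := fun x hd hx => by
          by_cases hxE : x ∈ E
          · rw [hB1 x hxE]
            have := hb₃ p (q3 p p0 hpE hpF) x (q3 x hd hxE hx)
            rw [hb₁ p (q1 p p0 hpE) x (q1 x hd hxE), hb₂ p (q2 p p0 hpF) x (q2 x hd hx)] at this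
            exact this
          · simp [B, hxE]
        have f1 : ∀ x, dist x p < ε → ∀ y, dist y p < ε → x ∈ E → y ∈ E → c₁ x y = B y - B x :=
          fun x hx y hy hxE hyE => by
            rw [hb₁ x (q1 x hx hxE) y (q1 y hy hyE), hB1 x hxE, hB1 y hyE]; abel
        have f2 : ∀ x, dist x p < ε → ∀ y, dist y p < ε → x ∈ F → y ∈ F → c₂ x y = B y - B x :=
          fun x hx y hy hxE hyE => by
            rw [hb₂ x (q2 x hx hxE) y (q2 y hy hyE), hB2 x hx hxE, hB2 y hy hyE]; abel
        refine (eventually_prod_self_iff (r := fun x y => c x y = B y - B x)).2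
          ⟨Metric.ball p (ε / 3) ∩ (E ∪ F), Filter.inter_mem (mem_nhdsWithin_of_mem_nhds
            (Metric.ball_mem_nhds _ (by linarith))) self_mem_nhdsWithin, ?_⟩
        rintro x ⟨hx, hxS⟩ y ⟨hy, hyS⟩
        rw [Metric.mem_ball] at hx hy
        have hx' : dist x p < ε := by linarith
        have hy' : dist y p < ε := by linarith
        by_cases c1 : x ∈ E ∧ y ∈ E
        · rw [e1 x c1.1 y c1.2]; exact f1 x hx' y hy' c1.1 c1.2
        by_cases c2 : x ∈ F ∧ y ∈ F
        · simp only [hcdef, c1, c2, if_false, and_self, if_true]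
          exact f2 x hx' y hy' c2.1 c2.2
        by_cases c3 : x ∈ E
        · have hyE : y ∉ E := fun h => c1 ⟨c3, h⟩
          have hyF : y ∈ F := hyS.resolve_left hyE
          have hxF : x ∉ F := fun h => c2 ⟨h, hyF⟩
          obtain ⟨k1, k2⟩ := hrx x hx hxS fun h => hxF h.2
          have hcx : c x y = c₁ x (r x) + c₂ (r x) y := by simp [hcdef, hyE, hxF, c3]
          rw [hcx, f1 x hx' _ k2 c3 k1.1, f2 _ k2 y hy' k1.2 hyF, sub_add_sub_cancel']
        · have hxF : x ∈ F := hxS.resolve_left c3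
          have hyF : y ∉ F := fun h => c2 ⟨hxF, h⟩
          have hyE : y ∈ E := hyS.resolve_right hyF
          obtain ⟨k1, k2⟩ := hrx x hx hxS fun h => c3 h.1
          have hcx : c x y = c₂ x (r x) + c₁ (r x) y := by simp [hcdef, hyF, c3]
          rw [hcx, f2 x hx' _ k2 hxF k1.2, f1 _ k2 y hy' k1.1 hyE, sub_add_sub_cancel']
      · rw [nhdsWithin_union_eq_left hF hpE hpF]
        exact (h1.congr (.of_forall e1)) p hpE
    · have hpF : p ∈ F := hp.resolve_left hpE
      rw [Set.union_comm, nhdsWithin_union_eq_left (by rwa [Set.union_comm]) hpF hpE]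
      obtain ⟨b, hb⟩ := h2 p hpF
      have hEc : Eᶜ ∈ 𝓝[F] p := by
        have h1 : p ∉ closure E := fun h => hpE (hE ⟨h, Or.inr hpF⟩)
        filter_upwards [mem_nhdsWithin_of_mem_nhds
          (isClosed_closure.isOpen_compl.mem_nhds h1)] with x hx hxE using hx (subset_closure hxE)
      refine ⟨b, ?_⟩
      filter_upwards [hb, prod_mem_prod hEc hEc, prod_mem_prod (self_mem_nhdsWithin (s := F))
        (self_mem_nhdsWithin (s := F))] with q hq hq1 hq2
      have : q.1 ∉ E := hq1.1
      simp [hcdef, this, hq2.1, hq2.2, hq]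
  · refine .of_nhds fun p hpF => ?_
    by_cases hpE : p ∈ E
    · obtain ⟨U, hU, hU'⟩ := h.exists_nhds (p := p) ⟨hpE, hpF⟩
      obtain ⟨ε, hε, hs⟩ := Metric.mem_nhdsWithin_iff.1 hU
      refine ⟨Metric.ball p ε ∩ F, Filter.inter_mem (mem_nhdsWithin_of_mem_nhds
            (Metric.ball_mem_nhds _ hε)) self_mem_nhdsWithin, fun x hx y hy => ?_⟩
      by_cases c1 : x ∈ E ∧ y ∈ E
      · rw [e1 x c1.1 y c1.2]
        exact hU' x (hs ⟨hx.1, c1.1, hx.2⟩) y (hs ⟨hy.1, c1.2, hy.2⟩)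
      · simp [hcdef, c1, hx.2, hy.2]
    · have hEc : Eᶜ ∈ 𝓝[F] p := by
        have h1 : p ∉ closure E := fun h => hpE (hE ⟨h, Or.inr hpF⟩)
        filter_upwards [mem_nhdsWithin_of_mem_nhds
          (isClosed_closure.isOpen_compl.mem_nhds h1)] with x hx hxE using hx (subset_closure hxE)
      refine ⟨Eᶜ ∩ F, Filter.inter_mem hEc self_mem_nhdsWithin, fun x hx y hy => ?_⟩
      have : x ∉ E := hx.1
      simp [hcdef, this, hx.2, hy.2]

end Glue

section Lift

/-- An angle-valued cochain lifts, near the diagonal of `S`, to a real cocycle. -/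
def Liftable {α : Type*} [TopologicalSpace α] (S : Set α) (c : α → α → Real.Angle) : Prop :=
  ∃ l : α → α → ℝ, IsCoc S l ∧ NearDiag S fun x y => (l x y : Real.Angle) = c x y

variable {α β : Type*}

lemma Liftable.comp [TopologicalSpace α] [TopologicalSpace β] {f : α → β} {S : Set α} {T : Set β}
    {c : β → β → Real.Angle} (h : Liftable T c) (hf : ContinuousOn f S) (hm : Set.MapsTo f S T) :
    Liftable S fun x y => c (f x) (f y) := by
  obtain ⟨l, hl, hl'⟩ := h
  exact ⟨_, hl.comp hf hm, hl'.comp hf hm⟩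

lemma Liftable.mono [TopologicalSpace α] {S T : Set α} {c : α → α → Real.Angle}
    (h : Liftable S c) (hT : T ⊆ S) : Liftable T c := by
  obtain ⟨l, hl, hl'⟩ := h
  exact ⟨l, hl.mono hT, hl'.mono hT⟩

lemma Liftable.congr [TopologicalSpace α] {S : Set α} {c c' : α → α → Real.Angle}
    (h : Liftable S c) (h' : NearDiag S fun x y => c' x y = c x y) : Liftable S c' := by
  obtain ⟨l, hl, hl'⟩ := h
  exact ⟨l, hl, (hl'.and h').imp fun x _ y _ h => by rw [h.1, h.2]⟩

lemma Real.Angle.exists_coe_eq (θ : Real.Angle) : ∃ x : ℝ, (x : Real.Angle) = θ :=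
  ⟨θ.toReal, θ.coe_toReal⟩

lemma IsPrim.liftable [TopologicalSpace α] {S : Set α} {c : α → α → Real.Angle}
    {b : α → Real.Angle} (h : IsPrim S c b) : Liftable S c :=
  ⟨fun x y => (b y).toReal - (b x).toReal, (isPrim_cob S fun x => (b x).toReal).isCoc,
    h.imp fun x _ y _ h => by simp [h]⟩

lemma Real.Angle.coe_eq_zero_iff_int {x : ℝ} :
    (x : Real.Angle) = 0 ↔ ∃ n : ℤ, x = 2 * Real.pi * n := by
  rw [← Real.Angle.coe_zero, Real.Angle.angle_eq_iff_two_pi_dvd_sub]; simp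

/-- Lifts on the pieces of a closed cover can be modified so as to glue, provided integral cocycles
on the overlap are coboundaries. -/
lemma Liftable.glue [PseudoMetricSpace α] {E F : Set α} (hE : closure E ∩ (E ∪ F) ⊆ E)
    (hF : closure F ∩ (E ∪ F) ⊆ F) {c : α → α → Real.Angle} (hc : IsCoc (E ∪ F) c)
    {l₁ l₂ : α → α → ℝ} (hl₁ : IsCoc E l₁)
    (hr₁ : NearDiag E fun x y => (l₁ x y : Real.Angle) = c x y)
    (hl₂ : IsCoc F l₂) (hr₂ : NearDiag F fun x y => (l₂ x y : Real.Angle) = c x y)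
    (hH : ∀ D : α → α → ℤ, IsCoc (E ∩ F) D →
      (NearDiag (E ∩ F) fun x y => l₁ x y - l₂ x y = 2 * Real.pi * D x y) →
      ∃ n, IsPrim (E ∩ F) D n) :
    Liftable (E ∪ F) c := by
  classical
  have hD : ∀ x y, ∃ n : ℤ, (∃ m : ℤ, l₁ x y - l₂ x y = 2 * Real.pi * m) →
      l₁ x y - l₂ x y = 2 * Real.pi * n := fun x y => by
    by_cases h : ∃ m : ℤ, l₁ x y - l₂ x y = 2 * Real.pi * m
    · exact h.imp fun m hm _ => hm
    · exact ⟨0, fun h' => (h h').elim⟩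
  choose D hD using hD
  have hnear : NearDiag (E ∩ F) fun x y => l₁ x y - l₂ x y = 2 * Real.pi * D x y :=
    ((hr₁.mono Set.inter_subset_left).and (hr₂.mono Set.inter_subset_right)).imp
      fun x _ y _ h => hD x y (Real.Angle.coe_eq_zero_iff_int.1 (by
        rw [Real.Angle.coe_sub, h.1, h.2, sub_self]))
  have hDc : IsCoc (E ∩ F) D := by
    refine .of_nhds fun p hp => ?_
    obtain ⟨b, U, hU, hb⟩ := ((hl₁.mono Set.inter_subset_left).sub
      (hl₂.mono Set.inter_subset_right)).exists_nhds hp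
    obtain ⟨V, hV, hb'⟩ := hnear.exists_nhds hp
    refine ⟨fun x => D p x, U ∩ V, Filter.inter_mem hU hV, fun x hx y hy => ?_⟩
    have pU := mem_of_mem_nhdsWithin hp hU
    have pV := mem_of_mem_nhdsWithin hp hV
    have e1 := (hb x hx.1 y hy.1).symm.trans (hb' x hx.2 y hy.2)
    have e2 := (hb p pU y hy.1).symm.trans (hb' p pV y hy.2)
    have e3 := (hb p pU x hx.1).symm.trans (hb' p pV x hx.2)
    have h0 : (2 * Real.pi) ≠ 0 := by positivity
    have e4 : (2 * Real.pi) * (D x y : ℝ) = (2 * Real.pi) * ((D p y : ℝ) - D p x) := by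
      rw [mul_sub]; linarith
    exact_mod_cast mul_left_cancel₀ h0 e4
  obtain ⟨n, hn⟩ := hH D hDc hnear
  set m : α → ℝ := fun x => 2 * Real.pi * n x
  have hl₂' : IsCoc F fun x y => l₂ x y + (m y - m x) := hl₂.add (isPrim_cob F m).isCoc
  obtain ⟨l, hl, hlE, hlF⟩ := IsCoc.exists_glue hE hF hl₁ hl₂' ((hnear.and hn).imp
    fun x _ y _ h => by
      have h2 := h.2
      have h1 := h.1
      rw [h2] at h1
      push_cast at h1
      simp only [m]
      linarith)
  refine ⟨l, hl, NearDiag.eq_union hE hF (c := fun x y => (l x y : Real.Angle))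
    (hl.map Real.Angle.coeHom) hc
    ((hlE.and hr₁).imp fun x _ y _ h => by rw [h.1, h.2])
    ((hlF.and hr₂).imp fun x _ y _ h => ?_)⟩
  have hm : ∀ x, ((m x : ℝ) : Real.Angle) = 0 := fun x =>
    Real.Angle.coe_eq_zero_iff_int.2 ⟨n x, rfl⟩
  rw [h.1, Real.Angle.coe_add, Real.Angle.coe_sub, hm, hm, h.2]; simp

lemma Liftable.union [PseudoMetricSpace α] {E F : Set α} (hE : closure E ∩ (E ∪ F) ⊆ E)
    (hF : closure F ∩ (E ∪ F) ⊆ F) {c : α → α → Real.Angle} (hc : IsCoc (E ∪ F) c)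
    (h1 : Liftable E c) (h2 : Liftable F c)
    (hH : ∀ D : α → α → ℤ, IsCoc (E ∩ F) D → ∃ n, IsPrim (E ∩ F) D n) :
    Liftable (E ∪ F) c := by
  obtain ⟨l₁, hl₁, hr₁⟩ := h1
  obtain ⟨l₂, hl₂, hr₂⟩ := h2
  exact .glue hE hF hc hl₁ hr₁ hl₂ hr₂ fun D hD _ => hH D hD

end Lift

section Arg

variable {α : Type*} [TopologicalSpace α] {S : Set α} {u v : α → ℂ}

lemma nearDiag_re_div_pos (hu : ContinuousOn u S) (h0 : ∀ p ∈ S, u p ≠ 0) :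
    NearDiag S fun p q => 0 < (u q / u p).re := by
  intro p hp
  have h1 : Tendsto (fun q : α × α => (u q.2 / u q.1).re) (𝓝[S] p ×ˢ 𝓝[S] p)
      (𝓝 (u p / u p).re) :=
    (Complex.continuous_re.tendsto _).comp
      (((hu p hp).tendsto.comp tendsto_snd).div ((hu p hp).tendsto.comp tendsto_fst) (h0 p hp))
  rw [div_self (h0 p hp)] at h1
  exact h1.eventually (lt_mem_nhds (by simp))

lemma Complex.arg_mul_of_re_pos {a b : ℂ} (ha : 0 < a.re) (hb : 0 < b.re) :
    (a * b).arg = a.arg + b.arg := by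
  have h1 := Complex.abs_arg_lt_pi_div_two_iff.2 (Or.inl ha)
  have h2 := Complex.abs_arg_lt_pi_div_two_iff.2 (Or.inl hb)
  rw [abs_lt] at h1 h2
  refine (Complex.arg_mul_eq_add_arg_iff (fun h => by simp [h] at ha)
    (fun h => by simp [h] at hb)).2 ⟨by linarith, by linarith⟩

/-- The winding cocycle of a nowhere vanishing function. -/
lemma isCoc_arg (hu : ContinuousOn u S) (h0 : ∀ p ∈ S, u p ≠ 0) :
    IsCoc S fun p q => (u q / u p).arg := by
  refine .of_nhds fun p hp => ?_
  obtain ⟨U, hU, hU'⟩ := (nearDiag_re_div_pos hu h0).exists_nhds hp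
  refine ⟨fun x => (u x / u p).arg, U ∩ S, Filter.inter_mem hU self_mem_nhdsWithin,
    fun x hx y hy => ?_⟩
  have pU := mem_of_mem_nhdsWithin hp hU
  rw [eq_sub_iff_add_eq, ← Complex.arg_mul_of_re_pos (hU' x hx.1 y hy.1) (hU' p pU x hx.1),
    div_mul_div_cancel₀ (h0 x hx.2)]

lemma isPrim_arg_coe (h0 : ∀ p ∈ S, u p ≠ 0) :
    IsPrim S (fun p q => ((u q / u p).arg : Real.Angle)) fun p => ((u p).arg : Real.Angle) :=
  .of_forall fun p hp q hq => Complex.arg_div_coe_angle (h0 q hq) (h0 p hp)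

lemma nearDiag_arg_mul (hu : ContinuousOn u S) (h0 : ∀ p ∈ S, u p ≠ 0)
    (hv : ContinuousOn v S) (h0' : ∀ p ∈ S, v p ≠ 0) :
    NearDiag S fun p q => (u q * v q / (u p * v p)).arg = (u q / u p).arg + (v q / v p).arg :=
  ((nearDiag_re_div_pos hu h0).and (nearDiag_re_div_pos hv h0')).imp fun x _ y _ h => by
    rw [← Complex.arg_mul_of_re_pos h.1 h.2, mul_div_mul_comm]

lemma nearDiag_arg_pow (hu : ContinuousOn u S) (h0 : ∀ p ∈ S, u p ≠ 0) (n : ℕ) :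
    NearDiag S fun p q => (u q ^ n / u p ^ n).arg = n * (u q / u p).arg := by
  induction n with
  | zero => exact .of_forall fun x _ y _ => by simp
  | succ n ih =>
    refine (ih.and (nearDiag_arg_mul (hu.pow n) (fun p hp => pow_ne_zero n (h0 p hp)) hu h0)).imp
      fun x _ y _ h => ?_
    have h2 := h.2
    simp only [Pi.pow_apply] at h2
    rw [pow_succ, pow_succ, h2, h.1]; push_cast; ring

lemma nearDiag_arg_inv (hu : ContinuousOn u S) (h0 : ∀ p ∈ S, u p ≠ 0) :
    NearDiag S fun p q => ((u q)⁻¹ / (u p)⁻¹).arg = - (u q / u p).arg :=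
  (nearDiag_re_div_pos hu h0).imp fun x _ y _ h => by
    rw [← inv_div_inv, inv_inv, inv_inv, ← inv_div, Complex.arg_inv, if_neg]
    intro h1
    have := Complex.abs_arg_lt_pi_div_two_iff.2 (Or.inl h)
    rw [h1, abs_of_pos Real.pi_pos] at this
    linarith [Real.pi_pos]

lemma nearDiag_arg_zpow (hu : ContinuousOn u S) (h0 : ∀ p ∈ S, u p ≠ 0) (n : ℤ) :
    NearDiag S fun p q => (u q ^ n / u p ^ n).arg = n * (u q / u p).arg := by
  obtain ⟨n, rfl | rfl⟩ := n.eq_nat_or_neg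
  · simpa using nearDiag_arg_pow hu h0 n
  · refine ((nearDiag_arg_pow hu h0 n).and (nearDiag_arg_inv (hu.pow n)
      fun p hp => pow_ne_zero n (h0 p hp))).imp fun x _ y _ h => ?_
    have h2 := h.2
    simp only [Pi.pow_apply] at h2
    simp only [zpow_neg, zpow_natCast, h2, h.1]; push_cast; ring

lemma hasPathInt_arg_exp {γ : ℝ → α} {a : ℂ} (ha : a ≠ 0)
    (h : ∀ t ∈ Set.Icc (0 : ℝ) 1, u (γ t) = a * Complex.exp (2 * Real.pi * Complex.I * t)) :
    HasPathInt (fun p q => (u q / u p).arg) γ (2 * Real.pi) := by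
  refine ⟨fun t => 2 * Real.pi * t, .of_nhds fun p hp => ?_, by simp⟩
  refine ⟨Metric.ball p (1 / 4) ∩ Set.Icc 0 1, Filter.inter_mem (mem_nhdsWithin_of_mem_nhds
    (Metric.ball_mem_nhds _ (by norm_num))) self_mem_nhdsWithin, fun x hx y hy => ?_⟩
  simp only
  rw [h x hx.2, h y hy.2, mul_div_mul_left _ _ ha, ← Complex.exp_sub,
    show 2 * Real.pi * Complex.I * (y : ℂ) - 2 * Real.pi * Complex.I * x =
      ((2 * Real.pi * y - 2 * Real.pi * x : ℝ) : ℂ) * Complex.I by push_cast; ring]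
  have h1 := hx.1
  have h2 := hy.1
  rw [Metric.mem_ball, Real.dist_eq, abs_lt] at h1 h2
  rw [Complex.arg_exp_mul_I, toIocMod_eq_self]
  constructor <;> nlinarith [Real.pi_pos]

lemma HasPathInt.neg {A : Type*} [AddCommGroup A] {c : α → α → A} {γ : ℝ → α} {v : A}
    (h : HasPathInt c γ v) : HasPathInt (fun x y => - c x y) γ (-v) :=
  h.map (-AddMonoidHom.id A)

end Arg

section Matching

variable {d : ℕ}

lemma exists_matchPerm (a b : Fin d → ℂ) : ∃ σ : Equiv.Perm (Fin d),
    ∀ τ : Equiv.Perm (Fin d), dist (b ∘ σ) a ≤ dist (b ∘ τ) a :=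
  Finite.exists_min fun σ : Equiv.Perm (Fin d) => dist (b ∘ σ) a

/-- An optimal matching between two tuples of points. -/
noncomputable def matchPerm (a b : Fin d → ℂ) : Equiv.Perm (Fin d) := (exists_matchPerm a b).choose

lemma matchPerm_dist_lt {a b : Fin d → ℂ} {σ : Equiv.Perm (Fin d)} {ε : ℝ} (hε : 0 < ε)
    (h : ∀ j, dist (b (σ j)) (a j) < ε) (j : Fin d) : dist (b (matchPerm a b j)) (a j) < ε :=
  (dist_pi_lt_iff hε).1 (((exists_matchPerm a b).choose_spec σ).trans_lt
    ((dist_pi_lt_iff hε).2 h)) j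

lemma perm_apply_inv {α : Type*} (σ : Equiv.Perm α) (a : α) : σ (σ⁻¹ a) = a :=
  σ.apply_symm_apply a

lemma exists_pos_forall_le {ι : Type*} [Finite ι] (f : ι → ℝ) (hf : ∀ i, 0 < f i) :
    ∃ ε > 0, ∀ i, ε ≤ f i := by
  cases isEmpty_or_nonempty ι
  · exact ⟨1, one_pos, fun i => isEmptyElim i⟩
  · obtain ⟨i, hi⟩ := Finite.exists_min f
    exact ⟨f i, hf i, hi⟩

lemma exists_separation {ι X : Type*} [Finite ι] [MetricSpace X] (f : ι → X) :
    ∃ ε > 0, ∀ i j, dist (f i) (f j) < ε → f i = f j := by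
  classical
  obtain ⟨ε, hε, h⟩ := exists_pos_forall_le
    (fun q : ι × ι => if f q.1 = f q.2 then 1 else dist (f q.1) (f q.2)) fun q => by
      split_ifs with h
      · exact one_pos
      · exact dist_pos.2 h
  refine ⟨ε, hε, fun i j hij => ?_⟩
  by_contra hne
  have := h (i, j)
  simp only [hne, if_false] at this
  linarith

variable {X : Type*} [PseudoMetricSpace X] {K : Set X} {R : X → Fin d → ℂ}

/-- The unordered tuple `R x` depends continuously on `x ∈ K`. -/
def SymContOn (R : X → Fin d → ℂ) (K : Set X) : Prop :=
  ∀ p ∈ K, ∀ ε > 0, ∀ᶠ x in 𝓝[K] p, ∃ σ : Equiv.Perm (Fin d), ∀ j, dist (R x (σ j)) (R p j) < ε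

/-- The total space over `K` of the family of tuples `R`. -/
def rootSet (R : X → Fin d → ℂ) (K : Set X) : Set (ℂ × X) := {p | p.2 ∈ K ∧ p.1 ∈ Set.range (R p.2)}

lemma rootSet_mono {K K' : Set X} (h : K ⊆ K') : rootSet R K ⊆ rootSet R K' :=
  fun _ hp => ⟨h hp.1, hp.2⟩

lemma SymContOn.mono {K K' : Set X} (h : SymContOn R K) (hK : K' ⊆ K) : SymContOn R K' :=
  fun p hp ε hε => (h p (hK hp) ε hε).filter_mono (nhdsWithin_mono _ hK)

lemma SymContOn.comp {Y : Type*} [PseudoMetricSpace Y] {f : Y → X} {S : Set Y}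
    (h : SymContOn R K) (hf : ContinuousOn f S) (hm : Set.MapsTo f S K) :
    SymContOn (fun y => R (f y)) S := fun p hp ε hε =>
  (hf.tendsto_nhdsWithin_mapsTo hm hp).eventually (h (f p) (hm hp) ε hε)

lemma SymContOn.nearDiag (h : SymContOn R K) {ε : ℝ} (hε : 0 < ε) :
    NearDiag K fun x y => ∀ j, dist (R y (matchPerm (R x) (R y) j)) (R x j) < ε := by
  refine .of_nhds fun p hp => ⟨_, h p hp (ε / 2) (by linarith), ?_⟩
  rintro x ⟨σ, hσ⟩ y ⟨τ, hτ⟩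
  refine matchPerm_dist_lt (σ := σ.symm.trans τ) hε fun j => ?_
  have h1 := hσ (σ.symm j)
  have h2 := hτ (σ.symm j)
  simp only [Equiv.apply_symm_apply, Equiv.trans_apply] at h1 ⊢
  linarith [dist_triangle_right (R y (τ (σ.symm j))) (R x j) (R p (σ.symm j))]

/-- A family of tuples of pairwise distinct points over a compact convex set splits into
continuous sheets. -/
lemma SymContOn.exists_sheets {E : Type*} [NormedAddCommGroup E] [NormedSpace ℝ E] {K : Set E}
    {R : E → Fin d → ℂ} (hK : IsCompact K) (hconv : Convex ℝ K) (h : SymContOn R K)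
    (hinj : ∀ x ∈ K, Function.Injective (R x)) :
    ∃ η : E → Fin d → ℂ, (∀ j, ContinuousOn (fun x => η x j) K) ∧
      ∀ x, ∃ σ : Equiv.Perm (Fin d), ∀ j, η x j = R x (σ j) := by
  have key : ∀ p ∈ K, ∃ b : E → Equiv.Perm (Fin d), ∀ᶠ q in 𝓝[K] p ×ˢ 𝓝[K] p,
      (matchPerm (R q.1) (R q.2))⁻¹ = (b q.1)⁻¹ * b q.2 := by
    intro p hp
    obtain ⟨ε, hε, hsep⟩ := exists_separation (R p)
    have hx := h p hp (ε / 4) (by linarith)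
    have : ∀ x : E, ∃ σ : Equiv.Perm (Fin d),
        (∃ σ : Equiv.Perm (Fin d), ∀ j, dist (R x (σ j)) (R p j) < ε / 4) →
        ∀ j, dist (R x (σ j)) (R p j) < ε / 4 := fun x => by
      by_cases hx : ∃ σ : Equiv.Perm (Fin d), ∀ j, dist (R x (σ j)) (R p j) < ε / 4
      · exact hx.imp fun σ hσ _ => hσ
      · exact ⟨1, fun h => (hx h).elim⟩
    choose s hs using this
    refine ⟨fun x => (s x)⁻¹, ?_⟩
    filter_upwards [h.nearDiag (ε := ε / 2) (by linarith) p hp,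
      hx.prod_mk hx] with q hq hq2
    rw [inv_inv, inv_eq_iff_eq_inv, mul_inv_rev, inv_inv]
    refine Equiv.ext fun j => ?_
    have e1 := hq j
    have e2 := hs q.1 hq2.1 ((s q.1)⁻¹ j)
    have e3 := hs q.2 hq2.2 ((s q.2)⁻¹ (matchPerm (R q.1) (R q.2) j))
    rw [perm_apply_inv] at e2 e3
    have e4 : dist (R p ((s q.2)⁻¹ (matchPerm (R q.1) (R q.2) j))) (R p ((s q.1)⁻¹ j)) < ε := by
      have t1 := dist_triangle_left (R p ((s q.2)⁻¹ (matchPerm (R q.1) (R q.2) j)))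
        (R q.1 j) (R q.2 (matchPerm (R q.1) (R q.2) j))
      have t2 := dist_triangle (R p ((s q.2)⁻¹ (matchPerm (R q.1) (R q.2) j)))
        (R q.1 j) (R p ((s q.1)⁻¹ j))
      linarith
    have e5 := hinj p hp (hsep _ _ e4)
    rw [Equiv.Perm.inv_eq_iff_eq] at e5
    simp [e5]
  obtain ⟨b, hb⟩ := exists_group_primitive (c := fun x y => (matchPerm (R x) (R y))⁻¹) hK hconv key
  refine ⟨fun x j => R x ((b x)⁻¹ j), fun j p hp => ?_, fun x => ⟨(b x)⁻¹, fun j => rfl⟩⟩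
  refine Metric.tendsto_nhds.2 fun ε hε => ?_
  obtain ⟨U, hU, hb'⟩ := (hb.and (h.nearDiag hε)).exists_nhds hp
  have hpU := mem_of_mem_nhdsWithin hp hU
  filter_upwards [hU] with y hy
  obtain ⟨e1, e2⟩ := hb' p hpU y hy
  have e3 := e2 ((b p)⁻¹ j)
  rw [inv_eq_iff_eq_inv] at e1
  rwa [e1, mul_inv_rev, inv_inv, Equiv.Perm.mul_apply, perm_apply_inv] at e3

end Matching

section Trace

variable {d : ℕ} {X A : Type*} [PseudoMetricSpace X] [AddCommGroup A] {K : Set X}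
  {R : X → Fin d → ℂ}

/-- Near a fibre, a cocycle on the total space has one potential for all clusters of points. -/
lemma SymContOn.exists_local_potential (h : SymContOn R K) {c : ℂ × X → ℂ × X → A}
    (hc : IsCoc (rootSet R K) c) {p : X} (hp : p ∈ K) :
    ∃ U ∈ 𝓝[K] p, ∃ ρ > 0, ∃ b : ℂ × X → A, ∀ P ∈ rootSet R U, ∀ Q ∈ rootSet R U,
      dist P.1 Q.1 < ρ → c P Q = b Q - b P := by
  classical
  have h1 : ∀ v : Set.range (R p), ∃ r > 0, ∃ b : ℂ × X → A, ∀ P ∈ rootSet R K,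
      dist P.1 v < r → dist P.2 p < r → ∀ Q ∈ rootSet R K, dist Q.1 v < r → dist Q.2 p < r →
      c P Q = b Q - b P := by
    rintro ⟨v, hv⟩
    obtain ⟨b, U, hU, hb⟩ := hc.exists_nhds (p := (v, p)) ⟨hp, hv⟩
    obtain ⟨r, hr, hs⟩ := Metric.mem_nhdsWithin_iff.1 hU
    refine ⟨r, hr, b, fun P hP hP1 hP2 Q hQ hQ1 hQ2 => hb P (hs ⟨?_, hP⟩) Q (hs ⟨?_, hQ⟩)⟩
    · exact max_lt hP1 hP2
    · exact max_lt hQ1 hQ2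
  choose r hr b hb using h1
  obtain ⟨ε₁, hε₁, h1⟩ := exists_pos_forall_le r hr
  obtain ⟨ε₂, hε₂, h2⟩ := exists_separation (R p)
  set ε := min ε₁ (ε₂ / 4) with hεdef
  have hε : 0 < ε := by positivity
  have hle1 : ε ≤ ε₁ := min_le_left _ _
  have hle2 : ε ≤ ε₂ / 4 := min_le_right _ _
  have hv : ∀ z : ℂ, ∃ v : ℂ, (∃ j, dist z (R p j) < ε) → v ∈ Set.range (R p) ∧ dist z v < ε :=
    fun z => by
      by_cases hz : ∃ j, dist z (R p j) < ε
      · obtain ⟨j, hj⟩ := hz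
        exact ⟨R p j, fun _ => ⟨⟨j, rfl⟩, hj⟩⟩
      · exact ⟨0, fun h => (hz h).elim⟩
  choose v hv using hv
  refine ⟨{x | ∃ σ : Equiv.Perm (Fin d), ∀ j, dist (R x (σ j)) (R p j) < ε} ∩
    (Metric.ball p ε ∩ K), Filter.inter_mem (h p hp ε hε) (Filter.inter_mem
    (mem_nhdsWithin_of_mem_nhds (Metric.ball_mem_nhds _ hε)) self_mem_nhdsWithin), ε, hε,
    fun P => if hP : v P.1 ∈ Set.range (R p) then b ⟨_, hP⟩ P else 0, ?_⟩
  rintro P ⟨⟨⟨σ, hσ⟩, hP1, hP2⟩, j, hj⟩ Q ⟨⟨⟨τ, hτ⟩, hQ1, hQ2⟩, k, hk⟩ hPQ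
  have a1 := hv P.1 ⟨σ.symm j, by rw [← hj]; simpa using hσ (σ.symm j)⟩
  have a2 := hv Q.1 ⟨τ.symm k, by rw [← hk]; simpa using hτ (τ.symm k)⟩
  have a3 : v P.1 = v Q.1 := by
    obtain ⟨i, hi⟩ := a1.1
    obtain ⟨i', hi'⟩ := a2.1
    rw [← hi, ← hi']
    refine h2 i i' ?_
    rw [hi, hi']
    have t1 := dist_triangle4 (v P.1) P.1 Q.1 (v Q.1)
    rw [dist_comm (v P.1) P.1] at t1
    linarith [a1.2, a2.2]
  have a4 : ∀ hP : v P.1 ∈ Set.range (R p), ∀ hQ : v Q.1 ∈ Set.range (R p),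
      b ⟨v P.1, hP⟩ = b ⟨v Q.1, hQ⟩ := fun hP hQ => by congr 1; exact Subtype.ext a3
  simp only [a1.1, a2.1, dif_pos]
  rw [a4 a1.1 a2.1]
  have b1 := h1 ⟨_, a2.1⟩
  refine hb ⟨_, a2.1⟩ P ⟨hP2, j, hj⟩ ?_ ?_ Q ⟨hQ2, k, hk⟩ ?_ ?_
  · have := a1.2
    rw [a3] at this
    exact (this.trans_le hle1).trans_le b1
  · rw [Metric.mem_ball] at hP1; linarith
  · linarith [a2.2]
  · rw [Metric.mem_ball] at hQ1; linarith

/-- The sum over the sheets of the integrals of a cocycle along the lifts of a loop in a compact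
convex base vanishes. -/
lemma SymContOn.sum_hasPathInt_eq_zero {E : Type*} [NormedAddCommGroup E] [NormedSpace ℝ E]
    {K : Set E} {R : E → Fin d → ℂ} (hK : IsCompact K) (hconv : Convex ℝ K) (h : SymContOn R K)
    {c : ℂ × E → ℂ × E → A} (hc : IsCoc (rootSet R K) c) {γ : ℝ → E} {z : Fin d → ℝ → ℂ}
    (hγ : ContinuousOn γ (Set.Icc 0 1)) (hm : Set.MapsTo γ (Set.Icc 0 1) K) (hloop : γ 0 = γ 1)
    (hzc : ∀ j, ContinuousOn (z j) (Set.Icc 0 1))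
    (hz : ∀ t ∈ Set.Icc (0 : ℝ) 1, ∃ π : Equiv.Perm (Fin d), ∀ j, z j t = R (γ t) (π j))
    {v : Fin d → A} (hv : ∀ j, HasPathInt c (fun t => (z j t, γ t)) (v j)) : ∑ j, v j = 0 := by
  set T : E → E → A := fun x y => ∑ j, c (R x j, x) (R y (matchPerm (R x) (R y) j), y) with hT
  have hloc : ∀ p ∈ K, ∃ U ∈ 𝓝[K] p, ∃ ρ > 0, ∃ b : ℂ × E → A,
      (∀ P ∈ rootSet R U, ∀ Q ∈ rootSet R U, dist P.1 Q.1 < ρ → c P Q = b Q - b P) ∧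
      ∀ x ∈ U, ∀ y ∈ U, T x y = ∑ j, b (R y j, y) - ∑ j, b (R x j, x) := by
    intro p hp
    obtain ⟨U, hU, ρ, hρ, b, hb⟩ := h.exists_local_potential hc hp
    obtain ⟨V, hV, hV'⟩ := (h.nearDiag hρ).exists_nhds hp
    refine ⟨U ∩ V, Filter.inter_mem hU hV, ρ, hρ, b, fun P hP Q hQ => hb P ⟨hP.1.1, hP.2⟩ Q
      ⟨hQ.1.1, hQ.2⟩, fun x hx y hy => ?_⟩
    rw [← Equiv.sum_comp (matchPerm (R x) (R y)) fun j => b (R y j, y), ← Finset.sum_sub_distrib]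
    refine Finset.sum_congr rfl fun j _ => hb _ ⟨hx.1, j, rfl⟩ _ ⟨hy.1, _, rfl⟩ ?_
    rw [dist_comm]
    exact hV' x hx.2 y hy.2 j
  have hTc : IsCoc K T := .of_nhds fun p hp => by
    obtain ⟨U, hU, ρ, hρ, b, -, hb⟩ := hloc p hp
    exact ⟨fun x => ∑ j, b (R x j, x), U, hU, hb⟩
  obtain ⟨B, hB⟩ := hTc.exists_isPrim hK hconv
  choose w hw hwv using hv
  have h1 : IsPrim (Set.Icc 0 1) (fun s t => T (γ s) (γ t)) fun t => ∑ j, w j t := by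
    refine .of_nhds fun t₀ ht₀ => ?_
    obtain ⟨U, hU, ρ, hρ, b, hb1, hb2⟩ := hloc (γ t₀) (hm ht₀)
    have hU' := (hγ.tendsto_nhdsWithin_mapsTo hm ht₀) hU
    choose W hW hW' using fun j => NearDiag.exists_nhds (hw j) ht₀
    have hnear : ∀ j, {t | dist (z j t) (z j t₀) < ρ / 2} ∈ 𝓝[Set.Icc 0 1] t₀ := fun j =>
      Metric.tendsto_nhds.1 (hzc j t₀ ht₀) (ρ / 2) (by linarith)
    refine ⟨(γ ⁻¹' U ∩ Set.Icc 0 1) ∩ ((⋂ j, W j) ∩ ⋂ j, {t | dist (z j t) (z j t₀) < ρ / 2}),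
      Filter.inter_mem (Filter.inter_mem hU' self_mem_nhdsWithin) (Filter.inter_mem
        (Filter.iInter_mem.2 hW) (Filter.iInter_mem.2 hnear)), fun s hs t ht => ?_⟩
    simp only
    rw [hb2 _ hs.1.1 _ ht.1.1]
    have e1 : ∀ t ∈ Set.Icc (0 : ℝ) 1, ∑ j, b (R (γ t) j, γ t) = ∑ j, b (z j t, γ t) := by
      intro t ht
      obtain ⟨π, hπ⟩ := hz t ht
      rw [← Equiv.sum_comp π]
      simp [hπ]
    rw [e1 t ht.1.2, e1 s hs.1.2, ← Finset.sum_sub_distrib, ← Finset.sum_sub_distrib]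
    refine Finset.sum_congr rfl fun j _ => ?_
    have m1 := Set.mem_iInter.1 hs.2.1 j
    have m2 := Set.mem_iInter.1 ht.2.1 j
    have m3 := Set.mem_iInter.1 hs.2.2 j
    have m4 := Set.mem_iInter.1 ht.2.2 j
    simp only [Set.mem_ofPred_eq] at m3 m4
    rw [← hW' j s m1 t m2]
    refine (hb1 (z j s, γ s) ⟨hs.1.1, ?_⟩ (z j t, γ t) ⟨ht.1.1, ?_⟩ ?_).symm
    · obtain ⟨π, hπ⟩ := hz s hs.1.2
      exact ⟨π j, (hπ j).symm⟩
    · obtain ⟨π, hπ⟩ := hz t ht.1.2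
      exact ⟨π j, (hπ j).symm⟩
    · simp only
      linarith [dist_triangle_right (z j s) (z j t) (z j t₀)]
  have h2 := IsPrim.sub_eq_sub isPreconnected_Icc h1 (hB.comp hγ hm) (x := 0) (y := 1) (by simp)
    (by simp)
  rw [hloop, sub_self, ← Finset.sum_sub_distrib] at h2
  simpa [hwv] using h2

end Trace

section SheetPrim

/-- Primitives on finitely many disjoint sheets assemble to a primitive. -/
lemma exists_isPrim_of_sheets {α β A ι : Type*} [TopologicalSpace α] [T2Space α]
    [TopologicalSpace β] [AddCommGroup A] [Finite ι] {S : Set α} {T : Set β} {g : α → β}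
    {ψ : ι → β → α} (hg : ContinuousOn g S) (hm : Set.MapsTo g S T)
    (hψ : ∀ j, ContinuousOn (ψ j) T) (hsep : ∀ y ∈ T, Function.Injective fun j => ψ j y)
    (hex : ∀ p ∈ S, ∃ j, ψ j (g p) = p) {c : α → α → A} {b : ι → β → A}
    (hb : ∀ j, IsPrim T (fun x y => c (ψ j x) (ψ j y)) (b j)) : ∃ b', IsPrim S c b' := by
  classical
  have hι : ∀ p : α, ∃ k : Option ι, p ∈ S → ∃ j, k = some j ∧ ψ j (g p) = p := fun p => by
    by_cases hp : p ∈ S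
    · obtain ⟨j, hj⟩ := hex p hp
      exact ⟨some j, fun _ => ⟨j, rfl, hj⟩⟩
    · exact ⟨none, fun h => (hp h).elim⟩
  choose k hk using hι
  refine ⟨fun p => (k p).elim 0 fun j => b j (g p), ?_⟩
  refine .of_nhds fun p hp => ?_
  obtain ⟨j, hj, hjp⟩ := hk p hp
  obtain ⟨U, hU, hUb⟩ := (NearDiag.comp (hb j) hg hm).exists_nhds hp
  have hne : ∀ i, i ≠ j → ∀ᶠ q in 𝓝[S] p, ψ i (g q) ≠ q := by
    intro i hi
    have h1 : ContinuousWithinAt (fun q => (ψ i (g q), q)) S p :=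
      (((hψ i).comp hg hm).continuousWithinAt hp).prodMk continuousWithinAt_id
    have h2 : (ψ i (g p), p) ∈ (Set.diagonal α)ᶜ := by
      intro h
      exact hi (hsep _ (hm hp) ((Set.mem_diagonal_iff.1 h).trans hjp.symm))
    exact h1.eventually_mem (isClosed_diagonal.isOpen_compl.mem_nhds h2)
  have hev : ∀ᶠ q in 𝓝[S] p, k q = some j ∧ ψ j (g q) = q := by
    have h1 : ∀ᶠ q in 𝓝[S] p, ∀ i, i ≠ j → ψ i (g q) ≠ q := by
      rw [Filter.eventually_all]
      intro i
      by_cases hi : i = j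
      · exact .of_forall fun q h => (h hi).elim
      · exact (hne i hi).mono fun q hq _ => hq
    filter_upwards [h1, self_mem_nhdsWithin] with q hq hqS
    obtain ⟨i, hi, hi'⟩ := hk q hqS
    by_cases hij : i = j
    · subst hij
      exact ⟨hi, hi'⟩
    · exact (hq i hij hi').elim
  refine ⟨U ∩ {q | k q = some j ∧ ψ j (g q) = q}, Filter.inter_mem hU hev, fun x hx y hy => ?_⟩
  have := hUb x hx.1 y hy.1
  simp only [hx.2.1, hx.2.2, hy.2.1, hy.2.2, Option.elim] at this ⊢
  exact this

/-- Cocycles on an unramified finite cover of a compact convex set are coboundaries. -/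
lemma IsCoc.exists_isPrim_rootSet {E A : Type*} [NormedAddCommGroup E] [NormedSpace ℝ E]
    [AddCommGroup A] {d : ℕ} {K : Set E} {R : E → Fin d → ℂ} (hK : IsCompact K)
    (hconv : Convex ℝ K) (h : SymContOn R K) (hinj : ∀ x ∈ K, Function.Injective (R x))
    {c : ℂ × E → ℂ × E → A} (hc : IsCoc (rootSet R K) c) : ∃ b, IsPrim (rootSet R K) c b := by
  obtain ⟨η, hη, hR⟩ := h.exists_sheets hK hconv hinj
  have hψ : ∀ j, ContinuousOn (fun x => (η x j, x)) K := fun j => (hη j).prodMk continuousOn_id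
  have hψm : ∀ j, Set.MapsTo (fun x => (η x j, x)) K (rootSet R K) := fun j x hx => by
    obtain ⟨σ, hσ⟩ := hR x
    exact ⟨hx, σ j, (hσ j).symm⟩
  choose b hb using fun j => (hc.comp (hψ j) (hψm j)).exists_isPrim hK hconv
  refine exists_isPrim_of_sheets (g := Prod.snd) (T := K) (ψ := fun j x => (η x j, x)) (by fun_prop)
    (fun p hp => hp.1) hψ (fun y hy i j hij => ?_) (fun p hp => ?_) hb
  · obtain ⟨σ, hσ⟩ := hR y
    have h1 : η y i = η y j := congrArg Prod.fst hij
    rw [hσ, hσ] at h1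
    exact σ.injective (hinj y hy h1)
  · obtain ⟨σ, hσ⟩ := hR p.2
    obtain ⟨j, hj⟩ := hp.2
    refine ⟨σ.symm j, Prod.ext ?_ rfl⟩
    simp [hσ, hj]

end SheetPrim

section Sweep

lemma interval_sweep {P : ℝ → ℝ → Prop} {bad : Set ℝ} (hbad : bad.Finite) {δ : ℝ} (hδ : 0 < δ)
    (small : ∀ a b, a ≤ b → b - a < δ → P a b)
    (glue : ∀ a t b, a ≤ t → t ≤ b → t ∉ bad → P a t → P t b → P a b) {a b : ℝ} (hab : a ≤ b) :
    P a b := by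
  have key : ∀ n : ℕ, ∀ b, a ≤ b → b - a < (n + 1) * (δ / 2) → P a b := by
    intro n
    induction n with
    | zero => intro b hab h; exact small a b hab (by push_cast at h; linarith)
    | succ n ih =>
      intro b hab h
      by_cases hs : b - a < δ
      · exact small a b hab hs
      · obtain ⟨t, ht, htb⟩ := ((Set.Ioo_infinite (show b - δ < b - δ / 2 by linarith)).sdiff
          hbad).nonempty
        have h1 : a ≤ t := by linarith [ht.1]
        have h2 : t ≤ b := by linarith [ht.2]
        refine glue a t b h1 h2 htb (ih t h1 ?_) (small t b h2 (by linarith [ht.1]))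
        push_cast at h ⊢
        linarith [ht.2]
  obtain ⟨n, hn⟩ := exists_nat_gt ((b - a) / (δ / 2))
  refine key n b hab ?_
  rw [div_lt_iff₀ (by positivity)] at hn
  linarith

variable {d : ℕ} {R : ℂ → Fin d → ℂ} {B : Set ℂ} {c : ℂ × ℂ → ℂ × ℂ → Real.Angle}

lemma rootSet_union (K L : Set ℂ) : rootSet R (K ∪ L) = rootSet R K ∪ rootSet R L := by
  ext p
  simp only [rootSet, Set.mem_union, Set.mem_ofPred_eq, or_and_right]

lemma rootSet_inter (K L : Set ℂ) : rootSet R (K ∩ L) = rootSet R K ∩ rootSet R L := by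
  ext p
  simp only [rootSet, Set.mem_inter_iff, Set.mem_ofPred_eq]
  tauto

lemma Liftable.rootSet_union (hR : SymContOn R Set.univ) (hinj : ∀ x ∉ B, Function.Injective (R x))
    (hc : IsCoc (rootSet R Set.univ) c) {K L : Set ℂ} (hK : IsClosed K) (hL : IsClosed L)
    (hKL : IsCompact (K ∩ L)) (hconv : Convex ℝ (K ∩ L)) (hB : ∀ x ∈ K ∩ L, x ∉ B)
    (h1 : Liftable (rootSet R K) c) (h2 : Liftable (rootSet R L) c) :
    Liftable (rootSet R (K ∪ L)) c := by
  have hcl : ∀ K : Set ℂ, IsClosed K → ∀ M, closure (rootSet R K) ∩ rootSet R M ⊆ rootSet R K :=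
    fun K hK M p hp => ⟨closure_minimal (fun q hq => hq.1)
      (hK.preimage continuous_snd) hp.1, hp.2.2⟩
  rw [_root_.rootSet_union]
  refine Liftable.union ?_ ?_ (hc.mono ?_) h1 h2 ?_
  · rw [← _root_.rootSet_union]; exact hcl K hK _
  · rw [← _root_.rootSet_union]; exact hcl L hL _
  · rw [← _root_.rootSet_union]; exact rootSet_mono (Set.subset_univ _)
  · intro D hD
    rw [← rootSet_inter] at hD ⊢
    exact hD.exists_isPrim_rootSet hKL hconv (hR.mono (Set.subset_univ _))
      fun x hx => hinj x (hB x hx)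

lemma isCompact_reProdIm_Icc (a b y z : ℝ) : IsCompact (Set.Icc a b ×ℂ Set.Icc y z) :=
  isCompact_Icc.reProdIm isCompact_Icc

lemma convex_reProdIm_Icc (a b y z : ℝ) : Convex ℝ (Set.Icc a b ×ℂ Set.Icc y z) :=
  ((convex_Icc a b).is_linear_preimage Complex.reLm.isLinear).inter
    ((convex_Icc y z).is_linear_preimage Complex.imLm.isLinear)

/-- An angle-valued cocycle on a finite branched cover of a rectangle lifts to the reals. -/
lemma liftable_rootSet_rect (hR : SymContOn R Set.univ) (hBf : B.Finite)
    (hinj : ∀ x ∉ B, Function.Injective (R x)) (hc : IsCoc (rootSet R Set.univ) c) {r : ℝ}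
    (hr : 0 ≤ r) : Liftable (rootSet R (Set.Icc (-r) r ×ℂ Set.Icc (-r) r)) c := by
  set K := Set.Icc (-r) r ×ℂ Set.Icc (-r) r with hK
  choose! U hU ρ hρ b hb using fun p (hp : p ∈ (Set.univ : Set ℂ)) =>
    hR.exists_local_potential hc hp
  obtain ⟨δ, hδ, hleb⟩ := lebesgue_number_lemma_of_metric (c := fun x => interior (U x))
    (isCompact_reProdIm_Icc (-r) r (-r) r) (fun _ => isOpen_interior) fun x _ =>
      Set.mem_iUnion.2 ⟨x, mem_interior_iff_mem_nhds.2 (by simpa using hU x trivial)⟩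
  have hsmall : ∀ M : Set ℂ, (∃ x ∈ K, M ⊆ Metric.ball x δ) → Liftable (rootSet R M) c := by
    rintro M ⟨x, hx, hM⟩
    obtain ⟨y, hy⟩ := hleb x hx
    replace hy := hy.trans interior_subset
    refine IsPrim.liftable (b := b y) ?_
    have hcl : NearDiag (rootSet R M) fun P Q => dist P.1 Q.1 < ρ y := by
      refine .of_nhds fun p hp => ⟨_, mem_nhdsWithin_of_mem_nhds
        (Metric.ball_mem_nhds p (half_pos (hρ y trivial))), fun P hP Q hQ => ?_⟩
      have := dist_triangle_right P Q p
      have h3 : dist P.1 Q.1 ≤ dist P Q := le_max_left _ _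
      rw [Metric.mem_ball] at hP hQ
      linarith
    exact hcl.imp fun P hP Q hQ h => hb y trivial P (rootSet_mono (hM.trans hy) hP) Q
      (rootSet_mono (hM.trans hy) hQ) h
  have key : ∀ a b, a ≤ b → (-r ≤ a → b ≤ r → b - a < δ / 2 → ∀ y z, y ≤ z →
      (-r ≤ y → z ≤ r → Liftable (rootSet R (Set.Icc a b ×ℂ Set.Icc y z)) c)) := by
    intro a b hab ha hb' hδ' y z hyz
    refine interval_sweep (P := fun y z => -r ≤ y → z ≤ r →
      Liftable (rootSet R (Set.Icc a b ×ℂ Set.Icc y z)) c) (hBf.image Complex.im)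
      (half_pos hδ) ?_ ?_ hyz
    · intro y z hyz hd hy hz
      refine hsmall _ ⟨⟨a, y⟩, ⟨⟨ha, hab.trans hb'⟩, hy, hyz.trans hz⟩, fun w hw => ?_⟩
      obtain ⟨⟨h1, h2⟩, h3, h4⟩ := hw
      rw [Metric.mem_ball, Complex.dist_eq]
      refine (Complex.norm_le_abs_re_add_abs_im _).trans_lt ?_
      simp only [Complex.sub_re, Complex.sub_im]
      rw [abs_of_nonneg (by linarith), abs_of_nonneg (by linarith)]
      linarith
    · intro y t z hyt htz ht h1 h2 hy hz
      have hun : Set.Icc a b ×ℂ Set.Icc y z =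
          (Set.Icc a b ×ℂ Set.Icc y t) ∪ (Set.Icc a b ×ℂ Set.Icc t z) := by
        rw [← Set.Icc_union_Icc_eq_Icc hyt htz]
        ext w; simp only [Complex.mem_reProdIm, Set.mem_union]; tauto
      have hin : (Set.Icc a b ×ℂ Set.Icc y t) ∩ (Set.Icc a b ×ℂ Set.Icc t z) =
          Set.Icc a b ×ℂ Set.Icc t t := by
        ext w; simp only [Complex.mem_reProdIm, Set.mem_inter_iff, Set.mem_Icc]; grind
      rw [hun]
      refine Liftable.rootSet_union (B := B) hR hinj hc (isCompact_reProdIm_Icc _ _ _ _).isClosed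
        (isCompact_reProdIm_Icc _ _ _ _).isClosed ?_ ?_ ?_ (h1 hy (htz.trans hz))
        (h2 (hy.trans hyt) hz)
      · rw [hin]; exact isCompact_reProdIm_Icc _ _ _ _
      · rw [hin]; exact convex_reProdIm_Icc _ _ _ _
      · rw [hin]
        rintro x ⟨-, hx⟩ hxB
        exact ht ⟨x, hxB, le_antisymm hx.2 hx.1⟩
  refine interval_sweep (P := fun a b => -r ≤ a → b ≤ r →
    Liftable (rootSet R (Set.Icc a b ×ℂ Set.Icc (-r) r)) c) (hBf.image Complex.re)
    (half_pos hδ) ?_ ?_ (show -r ≤ r by linarith) le_rfl le_rfl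
  · intro a b hab hd ha hb'
    exact key a b hab ha hb' hd _ _ (by linarith) le_rfl le_rfl
  · intro y t z hyt htz ht h1 h2 hy hz
    have hun : Set.Icc y z ×ℂ Set.Icc (-r) r =
        (Set.Icc y t ×ℂ Set.Icc (-r) r) ∪ (Set.Icc t z ×ℂ Set.Icc (-r) r) := by
      rw [← Set.Icc_union_Icc_eq_Icc hyt htz]
      ext w; simp only [Complex.mem_reProdIm, Set.mem_union]; tauto
    have hin : (Set.Icc y t ×ℂ Set.Icc (-r) r) ∩ (Set.Icc t z ×ℂ Set.Icc (-r) r) =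
        Set.Icc t t ×ℂ Set.Icc (-r) r := by
      ext w; simp only [Complex.mem_reProdIm, Set.mem_inter_iff, Set.mem_Icc]; grind
    rw [hun]
    refine Liftable.rootSet_union (B := B) hR hinj hc (isCompact_reProdIm_Icc _ _ _ _).isClosed
      (isCompact_reProdIm_Icc _ _ _ _).isClosed ?_ ?_ ?_ (h1 hy (htz.trans hz))
      (h2 (hy.trans hyt) hz)
    · rw [hin]; exact isCompact_reProdIm_Icc _ _ _ _
    · rw [hin]; exact convex_reProdIm_Icc _ _ _ _
    · rw [hin]
      rintro x ⟨hx, -⟩ hxB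
      exact ht ⟨x, hxB, le_antisymm hx.2 hx.1⟩

end Sweep

section Cone

/-- Data describing an irreducible homogeneous surface as a finite branched cover of `ℂ²`
of degree `d`, unramified off the lines over `B ∪ {∞}`. -/
structure ConeData (d : ℕ) (R : ℂ × ℂ → Fin d → ℂ) (B : Set ℂ) : Prop where
  pos : 0 < d
  cont : SymContOn R Set.univ
  homog : ∀ l : ℂ, l ≠ 0 → ∀ b, ∀ z ∈ Set.range (R b), l * z ∈ Set.range (R (l • b))
  finite : B.Finite
  zero_notMem : 0 ∉ B
  inj : ∀ b : ℂ × ℂ, b.1 ≠ 0 → b.2 / b.1 ∉ B → Function.Injective (R b)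
  conn : IsPreconnected (rootSet R {b | b.1 ≠ 0 ∧ b.2 / b.1 ∉ B})

lemma exists_perm_of_range_subset {d : ℕ} {a b : Fin d → ℂ} (ha : Function.Injective a)
    (h : Set.range a ⊆ Set.range b) : ∃ π : Equiv.Perm (Fin d), ∀ j, a j = b (π j) := by
  choose π hπ using fun j => h ⟨j, rfl⟩
  have hi : Function.Injective π := fun i j hij => ha (by rw [← hπ, ← hπ, hij])
  exact ⟨Equiv.ofBijective π (Finite.injective_iff_bijective.1 hi), fun j => (hπ j).symm⟩

variable {d : ℕ} {R : ℂ × ℂ → Fin d → ℂ} {B : Set ℂ} {A : Type*} [AddCommGroup A]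

/-- The cone with its vertex removed. -/
abbrev Vstar (R : ℂ × ℂ → Fin d → ℂ) : Set (ℂ × ℂ × ℂ) := rootSet R {0}ᶜ

namespace ConeData

lemma smul_mem (h : ConeData d R B) {l : ℂ} (hl : l ≠ 0) {p : ℂ × ℂ × ℂ} (hp : p ∈ Vstar R) :
    l • p ∈ Vstar R :=
  ⟨fun h0 => hp.1 ((smul_eq_zero_iff_right hl).1 h0), h.homog l hl p.2 p.1 hp.2⟩

/-- The good part is dense in the cone. -/
lemma vstar_subset_closure (h : ConeData d R B) :
    Vstar R ⊆ closure (rootSet R {b | b.1 ≠ 0 ∧ b.2 / b.1 ∉ B}) := by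
  rintro ⟨z, b⟩ ⟨hb, j, hj⟩
  simp only at hb hj
  refine Metric.mem_closure_iff.2 fun ε hε => ?_
  have hgood : ∀ᶠ b' in 𝓝 b, ∃ σ : Equiv.Perm (Fin d), ∀ j, dist (R b' (σ j)) (R b j) < ε := by
    simpa using h.cont b trivial ε hε
  obtain ⟨δ, hδ, hball⟩ := Metric.eventually_nhds_iff.1 hgood
  obtain ⟨b', hb', hb1, hb2⟩ : ∃ b', dist b' b < min δ ε ∧ b'.1 ≠ 0 ∧ b'.2 / b'.1 ∉ B := by
    obtain ⟨x, hx, hxd⟩ := ((Set.finite_singleton (0 : ℂ)).countable.dense_compl ℝ).exists_dist_lt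
      b.1 (lt_min hδ hε)
    obtain ⟨w, hw, hwd⟩ := ((h.finite.image (· * x)).countable.dense_compl ℝ).exists_dist_lt
      b.2 (lt_min hδ hε)
    refine ⟨(x, w), max_lt (by rwa [dist_comm]) (by rwa [dist_comm]), hx, fun hB => hw
      ⟨w / x, hB, div_mul_cancel₀ w hx⟩⟩
  obtain ⟨σ, hσ⟩ := hball (hb'.trans_le (min_le_left _ _))
  refine ⟨(R b' (σ j), b'), ⟨⟨hb1, hb2⟩, _, rfl⟩, ?_⟩
  rw [dist_comm]
  refine max_lt ?_ (hb'.trans_le (min_le_right _ _))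
  simpa [hj] using hσ j

lemma isPreconnected_vstar (h : ConeData d R B) : IsPreconnected (Vstar R) := by
  refine h.conn.subset_closure (fun p hp => ⟨fun h0 => hp.1.1 ?_, hp.2⟩) h.vstar_subset_closure
  rw [Set.mem_singleton_iff.1 h0]; rfl

/-- The circle through a point of the cone. -/
noncomputable def _root_.coneLoop (p : ℂ × ℂ × ℂ) (t : ℝ) : ℂ × ℂ × ℂ :=
  Complex.exp (2 * Real.pi * Complex.I * t) • p

lemma _root_.continuous_coneLoop : Continuous fun q : ℝ × ℂ × ℂ × ℂ => coneLoop q.2 q.1 := by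
  unfold coneLoop; fun_prop

lemma coneLoop_mem (h : ConeData d R B) {p : ℂ × ℂ × ℂ} (hp : p ∈ Vstar R) (t : ℝ) :
    coneLoop p t ∈ Vstar R := h.smul_mem (Complex.exp_ne_zero _) hp

lemma _root_.exp_two_pi_I_zero_one : Complex.exp (2 * Real.pi * Complex.I * (0 : ℝ)) =
    Complex.exp (2 * Real.pi * Complex.I * (1 : ℝ)) := by simp

lemma hasPathInt_coneLoop (h : ConeData d R B) {c : ℂ × ℂ × ℂ → ℂ × ℂ × ℂ → A}
    (hc : IsCoc (Vstar R) c) {p q : ℂ × ℂ × ℂ} (hp : p ∈ Vstar R) (hq : q ∈ Vstar R) {v : A}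
    (hv : HasPathInt c (coneLoop p) v) : HasPathInt c (coneLoop q) v :=
  hc.hasPathInt_homotopy (H := fun q => coneLoop q.2 q.1) h.isPreconnected_vstar
    continuous_coneLoop.continuousOn (fun q hq => h.coneLoop_mem hq.2 _)
    (fun t _ => by simp only [coneLoop, exp_two_pi_I_zero_one]) hp hq hv

/-- Continuous sheets over a disc around the line `w = 0`. -/
structure _root_.Sheets (R : ℂ × ℂ → Fin d → ℂ) (B : Set ℂ) (ρ : ℝ) (η : ℂ → Fin d → ℂ) :
    Prop where
  pos : 0 < ρ
  disj : ∀ s, ‖s‖ ≤ ρ → s ∉ B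
  cont : ∀ j, ContinuousOn (fun s => η s j) (Metric.closedBall 0 ρ)
  perm : ∀ s, ∃ σ : Equiv.Perm (Fin d), ∀ j, η s j = R (1, s) (σ j)

lemma exists_sheets (h : ConeData d R B) : ∃ ρ η, Sheets R B ρ η := by
  obtain ⟨ρ, hρ, hB⟩ := Metric.nhds_basis_closedBall.mem_iff.1
    (h.finite.isClosed.isOpen_compl.mem_nhds h.zero_notMem)
  have h1 : SymContOn (fun s : ℂ => R (1, s)) (Metric.closedBall 0 ρ) :=
    h.cont.comp (f := fun s : ℂ => ((1, s) : ℂ × ℂ)) (by fun_prop) fun _ _ => trivial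
  obtain ⟨η, hη, hR⟩ := h1.exists_sheets (isCompact_closedBall _ _) (convex_closedBall _ _)
    fun s hs => h.inj (1, s) one_ne_zero (by simpa using hB hs)
  exact ⟨ρ, η, hρ, fun s hs => hB (by simpa using hs), hη, hR⟩

variable {ρ : ℝ} {η : ℂ → Fin d → ℂ}

/-- The point of the `j`-th sheet over `l • (1, s)`. -/
def _root_.sheetPt (η : ℂ → Fin d → ℂ) (j : Fin d) (q : ℂ × ℂ) : ℂ × ℂ × ℂ :=
  q.1 • (η q.2 j, 1, q.2)

lemma _root_.Sheets.mem (hs : Sheets R B ρ η) (s : ℂ) (j : Fin d) : η s j ∈ Set.range (R (1, s)) := by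
  obtain ⟨σ, hσ⟩ := hs.perm s
  exact ⟨_, (hσ j).symm⟩

lemma _root_.Sheets.exists_eq (hs : Sheets R B ρ η) {s z : ℂ} (hz : z ∈ Set.range (R (1, s))) :
    ∃ j, η s j = z := by
  obtain ⟨σ, hσ⟩ := hs.perm s
  obtain ⟨j, hj⟩ := hz
  exact ⟨σ.symm j, by simp [hσ, hj]⟩

lemma sheet_injective (h : ConeData d R B) (hs : Sheets R B ρ η) {s : ℂ} (hsρ : ‖s‖ ≤ ρ) :
    Function.Injective (η s) := by
  obtain ⟨σ, hσ⟩ := hs.perm s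
  intro i j hij
  rw [hσ, hσ] at hij
  exact σ.injective (h.inj (1, s) one_ne_zero (by simpa using hs.disj s hsρ) hij)

lemma sheetPt_mem (h : ConeData d R B) (hs : Sheets R B ρ η) (j : Fin d) {q : ℂ × ℂ}
    (hq : q.1 ≠ 0) : sheetPt η j q ∈ Vstar R :=
  h.smul_mem hq ⟨fun h0 => one_ne_zero (congrArg Prod.fst h0), hs.mem _ _⟩

lemma _root_.Sheets.continuousOn_sheetPt (hs : Sheets R B ρ η) (j : Fin d) :
    ContinuousOn (sheetPt η j) (Set.univ ×ˢ Metric.closedBall 0 ρ) := by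
  have h1 : ContinuousOn (fun q : ℂ × ℂ => η q.2 j) (Set.univ ×ˢ Metric.closedBall 0 ρ) :=
    (hs.cont j).comp continuousOn_snd fun q hq => hq.2
  unfold sheetPt
  exact continuousOn_fst.smul (h1.prodMk (by fun_prop))

/-- The boundary circle of the `j`-th sheet, in the chart `w = 1`. -/
noncomputable def _root_.rimLoop (ρ : ℝ) (η : ℂ → Fin d → ℂ) (j : Fin d) (t : ℝ) : ℂ × ℂ × ℂ :=
  sheetPt η j (Complex.exp (2 * Real.pi * Complex.I * t) / ρ,
    ρ / Complex.exp (2 * Real.pi * Complex.I * t))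

lemma _root_.norm_exp_two_pi_I (t : ℝ) : ‖Complex.exp (2 * Real.pi * Complex.I * t)‖ = 1 := by
  rw [Complex.norm_exp]; simp

lemma _root_.continuousOn_rimHomotopy (hs : Sheets R B ρ η) (j : Fin d) :
    ContinuousOn (fun q : ℝ × ℝ => sheetPt η j (Complex.exp (2 * Real.pi * Complex.I * q.1) / ρ,
      q.2 * (ρ / Complex.exp (2 * Real.pi * Complex.I * q.1)))) (Set.univ ×ˢ Set.Icc 0 1) := by
  have hρ := hs.pos
  refine (hs.continuousOn_sheetPt j).comp (Continuous.continuousOn ?_) fun q hq =>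
    ⟨trivial, ?_⟩
  · exact .prodMk (by fun_prop) (by fun_prop (disch := simp))
  · have h2 := hq.2
    simp only [Metric.mem_closedBall, dist_zero_right, norm_mul, norm_div, norm_exp_two_pi_I]
    rw [Complex.norm_real, Complex.norm_real, Real.norm_of_nonneg hq.2.1,
      Real.norm_of_nonneg hρ.le, div_one]
    nlinarith [hq.2.2, hq.2.1]

lemma _root_.Sheets.continuous_rimLoop (hs : Sheets R B ρ η) (j : Fin d) :
    Continuous (rimLoop ρ η j) := by
  have := (continuousOn_rimHomotopy hs j).comp (f := fun t : ℝ => (t, (1 : ℝ))) (s := Set.univ)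
    (by fun_prop) (fun t _ => ⟨trivial, by simp⟩)
  rw [continuousOn_univ] at this
  refine this.congr fun t => ?_
  simp [rimLoop]

/-- A boundary circle is homologous to the circle fibre. -/
lemma hasPathInt_rimLoop (h : ConeData d R B) (hs : Sheets R B ρ η)
    {c : ℂ × ℂ × ℂ → ℂ × ℂ × ℂ → A} (hc : IsCoc (Vstar R) c) {p : ℂ × ℂ × ℂ} (hp : p ∈ Vstar R)
    {v : A} (hv : HasPathInt c (coneLoop p) v) (j : Fin d) : HasPathInt c (rimLoop ρ η j) v := by
  have hρ := hs.pos
  have hρ' : (ρ : ℂ) ≠ 0 := by exact_mod_cast hρ.ne'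
  have h1 := h.hasPathInt_coneLoop hc hp (h.sheetPt_mem hs j (q := ((ρ : ℂ)⁻¹, 0))
    (inv_ne_zero hρ')) hv
  have := hc.hasPathInt_homotopy (T := Set.Icc (0 : ℝ) 1) (t := 0) (t' := 1) (v := v)
    (H := fun q : ℝ × ℝ => sheetPt η j (Complex.exp (2 * Real.pi * Complex.I * q.1) / ρ,
      q.2 * (ρ / Complex.exp (2 * Real.pi * Complex.I * q.1)))) isPreconnected_Icc
    ((continuousOn_rimHomotopy hs j).mono fun q hq => ⟨trivial, hq.2⟩)
    (fun q _ => h.sheetPt_mem hs j (div_ne_zero (Complex.exp_ne_zero _) hρ'))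
    (fun t _ => by simp only [exp_two_pi_I_zero_one]) (by simp) (by simp) (by
      refine (congrArg (fun γ => HasPathInt c γ v) (funext fun t => ?_)).mp h1
      simp [coneLoop, sheetPt, div_eq_mul_inv, mul_assoc])
  refine (congrArg (fun γ => HasPathInt c γ v) (funext fun t => ?_)).mp this
  simp [rimLoop]

/-- The part of the cone in the chart `w = 1`. -/
lemma symContOn_chart (h : ConeData d R B) : SymContOn (fun ξ : ℂ => R (ξ, 1)) Set.univ :=
  h.cont.comp (f := fun ξ : ℂ => ((ξ, 1) : ℂ × ℂ)) (by fun_prop) fun _ _ => trivial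

lemma chart_mem {p : ℂ × ℂ} (hp : p ∈ rootSet (fun ξ : ℂ => R (ξ, 1)) Set.univ) :
    (p.1, p.2, (1 : ℂ)) ∈ Vstar R :=
  ⟨fun h0 => one_ne_zero (congrArg Prod.snd h0), hp.2⟩

/-- The integrals over the boundary circles sum to zero. -/
lemma sum_rimLoop_eq_zero (h : ConeData d R B) (hs : Sheets R B ρ η)
    {c : ℂ × ℂ → ℂ × ℂ → A}
    (hc : IsCoc (rootSet (fun ξ : ℂ => R (ξ, 1)) (Metric.closedBall 0 ρ⁻¹)) c)
    {v : Fin d → A}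
    (hv : ∀ j, HasPathInt c (fun t => ((rimLoop ρ η j t).1, (rimLoop ρ η j t).2.1)) (v j)) :
    ∑ j, v j = 0 := by
  have hρ := hs.pos
  have hρ' : (ρ : ℂ) ≠ 0 := by exact_mod_cast hρ.ne'
  have h2 : ∀ j t, (rimLoop ρ η j t).2.1 = Complex.exp (2 * Real.pi * Complex.I * t) / ρ :=
    fun j t => by simp [rimLoop, sheetPt]
  refine SymContOn.sum_hasPathInt_eq_zero (isCompact_closedBall _ _) (convex_closedBall _ _)
    (h.symContOn_chart.mono (Set.subset_univ _)) hc (γ := fun t =>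
      Complex.exp (2 * Real.pi * Complex.I * t) / ρ) (z := fun j t => (rimLoop ρ η j t).1)
    (by fun_prop) (fun t _ => ?_) (by simp only [exp_two_pi_I_zero_one])
    (fun j => (hs.continuous_rimLoop j).fst.continuousOn) (fun t _ => ?_) (v := v)
    (fun j => by simpa only [h2] using hv j)
  · simp [norm_exp_two_pi_I, abs_of_pos hρ]
  · set e := Complex.exp (2 * Real.pi * Complex.I * t) with he
    have hee : e ≠ 0 := Complex.exp_ne_zero _
    have hne : ‖(ρ : ℂ) / e‖ ≤ ρ := by
      rw [norm_div, norm_exp_two_pi_I, Complex.norm_real, Real.norm_of_nonneg hρ.le, div_one]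
    refine exists_perm_of_range_subset (a := fun j => (rimLoop ρ η j t).1) (fun i j hij => ?_) ?_
    · simp only [rimLoop, sheetPt, Prod.smul_fst, smul_eq_mul] at hij
      exact h.sheet_injective hs hne (mul_left_cancel₀ (div_ne_zero hee hρ') hij)
    · rintro _ ⟨j, rfl⟩
      have := (h.sheetPt_mem hs j (q := (e / ρ, ρ / e)) (div_ne_zero hee hρ')).2
      have e1 : (sheetPt η j (e / ρ, ρ / e)).2 = (e / ρ, 1) := by
        simp [sheetPt]
        field_simp
      rw [e1] at this
      exact this

/-- The circle fibre is torsion of order dividing `d`. -/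
lemma nsmul_eq_zero (h : ConeData d R B) {c : ℂ × ℂ × ℂ → ℂ × ℂ × ℂ → A} (hc : IsCoc (Vstar R) c)
    {p : ℂ × ℂ × ℂ} (hp : p ∈ Vstar R) {v : A} (hv : HasPathInt c (coneLoop p) v) :
    d • v = 0 := by
  obtain ⟨ρ, η, hs⟩ := h.exists_sheets
  have hρ' : (ρ : ℂ) ≠ 0 := by exact_mod_cast hs.pos.ne'
  have := h.sum_rimLoop_eq_zero hs (v := fun _ => v)
    (c := fun p q => c (p.1, p.2, 1) (q.1, q.2, 1))
    (hc.comp (by fun_prop) fun p hp => chart_mem (rootSet_mono (Set.subset_univ _) hp)) fun j => by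
      refine (congrArg (fun γ => HasPathInt c γ v) (funext fun t => ?_)).mp
        (h.hasPathInt_rimLoop hs hc hp hv j)
      simp [rimLoop, sheetPt, hρ']
  simpa using this

end ConeData

end Cone

section Divisor

variable {d : ℕ} {Q : ℂ → Fin d → ℂ}

/-- `u` has divisor `D` on the total space of `Q`, up to values on a fibre. -/
def HasDivisor (Q : ℂ → Fin d → ℂ) (D : ℂ × ℂ → ℤ) (u : ℂ × ℂ → ℂ) : Prop :=
  (∃ M : ℝ, ∀ q ∈ rootSet Q Set.univ, M < ‖q.2‖ → u q = 1) ∧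
  ∀ p ∈ rootSet Q Set.univ, ∃ v : ℂ × ℂ → ℂ, ∃ U ∈ 𝓝[rootSet Q Set.univ] p,
    ContinuousOn v U ∧ (∀ q ∈ U, v q ≠ 0) ∧ ∀ q ∈ U, q.2 ≠ p.2 → u q = (q.2 - p.2) ^ D p * v q

lemma HasDivisor.one : HasDivisor Q 0 fun _ => 1 :=
  ⟨⟨0, fun _ _ _ => rfl⟩, fun p _ => ⟨fun _ => 1, _, univ_mem, continuousOn_const,
    fun _ _ => one_ne_zero, fun q _ _ => by simp⟩⟩

lemma HasDivisor.mul {D D' : ℂ × ℂ → ℤ} {u u' : ℂ × ℂ → ℂ} (h : HasDivisor Q D u)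
    (h' : HasDivisor Q D' u') : HasDivisor Q (D + D') fun q => u q * u' q := by
  obtain ⟨⟨M, hM⟩, h⟩ := h
  obtain ⟨⟨M', hM'⟩, h'⟩ := h'
  refine ⟨⟨max M M', fun q hq hn => ?_⟩, fun p hp => ?_⟩
  · simp only [hM q hq ((le_max_left _ _).trans_lt hn), hM' q hq ((le_max_right _ _).trans_lt hn),
      mul_one]
  · obtain ⟨v, U, hU, hc, h0, he⟩ := h p hp
    obtain ⟨v', U', hU', hc', h0', he'⟩ := h' p hp
    refine ⟨fun q => v q * v' q, U ∩ U', Filter.inter_mem hU hU', (hc.mono Set.inter_subset_left).mul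
      (hc'.mono Set.inter_subset_right), fun q hq => mul_ne_zero (h0 q hq.1) (h0' q hq.2),
      fun q hq hne => ?_⟩
    simp only [he q hq.1 hne, he' q hq.2 hne, Pi.add_apply, zpow_add₀ (sub_ne_zero.2 hne)]
    ring

lemma HasDivisor.inv {D : ℂ × ℂ → ℤ} {u : ℂ × ℂ → ℂ} (h : HasDivisor Q D u) :
    HasDivisor Q (-D) fun q => (u q)⁻¹ := by
  obtain ⟨⟨M, hM⟩, h⟩ := h
  refine ⟨⟨M, fun q hq hn => by simp [hM q hq hn]⟩, fun p hp => ?_⟩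
  obtain ⟨v, U, hU, hc, h0, he⟩ := h p hp
  refine ⟨fun q => (v q)⁻¹, U, hU, hc.inv₀ h0, fun q hq => inv_ne_zero (h0 q hq),
    fun q hq hne => ?_⟩
  simp only [he q hq hne, Pi.neg_apply, zpow_neg, mul_inv]

lemma HasDivisor.zpow {D : ℂ × ℂ → ℤ} {u : ℂ × ℂ → ℂ} (h : HasDivisor Q D u) (n : ℤ) :
    ∃ u', HasDivisor Q (n • D) u' := by
  induction n with
  | zero => exact ⟨_, by simpa using HasDivisor.one⟩
  | succ n ih => 
    obtain ⟨u', hu'⟩ := ih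
    exact ⟨_, by simpa [add_smul] using hu'.mul h⟩
  | pred n ih => 
    obtain ⟨u', hu'⟩ := ih
    have e : (-(n : ℤ) - 1) • D = (-(n : ℤ)) • D + -D := by
      rw [sub_smul, one_smul, sub_eq_add_neg]
    rw [e]
    exact ⟨_, hu'.mul h.inv⟩

lemma HasDivisor.sum {ι : Type*} (s : Finset ι) {D : ι → ℂ × ℂ → ℤ}
    (h : ∀ i, ∃ u, HasDivisor Q (D i) u) : ∃ u, HasDivisor Q (∑ i ∈ s, D i) u := by
  classical
  induction s using Finset.induction_on with
  | empty => exact ⟨_, by simpa using HasDivisor.one⟩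
  | insert i s hi ih =>
    obtain ⟨u, hu⟩ := ih
    obtain ⟨u', hu'⟩ := h i
    rw [Finset.sum_insert hi]
    exact ⟨_, hu'.mul hu⟩

/-- A piecewise linear cut-off function. -/
noncomputable def cutoff (t : ℝ) : ℝ := max 0 (min 1 (2 - 2 * t))

lemma continuous_cutoff : Continuous cutoff := by unfold cutoff; fun_prop

lemma cutoff_of_le {t : ℝ} (h : t ≤ 1 / 2) : cutoff t = 1 := by
  rw [cutoff, min_eq_left (by linarith), max_eq_right zero_le_one]

lemma cutoff_of_ge {t : ℝ} (h : 1 ≤ t) : cutoff t = 0 := by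
  rw [cutoff, max_eq_left ((min_le_right _ _).trans (by linarith))]

lemma cutoff_nonneg (t : ℝ) : 0 ≤ cutoff t := le_max_left _ _

lemma cutoff_le_one (t : ℝ) : cutoff t ≤ 1 := max_le zero_le_one (min_le_left _ _)

lemma SymContOn.exists_isolation (hQ : SymContOn Q Set.univ) {z₀ s₀ : ℂ}
    (hinj : Function.Injective (Q s₀)) (h0 : z₀ ∈ Set.range (Q s₀)) :
    ∃ r > 0, ∃ ε > 0, (∀ q ∈ rootSet Q Set.univ, dist q.2 s₀ < ε →
      dist q.1 z₀ < r ∨ 3 * r ≤ dist q.1 z₀) ∧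
      ∀ q ∈ rootSet Q Set.univ, ∀ q' ∈ rootSet Q Set.univ, dist q.2 s₀ < ε → q.2 = q'.2 →
        dist q.1 z₀ < 3 * r → dist q'.1 z₀ < 3 * r → q = q' := by
  obtain ⟨j, rfl⟩ := h0
  obtain ⟨δ, hδ, hsep⟩ := exists_separation (Q s₀)
  have h1 := hQ s₀ trivial (δ / 4) (by linarith)
  rw [nhdsWithin_univ] at h1
  obtain ⟨ε, hε, hb⟩ := Metric.eventually_nhds_iff.1 h1
  have key : ∀ s, dist s s₀ < ε → ∃ σ : Equiv.Perm (Fin d), ∀ i,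
      dist (Q s (σ i)) (Q s₀ i) < δ / 4 ∧ (i ≠ j → 3 * (δ / 4) ≤ dist (Q s (σ i)) (Q s₀ j)) := by
    intro s hs
    obtain ⟨σ, hσ⟩ := hb hs
    refine ⟨σ, fun i => ⟨hσ i, fun hij => ?_⟩⟩
    by_contra hlt
    refine hij (hinj (hsep i j ?_))
    linarith [hσ i, dist_triangle_left (Q s₀ i) (Q s₀ j) (Q s (σ i))]
  refine ⟨δ / 4, by linarith, ε, hε, ?_, ?_⟩
  · rintro ⟨z, s⟩ ⟨-, k, hk⟩ hs
    obtain ⟨σ, hσ⟩ := key s hs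
    obtain ⟨i, rfl⟩ := σ.surjective k
    simp only at hk ⊢
    rw [← hk]
    by_cases hij : i = j
    · left; rw [← hij]; exact (hσ i).1
    · exact Or.inr ((hσ i).2 hij)
  · rintro ⟨z, s⟩ ⟨-, k, hk⟩ ⟨z', s'⟩ ⟨-, k', hk'⟩ hs hss hz hz'
    simp only at hss hk hk' hs hz hz'
    subst hss
    obtain ⟨σ, hσ⟩ := key s hs
    obtain ⟨i, rfl⟩ := σ.surjective k
    obtain ⟨i', rfl⟩ := σ.surjective k'
    have e1 : i = j := by
      by_contra h
      have := (hσ i).2 h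
      rw [hk] at this; linarith
    have e2 : i' = j := by
      by_contra h
      have := (hσ i').2 h
      rw [hk'] at this; linarith
    rw [← hk, ← hk', e1, e2]

open Classical in
/-- The elementary divisor of a point. -/
noncomputable def pointDiv (p : ℂ × ℂ) : ℂ × ℂ → ℤ := fun q => if q = p then 1 else 0

lemma pointDiv_self (p : ℂ × ℂ) : pointDiv p p = 1 := by simp [pointDiv]

lemma pointDiv_of_ne {p q : ℂ × ℂ} (h : q ≠ p) : pointDiv p q = 0 := by simp [pointDiv, h]

lemma SymContOn.exists_hasDivisor_near (hQ : SymContOn Q Set.univ) {p₀ : ℂ × ℂ}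
    (hp₀ : p₀ ∈ rootSet Q Set.univ) (hinj : Function.Injective (Q p₀.2)) :
    ∀ᶠ p₁ in 𝓝[rootSet Q Set.univ] p₀, ∃ u, HasDivisor Q (pointDiv p₀ - pointDiv p₁) u := by
  obtain ⟨z₀, s₀⟩ := p₀
  obtain ⟨r, hr, ε, hε, hiso, huniq⟩ := hQ.exists_isolation hinj hp₀.2
  simp only at hiso huniq hinj
  have hN : ∀ᶠ p : ℂ × ℂ in 𝓝[rootSet Q Set.univ] (z₀, s₀), dist p.1 z₀ < r ∧ dist p.2 s₀ < ε / 4 :=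
    mem_nhdsWithin_of_mem_nhds (((Metric.isOpen_ball (x := z₀) (ε := r)).prod
      (Metric.isOpen_ball (x := s₀) (ε := ε / 4))).mem_nhds
      ⟨Metric.mem_ball_self hr, Metric.mem_ball_self (by linarith)⟩)
  filter_upwards [hN, self_mem_nhdsWithin]
  rintro ⟨z₁, s₁⟩ ⟨hz₁, hs₁⟩ hp₁
  simp only at hz₁ hs₁
  set ψ : ℂ × ℂ → ℝ := fun q => cutoff (dist q.2 s₀ / ε) * cutoff (dist q.1 z₀ / (2 * r)) with hψ
  have hψc : Continuous ψ := by
    have := continuous_cutoff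
    fun_prop
  set u : ℂ × ℂ → ℂ := fun q => 1 + ψ q * (s₁ - s₀) / (q.2 - s₁) with hu
  have huc : ContinuousOn u {q | q.2 ≠ s₁} := by
    have : Continuous fun q => (ψ q : ℂ) := Complex.continuous_ofReal.comp hψc
    refine continuousOn_const.add (ContinuousOn.div (by fun_prop) (by fun_prop)
      fun q hq => sub_ne_zero.2 hq)
  have hψ1 : ∀ q : ℂ × ℂ, dist q.2 s₀ ≤ ε / 2 → dist q.1 z₀ < r → ψ q = 1 := by
    intro q h1 h2
    simp only [hψ]
    rw [cutoff_of_le, cutoff_of_le, mul_one]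
    · rw [div_le_iff₀ (by positivity)]; linarith
    · rw [div_le_iff₀ (by positivity)]; linarith
  have hu1 : ∀ q : ℂ × ℂ, dist q.2 s₀ ≤ ε / 2 → dist q.1 z₀ < r → q.2 ≠ s₁ →
      u q = (q.2 - s₀) / (q.2 - s₁) := by
    intro q h1 h2 h3
    simp only [hu, hψ1 q h1 h2]
    have := sub_ne_zero.2 h3
    field_simp
    push_cast; ring
  have hψ0 : ∀ q : ℂ × ℂ, 2 * r ≤ dist q.1 z₀ → ψ q = 0 := by
    intro q h1
    simp only [hψ]
    rw [cutoff_of_ge (t := dist q.1 z₀ / (2 * r)), mul_zero]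
    rw [le_div_iff₀ (by positivity)]; linarith
  have hψ0' : ∀ q : ℂ × ℂ, ε ≤ dist q.2 s₀ → ψ q = 0 := by
    intro q h1
    simp only [hψ]
    rw [cutoff_of_ge (t := dist q.2 s₀ / ε), zero_mul]
    rw [le_div_iff₀ (by positivity)]; linarith
  have hballN : ∀ p : ℂ × ℂ, dist p.1 z₀ < r → dist p.2 s₀ < ε / 4 →
      {q : ℂ × ℂ | dist q.1 z₀ < r ∧ dist q.2 s₀ < ε / 4} ∈ 𝓝 p := fun p h1 h2 =>
    ((Metric.isOpen_ball (x := z₀) (ε := r)).prod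
      (Metric.isOpen_ball (x := s₀) (ε := ε / 4))).mem_nhds ⟨h1, h2⟩
  refine ⟨u, ⟨‖s₀‖ + ε, fun q _ hq => ?_⟩, fun p hp => ?_⟩
  · have : ε ≤ dist q.2 s₀ := by
      rw [dist_eq_norm]
      linarith [norm_sub_norm_le q.2 s₀]
    simp [hu, hψ0' q this]
  by_cases hps : p.2 = s₁
  · by_cases hpe : p = (z₁, s₁)
    · subst hpe
      refine ⟨fun q => if s₀ = s₁ then 1 else q.2 - s₀,
        {q | dist q.1 z₀ < r ∧ dist q.2 s₀ < ε / 4} ∩ {q | s₀ ≠ s₁ → q.2 ≠ s₀},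
        mem_nhdsWithin_of_mem_nhds (Filter.inter_mem (hballN _ hz₁ hs₁) ?_), ?_, ?_, ?_⟩
      · by_cases h : s₀ = s₁
        · simp [h]
        · simp only [h, not_false_eq_true, ne_eq, forall_const]
          exact (isOpen_ne.preimage continuous_snd).mem_nhds (fun h' => h h'.symm)
      · split_ifs <;> fun_prop
      · intro q hq
        split_ifs with h
        · exact one_ne_zero
        · exact sub_ne_zero.2 (hq.2 h)
      · rintro q ⟨hq, -⟩ hne
        rw [hu1 q (by linarith [hq.2]) hq.1 hne]
        simp only [Pi.sub_apply, pointDiv_self]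
        split_ifs with h
        · subst h
          have : (z₁, s₀) = (z₀, s₀) := huniq _ hp _ hp₀ (by simp [hε]) rfl (by simp; linarith)
            (by simp [hr])
          rw [this, pointDiv_self]
          simp [div_self (sub_ne_zero.2 hne)]
        · rw [pointDiv_of_ne fun h' => h (congrArg Prod.snd h').symm]
          simp [div_eq_inv_mul]
    · have hfar : 3 * r ≤ dist p.1 z₀ := by
        by_contra hlt
        exact hpe (huniq p hp _ hp₁ (by rw [hps]; linarith) hps (not_le.1 hlt) (by simp; linarith))
      refine ⟨fun _ => 1, {q | 2 * r < dist q.1 z₀}, mem_nhdsWithin_of_mem_nhds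
        ((isOpen_lt (by fun_prop) (by fun_prop)).mem_nhds (by simp; linarith)), continuousOn_const,
        fun _ _ => one_ne_zero, fun q hq hne => ?_⟩
      have hp0 : p ≠ (z₀, s₀) := by
        rintro rfl
        simp at hfar; linarith
      simp [hu, hψ0 q (le_of_lt hq), pointDiv_of_ne hp0, pointDiv_of_ne hpe]
  · have hp1 : p ≠ (z₁, s₁) := fun h => hps (congrArg Prod.snd h)
    by_cases hpe : p = (z₀, s₀)
    · subst hpe
      simp only at hps
      refine ⟨fun q => (q.2 - s₁)⁻¹, {q | dist q.1 z₀ < r ∧ dist q.2 s₀ < ε / 4} ∩ {q | q.2 ≠ s₁},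
        mem_nhdsWithin_of_mem_nhds (Filter.inter_mem (hballN _ (by simpa) (by simp; linarith))
          ((isOpen_ne.preimage continuous_snd).mem_nhds hps)), ?_, ?_, ?_⟩
      · exact ContinuousOn.inv₀ (by fun_prop) fun q hq => sub_ne_zero.2 hq.2
      · exact fun q hq => inv_ne_zero (sub_ne_zero.2 hq.2)
      · rintro q ⟨hq, hq2⟩ hne
        rw [hu1 q (by linarith [hq.2]) hq.1 hq2]
        simp [pointDiv_self, pointDiv_of_ne hp1, div_eq_mul_inv]
    · have hup : u p ≠ 0 := by
        by_cases h1 : ψ p = 0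
        · simp [hu, h1]
        have h2 : dist p.2 s₀ < ε := by
          by_contra h
          exact h1 (hψ0' p (not_lt.1 h))
        have h3 : dist p.1 z₀ < r := by
          refine (hiso p hp h2).resolve_right fun h => h1 (hψ0 p (by linarith))
        by_cases h4 : dist p.2 s₀ ≤ ε / 2
        · rw [hu1 p h4 h3 hps]
          refine div_ne_zero (sub_ne_zero.2 fun h => hpe ?_) (sub_ne_zero.2 hps)
          exact huniq p hp _ hp₀ h2 h (by linarith) (by simp [hr])
        · intro h0
          have h5 : (ψ p : ℂ) * (s₁ - s₀) = - (p.2 - s₁) := by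
            have := sub_ne_zero.2 hps
            simp only [hu] at h0
            field_simp at h0
            linear_combination h0
          have h6 := congrArg norm h5
          rw [norm_mul, norm_neg, ← dist_eq_norm, ← dist_eq_norm, Complex.norm_real,
            Real.norm_of_nonneg (mul_nonneg (cutoff_nonneg _) (cutoff_nonneg _))] at h6
          have h7 : ψ p ≤ 1 := mul_le_one₀ (cutoff_le_one _) (cutoff_nonneg _) (cutoff_le_one _)
          have h8 := dist_triangle p.2 s₁ s₀
          have h9 : ψ p * dist s₁ s₀ ≤ 1 * dist s₁ s₀ := by gcongr
          simp only [hψ] at h6 h9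
          linarith
      have hopen : IsOpen {q : ℂ × ℂ | q.2 ≠ s₁} := isOpen_ne.preimage continuous_snd
      refine ⟨u, {q | q.2 ≠ s₁} ∩ u ⁻¹' {0}ᶜ, mem_nhdsWithin_of_mem_nhds
        ((huc.isOpen_inter_preimage hopen isOpen_compl_singleton).mem_nhds ⟨hps, hup⟩),
        huc.mono Set.inter_subset_left, fun q hq => hq.2, fun q _ _ => ?_⟩
      simp [pointDiv_of_ne hpe, pointDiv_of_ne hp1]

lemma SymContOn.exists_hasDivisor_pair (hQ : SymContOn Q Set.univ) {B : Set ℂ}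
    (hinj : ∀ s ∉ B, Function.Injective (Q s)) (hconn : IsPreconnected (rootSet Q Bᶜ))
    {p q : ℂ × ℂ} (hp : p ∈ rootSet Q Bᶜ) (hq : q ∈ rootSet Q Bᶜ) :
    ∃ u, HasDivisor Q (pointDiv p - pointDiv q) u := by
  refine hconn.induction₂ (fun p q => ∃ u, HasDivisor Q (pointDiv p - pointDiv q) u) ?_ ?_ ?_ hp hq
  · intro x hx
    exact (hQ.exists_hasDivisor_near (rootSet_mono (Set.subset_univ _) hx)
      (hinj _ hx.1)).filter_mono (nhdsWithin_mono _ (rootSet_mono (Set.subset_univ _)))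
  · rintro x y z - - - ⟨u, hu⟩ ⟨u', hu'⟩
    exact ⟨_, by simpa using hu.mul hu'⟩
  · rintro x y - - ⟨u, hu⟩
    exact ⟨_, by simpa using hu.inv⟩

lemma SymContOn.neBot_nhdsWithin_off_fibre (hQ : SymContOn Q Set.univ) {p : ℂ × ℂ}
    (hp : p ∈ rootSet Q Set.univ) : (𝓝[rootSet Q Set.univ ∩ {q | q.2 ≠ p.2}] p).NeBot := by
  obtain ⟨z, s⟩ := p
  obtain ⟨-, j, hj⟩ := hp
  simp only at hj
  rw [← mem_closure_iff_nhdsWithin_neBot]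
  refine Metric.mem_closure_iff.2 fun ε hε => ?_
  have h1 := hQ s trivial ε hε
  rw [nhdsWithin_univ] at h1
  obtain ⟨δ, hδ, hb⟩ := Metric.eventually_nhds_iff.1 h1
  obtain ⟨s', hs', hd⟩ := ((Set.finite_singleton s).countable.dense_compl ℝ).exists_dist_lt
    s (lt_min hδ hε)
  rw [dist_comm] at hd
  obtain ⟨σ, hσ⟩ := hb (hd.trans_le (min_le_left _ _))
  refine ⟨(Q s' (σ j), s'), ⟨⟨trivial, _, rfl⟩, hs'⟩, ?_⟩
  rw [dist_comm, Prod.dist_eq, ← hj]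
  exact max_lt (hσ j) (hd.trans_le (min_le_right _ _))

lemma HasDivisor.exists_normalized (hQ : SymContOn Q Set.univ) {D : ℂ × ℂ → ℤ} {u : ℂ × ℂ → ℂ}
    (h : HasDivisor Q D u) : ∃ u' : ℂ × ℂ → ℂ,
    (∃ M : ℝ, ∀ q ∈ rootSet Q Set.univ, M < ‖q.2‖ → u' q = 1) ∧
    ∀ p ∈ rootSet Q Set.univ, ∃ v : ℂ × ℂ → ℂ, ∃ U ∈ 𝓝[rootSet Q Set.univ] p,
      ContinuousOn v U ∧ (∀ q ∈ U, v q ≠ 0) ∧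
        ∀ q ∈ U, D p = 0 ∨ q.2 ≠ p.2 → u' q = (q.2 - p.2) ^ D p * v q := by
  set C := rootSet Q Set.univ with hC
  obtain ⟨⟨M, hM⟩, h⟩ := h
  refine ⟨fun q => limUnder (𝓝[C ∩ {q' | q'.2 ≠ q.2}] q) u, ⟨M, fun q hq hn => ?_⟩,
    fun p hp => ?_⟩
  · have := hQ.neBot_nhdsWithin_off_fibre hq
    refine Tendsto.limUnder_eq (tendsto_const_nhds.congr' ?_)
    have hn' : {q' : ℂ × ℂ | M < ‖q'.2‖} ∈ 𝓝 q :=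
      (isOpen_lt continuous_const (by fun_prop)).mem_nhds hn
    filter_upwards [mem_nhdsWithin_of_mem_nhds hn', self_mem_nhdsWithin] with q' h1 h2
    exact (hM q' h2.1 h1).symm
  · obtain ⟨v, U, hU, hv, h0, he⟩ := h p hp
    obtain ⟨O, hO, hpO, hOU⟩ := mem_nhdsWithin.1 hU
    refine ⟨v, O ∩ C, Filter.inter_mem (mem_nhdsWithin_of_mem_nhds (hO.mem_nhds hpO)) self_mem_nhdsWithin, hv.mono hOU, fun q hq => h0 q (hOU hq),
      fun q hq hor => ?_⟩
    have := hQ.neBot_nhdsWithin_off_fibre hq.2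
    have hvt : Tendsto v (𝓝[C ∩ {q' | q'.2 ≠ q.2}] q) (𝓝 (v q)) := by
      have h1 : Tendsto v (𝓝[O ∩ C] q) (𝓝 (v q)) := hv.mono hOU q hq
      refine h1.mono_left ?_
      rw [Set.inter_comm O, nhdsWithin_inter_of_mem' (mem_nhdsWithin_of_mem_nhds (hO.mem_nhds hq.1))]
      exact nhdsWithin_mono _ Set.inter_subset_left
    have hpow : Tendsto (fun q' : ℂ × ℂ => (q'.2 - p.2) ^ D p) (𝓝[C ∩ {q' | q'.2 ≠ q.2}] q)
        (𝓝 ((q.2 - p.2) ^ D p)) := by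
      rcases hor with h | h
      · simp [h]
      · refine Tendsto.zpow₀ ?_ _ (Or.inl (sub_ne_zero.2 h))
        exact (Continuous.tendsto (by fun_prop) q).mono_left nhdsWithin_le_nhds
    refine Tendsto.limUnder_eq ((hpow.mul hvt).congr' ?_)
    have hOq : ∀ᶠ q' in 𝓝[C ∩ {q' | q'.2 ≠ q.2}] q, q' ∈ O :=
      mem_nhdsWithin_of_mem_nhds (hO.mem_nhds hq.1)
    have hne : ∀ᶠ q' : ℂ × ℂ in 𝓝[C ∩ {q' | q'.2 ≠ q.2}] q, q'.2 ≠ p.2 := by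
      by_cases hqp : q.2 = p.2
      · filter_upwards [self_mem_nhdsWithin] with q' hq'
        rw [← hqp]; exact hq'.2
      · exact mem_nhdsWithin_of_mem_nhds
          ((isOpen_ne.preimage continuous_snd).mem_nhds (show q.2 ≠ p.2 from hqp))
    filter_upwards [hOq, hne, self_mem_nhdsWithin] with q' h1 h2 h3
    exact (he q' (hOU ⟨h1, h3.1⟩) h2).symm

end Divisor

namespace ConeData

variable {d : ℕ} {R : ℂ × ℂ → Fin d → ℂ} {B : Set ℂ} {ρ : ℝ} {η : ℂ → Fin d → ℂ}

lemma isPreconnected_affine (h : ConeData d R B) :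
    IsPreconnected (rootSet (fun s => R (1, s)) Bᶜ) := by
  have hcont : ContinuousOn (fun p : ℂ × ℂ × ℂ => (p.1 / p.2.1, p.2.2 / p.2.1))
      (rootSet R {b | b.1 ≠ 0 ∧ b.2 / b.1 ∉ B}) := by
    have h0 : ∀ p ∈ rootSet R {b | b.1 ≠ 0 ∧ b.2 / b.1 ∉ B}, p.2.1 ≠ 0 := fun p hp => hp.1.1
    fun_prop (disch := assumption)
  convert h.conn.image _ hcont using 1
  ext ⟨z, s⟩
  constructor
  · rintro ⟨hs, hz⟩
    exact ⟨(z, 1, s), ⟨⟨one_ne_zero, by simpa using hs⟩, hz⟩, by simp⟩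
  · rintro ⟨⟨z', x, w⟩, ⟨⟨hx, hw⟩, hz'⟩, he⟩
    simp only [Prod.mk.injEq] at he hx hw hz'
    obtain ⟨rfl, rfl⟩ := he
    refine ⟨hw, ?_⟩
    have := h.homog x⁻¹ (inv_ne_zero hx) _ _ hz'
    simp only [Prod.smul_mk, smul_eq_mul, inv_mul_cancel₀ hx] at this
    simpa [div_eq_inv_mul] using this

/-- Nonvanishing functions with prescribed orders at the points over `s = 0`. -/
lemma exists_unit (h : ConeData d R B) (hs : Sheets R B ρ η) (e : Fin d → ℤ) (he : ∑ j, e j = 0) :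
    ∃ u : ℂ × ℂ → ℂ,
      (∀ p ∈ rootSet (fun s => R (1, s)) Set.univ, p.2 ≠ 0 →
        ContinuousWithinAt u (rootSet (fun s => R (1, s)) Set.univ) p ∧ u p ≠ 0) ∧
      (∃ M : ℝ, ∀ p ∈ rootSet (fun s => R (1, s)) Set.univ, M < ‖p.2‖ → u p = 1) ∧
      ∀ j, ∃ v : ℂ → ℂ, ContinuousOn v (Metric.closedBall 0 ρ) ∧
        (∀ s ∈ Metric.closedBall (0 : ℂ) ρ, v s ≠ 0) ∧
        ∀ s ∈ Metric.closedBall (0 : ℂ) ρ, s ≠ 0 → u (η s j, s) = s ^ e j * v s := by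
  set Q : ℂ → Fin d → ℂ := fun s => R (1, s) with hQdef
  have hQ : SymContOn Q Set.univ :=
    h.cont.comp (f := fun s : ℂ => ((1, s) : ℂ × ℂ)) (by fun_prop) fun _ _ => trivial
  have hinj : ∀ s ∉ B, Function.Injective (Q s) := fun s hsB => h.inj (1, s) one_ne_zero (by simpa)
  set C := rootSet Q Set.univ with hC
  have hmem : ∀ s j, (η s j, s) ∈ C := fun s j => ⟨trivial, hs.mem s j⟩
  have hmem0 : ∀ j, (η 0 j, (0 : ℂ)) ∈ rootSet Q Bᶜ := fun j => ⟨h.zero_notMem, hs.mem 0 j⟩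
  let D : ℂ × ℂ → ℤ := fun p => ∑ j, e j * pointDiv (η 0 j, 0) p
  have hD : ∃ u, HasDivisor Q D u := by
    have j₀ : Fin d := ⟨0, h.pos⟩
    obtain ⟨u, hu⟩ := HasDivisor.sum (Q := Q) Finset.univ
      (D := fun j => e j • (pointDiv (η 0 j, 0) - pointDiv (η 0 j₀, 0))) fun j => by
        obtain ⟨u, hu⟩ := hQ.exists_hasDivisor_pair hinj h.isPreconnected_affine (hmem0 j)
          (hmem0 j₀)
        exact hu.zpow _
    refine ⟨u, ?_⟩
    convert hu using 1
    ext p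
    simp only [D, Finset.sum_apply, Pi.smul_apply, Pi.sub_apply, smul_eq_mul, mul_sub,
      Finset.sum_sub_distrib, ← Finset.sum_mul, he, zero_mul, sub_zero]
  have hD0 : ∀ p : ℂ × ℂ, p.2 ≠ 0 → D p = 0 := fun p hp =>
    Finset.sum_eq_zero fun j _ => by
      rw [pointDiv_of_ne fun h' => hp (congrArg Prod.snd h'), mul_zero]
  have hDj : ∀ j, D (η 0 j, 0) = e j := by
    intro j
    simp only [D]
    rw [Finset.sum_eq_single j, pointDiv_self, mul_one]
    · intro i _ hij
      rw [pointDiv_of_ne, mul_zero]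
      exact fun h' => hij (h.sheet_injective hs (by simpa using hs.pos.le)
        (congrArg Prod.fst h')).symm
    · simp
  obtain ⟨u₀, hu₀⟩ := hD
  obtain ⟨u, hM, hu⟩ := hu₀.exists_normalized hQ
  have hcont : ∀ p ∈ C, p.2 ≠ 0 → ContinuousWithinAt u C p ∧ u p ≠ 0 := by
    intro p hp hp2
    obtain ⟨v, U, hU, hv, h0, he⟩ := hu p hp
    simp only [hD0 p hp2, zpow_zero, one_mul, true_or, forall_true_left] at he
    have hpU := mem_of_mem_nhdsWithin hp hU
    refine ⟨((hv p hpU).mono_of_mem_nhdsWithin hU).congr_of_eventuallyEq ?_ (he p hpU), ?_⟩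
    · filter_upwards [hU] with q hq using he q hq
    · rw [he p hpU]; exact h0 p hpU
  refine ⟨u, hcont, hM, fun j => ?_⟩
  obtain ⟨v, U, hU, hv, h0, he'⟩ := hu _ (hmem 0 j)
  simp only [hDj, sub_zero] at he'
  have hpU := mem_of_mem_nhdsWithin (hmem 0 j) hU
  have hgc : ContinuousOn (fun s => (η s j, s)) (Metric.closedBall 0 ρ) :=
    (hs.cont j).prodMk continuousOn_id
  have hgm : Set.MapsTo (fun s => (η s j, s)) (Metric.closedBall 0 ρ) C := fun s _ => hmem s j
  have h0ρ : (0 : ℂ) ∈ Metric.closedBall (0 : ℂ) ρ := by simpa using hs.pos.le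
  classical
  refine ⟨fun s => if s = 0 then v (η 0 j, 0) else u (η s j, s) * (s ^ e j)⁻¹, ?_, ?_, ?_⟩
  · intro s hsρ
    by_cases hs0 : s = 0
    · subst hs0
      have ht := hgc.tendsto_nhdsWithin_mapsTo hgm h0ρ
      have h1 : ContinuousWithinAt (fun s => v (η s j, s)) (Metric.closedBall 0 ρ) 0 :=
        ((hv _ hpU).mono_of_mem_nhdsWithin hU).tendsto.comp ht
      refine h1.congr_of_eventuallyEq ?_ (by simp)
      filter_upwards [ht hU] with s hsU
      split_ifs with h
      · rw [h]
      · rw [he' _ hsU (Or.inr h)]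
        have := zpow_ne_zero (e j) h
        field_simp
    · have h1 : ContinuousWithinAt (fun s => u (η s j, s) * (s ^ e j)⁻¹)
          (Metric.closedBall 0 ρ) s := by
        refine ContinuousWithinAt.mul ?_ ?_
        · exact (hcont _ (hmem s j) hs0).1.tendsto.comp (hgc.tendsto_nhdsWithin_mapsTo hgm hsρ)
        · exact ((continuousAt_id.zpow₀ _ (Or.inl hs0)).inv₀
            (zpow_ne_zero _ hs0)).continuousWithinAt
      refine h1.congr_of_eventuallyEq ?_ (by simp [hs0])
      filter_upwards [mem_nhdsWithin_of_mem_nhds (isOpen_ne.mem_nhds hs0)] with s' hs'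
      simp only [if_neg hs']
  · intro s _
    simp only
    split_ifs with h
    · exact h0 _ hpU
    · exact mul_ne_zero (hcont _ (hmem s j) h).2 (inv_ne_zero (zpow_ne_zero _ h))
  · intro s _ hs0
    simp only [if_neg hs0]
    have := zpow_ne_zero (e j) hs0
    field_simp

end ConeData

namespace ConeData

variable {d : ℕ} {R : ℂ × ℂ → Fin d → ℂ} {B : Set ℂ} {ρ : ℝ} {η : ℂ → Fin d → ℂ}
  {A : Type*} [AddCommGroup A]

/-- The part of the cone away from `w = 0`. -/
def _root_.outerPart (R : ℂ × ℂ → Fin d → ℂ) (ρ : ℝ) : Set (ℂ × ℂ × ℂ) :=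
  {p ∈ Vstar R | ρ * ‖p.2.1‖ ≤ ‖p.2.2‖}

/-- The part of the cone close to `w = 0`. -/
def _root_.innerPart (R : ℂ × ℂ → Fin d → ℂ) (ρ : ℝ) : Set (ℂ × ℂ × ℂ) :=
  {p ∈ Vstar R | ‖p.2.2‖ ≤ ρ * ‖p.2.1‖}

/-- Affine coordinates in the chart `w = 1`. -/
noncomputable def _root_.chartPt (p : ℂ × ℂ × ℂ) : ℂ × ℂ := (p.1 / p.2.2, p.2.1 / p.2.2)

lemma _root_.outerPart_snd_ne_zero (hρ : 0 < ρ) {p : ℂ × ℂ × ℂ} (hp : p ∈ outerPart R ρ) :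
    p.2.2 ≠ 0 := by
  intro h0
  have h1 := hp.2
  rw [h0, norm_zero] at h1
  have h2 : p.2.1 = 0 := norm_eq_zero.1 (le_antisymm (by nlinarith) (norm_nonneg _))
  exact hp.1.1 (Prod.ext h2 h0)

lemma _root_.innerPart_fst_ne_zero {p : ℂ × ℂ × ℂ} (hp : p ∈ innerPart R ρ) :
    p.2.1 ≠ 0 := by
  intro h0
  have h1 := hp.2
  rw [h0, norm_zero, mul_zero] at h1
  exact hp.1.1 (Prod.ext h0 (norm_eq_zero.1 (le_antisymm h1 (norm_nonneg _))))

lemma _root_.outerPart_union_innerPart : outerPart R ρ ∪ innerPart R ρ = Vstar R := by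
  ext p
  constructor
  · rintro (h | h) <;> exact h.1
  · intro h
    rcases le_total (ρ * ‖p.2.1‖) ‖p.2.2‖ with h' | h'
    exacts [Or.inl ⟨h, h'⟩, Or.inr ⟨h, h'⟩]

lemma _root_.closure_inter_subset_of_isClosed {α : Type*} [TopologicalSpace α] {S C : Set α}
    (hC : IsClosed C) : closure (S ∩ C) ∩ S ⊆ S ∩ C := fun _ hp =>
  ⟨hp.2, closure_minimal Set.inter_subset_right hC hp.1⟩

lemma _root_.closure_outerPart : closure (outerPart R ρ) ∩ Vstar R ⊆ outerPart R ρ :=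
  closure_inter_subset_of_isClosed (C := {p : ℂ × ℂ × ℂ | ρ * ‖p.2.1‖ ≤ ‖p.2.2‖})
    (isClosed_le (by fun_prop) (by fun_prop))

lemma _root_.closure_innerPart : closure (innerPart R ρ) ∩ Vstar R ⊆ innerPart R ρ :=
  closure_inter_subset_of_isClosed (C := {p : ℂ × ℂ × ℂ | ‖p.2.2‖ ≤ ρ * ‖p.2.1‖})
    (isClosed_le (by fun_prop) (by fun_prop))

lemma _root_.continuousOn_chartPt (hρ : 0 < ρ) : ContinuousOn chartPt (outerPart R ρ) := by
  have : ∀ p ∈ outerPart R ρ, p.2.2 ≠ 0 := fun p hp => outerPart_snd_ne_zero hρ hp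
  unfold chartPt
  fun_prop (disch := assumption)

lemma chartPt_mem (h : ConeData d R B) (hρ : 0 < ρ) {p : ℂ × ℂ × ℂ} (hp : p ∈ outerPart R ρ) :
    chartPt p ∈ rootSet (fun ξ : ℂ => R (ξ, 1)) (Metric.closedBall 0 ρ⁻¹) := by
  have h0 := outerPart_snd_ne_zero hρ hp
  refine ⟨?_, ?_⟩
  · have := hp.2
    simp only [chartPt, Metric.mem_closedBall, dist_zero_right, norm_div]
    rw [div_le_iff₀ (norm_pos_iff.2 h0), inv_mul_eq_div, le_div_iff₀ hρ]
    linarith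
  · have := h.homog (p.2.2)⁻¹ (inv_ne_zero h0) _ _ hp.1.2
    simpa [chartPt, Prod.smul_def, h0, div_eq_inv_mul] using this

/-- A class which is trivial on the circles comes from the chart. -/
lemma exists_chart_decomposition (h : ConeData d R B) (hρ : 0 < ρ)
    {c : ℂ × ℂ × ℂ → ℂ × ℂ × ℂ → A} (hc : IsCoc (Vstar R) c)
    (h0 : ∀ p ∈ Vstar R, HasPathInt c (coneLoop p) 0) :
    ∃ K : ℂ × ℂ × ℂ → A, NearDiag (outerPart R ρ) fun p q => c p q =
      c ((chartPt p).1, (chartPt p).2, 1) ((chartPt q).1, (chartPt q).2, 1) + K q - K p := by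
  have h1 : IsCoc ({0}ᶜ ×ˢ Vstar R) fun P Q : ℂ × ℂ × ℂ × ℂ => c (P.1 • P.2) (Q.1 • Q.2) :=
    hc.comp (f := fun P : ℂ × ℂ × ℂ × ℂ => P.1 • P.2) (by fun_prop) fun P hP => h.smul_mem hP.1 hP.2
  obtain ⟨J, hJ⟩ := h1.exists_punctured_product fun p hp => h0 p hp
  refine ⟨fun p => J (p.2.2, (chartPt p).1, (chartPt p).2, 1), ?_⟩
  have hcc := continuousOn_chartPt (R := R) hρ
  refine (hJ.comp (f := fun p : ℂ × ℂ × ℂ => (p.2.2, (chartPt p).1, (chartPt p).2, (1 : ℂ)))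
    (S := outerPart R ρ) ((by fun_prop : Continuous fun p : ℂ × ℂ × ℂ => p.2.2).continuousOn.prodMk
      (hcc.fst.prodMk (hcc.snd.prodMk continuousOn_const))) fun p hp => ⟨outerPart_snd_ne_zero hρ hp,
      chart_mem (rootSet_mono (Set.subset_univ _) (h.chartPt_mem hρ hp))⟩).imp
    fun p hp q hq he => ?_
  have key : ∀ p ∈ outerPart R ρ, p.2.2 • ((chartPt p).1, (chartPt p).2, (1 : ℂ)) = p := by
    intro p hp
    have := outerPart_snd_ne_zero hρ hp
    refine Prod.ext ?_ (Prod.ext ?_ ?_) <;> simp [chartPt] <;> field_simp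
  simp only [key p hp, key q hq, one_smul] at he
  exact he

/-- Coordinates near `w = 0`. -/
noncomputable def _root_.innerChart (p : ℂ × ℂ × ℂ) : ℂ × ℂ := (p.2.1, p.2.2 / p.2.1)

lemma _root_.continuousOn_innerChart : ContinuousOn innerChart (innerPart R ρ) := by
  have : ∀ p ∈ innerPart R ρ, p.2.1 ≠ 0 := fun p hp => innerPart_fst_ne_zero hp
  unfold innerChart
  fun_prop (disch := assumption)

lemma _root_.innerChart_mem {p : ℂ × ℂ × ℂ} (hp : p ∈ innerPart R ρ) :
    innerChart p ∈ ({0}ᶜ : Set ℂ) ×ˢ Metric.closedBall (0 : ℂ) ρ := by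
  have h0 := innerPart_fst_ne_zero hp
  refine ⟨h0, ?_⟩
  simp only [innerChart, Metric.mem_closedBall, dist_zero_right, norm_div]
  rw [div_le_iff₀ (norm_pos_iff.2 h0)]
  exact hp.2

lemma exists_sheetPt_eq (h : ConeData d R B) (hs : Sheets R B ρ η) {p : ℂ × ℂ × ℂ}
    (hp : p ∈ innerPart R ρ) : ∃ j, sheetPt η j (innerChart p) = p := by
  have h0 := innerPart_fst_ne_zero hp
  have := h.homog (p.2.1)⁻¹ (inv_ne_zero h0) _ _ hp.1.2
  have h2 : (p.2.1)⁻¹ • p.2 = (1, p.2.2 / p.2.1) := by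
    refine Prod.ext ?_ ?_ <;> simp [h0, div_eq_inv_mul]
  rw [h2] at this
  obtain ⟨j, hj⟩ := hs.exists_eq this
  refine ⟨j, ?_⟩
  refine Prod.ext ?_ (Prod.ext ?_ ?_) <;> simp [sheetPt, innerChart, hj] <;> field_simp

lemma sheetPt_mem_innerPart (h : ConeData d R B) (hs : Sheets R B ρ η) (j : Fin d) {q : ℂ × ℂ}
    (hq : q ∈ ({0}ᶜ : Set ℂ) ×ˢ Metric.closedBall (0 : ℂ) ρ) : sheetPt η j q ∈ innerPart R ρ := by
  refine ⟨h.sheetPt_mem hs j hq.1, ?_⟩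
  have := hq.2
  simp only [Metric.mem_closedBall, dist_zero_right] at this
  simp only [sheetPt, Prod.smul_mk, smul_eq_mul, mul_one, norm_mul]
  nlinarith [norm_nonneg q.1]

lemma sheetPt_injective (h : ConeData d R B) (hs : Sheets R B ρ η) {q : ℂ × ℂ}
    (hq : q ∈ ({0}ᶜ : Set ℂ) ×ˢ Metric.closedBall (0 : ℂ) ρ) :
    Function.Injective fun j => sheetPt η j q := by
  intro i j hij
  have h1 : q.1 * η q.2 i = q.1 * η q.2 j := congrArg Prod.fst hij
  exact h.sheet_injective hs (by simpa using hq.2) (mul_left_cancel₀ hq.1 h1)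

lemma _root_.sheetPt_exp (j : Fin d) (s : ℂ) (t : ℝ) :
    sheetPt η j (Complex.exp (2 * Real.pi * Complex.I * t), s) = coneLoop (sheetPt η j (1, s)) t := by
  simp [sheetPt, coneLoop]

lemma exists_isPrim_innerPart (h : ConeData d R B) (hs : Sheets R B ρ η)
    {c : ℂ × ℂ × ℂ → ℂ × ℂ × ℂ → A} (hc : IsCoc (innerPart R ρ) c)
    (h0 : ∀ p ∈ innerPart R ρ, HasPathInt c (coneLoop p) 0) :
    ∃ θ, IsPrim (innerPart R ρ) c θ := by
  have hcont : ∀ j, ContinuousOn (sheetPt η j) ({0}ᶜ ×ˢ Metric.closedBall 0 ρ) := fun j =>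
    (hs.continuousOn_sheetPt j).mono (Set.prod_mono (Set.subset_univ _) subset_rfl)
  have hj : ∀ j, ∃ b, IsPrim ({0}ᶜ ×ˢ Metric.closedBall (0 : ℂ) ρ)
      (fun x y => c (sheetPt η j x) (sheetPt η j y)) b := by
    intro j
    have hcj := hc.comp (hcont j) fun q hq => h.sheetPt_mem_innerPart hs j hq
    obtain ⟨J, hJ⟩ := hcj.exists_punctured_product fun s hsρ => by
      change HasPathInt c (fun t : ℝ => sheetPt η j (Complex.exp (2 * Real.pi * Complex.I * t), s)) 0
      simp only [sheetPt_exp]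
      exact h0 _ (h.sheetPt_mem_innerPart hs j ⟨one_ne_zero, hsρ⟩)
    obtain ⟨b, hb⟩ := (hcj.comp (f := fun s : ℂ => ((1 : ℂ), s)) (S := Metric.closedBall 0 ρ)
      (by fun_prop) fun s hsρ => ⟨one_ne_zero, hsρ⟩).exists_isPrim (isCompact_closedBall _ _)
      (convex_closedBall _ _)
    refine ⟨_, ((hb.comp (f := Prod.snd) (S := {0}ᶜ ×ˢ Metric.closedBall (0 : ℂ) ρ)
      continuousOn_snd fun q hq => hq.2).add (isPrim_cob _ J)).congr (hJ.imp fun x _ y _ he => ?_)⟩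
    rw [he]; abel
  choose b hb using hj
  exact exists_isPrim_of_sheets continuousOn_innerChart (fun p hp => innerChart_mem hp) hcont
    (fun q hq => h.sheetPt_injective hs hq) (fun p hp => h.exists_sheetPt_eq hs hp) hb

/-- The projection of a boundary circle to the chart `w = 1`. -/
noncomputable def _root_.rimChart (ρ : ℝ) (η : ℂ → Fin d → ℂ) (j : Fin d) (t : ℝ) : ℂ × ℂ :=
  ((rimLoop ρ η j t).1, (rimLoop ρ η j t).2.1)

lemma _root_.rimLoop_snd_snd (hρ : 0 < ρ) (j : Fin d) (t : ℝ) : (rimLoop ρ η j t).2.2 = 1 := by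
  have : (ρ : ℂ) ≠ 0 := by exact_mod_cast hρ.ne'
  simp [rimLoop, sheetPt, this]

lemma _root_.rimParam_mem (hρ : 0 < ρ) (t : ℝ) :
    (Complex.exp (2 * Real.pi * Complex.I * t) / ρ, ρ / Complex.exp (2 * Real.pi * Complex.I * t)) ∈
      ({0}ᶜ : Set ℂ) ×ˢ Metric.sphere (0 : ℂ) ρ := by
  have : (ρ : ℂ) ≠ 0 := by exact_mod_cast hρ.ne'
  refine ⟨div_ne_zero (Complex.exp_ne_zero _) this, ?_⟩
  simp only [mem_sphere_iff_norm, sub_zero, norm_div, norm_exp_two_pi_I, div_one]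
  rw [Complex.norm_real, Real.norm_of_nonneg hρ.le]

lemma rimLoop_mem (h : ConeData d R B) (hs : Sheets R B ρ η) (j : Fin d) (t : ℝ) :
    rimLoop ρ η j t ∈ outerPart R ρ ∩ innerPart R ρ := by
  have h1 := rimParam_mem hs.pos t
  have h2 := h.sheetPt_mem_innerPart hs j (Set.prod_mono subset_rfl Metric.sphere_subset_closedBall h1)
  refine ⟨⟨h2.1, ?_⟩, h2⟩
  have h3 := h1.2
  simp only [mem_sphere_iff_norm, sub_zero] at h3
  simp only [rimLoop, sheetPt, Prod.smul_mk, smul_eq_mul, mul_one]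
  rw [norm_mul, h3, mul_comm]

lemma _root_.chartPt_rimLoop (hρ : 0 < ρ) (j : Fin d) (t : ℝ) :
    chartPt (rimLoop ρ η j t) = rimChart ρ η j t := by
  simp [chartPt, rimChart, rimLoop_snd_snd hρ]

lemma _root_.Sheets.continuous_rimChart (hs : Sheets R B ρ η) (j : Fin d) :
    Continuous (rimChart ρ η j) := by
  have := hs.continuous_rimLoop j
  unfold rimChart
  exact this.fst.prodMk this.snd.fst

lemma rimChart_mem (h : ConeData d R B) (hs : Sheets R B ρ η) (j : Fin d) (t : ℝ) :
    rimChart ρ η j t ∈ rootSet (fun ξ : ℂ => R (ξ, 1)) (Metric.closedBall 0 ρ⁻¹) := by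
  rw [← chartPt_rimLoop hs.pos]
  exact h.chartPt_mem hs.pos (h.rimLoop_mem hs j t).1

/-- Nonvanishing functions on the chart `w = 1` with prescribed winding along the boundary. -/
lemma exists_chart_unit (h : ConeData d R B) (hs : Sheets R B ρ η) (e : Fin d → ℤ)
    (he : ∑ j, e j = 0) : ∃ U : ℂ × ℂ → ℂ,
      ContinuousOn U (rootSet (fun ξ : ℂ => R (ξ, 1)) Set.univ) ∧
      (∀ p ∈ rootSet (fun ξ : ℂ => R (ξ, 1)) Set.univ, U p ≠ 0) ∧
      ∀ j, ∃ v : ℂ → ℂ, ContinuousOn v (Metric.closedBall 0 ρ) ∧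
        (∀ s ∈ Metric.closedBall (0 : ℂ) ρ, v s ≠ 0) ∧
        ∀ s ∈ Metric.closedBall (0 : ℂ) ρ, s ≠ 0 → U (η s j / s, 1 / s) = s ^ e j * v s := by
  obtain ⟨u, hu, ⟨M, hM⟩, hv⟩ := h.exists_unit hs e he
  set C := rootSet (fun s => R (1, s)) Set.univ with hC
  have hmem : ∀ p ∈ rootSet (fun ξ : ℂ => R (ξ, 1)) Set.univ, p.2 ≠ 0 →
      (p.1 / p.2, 1 / p.2) ∈ C := by
    intro p hp h0
    have := h.homog (p.2)⁻¹ (inv_ne_zero h0) _ _ hp.2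
    refine ⟨trivial, ?_⟩
    simpa [Prod.smul_def, h0, div_eq_inv_mul] using this
  classical
  refine ⟨fun p => if p.2 = 0 then 1 else u (p.1 / p.2, 1 / p.2), fun p hp => ?_, fun p hp => ?_,
    fun j => ?_⟩
  · by_cases h0 : p.2 = 0
    · refine (continuousWithinAt_const (b := (1 : ℂ))).congr_of_eventuallyEq ?_ (by simp [h0])
      have hnear : ∀ᶠ q in 𝓝[rootSet (fun ξ : ℂ => R (ξ, 1)) Set.univ] p,
          (|M| + 1) * ‖q.2‖ < 1 :=
        mem_nhdsWithin_of_mem_nhds ((isOpen_lt (by fun_prop) continuous_const).mem_nhds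
          (by simp [h0]))
      filter_upwards [hnear, self_mem_nhdsWithin] with q hq hqm
      split_ifs with hq0
      · rfl
      · refine hM _ (hmem q hqm hq0) ?_
        rw [norm_div, norm_one, lt_div_iff₀ (norm_pos_iff.2 hq0)]
        nlinarith [le_abs_self M, norm_nonneg q.2]
    · have hT : ContinuousWithinAt (fun q : ℂ × ℂ => (q.1 / q.2, 1 / q.2))
          (rootSet (fun ξ : ℂ => R (ξ, 1)) Set.univ ∩ {q | q.2 ≠ 0}) p := by
        refine ContinuousAt.continuousWithinAt ?_
        exact ContinuousAt.prodMk (by fun_prop (disch := assumption))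
          (by fun_prop (disch := assumption))
      have hcu := (hu _ (hmem p hp h0) (one_div_ne_zero h0)).1.comp (f := fun q : ℂ × ℂ =>
        (q.1 / q.2, 1 / q.2)) hT fun q hq => hmem q hq.1 hq.2
      have hop : {q : ℂ × ℂ | q.2 ≠ 0} ∈ 𝓝 p := (isOpen_ne.preimage continuous_snd).mem_nhds h0
      refine ((continuousWithinAt_inter hop).1 hcu).congr_of_eventuallyEq ?_ (by simp [h0])
      filter_upwards [mem_nhdsWithin_of_mem_nhds hop] with q hq
      simp only [if_neg hq, Function.comp_apply]
  · simp only
    split_ifs with h0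
    · exact one_ne_zero
    · exact (hu _ (hmem p hp h0) (one_div_ne_zero h0)).2
  · obtain ⟨v, hv1, hv2, hv3⟩ := hv j
    refine ⟨v, hv1, hv2, fun s hsρ hs0 => ?_⟩
    rw [← hv3 s hsρ hs0]
    simp only [one_div, inv_eq_zero, hs0, if_false]
    congr 1
    simp [hs0]

lemma _root_.Sheets.hasPathInt_rimChart_of_unit (hs : Sheets R B ρ η) {U : ℂ × ℂ → ℂ}
    {j : Fin d} {n : ℤ} {v : ℂ → ℂ} (hv : ContinuousOn v (Metric.closedBall 0 ρ))
    (hv0 : ∀ s ∈ Metric.closedBall (0 : ℂ) ρ, v s ≠ 0)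
    (hU : ∀ s ∈ Metric.closedBall (0 : ℂ) ρ, s ≠ 0 → U (η s j / s, 1 / s) = s ^ n * v s) :
    HasPathInt (fun p q => (U q / U p).arg) (rimChart ρ η j) (n * (-(2 * Real.pi))) := by
  have hρ' : (ρ : ℂ) ≠ 0 := by exact_mod_cast hs.pos.ne'
  set γ : ℝ → ℂ := fun t => ρ / Complex.exp (2 * Real.pi * Complex.I * t) with hγ
  have hγc : Continuous γ := by
    rw [hγ]; fun_prop (disch := simp)
  have hγm : ∀ t, γ t ∈ Metric.closedBall (0 : ℂ) ρ := fun t =>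
    Metric.sphere_subset_closedBall (rimParam_mem hs.pos t).2
  have hγ0 : ∀ t, γ t ≠ 0 := fun t => div_ne_zero hρ' (Complex.exp_ne_zero _)
  have hrim : ∀ t, rimChart ρ η j t = (η (γ t) j / γ t, 1 / γ t) := by
    intro t
    have := Complex.exp_ne_zero (2 * Real.pi * Complex.I * t)
    refine Prod.ext ?_ ?_ <;> simp [rimChart, rimLoop, sheetPt, hγ]; field_simp
  have h1 : HasPathInt (fun p q => (p / q).arg) γ (2 * Real.pi) := by
    have h1 := hasPathInt_arg_exp (u := fun s : ℂ => s⁻¹) (γ := γ) (a := (ρ : ℂ)⁻¹)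
      (inv_ne_zero hρ') fun t _ => by simp [hγ]; field_simp
    simpa [div_eq_mul_inv, mul_comm] using h1
  have h2 : HasPathInt (fun p q : ℂ => (q / p).arg) γ (-(2 * Real.pi)) := by
    refine h1.neg.congr (S := {0}ᶜ) ?_ hγc.continuousOn fun t _ => hγ0 t
    refine (nearDiag_arg_inv (u := fun s : ℂ => s) (S := {0}ᶜ) continuousOn_id fun s hs => hs).imp
      fun s _ t _ he => ?_
    have e : s / t = t⁻¹ / s⁻¹ := by rw [div_inv_eq_mul, inv_mul_eq_div]
    rw [e, he, neg_neg]
  have h3 : HasPathInt (fun p q : ℂ => (v q / v p).arg) γ 0 := by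
    obtain ⟨b, hb⟩ := (isCoc_arg hv hv0).exists_isPrim (isCompact_closedBall _ _)
      (convex_closedBall _ _)
    have := hb.hasPathInt hγc.continuousOn fun t _ => hγm t
    have e : γ 1 = γ 0 := by simp [hγ]
    rwa [e, sub_self] at this
  have h4 : HasPathInt (fun p q : ℂ => (q ^ n * v q / (p ^ n * v p)).arg) γ
      (n * (-(2 * Real.pi)) + 0) := by
    refine ((h2.map (AddMonoidHom.mulLeft (n : ℝ))).add h3).congr
      (S := Metric.closedBall 0 ρ ∩ {0}ᶜ) ?_ hγc.continuousOn fun t _ => ⟨hγm t, hγ0 t⟩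
    have hz : ContinuousOn (fun s : ℂ => s ^ n) (Metric.closedBall 0 ρ ∩ {0}ᶜ) := fun s hs =>
      (continuousAt_id.zpow₀ _ (Or.inl hs.2)).continuousWithinAt
    refine ((nearDiag_arg_mul hz (fun s hs => zpow_ne_zero _ hs.2)
      (hv.mono Set.inter_subset_left) fun s hs => hv0 s hs.1).and
      (nearDiag_arg_zpow (u := fun s : ℂ => s) continuousOn_id (fun s hs => hs.2) n)).imp
      fun s _ t _ he => ?_
    rw [he.1, he.2]
    rfl
  rw [add_zero] at h4
  obtain ⟨b, hb, he⟩ := h4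
  refine ⟨b, hb.congr (NearDiag.of_forall fun s _ t _ => ?_), he⟩
  simp only [hrim, hU _ (hγm _) (hγ0 _)]

/-- The common boundary of the two parts. -/
lemma exists_isPrim_rim (h : ConeData d R B) (hs : Sheets R B ρ η)
    {c : ℂ × ℂ × ℂ → ℂ × ℂ × ℂ → A} (hc : IsCoc (outerPart R ρ ∩ innerPart R ρ) c)
    (h0 : ∀ p ∈ outerPart R ρ ∩ innerPart R ρ, HasPathInt c (coneLoop p) 0)
    (h1 : ∀ j, HasPathInt c (fun t => sheetPt η j (1, ρ / Complex.exp (2 * Real.pi * Complex.I * t))) 0) :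
    ∃ θ, IsPrim (outerPart R ρ ∩ innerPart R ρ) c θ := by
  have hρ' : (ρ : ℂ) ≠ 0 := by exact_mod_cast hs.pos.ne'
  have hsub : ({0}ᶜ : Set ℂ) ×ˢ Metric.sphere (0 : ℂ) ρ ⊆ {0}ᶜ ×ˢ Metric.closedBall 0 ρ :=
    Set.prod_mono subset_rfl Metric.sphere_subset_closedBall
  have hcont : ∀ j, ContinuousOn (sheetPt η j) ({0}ᶜ ×ˢ Metric.sphere 0 ρ) := fun j =>
    (hs.continuousOn_sheetPt j).mono
      (hsub.trans (Set.prod_mono (Set.subset_univ _) subset_rfl))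
  have hmem : ∀ j, Set.MapsTo (sheetPt η j) ({0}ᶜ ×ˢ Metric.sphere 0 ρ)
      (outerPart R ρ ∩ innerPart R ρ) := by
    intro j q hq
    have h2 := h.sheetPt_mem_innerPart hs j (hsub hq)
    refine ⟨⟨h2.1, ?_⟩, h2⟩
    have h3 := hq.2
    simp only [mem_sphere_iff_norm, sub_zero] at h3
    simp only [sheetPt, Prod.smul_mk, smul_eq_mul, mul_one]
    rw [norm_mul, h3, mul_comm]
  have hj : ∀ j, ∃ b, IsPrim ({0}ᶜ ×ˢ Metric.sphere (0 : ℂ) ρ)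
      (fun x y => c (sheetPt η j x) (sheetPt η j y)) b := by
    intro j
    have hcj := hc.comp (hcont j) (hmem j)
    obtain ⟨J, hJ⟩ := hcj.exists_punctured_product fun s hsρ => by
      change HasPathInt c (fun t : ℝ => sheetPt η j (Complex.exp (2 * Real.pi * Complex.I * t), s)) 0
      simp only [sheetPt_exp]
      exact h0 _ (hmem j ⟨one_ne_zero, hsρ⟩)
    have hn : ∀ ζ ∈ ({0}ᶜ : Set ℂ), (‖ζ‖ : ℂ) ≠ 0 := fun ζ hζ => by
      exact_mod_cast norm_ne_zero_iff.2 hζ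
    have hcp := hcj.comp (f := fun ζ : ℂ => ((1 : ℂ), (ρ : ℂ) * ‖ζ‖ / ζ)) (S := {0}ᶜ)
      (continuousOn_const.prodMk (ContinuousOn.div (Continuous.continuousOn (by fun_prop))
        continuousOn_id fun ζ hζ => hζ))
      fun ζ hζ => ⟨one_ne_zero, by
        simp only [mem_sphere_iff_norm, sub_zero, norm_div, norm_mul, Complex.norm_real, norm_norm]
        rw [mul_div_assoc, div_self (norm_ne_zero_iff.2 hζ), mul_one,
          Real.norm_of_nonneg hs.pos.le]⟩
    obtain ⟨b, hb⟩ := hcp.exists_isPrim_punctured (by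
      refine (congrArg (fun γ => HasPathInt c γ 0) (funext fun t => ?_)).mp (h1 j)
      simp only [norm_exp_two_pi_I, Complex.ofReal_one, mul_one])
    have hs0 : ∀ q ∈ ({0}ᶜ : Set ℂ) ×ˢ Metric.sphere (0 : ℂ) ρ, q.2 ≠ 0 := by
      intro q hq h0
      have := hq.2
      simp [h0] at this
      exact hs.pos.ne this
    have hb' := hb.comp (f := fun q : ℂ × ℂ => (ρ : ℂ) / q.2)
      (S := {0}ᶜ ×ˢ Metric.sphere (0 : ℂ) ρ) (ContinuousOn.div continuousOn_const
        continuousOn_snd hs0) fun q hq => div_ne_zero hρ' (hs0 q hq)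
    refine ⟨_, (hb'.add (isPrim_cob _ J)).congr (hJ.imp fun x hx y hy he => ?_)⟩
    have key : ∀ q ∈ ({0}ᶜ : Set ℂ) ×ˢ Metric.sphere (0 : ℂ) ρ,
        (ρ : ℂ) * ‖(ρ : ℂ) / q.2‖ / (ρ / q.2) = q.2 := by
      intro q hq
      have h2 := hq.2
      simp only [mem_sphere_iff_norm, sub_zero] at h2
      have h3 := hs0 q hq
      rw [norm_div, h2, Complex.norm_real, Real.norm_of_nonneg hs.pos.le, div_self hs.pos.ne']
      field_simp
      simp
    simp only [key x hx, key y hy]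
    rw [he]; abel
  choose b hb using hj
  refine exists_isPrim_of_sheets (continuousOn_innerChart.mono Set.inter_subset_right)
    (T := {0}ᶜ ×ˢ Metric.sphere (0 : ℂ) ρ) ?_ hcont
    (fun q hq => h.sheetPt_injective hs (hsub hq)) (fun p hp => h.exists_sheetPt_eq hs hp.2) hb
  refine fun p hp => ⟨(innerChart_mem hp.2).1, ?_⟩
  have h4 := innerPart_fst_ne_zero hp.2
  simp only [innerChart, mem_sphere_iff_norm, sub_zero, norm_div]
  rw [div_eq_iff (norm_ne_zero_iff.2 h4)]
  exact le_antisymm hp.2.2 hp.1.2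

lemma liftable_chart (h : ConeData d R B) {c : ℂ × ℂ × ℂ → ℂ × ℂ × ℂ → Real.Angle}
    (hc : IsCoc (Vstar R) c) (hρ : 0 < ρ) :
    Liftable (rootSet (fun ξ : ℂ => R (ξ, 1)) (Metric.closedBall 0 ρ⁻¹))
      fun p q => c (p.1, p.2, 1) (q.1, q.2, 1) := by
  have h1 := liftable_rootSet_rect (c := fun p q : ℂ × ℂ => c (p.1, p.2, 1) (q.1, q.2, 1))
    (B := {0} ∪ (fun s => s⁻¹) '' B) h.symContOn_chart
    ((Set.finite_singleton _).union (h.finite.image _)) (fun x hx => h.inj (x, 1)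
      (fun h0 => hx (Or.inl h0)) fun hxB => hx (Or.inr ⟨_, hxB, by simp⟩))
    (hc.comp (by fun_prop) fun p hp => chart_mem hp) (inv_nonneg.2 hρ.le)
  refine h1.mono (rootSet_mono fun ξ hξ => ?_)
  simp only [Metric.mem_closedBall, dist_zero_right] at hξ
  exact ⟨abs_le.1 ((Complex.abs_re_le_norm ξ).trans hξ),
    abs_le.1 ((Complex.abs_im_le_norm ξ).trans hξ)⟩

lemma _root_.chartPt_sheetPt (j : Fin d) {q : ℂ × ℂ} (hq : q.1 ≠ 0) :
    chartPt (sheetPt η j q) = (η q.2 j / q.2, 1 / q.2) := by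
  refine Prod.ext ?_ ?_ <;> simp [chartPt, sheetPt]
  · rw [mul_div_mul_left _ _ hq]
  · by_cases h : q.2 = 0
    · simp [h]
    · field_simp

lemma _root_.chartPt_coneLoop (p : ℂ × ℂ × ℂ) (t : ℝ) : chartPt (coneLoop p t) = chartPt p := by
  have := Complex.exp_ne_zero (2 * Real.pi * Complex.I * t)
  refine Prod.ext ?_ ?_ <;> simp [chartPt, coneLoop] <;> rw [mul_div_mul_left _ _ this]

/-- A class trivial on the circles lifts to a real class. -/
lemma liftable_of_coneLoop (h : ConeData d R B) {c : ℂ × ℂ × ℂ → ℂ × ℂ × ℂ → Real.Angle}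
    (hc : IsCoc (Vstar R) c) (h0 : ∀ p ∈ Vstar R, HasPathInt c (coneLoop p) 0) :
    Liftable (Vstar R) c := by
  obtain ⟨ρ, η, hs⟩ := h.exists_sheets
  have hρ := hs.pos
  have hρ' : (ρ : ℂ) ≠ 0 := by exact_mod_cast hs.pos.ne'
  have hAV : outerPart R ρ ⊆ Vstar R := fun p hp => hp.1
  have hBV : innerPart R ρ ⊆ Vstar R := fun p hp => hp.1
  obtain ⟨K, hK⟩ := h.exists_chart_decomposition hρ hc h0
  obtain ⟨θ, hθ⟩ := h.exists_isPrim_innerPart hs (hc.mono hBV) fun p hp => h0 p (hBV hp)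
  obtain ⟨L, hL, hLc⟩ := h.liftable_chart hc hρ
  -- the real periods along the boundary circles are integral
  have hrimc := fun j => (hs.continuous_rimChart j).continuousOn (s := Set.Icc (0 : ℝ) 1)
  have hrimm := fun j (t : ℝ) (_ : t ∈ Set.Icc (0 : ℝ) 1) => h.rimChart_mem hs j t
  choose v hv using fun j => hL.exists_hasPathInt (hrimc j) (hrimm j)
  have hv2 : ∀ j, ∃ n : ℤ, v j = 2 * Real.pi * n := by
    intro j
    refine Real.Angle.coe_eq_zero_iff_int.1 ?_
    have h1 : HasPathInt (fun p q : ℂ × ℂ => c (p.1, p.2, 1) (q.1, q.2, 1)) (rimChart ρ η j)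
        (v j : Real.Angle) := ((hv j).map Real.Angle.coeHom).congr
          (hLc.imp fun _ _ _ _ he => he.symm) (hrimc j) (hrimm j)
    have h2 : HasPathInt c (rimLoop ρ η j) (v j : Real.Angle) := by
      refine (congrArg (fun γ => HasPathInt c γ (v j : Real.Angle)) (funext fun t => ?_)).mp h1
      simp only [rimChart]
      rw [← rimLoop_snd_snd (η := η) hρ j t]
    have h3 := hθ.hasPathInt (hs.continuous_rimLoop j).continuousOn
      fun t _ => (h.rimLoop_mem hs j t).2
    have e : rimLoop ρ η j 1 = rimLoop ρ η j 0 := by simp [rimLoop]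
    rw [e, sub_self] at h3
    exact h2.unique h3
  choose n hn using hv2
  have hsum : ∑ j, n j = 0 := by
    have h1 := h.sum_rimLoop_eq_zero hs hL hv
    simp only [hn, ← Finset.mul_sum] at h1
    have h2 : (∑ j, (n j : ℝ)) = 0 := (mul_eq_zero.1 h1).resolve_left (by positivity)
    exact_mod_cast h2
  obtain ⟨U, hU, hU0, hUv⟩ := h.exists_chart_unit hs n hsum
  have hUc : ContinuousOn U (rootSet (fun ξ : ℂ => R (ξ, 1)) (Metric.closedBall 0 ρ⁻¹)) :=
    hU.mono (rootSet_mono (Set.subset_univ _))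
  have hU0c : ∀ p ∈ rootSet (fun ξ : ℂ => R (ξ, 1)) (Metric.closedBall 0 ρ⁻¹), U p ≠ 0 :=
    fun p hp => hU0 p (rootSet_mono (Set.subset_univ _) hp)
  set L' : ℂ × ℂ → ℂ × ℂ → ℝ := fun p q => L p q + (U q / U p).arg with hL'
  have hL'c : IsCoc (rootSet (fun ξ : ℂ => R (ξ, 1)) (Metric.closedBall 0 ρ⁻¹)) L' :=
    hL.add (isCoc_arg hUc hU0c)
  have hL'rim : ∀ j, HasPathInt L' (rimChart ρ η j) 0 := by
    intro j
    obtain ⟨w, hw, hw0, hwe⟩ := hUv j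
    have h1 := (hv j).add (hs.hasPathInt_rimChart_of_unit hw hw0 hwe)
    rw [hn] at h1
    convert h1 using 1
    ring
  choose lift hlift using Real.Angle.exists_coe_eq
  set K' : ℂ × ℂ × ℂ → ℝ := fun p => lift (K p - ((U (chartPt p)).arg : Real.Angle)) with hK'
  set l₁ : ℂ × ℂ × ℂ → ℂ × ℂ × ℂ → ℝ := fun p q =>
    L' (chartPt p) (chartPt q) + (K' q - K' p) with hl₁
  set l₂ : ℂ × ℂ × ℂ → ℂ × ℂ × ℂ → ℝ := fun p q => lift (θ q) - lift (θ p) with hl₂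
  have hchm : Set.MapsTo chartPt (outerPart R ρ)
      (rootSet (fun ξ : ℂ => R (ξ, 1)) (Metric.closedBall 0 ρ⁻¹)) := fun p hp =>
    h.chartPt_mem hρ hp
  have hch := continuousOn_chartPt (R := R) hρ
  have hV : outerPart R ρ ∪ innerPart R ρ = Vstar R := outerPart_union_innerPart
  rw [← hV] at hc ⊢
  refine Liftable.glue (by rw [hV]; exact closure_outerPart) (by rw [hV]; exact closure_innerPart)
    hc (l₁ := l₁) (l₂ := l₂) ((hL'c.comp hch hchm).add (isPrim_cob _ K').isCoc) ?_
    (isPrim_cob _ _).isCoc ?_ ?_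
  · refine (((hLc.and (isPrim_arg_coe hU0c)).comp hch hchm).and hK).imp fun p _ q _ he => ?_
    obtain ⟨⟨e1, e2⟩, e3⟩ := he
    simp only [hl₁, hL', hK', Real.Angle.coe_add, Real.Angle.coe_sub, hlift]
    simp only at e1 e2
    rw [e1, e2, e3]
    abel
  · refine hθ.imp fun p _ q _ he => ?_
    simp only [hl₂, Real.Angle.coe_sub, hlift]
    exact he.symm
  · intro D hD hDl
    have hpath : ∀ γ : ℝ → ℂ × ℂ × ℂ, ContinuousOn γ (Set.Icc 0 1) →
        Set.MapsTo γ (Set.Icc 0 1) (outerPart R ρ ∩ innerPart R ρ) → γ 1 = γ 0 →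
        HasPathInt L' (fun t => chartPt (γ t)) 0 → HasPathInt D γ 0 := by
      intro γ hγ hm hloop hLγ
      obtain ⟨w, hw⟩ := hD.exists_hasPathInt hγ hm
      have h1 := (isPrim_cob Set.univ K').hasPathInt hγ fun _ _ => trivial
      have h2 := (isPrim_cob Set.univ fun p => lift (θ p)).hasPathInt hγ fun _ _ => trivial
      rw [hloop, sub_self] at h1 h2
      have h3 : HasPathInt l₁ γ (0 + 0) := HasPathInt.add (c := fun p q =>
        L' (chartPt p) (chartPt q)) hLγ h1
      have h4 := (h3.sub h2).congr (c' := fun x y => 2 * Real.pi * D x y)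
        (hDl.imp fun _ _ _ _ he => he.symm) hγ hm
      have h5 := hw.map ((AddMonoidHom.mulLeft (2 * Real.pi)).comp (Int.castAddHom ℝ))
      have h6 := h5.unique h4
      simp only [AddMonoidHom.comp_apply, Int.coe_castAddHom, AddMonoidHom.coe_mulLeft,
        add_zero, sub_zero, mul_eq_zero, Real.pi_ne_zero, OfNat.ofNat_ne_zero, or_self, false_or,
        Int.cast_eq_zero] at h6
      rwa [h6] at hw
    refine h.exists_isPrim_rim hs hD (fun p hp => hpath _ ?_ ?_ ?_ ?_) fun j => hpath _ ?_ ?_ ?_ ?_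
    · exact (continuous_coneLoop.comp (by fun_prop : Continuous fun t : ℝ => (t, p))).continuousOn
    · intro t _
      have h1 := h.coneLoop_mem hp.1.1 t
      have h2 := hp.1.2
      have h3 := hp.2.2
      refine ⟨⟨h1, ?_⟩, h1, ?_⟩ <;>
      · simp only [coneLoop, Prod.smul_snd, Prod.smul_fst, norm_smul, norm_exp_two_pi_I, one_mul]
        assumption
    · simp only [coneLoop, exp_two_pi_I_zero_one]
    · simp only [chartPt_coneLoop]
      refine ⟨fun _ => 0, NearDiag.of_forall fun s _ t _ => ?_, by simp⟩
      simp only [hL'c.self (hchm hp.1), sub_self]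
    · refine (hs.continuousOn_sheetPt j).comp (Continuous.continuousOn ?_) fun t _ => ⟨trivial,
        Metric.sphere_subset_closedBall (rimParam_mem hρ t).2⟩
      exact .prodMk (by fun_prop) (by fun_prop (disch := simp))
    · intro t _
      have h1 := (rimParam_mem hρ t).2
      have h2 := h.sheetPt_mem_innerPart hs j (q := (1, ρ / Complex.exp (2 * Real.pi * Complex.I * t)))
        ⟨one_ne_zero, Metric.sphere_subset_closedBall h1⟩
      refine ⟨⟨h2.1, ?_⟩, h2⟩
      simp only [mem_sphere_iff_norm, sub_zero] at h1
      simp only [sheetPt, Prod.smul_mk, smul_eq_mul, mul_one, one_mul]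
      rw [h1]; simp
    · simp only [exp_two_pi_I_zero_one]
    · refine (congrArg (fun γ => HasPathInt L' γ 0) (funext fun t => ?_)).mp (hL'rim j)
      rw [chartPt_sheetPt j one_ne_zero, ← chartPt_rimLoop hρ, rimLoop, chartPt_sheetPt]
      exact (rimParam_mem hρ t).1

end ConeData

/-- Every class in `H¹(S, ℝ / (2 * π * ℤ))` multiplied by `k` lifts to `H¹(S, ℝ)`. -/
def MulLiftable {α : Type*} [TopologicalSpace α] (S : Set α) (k : ℕ) : Prop :=
  ∀ c : α → α → Real.Angle, IsCoc S c → Liftable S fun x y => k • c x y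

lemma MulLiftable.of_homeo {α β : Type*} [TopologicalSpace α] [TopologicalSpace β] {S : Set α}
    {T : Set β} {k : ℕ} (h : MulLiftable S k) {f : α → β} {g : β → α} (hf : ContinuousOn f S)
    (hfm : Set.MapsTo f S T) (hg : ContinuousOn g T) (hgm : Set.MapsTo g T S)
    (hfg : ∀ y ∈ T, f (g y) = y) : MulLiftable T k := by
  intro c hc
  refine ((h _ (hc.comp hf hfm)).comp hg hgm).congr (NearDiag.of_forall fun x hx y hy => ?_)
  simp only [hfg x hx, hfg y hy]

namespace ConeData

variable {d : ℕ} {R : ℂ × ℂ → Fin d → ℂ} {B : Set ℂ} {ρ : ℝ} {η : ℂ → Fin d → ℂ}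

lemma mulLiftable (h : ConeData d R B) : MulLiftable (Vstar R) d := by
  intro c hc
  refine h.liftable_of_coneLoop (hc.map (nsmulAddMonoidHom d)) fun p hp => ?_
  obtain ⟨v, hv⟩ := hc.exists_hasPathInt (γ := coneLoop p)
    (continuous_coneLoop.comp (by fun_prop : Continuous fun t : ℝ => (t, p))).continuousOn
    fun t _ => h.coneLoop_mem hp t
  have := hv.map (nsmulAddMonoidHom d)
  rwa [nsmulAddMonoidHom_apply, h.nsmul_eq_zero hc hp hv] at this

lemma eventually_sheetPt_ne (hs : Sheets R B ρ η) (j : Fin d) {p : ℂ × ℂ × ℂ}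
    (hp : p ∈ innerPart R ρ) (hj : sheetPt η j (innerChart p) ≠ p) :
    ∀ᶠ q in 𝓝[innerPart R ρ] p, sheetPt η j (innerChart q) ≠ q := by
  have h1 : ContinuousOn (fun q => sheetPt η j (innerChart q)) (innerPart R ρ) :=
    (hs.continuousOn_sheetPt j).comp continuousOn_innerChart fun q hq =>
      ⟨trivial, (innerChart_mem hq).2⟩
  have h2 := (h1 p hp).tendsto.sub (continuousWithinAt_id (s := innerPart R ρ) (x := p)).tendsto
  filter_upwards [h2.eventually_ne (sub_ne_zero.2 hj)] with q hq
  exact sub_ne_zero.1 hq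

lemma eventually_sheetPt_eq (h : ConeData d R B) (hs : Sheets R B ρ η) (j : Fin d)
    {p : ℂ × ℂ × ℂ} (hp : p ∈ innerPart R ρ) (hj : sheetPt η j (innerChart p) = p) :
    ∀ᶠ q in 𝓝[innerPart R ρ] p, sheetPt η j (innerChart q) = q := by
  have h1 : ∀ᶠ q in 𝓝[innerPart R ρ] p, ∀ i, i ≠ j → sheetPt η i (innerChart q) ≠ q := by
    refine eventually_all.2 fun i => ?_
    by_cases hij : i = j
    · simp [hij]
    · simp only [ne_eq, hij, not_false_eq_true, forall_true_left]
      refine eventually_sheetPt_ne hs i hp fun hi => hij ?_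
      exact h.sheetPt_injective hs (innerChart_mem hp) (hi.trans hj.symm)
  filter_upwards [h1, self_mem_nhdsWithin] with q hq hqm
  obtain ⟨i, hi⟩ := h.exists_sheetPt_eq hs hqm
  by_cases hij : i = j
  · rwa [← hij]
  · exact absurd hi (hq i hij)

lemma innerPart_mem_nhdsWithin {p : ℂ × ℂ × ℂ} (hlt : ‖p.2.2‖ < ρ * ‖p.2.1‖) :
    innerPart R ρ ∈ 𝓝[Vstar R] p := by
  have h1 : {q : ℂ × ℂ × ℂ | ‖q.2.2‖ < ρ * ‖q.2.1‖} ∈ 𝓝 p :=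
    (isOpen_lt (by fun_prop) (by fun_prop)).mem_nhds hlt
  filter_upwards [mem_nhdsWithin_of_mem_nhds h1, self_mem_nhdsWithin] with q hq hqm
  exact ⟨hqm, le_of_lt hq⟩

/-- A function on the cone which is homogeneous of degree one and vanishes only on a single line,
to order `d`. -/
lemma exists_section (h : ConeData d R B) (hs : Sheets R B ρ η) (j₀ : Fin d) :
    ∃ (f : ℂ × ℂ × ℂ → ℂ) (v : ℂ → ℂ), ContinuousOn v (Metric.closedBall 0 ρ) ∧
      (∀ s ∈ Metric.closedBall (0 : ℂ) ρ, v s ≠ 0) ∧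
      (∀ p ∈ Vstar R, ¬ (p.2.2 = 0 ∧ sheetPt η j₀ (innerChart p) = p) →
        ContinuousWithinAt f (Vstar R) p ∧ f p ≠ 0) ∧
      ∀ p ∈ innerPart R ρ, p.2.2 ≠ 0 → sheetPt η j₀ (innerChart p) = p →
        f p = p.2.1 * v (p.2.2 / p.2.1) * (p.2.2 / p.2.1) ^ d := by
  classical
  have hpos := h.pos
  obtain ⟨U, hU, hU0, hUv⟩ := h.exists_chart_unit hs
    (fun j => if j = j₀ then (d : ℤ) - 1 else -1) (by
      rw [Finset.sum_ite]
      simp [Finset.filter_eq', Finset.filter_ne']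
      rw [Nat.cast_sub hpos]; simp)
  choose v hv hv0 hvU using hUv
  have : Nonempty (Fin d) := ⟨j₀⟩
  choose! idx hidx using fun p (hp : p ∈ innerPart R ρ) => h.exists_sheetPt_eq hs hp
  set f : ℂ × ℂ × ℂ → ℂ := fun p => if p.2.2 = 0 then p.2.1 * v (idx p) 0 else
    p.2.2 * U (chartPt p) with hf
  have hfj : ∀ p ∈ innerPart R ρ, p.2.2 ≠ 0 → ∀ j, sheetPt η j (innerChart p) = p →
      f p = p.2.2 * ((p.2.2 / p.2.1) ^ (if j = j₀ then (d : ℤ) - 1 else -1) *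
        v j (p.2.2 / p.2.1)) := by
    intro p hp hw j hj
    have hx := innerPart_fst_ne_zero hp
    simp only [hf, if_neg hw]
    rw [← hvU j (p.2.2 / p.2.1) (innerChart_mem hp).2 (div_ne_zero hw hx)]
    congr 2
    conv_lhs => rw [← hj]
    rw [chartPt_sheetPt j (innerChart_mem hp).1]
    rfl
  refine ⟨f, v j₀, hv j₀, hv0 j₀, fun p hp hn => ?_, fun p hp hw hj => ?_⟩
  · by_cases hw : p.2.2 = 0
    · have hx : p.2.1 ≠ 0 := fun hx => hp.1 (Prod.ext hx hw)
      have hlt : ‖p.2.2‖ < ρ * ‖p.2.1‖ := by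
        rw [hw, norm_zero]; exact mul_pos hs.pos (norm_pos_iff.2 hx)
      have hpi : p ∈ innerPart R ρ := ⟨hp, hlt.le⟩
      have hj := hidx p hpi
      have hne : idx p ≠ j₀ := fun he => hn ⟨hw, by rw [← he]; exact hj⟩
      have hin := innerPart_mem_nhdsWithin (R := R) hlt
      have h0 : (0 : ℂ) ∈ Metric.closedBall (0 : ℂ) ρ := by simpa using hs.pos.le
      refine ⟨?_, by simp only [hf, if_pos hw]; exact mul_ne_zero hx (hv0 _ _ h0)⟩
      have hcs : ContinuousOn (fun q : ℂ × ℂ × ℂ => q.2.1 * v (idx p) (innerChart q).2)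
          (innerPart R ρ) :=
        ContinuousOn.mul (Continuous.continuousOn (by fun_prop))
          ((hv (idx p)).comp continuousOn_innerChart.snd fun q hq => (innerChart_mem hq).2)
      refine ((hcs p hpi).congr_of_eventuallyEq ?_ ?_).mono_of_mem_nhdsWithin hin
      · filter_upwards [h.eventually_sheetPt_eq hs _ hpi hj, self_mem_nhdsWithin] with q hq hqm
        by_cases hqw : q.2.2 = 0
        · have e : idx q = idx p := h.sheetPt_injective hs (innerChart_mem hqm)
            ((hidx q hqm).trans hq.symm)
          simp only [hf, if_pos hqw, e, innerChart, hqw, zero_div]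
        · rw [hfj q hqm hqw _ hq, if_neg hne]
          have := innerPart_fst_ne_zero hqm
          simp only [innerChart, zpow_neg, zpow_one]
          field_simp
      · simp only [hf, if_pos hw, innerChart, hw, zero_div]
    · have hch : ContinuousAt chartPt p := by
        unfold chartPt
        exact ContinuousAt.prodMk (by fun_prop (disch := assumption))
          (by fun_prop (disch := assumption))
      have hm : ∀ q ∈ Vstar R ∩ {q | q.2.2 ≠ 0},
          chartPt q ∈ rootSet (fun ξ : ℂ => R (ξ, 1)) Set.univ := by
        rintro q ⟨hq, hq0 : q.2.2 ≠ 0⟩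
        have := h.homog (q.2.2)⁻¹ (inv_ne_zero hq0) _ _ hq.2
        refine ⟨trivial, ?_⟩
        simpa [chartPt, Prod.smul_def, hq0, div_eq_inv_mul] using this
      have hop : {q : ℂ × ℂ × ℂ | q.2.2 ≠ 0} ∈ 𝓝 p :=
        (isOpen_ne_fun (by fun_prop) (by fun_prop)).mem_nhds hw
      refine ⟨?_, by simp only [hf, if_neg hw]; exact mul_ne_zero hw (hU0 _ (hm p ⟨hp, hw⟩))⟩
      rw [← continuousWithinAt_inter hop]
      have h1 : ContinuousWithinAt (fun q : ℂ × ℂ × ℂ => q.2.2 * U (chartPt q))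
          (Vstar R ∩ {q | q.2.2 ≠ 0}) p :=
        ContinuousWithinAt.mul (Continuous.continuousWithinAt (by fun_prop))
          ((hU _ (hm p ⟨hp, hw⟩)).comp hch.continuousWithinAt hm)
      refine h1.congr (fun q hq => ?_) ?_
      · simp only [hf, if_neg (show q.2.2 ≠ 0 from hq.2)]
      · simp only [hf, if_neg hw]
  · rw [hfj p hp hw j₀ hj, if_pos rfl]
    have hx := innerPart_fst_ne_zero hp
    have hs0 := div_ne_zero hw hx
    rw [zpow_sub₀ hs0, zpow_natCast, zpow_one]
    field_simp

lemma exists_generating_class (h : ConeData d R B) : ∃ c : ℂ × ℂ × ℂ → ℂ × ℂ × ℂ → Real.Angle,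
    IsCoc (Vstar R) c ∧ ∃ p ∈ Vstar R,
      HasPathInt c (coneLoop p) (((d : ℝ)⁻¹ * (2 * Real.pi) : ℝ) : Real.Angle) := by
  classical
  obtain ⟨ρ, η, hs⟩ := h.exists_sheets
  have hd : (d : ℝ) ≠ 0 := by exact_mod_cast h.pos.ne'
  set j₀ : Fin d := ⟨0, h.pos⟩
  obtain ⟨f, v, hv, hv0, hf, hfv⟩ := h.exists_section hs j₀
  set E : Set (ℂ × ℂ × ℂ) := {p ∈ innerPart R ρ | sheetPt η j₀ (innerChart p) = p} with hE
  set F : Set (ℂ × ℂ × ℂ) := {p ∈ Vstar R | ¬ (p ∈ E ∧ ‖p.2.2‖ < ρ * ‖p.2.1‖)} with hF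
  have hEF : E ∪ F = Vstar R := by
    ext p
    constructor
    · rintro (hp | hp)
      exacts [hp.1.1, hp.1]
    · intro hp
      by_cases hpE : p ∈ E
      · exact Or.inl hpE
      · exact Or.inr ⟨hp, fun h' => hpE h'.1⟩
  have hEc : closure E ∩ (E ∪ F) ⊆ E := by
    rw [hEF]
    rintro p ⟨hpc, hpV⟩
    have hpi : p ∈ innerPart R ρ :=
      closure_innerPart ⟨closure_mono (fun q hq => hq.1) hpc, hpV⟩
    refine ⟨hpi, ?_⟩
    by_contra hne
    have h1 := eventually_sheetPt_ne hs j₀ hpi hne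
    rw [mem_closure_iff_nhdsWithin_neBot] at hpc
    have h2 := h1.filter_mono (nhdsWithin_mono p (fun q (hq : q ∈ E) => hq.1))
    obtain ⟨q, hq1, hq2⟩ := (h2.and self_mem_nhdsWithin).exists
    exact hq1 hq2.2
  have hFc : closure F ∩ (E ∪ F) ⊆ F := by
    rw [hEF]
    rintro p ⟨hpc, hpV⟩
    refine ⟨hpV, fun ⟨hpE, hlt⟩ => ?_⟩
    have h1 : ∀ᶠ q in 𝓝[Vstar R] p, q ∈ E ∧ ‖q.2.2‖ < ρ * ‖q.2.1‖ := by
      have hin := innerPart_mem_nhdsWithin (R := R) hlt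
      have h2 := (h.eventually_sheetPt_eq hs j₀ hpE.1 hpE.2).filter_mono
        (nhdsWithin_le_iff.2 hin)
      have h3 : {q : ℂ × ℂ × ℂ | ‖q.2.2‖ < ρ * ‖q.2.1‖} ∈ 𝓝 p :=
        (isOpen_lt (by fun_prop) (by fun_prop)).mem_nhds hlt
      filter_upwards [h2, hin, mem_nhdsWithin_of_mem_nhds h3] with q a b c
      exact ⟨⟨b, a⟩, c⟩
    rw [mem_closure_iff_nhdsWithin_neBot] at hpc
    have h2 := h1.filter_mono (nhdsWithin_mono p (fun q (hq : q ∈ F) => hq.1))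
    obtain ⟨q, hq1, hq2⟩ := (h2.and self_mem_nhdsWithin).exists
    exact hq2.2 hq1
  set n : ℂ × ℂ × ℂ → ℂ := fun p => p.2.1 * v (innerChart p).2 with hn
  have hnc : ContinuousOn n (innerPart R ρ) :=
    ContinuousOn.mul (Continuous.continuousOn (by fun_prop))
      (hv.comp continuousOn_innerChart.snd fun q hq => (innerChart_mem hq).2)
  have hn0 : ∀ p ∈ innerPart R ρ, n p ≠ 0 := fun p hp =>
    mul_ne_zero (innerPart_fst_ne_zero hp) (hv0 _ (innerChart_mem hp).2)
  have hFn : ∀ p ∈ F, ¬ (p.2.2 = 0 ∧ sheetPt η j₀ (innerChart p) = p) := by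
    rintro p hp ⟨hw, hj⟩
    have hx : p.2.1 ≠ 0 := fun hx => hp.1.1 (Prod.ext hx hw)
    have hlt : ‖p.2.2‖ < ρ * ‖p.2.1‖ := by
      rw [hw, norm_zero]; exact mul_pos hs.pos (norm_pos_iff.2 hx)
    exact hp.2 ⟨⟨⟨hp.1, hlt.le⟩, hj⟩, hlt⟩
  have hfc : ContinuousOn f F := fun p hp => (hf p hp.1 (hFn p hp)).1.mono fun q hq => hq.1
  have hf0 : ∀ p ∈ F, f p ≠ 0 := fun p hp => (hf p hp.1 (hFn p hp)).2
  set θ : ℂ × ℂ × ℂ → Real.Angle := fun p => if p ∈ E then ((innerChart p).2.arg : Real.Angle) else 0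
    with hθ
  set inv : ℝ →+ Real.Angle := Real.Angle.coeHom.comp (AddMonoidHom.mulLeft (d : ℝ)⁻¹) with hinv
  have hEFw : ∀ p ∈ E ∩ F, p.2.2 ≠ 0 := fun p hp hw => hFn p hp.2 ⟨hw, hp.1.2⟩
  have hscont : ContinuousOn (fun p => (innerChart p).2) (E ∩ F) :=
    continuousOn_innerChart.snd.mono fun p hp => hp.1.1
  have hs0 : ∀ p ∈ E ∩ F, (innerChart p).2 ≠ 0 := fun p hp =>
    div_ne_zero (hEFw p hp) (innerPart_fst_ne_zero hp.1.1)
  have hagree : NearDiag (E ∩ F) fun p q => inv (n q / n p).arg =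
      inv (f q / f p).arg - (θ q - θ p) := by
    refine ((nearDiag_arg_mul (hnc.mono fun p (hp : p ∈ E ∩ F) => hp.1.1)
      (fun p hp => hn0 p hp.1.1) (hscont.pow d) (fun p hp => pow_ne_zero d (hs0 p hp))).and
      ((nearDiag_arg_pow hscont hs0 d).and (isPrim_arg_coe hs0))).imp fun p hp q hq he => ?_
    obtain ⟨e1, e2, e3⟩ := he
    have e4 : ∀ p ∈ E ∩ F, f p = n p * (innerChart p).2 ^ d := fun p hp => by
      rw [hfv p hp.1.1 (hEFw p hp) hp.1.2]; rfl
    simp only [Pi.pow_apply] at e1 e3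
    rw [e4 p hp, e4 q hq, e1, e2, map_add]
    have e5 : inv (d * ((innerChart q).2 / (innerChart p).2).arg) = θ q - θ p := by
      simp only [hinv, hθ, if_pos hp.1, if_pos hq.1, AddMonoidHom.comp_apply,
        AddMonoidHom.coe_mulLeft, inv_mul_cancel_left₀ hd]
      rw [← e3]; rfl
    rw [e5]; abel
  obtain ⟨c, hc, hc1, -⟩ := IsCoc.exists_glue hEc hFc
    (((isCoc_arg hnc hn0).map inv).mono fun p hp => hp.1)
    (((isCoc_arg hfc hf0).map inv).sub (isPrim_cob F θ).isCoc) hagree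
  rw [hEF] at hc
  have hp : sheetPt η j₀ (1, 0) ∈ innerPart R ρ := h.sheetPt_mem_innerPart hs j₀
    ⟨one_ne_zero, by simpa using hs.pos.le⟩
  refine ⟨c, hc, _, hp.1, ?_⟩
  have hE' : ∀ t : ℝ, coneLoop (sheetPt η j₀ (1, 0)) t ∈ E := by
    intro t
    rw [← sheetPt_exp]
    refine ⟨h.sheetPt_mem_innerPart hs j₀ ⟨Complex.exp_ne_zero _, by simpa using hs.pos.le⟩, ?_⟩
    congr 1
    simp [innerChart, sheetPt]
  have h1 : HasPathInt (fun p q => (n q / n p).arg) (coneLoop (sheetPt η j₀ (1, 0))) (2 * Real.pi) :=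
    hasPathInt_arg_exp (a := v 0) (hv0 _ (by simpa using hs.pos.le)) fun t _ => by
      simp [hn, coneLoop, sheetPt, innerChart, mul_comm]
  exact (h1.map inv).congr hc1
    (continuous_coneLoop.comp (by fun_prop : Continuous fun t : ℝ => (t, _))).continuousOn
    fun t _ => hE' t

lemma mulLiftable_iff (h : ConeData d R B) {k : ℕ} : MulLiftable (Vstar R) k ↔ d ∣ k := by
  have hd : (d : ℝ) ≠ 0 := by exact_mod_cast h.pos.ne'
  constructor
  · intro hk
    obtain ⟨c, hc, p, hp, hv⟩ := h.exists_generating_class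
    obtain ⟨l, hl, hlc⟩ := hk c hc
    have hcl : ContinuousOn (coneLoop p) (Set.Icc 0 1) :=
      (continuous_coneLoop.comp (by fun_prop : Continuous fun t : ℝ => (t, p))).continuousOn
    have hcm : Set.MapsTo (coneLoop p) (Set.Icc 0 1) (Vstar R) := fun t _ => h.coneLoop_mem hp t
    obtain ⟨w, hw⟩ := hl.exists_hasPathInt hcl hcm
    have hw0 : w = 0 := by
      have := h.nsmul_eq_zero hl hp hw
      simpa [hd] using this
    have h1 := ((hw.map Real.Angle.coeHom).congr (c' := fun x y => k • c x y)
      (hlc.imp fun _ _ _ _ he => he.symm) hcl hcm).unique (hv.map (nsmulAddMonoidHom k))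
    rw [hw0, map_zero, nsmulAddMonoidHom_apply, ← Real.Angle.coe_nsmul] at h1
    obtain ⟨n, hn⟩ := Real.Angle.coe_eq_zero_iff_int.1 h1.symm
    rw [nsmul_eq_mul] at hn
    have h2 : (k : ℝ) = d * n := by
      have := Real.pi_ne_zero
      field_simp at hn
      linarith
    have h3 : (k : ℤ) = d * n := by exact_mod_cast h2
    exact Int.natCast_dvd_natCast.1 ⟨n, h3⟩
  · rintro ⟨m, rfl⟩ c hc
    have h1 := h.mulLiftable _ (hc.map (nsmulAddMonoidHom m))
    refine h1.congr (NearDiag.of_forall fun x _ y _ => ?_)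
    simp only [nsmulAddMonoidHom_apply]
    exact mul_smul d m (c x y)

/-- The degree of a cone is a topological invariant of its punctured version. -/
theorem degree_eq_of_homeo {d' : ℕ} {R' : ℂ × ℂ → Fin d' → ℂ} {B' : Set ℂ} (h : ConeData d R B)
    (h' : ConeData d' R' B') {f g : ℂ × ℂ × ℂ → ℂ × ℂ × ℂ} (hf : ContinuousOn f (Vstar R))
    (hfm : Set.MapsTo f (Vstar R) (Vstar R')) (hg : ContinuousOn g (Vstar R'))
    (hgm : Set.MapsTo g (Vstar R') (Vstar R)) (hfg : ∀ y ∈ Vstar R', f (g y) = y)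
    (hgf : ∀ x ∈ Vstar R, g (f x) = x) : d = d' := by
  refine Nat.dvd_antisymm ?_ ?_
  · exact h.mulLiftable_iff.1 ((h'.mulLiftable_iff.2 dvd_rfl).of_homeo hg hgm hf hfm hgf)
  · exact h'.mulLiftable_iff.1 ((h.mulLiftable_iff.2 dvd_rfl).of_homeo hf hfm hg hgm hfg)

end ConeData

section PolynomialFamilies

lemma Polynomial.exists_eq_prod_X_sub_C {d : ℕ} {p : Polynomial ℂ} (hp : p.Monic)
    (hd : p.natDegree = d) : ∃ r : Fin d → ℂ, p = ∏ j, (Polynomial.X - Polynomial.C (r j)) := by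
  induction d generalizing p with
  | zero => exact ⟨Fin.elim0, by simpa using hp.natDegree_eq_zero.1 hd⟩
  | succ d ih =>
    obtain ⟨z, hz⟩ := IsAlgClosed.exists_root p (by
      rw [Polynomial.degree_eq_natDegree hp.ne_zero, hd]; exact_mod_cast d.succ_ne_zero)
    obtain ⟨q, rfl⟩ := Polynomial.dvd_iff_isRoot.2 hz
    have hq : q.Monic := (Polynomial.monic_X_sub_C z).of_mul_monic_left hp
    rw [(Polynomial.monic_X_sub_C z).natDegree_mul hq, Polynomial.natDegree_X_sub_C] at hd
    obtain ⟨r, hr⟩ := ih hq (by omega)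
    exact ⟨Fin.cons z r, by rw [Fin.prod_univ_succ, hr]; simp⟩

lemma Polynomial.exists_eq_prod_one_add {N : ℕ} {p : Polynomial ℂ} {a : ℂ} (ha : p.eval a ≠ 0)
    (hN : p.natDegree ≤ N) : ∃ u : Fin N → ℂ, p = Polynomial.C (p.eval a) *
      ∏ i, (1 + (Polynomial.X - Polynomial.C a) * Polynomial.C (u i)) := by
  induction N generalizing p with
  | zero =>
    refine ⟨Fin.elim0, ?_⟩
    rw [Polynomial.eq_C_of_natDegree_le_zero hN]
    simp
  | succ N ih =>
    by_cases h0 : p.natDegree = 0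
    · refine ⟨fun _ => 0, ?_⟩
      rw [Polynomial.eq_C_of_natDegree_eq_zero h0]
      simp
    obtain ⟨z, hz⟩ := IsAlgClosed.exists_root p fun h => h0 (Polynomial.natDegree_eq_of_degree_eq_some h)
    obtain ⟨q, rfl⟩ := Polynomial.dvd_iff_isRoot.2 hz
    rw [Polynomial.eval_mul, Polynomial.eval_sub, Polynomial.eval_X, Polynomial.eval_C] at ha ⊢
    have hq : q ≠ 0 := by rintro rfl; simp at ha
    rw [Polynomial.natDegree_mul (Polynomial.X_sub_C_ne_zero z) hq,
      Polynomial.natDegree_X_sub_C] at hN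
    obtain ⟨u, hu⟩ := ih (right_ne_zero_of_mul ha) (by omega)
    have haz := left_ne_zero_of_mul ha
    refine ⟨Fin.cons (a - z)⁻¹ u, ?_⟩
    rw [Fin.prod_univ_succ]
    simp only [Fin.cons_zero, Fin.cons_succ]
    conv_lhs => rw [hu]
    have : (Polynomial.X - Polynomial.C z : Polynomial ℂ) = Polynomial.C (a - z) *
        (1 + (Polynomial.X - Polynomial.C a) * Polynomial.C (a - z)⁻¹) := by
      have e : Polynomial.C (a - z) * Polynomial.C (a - z)⁻¹ = (1 : Polynomial ℂ) := by
        rw [← Polynomial.C_mul, mul_inv_cancel₀ haz, Polynomial.C_1]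
      rw [mul_add, mul_left_comm, e, Polynomial.C_sub]
      ring
    rw [this, Polynomial.C_mul]
    ring

lemma Polynomial.roots_prod_one_add {N : ℕ} {a c : ℂ} (hc : c ≠ 0) (u : Fin N → ℂ) :
    (Polynomial.C c * ∏ i, (1 + (Polynomial.X - Polynomial.C a) * Polynomial.C (u i))).roots =
      ∑ i, if u i = 0 then 0 else {a - (u i)⁻¹} := by
  have key : ∀ w : ℂ, (1 + (Polynomial.X - Polynomial.C a) * Polynomial.C w) ≠ 0 ∧
      (1 + (Polynomial.X - Polynomial.C a) * Polynomial.C w).roots =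
        if w = 0 then 0 else {a - w⁻¹} := by
    intro w
    constructor
    · intro h
      have := congrArg (Polynomial.eval a) h
      simp at this
    · split_ifs with hw
      · simp [hw]
      · have e : (1 + (Polynomial.X - Polynomial.C a) * Polynomial.C w) =
            Polynomial.C w * (Polynomial.X - Polynomial.C (a - w⁻¹)) := by
          have e : Polynomial.C w * Polynomial.C w⁻¹ = (1 : Polynomial ℂ) := by
            rw [← Polynomial.C_mul, mul_inv_cancel₀ hw, Polynomial.C_1]
          rw [Polynomial.C_sub, ← e]
          ring
        rw [e, Polynomial.roots_C_mul _ hw, Polynomial.roots_X_sub_C]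
  rw [Polynomial.roots_C_mul _ hc, Polynomial.roots_prod _ _
    (Finset.prod_ne_zero_iff.2 fun i _ => (key _).1)]
  simp only [Multiset.bind, Multiset.join]
  rw [Finset.sum_eq_multiset_sum]
  congr 1
  exact Multiset.map_congr rfl fun i _ => (key _).2

variable {T : Type*} {l : Filter T} {P : T → Polynomial ℂ} {P₀ : Polynomial ℂ} {N : ℕ}

lemma Polynomial.tendsto_eval_of_coeff (hN : ∀ t, (P t).natDegree ≤ N) (hN₀ : P₀.natDegree ≤ N)
    (h : ∀ i, Tendsto (fun t => (P t).coeff i) l (𝓝 (P₀.coeff i))) (a : ℂ) :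
    Tendsto (fun q : T × ℂ => (P q.1).eval q.2) (l ×ˢ 𝓝 a) (𝓝 (P₀.eval a)) := by
  have e : ∀ (p : Polynomial ℂ) (z : ℂ), p.natDegree ≤ N →
      p.eval z = ∑ i ∈ Finset.range (N + 1), p.coeff i * z ^ i := fun p z hp =>
    Polynomial.eval_eq_sum_range' (Nat.lt_succ_of_le hp) z
  rw [e _ _ hN₀]
  simp only [fun q : T × ℂ => e (P q.1) q.2 (hN _)]
  exact tendsto_finsetSum _ fun i _ => ((h i).comp tendsto_fst).mul (tendsto_snd.pow i)

open scoped Classical in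
/-- The number of zeros of `P t` in a small ball about `z₀` is eventually the multiplicity of `z₀`
as a zero of the limit; the degree may drop in the limit. -/
lemma Polynomial.eventually_card_roots_ball (hN : ∀ t, (P t).natDegree ≤ N)
    (h : ∀ i, Tendsto (fun t => (P t).coeff i) l (𝓝 (P₀.coeff i))) (h₀ : P₀ ≠ 0) {z₀ : ℂ} {ρ : ℝ}
    (hρ : 0 < ρ) (hz : ∀ z ∈ Metric.closedBall z₀ ρ, P₀.IsRoot z → z = z₀) :
    ∀ᶠ t in l, P t ≠ 0 ∧
      ((P t).roots.filter (· ∈ Metric.ball z₀ ρ)).card = P₀.rootMultiplicity z₀ := by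
  classical
  rw [Filter.Eventually, Filter.mem_iff_ultrafilter]
  intro 𝒰 h𝒰
  replace h : ∀ i, Tendsto (fun t => (P t).coeff i) 𝒰 (𝓝 (P₀.coeff i)) := fun i => (h i).mono_left h𝒰
  have hN₀ : P₀.natDegree ≤ N := by
    rw [Polynomial.natDegree_le_iff_coeff_eq_zero]
    intro i hi
    refine tendsto_nhds_unique (h i) (tendsto_const_nhds.congr fun t => ?_)
    exact (Polynomial.coeff_eq_zero_of_natDegree_lt ((hN t).trans_lt hi)).symm
  obtain ⟨a, ha⟩ : ∃ a, P₀.eval a ≠ 0 := by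
    by_contra! hc
    exact h₀ (Polynomial.funext fun z => by simpa using hc z)
  have hT := Polynomial.tendsto_eval_of_coeff hN hN₀ h
  obtain ⟨U, hU, V, hV, hUV⟩ := Filter.mem_prod_iff.1 ((hT a).eventually_ne ha)
  obtain ⟨c, hc, hcV⟩ := Metric.mem_nhds_iff.1 hV
  have hUa : ∀ t ∈ U, (P t).eval a ≠ 0 := fun t ht => hUV (Set.mk_mem_prod ht (mem_of_mem_nhds hV))
  have hex : ∀ t, ∃ u : Fin N → ℂ, t ∈ U → P t = Polynomial.C ((P t).eval a) *
      ∏ i, (1 + (Polynomial.X - Polynomial.C a) * Polynomial.C (u i)) := by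
    intro t
    by_cases ht : t ∈ U
    · obtain ⟨u, hu⟩ := Polynomial.exists_eq_prod_one_add (hUa t ht) (hN t)
      exact ⟨u, fun _ => hu⟩
    · exact ⟨0, fun h => absurd h ht⟩
  choose u hu using hex
  have hub : ∀ t ∈ U, ∀ i, u t i ∈ Metric.closedBall (0 : ℂ) c⁻¹ := by
    intro t ht i
    rw [mem_closedBall_zero_iff]
    by_contra! hlt
    have hne : u t i ≠ 0 := by
      intro h0
      rw [h0, norm_zero] at hlt
      exact absurd (inv_pos.2 hc) (not_lt.2 hlt.le)
    have hroot : (P t).eval (a - (u t i)⁻¹) = 0 := by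
      rw [hu t ht, Polynomial.eval_mul, Polynomial.eval_prod]
      refine mul_eq_zero_of_right _ (Finset.prod_eq_zero (Finset.mem_univ i) ?_)
      simp [hne]
    refine hUV (Set.mk_mem_prod ht (hcV ?_)) hroot
    rw [mem_ball_iff_norm, sub_sub_cancel_left, norm_neg, norm_inv]
    exact inv_lt_of_inv_lt₀ hc hlt
  have hlim : ∀ i, ∃ v, Tendsto (fun t => u t i) 𝒰 (𝓝 v) := by
    intro i
    obtain ⟨v, -, hv⟩ := (isCompact_closedBall (0 : ℂ) c⁻¹).ultrafilter_le_nhds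
      (𝒰.map fun t => u t i) (by
        rw [le_principal_iff, Ultrafilter.coe_map, Filter.mem_map]
        exact mem_of_superset hU fun t ht => hub t ht i)
    exact ⟨v, hv⟩
  choose v hv using hlim
  have hP₀ : P₀ = Polynomial.C (P₀.eval a) *
      ∏ i, (1 + (Polynomial.X - Polynomial.C a) * Polynomial.C (v i)) := by
    refine Polynomial.funext fun z => ?_
    have h1 : Tendsto (fun t => (P t).eval z) 𝒰 (𝓝 (P₀.eval z)) :=
      (hT z).comp (tendsto_id.prodMk tendsto_const_nhds)
    have h2 : Tendsto (fun t => (P t).eval a) 𝒰 (𝓝 (P₀.eval a)) :=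
      (hT a).comp (tendsto_id.prodMk tendsto_const_nhds)
    refine tendsto_nhds_unique h1 ?_
    simp only [Polynomial.eval_mul, Polynomial.eval_C, Polynomial.eval_prod, Polynomial.eval_add,
      Polynomial.eval_one, Polynomial.eval_sub, Polynomial.eval_X]
    refine (h2.mul (tendsto_finsetProd _ fun i _ => ((hv i).const_mul (z - a)).const_add 1)).congr' ?_
    filter_upwards [hU] with t ht
    conv_rhs => rw [hu t ht]
    simp [Polynomial.eval_prod]
  have hcount : P₀.rootMultiplicity z₀ = ∑ i, if v i ≠ 0 ∧ a - (v i)⁻¹ = z₀ then 1 else 0 := by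
    rw [← Polynomial.count_roots, hP₀, Polynomial.roots_prod_one_add ha, Multiset.count_sum']
    refine Finset.sum_congr rfl fun i _ => ?_
    by_cases hvi : v i = 0
    · simp [hvi]
    · simp [hvi, Multiset.count_singleton, eq_comm]
  have hi : ∀ i, ∀ᶠ t in (𝒰 : Filter T), (u t i ≠ 0 ∧ a - (u t i)⁻¹ ∈ Metric.ball z₀ ρ) ↔
      (v i ≠ 0 ∧ a - (v i)⁻¹ = z₀) := by
    intro i
    by_cases hvi : v i = 0
    · have h1 : ∀ᶠ t in (𝒰 : Filter T), ‖u t i‖ * (ρ + ‖a - z₀‖) < 1 := by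
        have := (hv i).norm.mul_const (ρ + ‖a - z₀‖)
        rw [hvi, norm_zero, zero_mul] at this
        exact this.eventually_lt_const one_pos
      filter_upwards [h1] with t ht
      simp only [hvi, ne_eq, not_true_eq_false, false_and, iff_false, not_and]
      intro hne hmem
      rw [mem_ball_iff_norm] at hmem
      have h2 : ‖(u t i)⁻¹‖ < ρ + ‖a - z₀‖ := by
        calc ‖(u t i)⁻¹‖ = ‖(a - z₀) - (a - (u t i)⁻¹ - z₀)‖ := by congr 1; ring
          _ ≤ ‖a - z₀‖ + ‖a - (u t i)⁻¹ - z₀‖ := norm_sub_le _ _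
          _ < _ := by linarith
      have h3 : ‖u t i‖ * ‖(u t i)⁻¹‖ = 1 := by rw [← norm_mul, mul_inv_cancel₀ hne, norm_one]
      have := mul_lt_mul_of_pos_left h2 (norm_pos_iff.2 hne)
      linarith
    · have h1 : Tendsto (fun t => a - (u t i)⁻¹) 𝒰 (𝓝 (a - (v i)⁻¹)) := ((hv i).inv₀ hvi).const_sub a
      have h2 := (hv i).eventually_ne hvi
      by_cases hz0 : a - (v i)⁻¹ = z₀
      · filter_upwards [h2, h1 (Metric.ball_mem_nhds _ hρ)] with t ht ht2
        rw [← hz0]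
        exact ⟨fun _ => ⟨hvi, rfl⟩, fun _ => ⟨ht, ht2⟩⟩
      · have h3 : a - (v i)⁻¹ ∉ Metric.closedBall z₀ ρ := by
          refine fun hm => hz0 (hz _ hm ?_)
          rw [Polynomial.IsRoot, hP₀, Polynomial.eval_mul, Polynomial.eval_prod]
          refine mul_eq_zero_of_right _ (Finset.prod_eq_zero (Finset.mem_univ i) ?_)
          simp [hvi]
        filter_upwards [h1 (Metric.isClosed_closedBall.isOpen_compl.mem_nhds h3)] with t ht
        exact ⟨fun h => absurd (Metric.ball_subset_closedBall h.2) ht, fun h => absurd h.2 hz0⟩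
  filter_upwards [hU, eventually_all.2 hi] with t ht hti
  refine ⟨fun h => hUa t ht (by rw [h, Polynomial.eval_zero]), ?_⟩
  rw [hcount, hu t ht, Polynomial.roots_prod_one_add (hUa t ht), ← Multiset.countP_eq_card_filter,
    ← Multiset.coe_countPAddMonoidHom, map_sum]
  refine Finset.sum_congr rfl fun i _ => ?_
  rw [← if_congr (hti i) rfl rfl]
  by_cases h0 : u t i = 0
  · simp [h0]
  · simp only [h0, if_false, ne_eq, not_false_eq_true, true_and, Multiset.coe_countPAddMonoidHom,
      Multiset.countP_eq_card_filter, Multiset.filter_singleton]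
    split_ifs <;> simp

lemma exists_perm_of_card_fiber_eq {ι α : Type*} [Fintype ι] [DecidableEq α] {r s : ι → α}
    (h : ∀ z, Fintype.card {j // s j = z} = Fintype.card {j // r j = z}) :
    ∃ σ : Equiv.Perm ι, ∀ j, r (σ j) = s j := by
  refine ⟨(Equiv.sigmaFiberEquiv s).symm.trans ((Equiv.sigmaCongrRight fun z =>
    Fintype.equivOfCardEq (h z)).trans (Equiv.sigmaFiberEquiv r)), fun j => ?_⟩
  exact (Fintype.equivOfCardEq (h (s j)) ⟨j, rfl⟩).2

lemma roots_prod_X_sub_C' {d : ℕ} (r : Fin d → ℂ) :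
    (∏ j, (Polynomial.X - Polynomial.C (r j))).roots = Finset.univ.val.map r := by
  rw [← Polynomial.roots_multiset_prod_X_sub_C (Finset.univ.val.map r), Multiset.map_map]
  rfl

lemma exists_perm_of_prod_eq {d : ℕ} {r s : Fin d → ℂ}
    (h : ∏ j, (Polynomial.X - Polynomial.C (r j)) = ∏ j, (Polynomial.X - Polynomial.C (s j))) :
    ∃ σ : Equiv.Perm (Fin d), ∀ j, r (σ j) = s j := by
  classical
  have h1 := congrArg Polynomial.roots h
  rw [roots_prod_X_sub_C', roots_prod_X_sub_C'] at h1
  refine exists_perm_of_card_fiber_eq fun z => ?_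
  have h2 := congrArg (Multiset.count z) h1
  rw [Multiset.count_map, Multiset.count_map] at h2
  rw [Fintype.card_subtype, Fintype.card_subtype, Finset.card_def, Finset.card_def,
    Finset.filter_val, Finset.filter_val]
  simp only [eq_comm (a := z)] at h2
  exact h2.symm

/-- The roots of a continuous family of monic polynomials depend continuously on the parameter. -/
lemma symContOn_roots {X : Type*} [PseudoMetricSpace X] {d : ℕ} {P : X → Polynomial ℂ}
    {R : X → Fin d → ℂ} (hR : ∀ x, P x = ∏ j, (Polynomial.X - Polynomial.C (R x j)))
    (hP : ∀ i, Continuous fun x => (P x).coeff i) : SymContOn R Set.univ := by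
  have hmon : ∀ x, (P x).Monic := fun x => by
    rw [hR]; exact Polynomial.monic_prod_of_monic _ _ fun j _ => Polynomial.monic_X_sub_C _
  have hdeg : ∀ x, (P x).natDegree = d := fun x => by
    rw [hR, Polynomial.natDegree_prod_of_monic _ _ fun j _ => Polynomial.monic_X_sub_C _]; simp
  intro p _ ε hε
  rw [nhdsWithin_univ, Filter.Eventually, Filter.mem_iff_ultrafilter]
  intro 𝒰 h𝒰
  have hbd : ∀ᶠ x in 𝓝 p, ∀ i ∈ Finset.range d, ‖(P x).coeff i‖ < ‖(P p).coeff i‖ + 1 :=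
    (Finset.eventually_all _).2 fun i _ =>
      (hP i).norm.continuousAt.eventually_lt_const (by linarith)
  set M : ℝ := ∑ i ∈ Finset.range d, (‖(P p).coeff i‖ + 1) + 1 with hM
  have hb : ∀ᶠ x in 𝓝 p, ∀ j, R x j ∈ Metric.closedBall (0 : ℂ) M := by
    filter_upwards [hbd] with x hx j
    have hr : (P x).IsRoot (R x j) := by
      rw [Polynomial.IsRoot, hR, Polynomial.eval_prod]
      exact Finset.prod_eq_zero (Finset.mem_univ j) (by simp)
    have h1 := hr.norm_lt_cauchyBound (hmon x).ne_zero
    rw [mem_closedBall_zero_iff]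
    have h2 : (Polynomial.cauchyBound (P x) : ℝ) ≤ M := by
      rw [Polynomial.cauchyBound, (hmon x).leadingCoeff, hdeg]
      simp only [nnnorm_one, div_one, NNReal.coe_add, NNReal.coe_one, hM]
      gcongr
      have h3 : (Finset.range d).sup (fun i => ‖(P x).coeff i‖₊) ≤
          ∑ i ∈ Finset.range d, (‖(P p).coeff i‖₊ + 1) := by
        refine Finset.sup_le fun i hi => ?_
        refine le_trans ?_ (Finset.single_le_sum (f := fun i => ‖(P p).coeff i‖₊ + 1)
          (fun _ _ => zero_le) hi)
        have := (hx i hi).le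
        rw [← NNReal.coe_le_coe]
        simpa using this
      have := NNReal.coe_le_coe.2 h3
      simpa using this
    have h4 : ‖R x j‖ < Polynomial.cauchyBound (P x) := by exact_mod_cast h1
    linarith
  have hlim : ∀ j, ∃ v, Tendsto (fun x => R x j) 𝒰 (𝓝 v) := by
    intro j
    obtain ⟨v, -, hv⟩ := (isCompact_closedBall (0 : ℂ) M).ultrafilter_le_nhds
      (𝒰.map fun x => R x j) (by
        rw [le_principal_iff, Ultrafilter.coe_map, Filter.mem_map]
        exact h𝒰 (hb.mono fun x hx => hx j))
    exact ⟨v, hv⟩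
  choose v hv using hlim
  have hPp : ∏ j, (Polynomial.X - Polynomial.C (v j)) = P p := by
    refine Polynomial.funext fun z => ?_
    have h1 : Tendsto (fun x => (P x).eval z) 𝒰 (𝓝 ((P p).eval z)) :=
      ((Polynomial.tendsto_eval_of_coeff (N := d) (l := 𝓝 p) (fun t => (hdeg t).le) (hdeg p).le
        fun i => (hP i).continuousAt) z).comp
          ((tendsto_id.mono_left h𝒰).prodMk tendsto_const_nhds)
    refine tendsto_nhds_unique ?_ h1
    simp only [hR, Polynomial.eval_prod, Polynomial.eval_sub, Polynomial.eval_X, Polynomial.eval_C]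
    exact tendsto_finsetProd _ fun j _ => (hv j).const_sub z
  rw [hR p] at hPp
  obtain ⟨σ, hσ⟩ := exists_perm_of_prod_eq hPp
  have h5 : ∀ᶠ x in (𝒰 : Filter X), ∀ j, dist (R x (σ j)) (R p j) < ε :=
    eventually_all.2 fun j => by
      rw [← hσ j]
      exact (hv (σ j)) (Metric.ball_mem_nhds _ hε)
  exact h5.mono fun x hx => ⟨σ, hx⟩

end PolynomialFamilies

section Complements

/-- A set covered by finitely many Lipschitz parametrized complex curves. -/
def IsThin (E : Set (ℂ × ℂ)) : Prop :=
  ∃ (n : ℕ) (F : Fin n → ℂ → ℂ × ℂ), (∀ i, LocallyLipschitz (F i)) ∧ E ⊆ ⋃ i, Set.range (F i)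

lemma IsThin.mono {E E' : Set (ℂ × ℂ)} (h : IsThin E) (hE : E' ⊆ E) : IsThin E' := by
  obtain ⟨n, F, hF, hs⟩ := h
  exact ⟨n, F, hF, hE.trans hs⟩

lemma finrank_prod_complex : Module.finrank ℝ (ℂ × ℂ) = 4 := by
  simp [Module.finrank_prod, Complex.finrank_real_complex]

lemma dimH_iUnion_range_le {ι X : Type*} [Countable ι] [NormedAddCommGroup X] [NormedSpace ℝ X]
    [FiniteDimensional ℝ X] {F : ι → X → ℂ × ℂ} (hF : ∀ i, LocallyLipschitz (F i)) :
    dimH (⋃ i, Set.range (F i)) ≤ Module.finrank ℝ X := by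
  rw [dimH_iUnion]
  refine iSup_le fun i => ?_
  rw [← Real.dimH_univ_eq_finrank X]
  exact dimH_range_le_of_locally_lipschitzOn (hF i)

lemma IsThin.dense_compl {E : Set (ℂ × ℂ)} (h : IsThin E) : Dense Eᶜ := by
  obtain ⟨n, F, hF, hs⟩ := h
  refine dense_compl_of_dimH_lt_finrank (((dimH_mono hs).trans (dimH_iUnion_range_le hF)).trans_lt ?_)
  rw [finrank_prod_complex, Complex.finrank_real_complex]
  norm_num

/-- Removing a thin set from a convex open set leaves it connected. -/
lemma IsThin.isPreconnected_diff {E C : Set (ℂ × ℂ)} (h : IsThin E) (hC : Convex ℝ C)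
    (hCo : IsOpen C) : IsPreconnected (C \ E) := by
  obtain ⟨n, F, hF, hs⟩ := h
  refine isPreconnected_of_forall_pair fun p hp q hq => ?_
  obtain ⟨G, hG⟩ : ∃ G : (ℂ × ℂ) → Fin n → ℂ × ℝ → ℂ × ℂ, ∀ p i x, G p i x = p + x.2 • (F i x.1 - p) := ⟨_, fun _ _ _ => rfl⟩
  have hGl : ∀ p i, LocallyLipschitz (G p i) := by
    intro p i
    have h1 : LocallyLipschitz fun v : (ℂ × ℂ) × ℝ => p + v.2 • (v.1 - p) :=
      ContDiff.locallyLipschitz (𝕂 := ℝ) (by fun_prop)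
    have h3 : LocallyLipschitz (Prod.fst : ℂ × ℝ → ℂ) := LipschitzWith.prod_fst.locallyLipschitz
    have h4 : LocallyLipschitz (Prod.snd : ℂ × ℝ → ℝ) := LipschitzWith.prod_snd.locallyLipschitz
    have h2 : LocallyLipschitz fun x : ℂ × ℝ => (F i x.1, x.2) := ((hF i).comp h3).prodMk h4
    rw [show G p i = (fun v : (ℂ × ℂ) × ℝ => p + v.2 • (v.1 - p)) ∘ fun x : ℂ × ℝ => (F i x.1, x.2) from funext (hG p i)]
    exact LocallyLipschitz.comp h1 h2
  have hd : dimH ((⋃ i, Set.range (G p i)) ∪ ⋃ i, Set.range (G q i)) < Module.finrank ℝ (ℂ × ℂ) := by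
    rw [dimH_union]
    refine (max_le (dimH_iUnion_range_le (hGl p)) (dimH_iUnion_range_le (hGl q))).trans_lt ?_
    rw [finrank_prod_complex, Module.finrank_prod, Complex.finrank_real_complex, Module.finrank_self]
    norm_num
  obtain ⟨w, hw, hwC⟩ := (dense_compl_of_dimH_lt_finrank hd).exists_mem_open hCo ⟨p, hp.1⟩
  rw [Set.mem_compl_iff, Set.mem_union, not_or] at hw
  have key : ∀ p ∈ C \ E, w ∉ ⋃ i, Set.range (G p i) → segment ℝ p w ⊆ C \ E := by
    intro p hp hwp x hx
    refine ⟨hC.segment_subset hp.1 hwC hx, fun hxE => hwp ?_⟩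
    rw [segment_eq_image'] at hx
    obtain ⟨s, hs1, rfl⟩ := hx
    rcases eq_or_ne s 0 with rfl | hs0
    · simp only [zero_smul, add_zero] at hxE
      exact absurd hxE hp.2
    · obtain ⟨i, t, ht⟩ := Set.mem_iUnion.1 (hs hxE)
      refine Set.mem_iUnion.2 ⟨i, (t, s⁻¹), ?_⟩
      simp only [hG, ht, add_sub_cancel_left, smul_smul, inv_mul_cancel₀ hs0, one_smul]
      abel
  refine ⟨segment ℝ p w ∪ segment ℝ q w, Set.union_subset (key p hp hw.1) (key q hq hw.2),
    Or.inl (left_mem_segment ℝ p w), Or.inr (left_mem_segment ℝ q w), ?_⟩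
  exact (convex_segment p w).isPreconnected.union w (right_mem_segment ℝ p w)
    (right_mem_segment ℝ q w) (convex_segment q w).isPreconnected

end Complements

section Extension

variable {d : ℕ} {X : Type*} [PseudoMetricSpace X] {K : Set X} {R : X → Fin d → ℂ}

lemma SymContOn.exists_limit (h : SymContOn R K) {x : X} {Z : Set ℂ} (hZf : Z.Finite)
    (hZ : ∀ ε > 0, ∀ᶠ b in 𝓝[K] x, ∀ j, ∃ z ∈ Z, dist (R b j) z < ε)
    (hconn : ∀ U ∈ 𝓝 x, ∃ V ∈ 𝓝 x, V ⊆ U ∧ IsPreconnected (V ∩ K)) (hd : Dense K) :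
    ∃ r : Fin d → ℂ, ∀ ε > 0, ∀ᶠ b in 𝓝[K] x, ∃ σ : Equiv.Perm (Fin d),
      ∀ j, dist (R b (σ j)) (r j) < ε := by
  have : Finite Z := hZf
  obtain ⟨η, hη, hsep⟩ := exists_separation (fun z : Z => (z : ℂ))
  obtain ⟨U, hU, hU'⟩ := mem_nhdsWithin_iff_exists_mem_nhds_inter.1 (hZ (η / 4) (by positivity))
  obtain ⟨V, hV, hVU, hVc⟩ := hconn U hU
  choose! a haZ ha using fun b (hb : b ∈ V ∩ K) (j : Fin d) => hU' ⟨hVU hb.1, hb.2⟩ j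
  have hP : ∀ b ∈ V ∩ K, ∀ b' ∈ V ∩ K, ∃ σ : Equiv.Perm (Fin d), ∀ j, a b' (σ j) = a b j := by
    intro b hb b' hb'
    refine hVc.induction₂ (fun b b' => ∃ σ : Equiv.Perm (Fin d), ∀ j, a b' (σ j) = a b j)
      (fun x hx => ?_) ?_ ?_ hb hb'
    · filter_upwards [(h x hx.2 (η / 4) (by positivity)).filter_mono
        (nhdsWithin_mono x Set.inter_subset_right), self_mem_nhdsWithin] with y ⟨σ, hσ⟩ hy
      refine ⟨σ, fun j => hsep ⟨_, haZ y hy _⟩ ⟨_, haZ x hx _⟩ ?_⟩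
      have h1 := ha y hy (σ j)
      have h2 := ha x hx j
      have h3 := hσ j
      have := dist_triangle4 (a y (σ j)) (R y (σ j)) (R x j) (a x j)
      rw [dist_comm (a y (σ j)) (R y (σ j))] at this
      simp only
      linarith
    · rintro x y z - - - ⟨σ, hσ⟩ ⟨τ, hτ⟩
      exact ⟨σ.trans τ, fun j => by rw [Equiv.trans_apply, hτ, hσ]⟩
    · rintro x y - - ⟨σ, hσ⟩
      exact ⟨σ.symm, fun j => by rw [← hσ, Equiv.apply_symm_apply]⟩
  obtain ⟨b₀, hb₀⟩ : (V ∩ K).Nonempty := by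
    obtain ⟨y, hy⟩ := hd.inter_nhds_nonempty hV
    exact ⟨y, hy.2, hy.1⟩
  refine ⟨a b₀, fun ε hε => ?_⟩
  filter_upwards [hZ (min ε (η / 4)) (by positivity), mem_nhdsWithin_of_mem_nhds hV,
    self_mem_nhdsWithin] with b hb hbV hbK
  obtain ⟨σ, hσ⟩ := hP b₀ hb₀ b ⟨hbV, hbK⟩
  refine ⟨σ, fun j => ?_⟩
  obtain ⟨z, hz, hzd⟩ := hb (σ j)
  have h1 := ha b ⟨hbV, hbK⟩ (σ j)
  have h2 : z = a b (σ j) := by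
    refine hsep ⟨z, hz⟩ ⟨_, haZ b ⟨hbV, hbK⟩ _⟩ ?_
    have := dist_triangle_left z (a b (σ j)) (R b (σ j))
    have := hzd.trans_le (min_le_right _ _)
    simp only
    linarith
  rw [← hσ j, ← h2]
  exact hzd.trans_le (min_le_left _ _)

lemma SymContOn.exists_extension (h : SymContOn R K)
    (hZ : ∀ x, ∃ Z : Set ℂ, Z.Finite ∧ ∀ ε > 0, ∀ᶠ b in 𝓝[K] x, ∀ j, ∃ z ∈ Z, dist (R b j) z < ε)
    (hconn : ∀ x, ∀ U ∈ 𝓝 x, ∃ V ∈ 𝓝 x, V ⊆ U ∧ IsPreconnected (V ∩ K)) (hd : Dense K) :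
    ∃ R' : X → Fin d → ℂ, SymContOn R' Set.univ ∧ (∀ x ∈ K, R' x = R x) ∧
      rootSet R' Set.univ = closure (rootSet R K) := by
  classical
  have h1 : ∀ x, ∃ r : Fin d → ℂ, (x ∈ K → r = R x) ∧ ∀ ε > 0, ∀ᶠ b in 𝓝[K] x,
      ∃ σ : Equiv.Perm (Fin d), ∀ j, dist (R b (σ j)) (r j) < ε := by
    intro x
    by_cases hx : x ∈ K
    · exact ⟨R x, fun _ => rfl, fun ε hε => h x hx ε hε⟩
    · obtain ⟨Z, hZf, hZ'⟩ := hZ x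
      obtain ⟨r, hr⟩ := h.exists_limit hZf hZ' (hconn x) hd
      exact ⟨r, fun h => absurd h hx, hr⟩
  choose R' hR' hlim using h1
  refine ⟨R', fun p _ ε hε => ?_, hR', ?_⟩
  · rw [nhdsWithin_univ]
    filter_upwards [eventually_eventually_nhds.2 (eventually_nhdsWithin_iff.1
      (hlim p (ε / 2) (by positivity)))] with x hx
    have : (𝓝[K] x).NeBot := mem_closure_iff_nhdsWithin_neBot.1 (hd x)
    obtain ⟨b, ⟨σ, hσ⟩, ⟨τ, hτ⟩⟩ := ((eventually_nhdsWithin_iff.2 hx).and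
      (hlim x (ε / 2) (by positivity))).exists
    refine ⟨σ.trans τ.symm, fun j => ?_⟩
    have h2 := hτ (τ.symm (σ j))
    rw [Equiv.apply_symm_apply, dist_comm] at h2
    have := dist_triangle (R' x (τ.symm (σ j))) (R b (σ j)) (R' p j)
    have := hσ j
    simp only [Equiv.trans_apply]
    linarith
  · ext ⟨z, x⟩
    constructor
    · rintro ⟨-, j, hj⟩
      simp only at hj
      subst hj
      rw [Metric.mem_closure_iff]
      intro ε hε
      have : (𝓝[K] x).NeBot := mem_closure_iff_nhdsWithin_neBot.1 (hd x)
      obtain ⟨b, ⟨⟨σ, hσ⟩, hb⟩, hbK⟩ := (((hlim x ε hε).and (mem_nhdsWithin_of_mem_nhds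
        (Metric.ball_mem_nhds x hε))).and self_mem_nhdsWithin).exists
      exact ⟨(R b (σ j), b), ⟨hbK, σ j, rfl⟩, by
        rw [dist_comm, Prod.dist_eq]; exact max_lt (hσ j) hb⟩
    · intro hzx
      refine ⟨trivial, ?_⟩
      have hcl : IsClosed (Set.range (R' x)) := (Set.finite_range _).isClosed
      simp only
      rw [← hcl.closure_eq, Metric.mem_closure_iff]
      intro ε hε
      obtain ⟨δ, hδ, hball⟩ := Metric.mem_nhdsWithin_iff.1 (hlim x (ε / 2) (by positivity))
      obtain ⟨⟨w, b⟩, ⟨hbK, i, hi⟩, hd'⟩ := Metric.mem_closure_iff.1 hzx (min δ (ε / 2))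
        (by positivity)
      simp only at hi hbK
      subst hi
      rw [Prod.dist_eq, max_lt_iff] at hd'
      obtain ⟨σ, hσ⟩ := hball ⟨by
        rw [Metric.mem_ball, dist_comm]; exact hd'.2.trans_le (min_le_left _ _), hbK⟩
      refine ⟨R' x (σ.symm i), ⟨_, rfl⟩, ?_⟩
      have h3 := hσ (σ.symm i)
      rw [Equiv.apply_symm_apply] at h3
      have h4 := hd'.1.trans_le (min_le_right _ _)
      have := dist_triangle z (R b i) (R' x (σ.symm i))
      simp only at h4
      linarith

end Extension

section Components

/-- The complement of the lines `x = 0` and `y = β x`, `β ∈ B`. -/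
def goodBase (B : Set ℂ) : Set (ℂ × ℂ) := {b | b.1 ≠ 0 ∧ b.2 / b.1 ∉ B}

lemma isThin_compl_goodBase {B : Set ℂ} (hB : B.Finite) : IsThin (goodBase B)ᶜ := by
  obtain ⟨n, β, hβ⟩ : ∃ (n : ℕ) (β : Fin n → ℂ), B = Set.range β := by
    have := hB.fintype
    exact ⟨_, fun i => ((Fintype.equivFin B).symm i : ℂ), by
      ext z
      constructor
      · intro hz
        exact ⟨Fintype.equivFin B ⟨z, hz⟩, by simp⟩
      · rintro ⟨i, rfl⟩
        exact ((Fintype.equivFin B).symm i).2⟩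
  have h1 : ∀ v : ℂ × ℂ, LocallyLipschitz fun t : ℂ => t • v := fun v =>
    ContDiff.locallyLipschitz (𝕂 := ℝ) (by fun_prop)
  refine ⟨n + 1, Fin.cons (fun t => t • (0, 1)) fun i t => t • (1, β i), fun i => ?_, fun b hb => ?_⟩
  · refine Fin.cases ?_ (fun i => ?_) i
    · exact h1 _
    · exact h1 _
  · rw [Set.mem_iUnion]
    by_cases h0 : b.1 = 0
    · exact ⟨0, b.2, Prod.ext (by simp [h0]) (by simp)⟩
    · have : b.2 / b.1 ∈ B := by
        by_contra hc
        exact hb ⟨h0, hc⟩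
      rw [hβ] at this
      obtain ⟨i, hi⟩ := this
      refine ⟨i.succ, b.1, Prod.ext (by simp) ?_⟩
      simp only [Fin.cons_succ, hi, Prod.smul_snd, smul_eq_mul]
      field_simp

lemma isOpen_goodBase {B : Set ℂ} (hB : B.Finite) : IsOpen (goodBase B) := by
  rw [isOpen_iff_mem_nhds]
  intro b hb
  have h1 : ContinuousAt (fun b : ℂ × ℂ => b.2 / b.1) b :=
    continuousAt_snd.div continuousAt_fst hb.1
  filter_upwards [continuousAt_fst.eventually_ne hb.1, h1 (hB.isClosed.isOpen_compl.mem_nhds hb.2)]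
    with c h2 h3 using ⟨h2, h3⟩

lemma smul_mem_goodBase {B : Set ℂ} {b : ℂ × ℂ} (hb : b ∈ goodBase B) {l : ℂ} (hl : l ≠ 0) :
    l • b ∈ goodBase B := by
  refine ⟨mul_ne_zero hl hb.1, ?_⟩
  simp only [Prod.smul_snd, Prod.smul_fst, smul_eq_mul]
  rw [mul_div_mul_left _ _ hl]
  exact hb.2

lemma dense_goodBase {B : Set ℂ} (hB : B.Finite) : Dense (goodBase B) := by
  have := (isThin_compl_goodBase hB).dense_compl
  rwa [compl_compl] at this

lemma isPreconnected_inter_goodBase {B : Set ℂ} (hB : B.Finite) {C : Set (ℂ × ℂ)} (hC : Convex ℝ C)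
    (hCo : IsOpen C) : IsPreconnected (C ∩ goodBase B) := by
  have := (isThin_compl_goodBase hB).isPreconnected_diff hC hCo
  rwa [Set.sdiff_compl] at this

/-- A family of `k`-tuples over `ℂ²` whose total space is a cone, with distinct entries over
`goodBase B`. -/
structure RedData (k : ℕ) (R : ℂ × ℂ → Fin k → ℂ) (B : Set ℂ) : Prop where
  cont : SymContOn R Set.univ
  homog : ∀ l : ℂ, l ≠ 0 → ∀ b, ∀ z ∈ Set.range (R b), l * z ∈ Set.range (R (l • b))
  finite : B.Finite
  zero_notMem : 0 ∉ B
  inj : ∀ b ∈ goodBase B, Function.Injective (R b)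

namespace RedData

variable {k : ℕ} {R : ℂ × ℂ → Fin k → ℂ} {B : Set ℂ}

lemma eq_zero (h : RedData k R B) {z : ℂ} (hz : (z, (0 : ℂ × ℂ)) ∈ rootSet R Set.univ) : z = 0 := by
  by_contra hz0
  have h1 : Set.Infinite {w : ℂ | w ≠ 0} := (Set.finite_singleton (0 : ℂ)).infinite_compl
  refine (h1.image (f := fun l => l * z) (mul_left_injective₀ hz0).injOn)
    ((Set.finite_range (R 0)).subset ?_)
  rintro _ ⟨l, hl, rfl⟩
  have := h.homog l hl 0 z hz.2
  rwa [smul_zero] at this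

/-- Local sections over a small ball around a good point. -/
lemma exists_local_sections (h : RedData k R B) {b₀ : ℂ × ℂ} (hb₀ : b₀ ∈ goodBase B) :
    ∃ δ₀ > 0, ∀ δ ≤ δ₀, Metric.ball b₀ δ ⊆ goodBase B ∧ ∃ η : ℂ × ℂ → Fin k → ℂ,
      (∀ j, ContinuousOn (fun x => η x j) (Metric.ball b₀ δ)) ∧
        ∀ b ∈ Metric.ball b₀ δ, Function.Injective (η b) ∧ Set.range (η b) = Set.range (R b) := by
  obtain ⟨δ, hδ, hball⟩ := Metric.isOpen_iff.1 (isOpen_goodBase h.finite) b₀ hb₀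
  have hsub : Metric.closedBall b₀ (δ / 2) ⊆ goodBase B :=
    (Metric.closedBall_subset_ball (by linarith)).trans hball
  obtain ⟨η, hη, hσ⟩ := SymContOn.exists_sheets (isCompact_closedBall b₀ (δ / 2))
    (convex_closedBall _ _) (h.cont.mono (Set.subset_univ _)) fun x hx => h.inj x (hsub hx)
  refine ⟨δ / 2, by positivity, fun δ' hδ' => ?_⟩
  have hsub' : Metric.ball b₀ δ' ⊆ Metric.closedBall b₀ (δ / 2) :=
    (Metric.ball_subset_ball hδ').trans Metric.ball_subset_closedBall
  refine ⟨hsub'.trans hsub, η, fun j => (hη j).mono hsub', fun b hb => ?_⟩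
  obtain ⟨σ, hσb⟩ := hσ b
  have : η b = R b ∘ σ := funext hσb
  rw [this]
  exact ⟨(h.inj b (hsub (hsub' hb))).comp σ.injective, σ.surjective.range_comp _⟩

variable {p : ℂ × ℂ × ℂ}

lemma section_mem_component {δ : ℝ} {b₀ : ℂ × ℂ} {s : ℂ × ℂ → ℂ}
    (hs : ContinuousOn s (Metric.ball b₀ δ))
    (hm : ∀ b ∈ Metric.ball b₀ δ, (s b, b) ∈ rootSet R (goodBase B)) {b b' : ℂ × ℂ}
    (hb : b ∈ Metric.ball b₀ δ) (hb' : b' ∈ Metric.ball b₀ δ)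
    (hW : (s b, b) ∈ connectedComponentIn (rootSet R (goodBase B)) p) :
    (s b', b') ∈ connectedComponentIn (rootSet R (goodBase B)) p := by
  have h1 : IsPreconnected ((fun b => (s b, b)) '' Metric.ball b₀ δ) :=
    (convex_ball b₀ δ).isPreconnected.image _ (hs.prodMk continuousOn_id)
  rw [connectedComponentIn_eq hW]
  exact h1.subset_connectedComponentIn ⟨b, hb, rfl⟩ (by rintro _ ⟨c, hc, rfl⟩; exact hm c hc)
    ⟨b', hb', rfl⟩

lemma smul_mem_component (h : RedData k R B) {q : ℂ × ℂ × ℂ}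
    (hq : q ∈ connectedComponentIn (rootSet R (goodBase B)) p) {l : ℂ} (hl : l ≠ 0) :
    l • q ∈ connectedComponentIn (rootSet R (goodBase B)) p := by
  have hqV := connectedComponentIn_subset _ _ hq
  have h0 : IsPreconnected ({0}ᶜ : Set ℂ) :=
    (isConnected_compl_singleton_of_one_lt_rank (by simp) 0).isPreconnected
  have h1 : IsPreconnected ((fun l : ℂ => l • q) '' {0}ᶜ) :=
    h0.image _ (by fun_prop)
  rw [connectedComponentIn_eq hq]
  refine h1.subset_connectedComponentIn ⟨1, one_ne_zero, one_smul _ _⟩ ?_ ⟨l, hl, rfl⟩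
  rintro _ ⟨m, hm, rfl⟩
  exact ⟨smul_mem_goodBase hqV.1 hm, h.homog m hm _ _ hqV.2⟩

/-- The closure of a connected component of the good part is the total space of a cone. -/
lemma exists_coneData (h : RedData k R B) (hp : p ∈ rootSet R (goodBase B)) :
    ∃ (d : ℕ) (R' : ℂ × ℂ → Fin d → ℂ), ConeData d R' B ∧
      rootSet R' Set.univ = closure (connectedComponentIn (rootSet R (goodBase B)) p) ∧
      ∀ b ∈ goodBase B,
        {z | (z, b) ∈ connectedComponentIn (rootSet R (goodBase B)) p}.ncard = d := by
  classical
  set W := connectedComponentIn (rootSet R (goodBase B)) p with hW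
  have hWV : W ⊆ rootSet R (goodBase B) := connectedComponentIn_subset _ _
  have hsec : ∀ b₀ ∈ goodBase B, ∃ δ > 0, ∃ η : ℂ × ℂ → Fin k → ℂ,
      (∀ j, ContinuousOn (fun x => η x j) (Metric.ball b₀ δ)) ∧
      ∀ b ∈ Metric.ball b₀ δ, Function.Injective (η b) ∧
        {z | (z, b) ∈ W} = η b '' {j | (η b₀ j, b₀) ∈ W} := by
    intro b₀ hb₀
    obtain ⟨δ, hδ, hδ'⟩ := h.exists_local_sections hb₀
    obtain ⟨hsub, η, hη, hηR⟩ := hδ' δ le_rfl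
    refine ⟨δ, hδ, η, hη, fun b hb => ⟨(hηR b hb).1, ?_⟩⟩
    have hm : ∀ j, ∀ b ∈ Metric.ball b₀ δ, (η b j, b) ∈ rootSet R (goodBase B) := fun j b hb =>
      ⟨hsub hb, by rw [← (hηR b hb).2]; exact ⟨j, rfl⟩⟩
    have hb₀' := Metric.mem_ball_self (x := b₀) hδ
    ext z
    constructor
    · intro hz
      have h1 := (hWV hz).2
      rw [← (hηR b hb).2] at h1
      obtain ⟨j, hj⟩ := h1
      simp only at hj
      subst hj
      exact ⟨j, section_mem_component (hη j) (hm j) hb hb₀' hz, rfl⟩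
    · rintro ⟨j, hj, rfl⟩
      exact section_mem_component (hη j) (hm j) hb₀' hb hj
  have hGc : IsPreconnected (goodBase B) := by
    simpa using isPreconnected_inter_goodBase h.finite convex_univ isOpen_univ
  have hconst : ∀ b ∈ goodBase B, ∀ b' ∈ goodBase B,
      {z | (z, b) ∈ W}.ncard = {z | (z, b') ∈ W}.ncard := by
    intro b hb b' hb'
    refine hGc.induction₂ (fun b b' => {z | (z, b) ∈ W}.ncard = {z | (z, b') ∈ W}.ncard)
      (fun x hx => ?_) (fun _ _ _ _ _ _ h1 h2 => h1.trans h2) (fun _ _ _ _ h => h.symm) hb hb'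
    obtain ⟨δ, hδ, η, -, hη⟩ := hsec x hx
    filter_upwards [mem_nhdsWithin_of_mem_nhds (Metric.ball_mem_nhds x hδ)] with y hy
    obtain ⟨i1, e1⟩ := hη x (Metric.mem_ball_self hδ)
    obtain ⟨i2, e2⟩ := hη y hy
    rw [e1, e2, Set.ncard_image_of_injective _ i1, Set.ncard_image_of_injective _ i2]
  set d := {z | (z, p.2) ∈ W}.ncard with hd
  have hfin : ∀ b, {z | (z, b) ∈ W}.Finite := fun b =>
    (Set.finite_range (R b)).subset fun z hz => (hWV hz).2
  have hpW : p ∈ W := mem_connectedComponentIn hp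
  have henum : ∀ b, ∃ r : Fin d → ℂ, b ∈ goodBase B →
      Function.Injective r ∧ Set.range r = {z | (z, b) ∈ W} := by
    intro b
    by_cases hb : b ∈ goodBase B
    · have : Finite {z | (z, b) ∈ W} := hfin b
      have e := Finite.equivFinOfCardEq (show Nat.card {z | (z, b) ∈ W} = d from hconst b hb _ hp.1)
      refine ⟨fun i => (e.symm i : ℂ), fun _ => ⟨Subtype.val_injective.comp e.symm.injective, ?_⟩⟩
      change Set.range (Subtype.val ∘ e.symm) = _
      rw [e.symm.surjective.range_comp, Subtype.range_coe]
    · exact ⟨0, fun h => absurd h hb⟩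
  choose r hr using henum
  have hrW : rootSet r (goodBase B) = W := by
    ext ⟨z, b⟩
    constructor
    · rintro ⟨hb, hz⟩
      rw [(hr b hb).2] at hz
      exact hz
    · intro hz
      have hb := (hWV hz).1
      exact ⟨hb, by rw [(hr b hb).2]; exact hz⟩
  have hcont : SymContOn r (goodBase B) := by
    intro b₀ hb₀ ε hε
    obtain ⟨δ, hδ, η, hηc, hη⟩ := hsec b₀ hb₀
    have hb₀' := Metric.mem_ball_self (x := b₀) hδ
    have h1 : ∀ᶠ b in 𝓝[goodBase B] b₀, ∀ j, dist (η b j) (η b₀ j) < ε :=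
      eventually_all.2 fun j => mem_nhdsWithin_of_mem_nhds
        (((hηc j).continuousAt (Metric.ball_mem_nhds _ hδ)) (Metric.ball_mem_nhds _ hε))
    filter_upwards [h1, self_mem_nhdsWithin, mem_nhdsWithin_of_mem_nhds (Metric.ball_mem_nhds _ hδ)]
      with b hbε hbG hb
    have h2 : ∀ j, ∃ i, η b₀ i = r b₀ j ∧ (η b₀ i, b₀) ∈ W := by
      intro j
      have : r b₀ j ∈ {z | (z, b₀) ∈ W} := by rw [← (hr b₀ hb₀).2]; exact ⟨j, rfl⟩
      rw [(hη b₀ hb₀').2] at this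
      obtain ⟨i, hi, e⟩ := this
      exact ⟨i, e, hi⟩
    choose i hi hiW using h2
    have h3 : ∀ j, ∃ j', r b j' = η b (i j) := by
      intro j
      have : η b (i j) ∈ {z | (z, b) ∈ W} := by rw [(hη b hb).2]; exact ⟨_, hiW j, rfl⟩
      rw [← (hr b hbG).2] at this
      exact this
    choose σ hσ using h3
    have hinj : Function.Injective σ := by
      intro j j' hjj
      apply (hr b₀ hb₀).1
      rw [← hi, ← hi]
      congr 1
      apply (hη b hb).1
      rw [← hσ, ← hσ, hjj]
    refine ⟨Equiv.ofBijective σ (Finite.injective_iff_bijective.1 hinj), fun j => ?_⟩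
    rw [Equiv.ofBijective_apply, hσ, ← hi]
    exact hbε _
  obtain ⟨R', hR', hRr, hcl⟩ := hcont.exists_extension (fun x => ⟨Set.range (R x), Set.finite_range _,
      fun ε hε => by
        have h1 := h.cont x trivial ε hε
        rw [nhdsWithin_univ] at h1
        filter_upwards [mem_nhdsWithin_of_mem_nhds h1, self_mem_nhdsWithin] with b ⟨σ, hσ⟩ hb j
        have h2 : (r b j, b) ∈ W := by rw [← hrW]; exact ⟨hb, j, rfl⟩
        obtain ⟨i, hi⟩ := (hWV h2).2
        refine ⟨R x (σ.symm i), ⟨_, rfl⟩, ?_⟩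
        have := hσ (σ.symm i)
        rw [Equiv.apply_symm_apply] at this
        simp only at hi
        rwa [← hi]⟩)
    (fun x U hU => by
      obtain ⟨δ, hδ, hδU⟩ := Metric.mem_nhds_iff.1 hU
      exact ⟨_, Metric.ball_mem_nhds x hδ, hδU,
        isPreconnected_inter_goodBase h.finite (convex_ball _ _) Metric.isOpen_ball⟩)
    (dense_goodBase h.finite)
  rw [hrW] at hcl
  refine ⟨d, R', ⟨?_, hR', ?_, h.finite, h.zero_notMem, ?_, ?_⟩, hcl, fun b hb => hconst b hb _ hp.1⟩
  · exact (Set.ncard_pos (hfin _)).2 ⟨p.1, hpW⟩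
  · intro l hl b z hz
    have h1 : (z, b) ∈ closure W := by rw [← hcl]; exact ⟨trivial, hz⟩
    have h2 : l • ((z, b) : ℂ × ℂ × ℂ) ∈ closure W :=
      map_mem_closure (f := fun q : ℂ × ℂ × ℂ => l • q) (by fun_prop) h1
        fun q hq => h.smul_mem_component hq hl
    rw [← hcl] at h2
    exact h2.2
  · intro b h1 h2
    rw [hRr b ⟨h1, h2⟩]
    exact (hr b ⟨h1, h2⟩).1
  · have : rootSet R' (goodBase B) = W := by
      rw [← hrW]
      ext ⟨z, b⟩
      constructor
      · rintro ⟨hb, hz⟩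
        simp only at hb hz
        rw [hRr b hb] at hz
        exact ⟨hb, hz⟩
      · rintro ⟨hb, hz⟩
        simp only at hb hz
        refine ⟨hb, ?_⟩
        simp only
        rwa [hRr b hb]
    change IsPreconnected (rootSet R' (goodBase B))
    rw [this]
    exact isPreconnected_connectedComponentIn

end RedData

end Components

section LimitMaps

variable {ι E F : Type*} [NormedAddCommGroup E] [NormedAddCommGroup F] {l : Filter ι}

/-- `φ n : X n → Y n` are uniformly Lipschitz maps fixing the origin with left inverses `ψ n`, on
balls that exhaust the space along `l`. -/
structure LipFamily (l : Filter ι) (X : ι → Set E) (Y : ι → Set F) (φ : ι → E → F) (ψ : ι → F → E)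
    (C : ℝ) : Prop where
  pos : 0 < C
  maps : ∀ r, ∀ᶠ n in l, ∀ p ∈ X n, ‖p‖ < r → φ n p ∈ Y n ∧ ‖φ n p‖ ≤ C * ‖p‖ ∧ ψ n (φ n p) = p
  lip : ∀ r, ∀ᶠ n in l, ∀ p ∈ X n, ‖p‖ < r → ∀ q ∈ X n, ‖q‖ < r →
    dist (φ n p) (φ n q) ≤ C * dist p q

/-- `V` is the limit of the sets `X n` along `l`. -/
structure IsSetLimit (l : Filter ι) (X : ι → Set E) (V : Set E) : Prop where
  approx : ∀ p ∈ V, ∃ u : ι → E, Tendsto u l (𝓝 p) ∧ ∀ᶠ n in l, u n ∈ X n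
  mem : ∀ (u : ι → E) (p : E), Tendsto u l (𝓝 p) → (∀ᶠ n in l, u n ∈ X n) → p ∈ V

/-- `Φ` is the limit of the maps `φ n` along `l`. -/
def IsMapLimit (l : Filter ι) (X : ι → Set E) (φ : ι → E → F) (Φ : E → F) : Prop :=
  ∀ (u : ι → E) (p : E), Tendsto u l (𝓝 p) → (∀ᶠ n in l, u n ∈ X n) →
    Tendsto (fun n => φ n (u n)) l (𝓝 (Φ p))

variable {X : ι → Set E} {Y : ι → Set F} {φ : ι → E → F} {ψ : ι → F → E} {C : ℝ} {V : Set E}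
  {W : Set F}

lemma eventually_norm_lt {u : ι → E} {p : E} (hu : Tendsto u l (𝓝 p)) :
    ∀ᶠ n in l, ‖u n‖ < ‖p‖ + 1 :=
  hu.norm.eventually (gt_mem_nhds (lt_add_one _))

lemma LipFamily.exists_mapLimit {l : Ultrafilter ι} [ProperSpace F]
    (h : LipFamily (l : Filter ι) X Y φ ψ C) (hX : IsSetLimit (l : Filter ι) X V) :
    ∃ Φ, IsMapLimit (l : Filter ι) X φ Φ := by
  have key : ∀ p, ∃ y, ∀ u : ι → E, Tendsto u l (𝓝 p) → (∀ᶠ n in l, u n ∈ X n) →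
      Tendsto (fun n => φ n (u n)) l (𝓝 y) := by
    intro p
    by_cases hp : p ∈ V
    · obtain ⟨u, hu, huX⟩ := hX.approx p hp
      have hb : ∀ᶠ n in (l : Filter ι), φ n (u n) ∈ Metric.closedBall (0 : F) (C * (‖p‖ + 1)) := by
        filter_upwards [h.maps (‖p‖ + 1), huX, eventually_norm_lt hu] with n h1 h2 h3
        rw [mem_closedBall_zero_iff]
        exact (h1 _ h2 h3).2.1.trans (mul_le_mul_of_nonneg_left h3.le h.pos.le)
      obtain ⟨y, -, hy⟩ := (isCompact_closedBall (0 : F) (C * (‖p‖ + 1))).ultrafilter_le_nhds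
        (l.map fun n => φ n (u n)) (le_principal_iff.2 hb)
      have hy : Tendsto (fun n => φ n (u n)) l (𝓝 y) := hy
      refine ⟨y, fun v hv hvX => ?_⟩
      have hd : Tendsto (fun n => C * dist (v n) (u n)) l (𝓝 0) := by
        have := ((hv.dist hu).const_mul C)
        rwa [dist_self, mul_zero] at this
      have : Tendsto (fun n => dist (φ n (v n)) (φ n (u n))) l (𝓝 0) := by
        refine squeeze_zero' (Eventually.of_forall fun _ => dist_nonneg) ?_ hd
        filter_upwards [h.lip (‖p‖ + 1), huX, hvX, eventually_norm_lt hu, eventually_norm_lt hv]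
          with n h1 h2 h3 h4 h5
        exact h1 _ h3 h5 _ h2 h4
      exact tendsto_iff_of_dist this |>.2 hy
    · exact ⟨0, fun u hu huX => (hp (hX.mem u p hu huX)).elim⟩
  choose Φ hΦ using key
  exact ⟨Φ, fun u p hu huX => hΦ p u hu huX⟩

variable [l.NeBot] {Φ : E → F} {Ψ : F → E}

lemma IsMapLimit.eventually_mem (h : LipFamily l X Y φ ψ C) {u : ι → E} {p : E}
    (hu : Tendsto u l (𝓝 p)) (huX : ∀ᶠ n in l, u n ∈ X n) : ∀ᶠ n in l, φ n (u n) ∈ Y n := by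
  filter_upwards [h.maps (‖p‖ + 1), huX, eventually_norm_lt hu] with n h1 h2 h3
  exact (h1 _ h2 h3).1

lemma IsMapLimit.mapsTo (hΦ : IsMapLimit l X φ Φ) (h : LipFamily l X Y φ ψ C)
    (hX : IsSetLimit l X V) (hY : IsSetLimit l Y W) : Set.MapsTo Φ V W := by
  intro p hp
  obtain ⟨u, hu, huX⟩ := hX.approx p hp
  exact hY.mem _ _ (hΦ u p hu huX) (IsMapLimit.eventually_mem h hu huX)

lemma IsMapLimit.dist_le (hΦ : IsMapLimit l X φ Φ) (h : LipFamily l X Y φ ψ C)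
    (hX : IsSetLimit l X V) {p q : E} (hp : p ∈ V) (hq : q ∈ V) :
    dist (Φ p) (Φ q) ≤ C * dist p q := by
  obtain ⟨u, hu, huX⟩ := hX.approx p hp
  obtain ⟨v, hv, hvX⟩ := hX.approx q hq
  refine le_of_tendsto_of_tendsto ((hΦ u p hu huX).dist (hΦ v q hv hvX))
    ((hu.dist hv).const_mul C) ?_
  filter_upwards [h.lip (max (‖p‖ + 1) (‖q‖ + 1)), huX, hvX, eventually_norm_lt hu,
    eventually_norm_lt hv] with n h1 h2 h3 h4 h5
  exact h1 _ h2 (lt_max_of_lt_left h4) _ h3 (lt_max_of_lt_right h5)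

lemma IsMapLimit.norm_le (hΦ : IsMapLimit l X φ Φ) (h : LipFamily l X Y φ ψ C)
    (hX : IsSetLimit l X V) {p : E} (hp : p ∈ V) : ‖Φ p‖ ≤ C * ‖p‖ := by
  obtain ⟨u, hu, huX⟩ := hX.approx p hp
  refine le_of_tendsto_of_tendsto (hΦ u p hu huX).norm (hu.norm.const_mul C) ?_
  filter_upwards [h.maps (‖p‖ + 1), huX, eventually_norm_lt hu] with n h1 h2 h3
  exact (h1 _ h2 h3).2.1

lemma IsMapLimit.leftInvOn (hΦ : IsMapLimit l X φ Φ) (hΨ : IsMapLimit l Y ψ Ψ)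
    (h : LipFamily l X Y φ ψ C) (hX : IsSetLimit l X V) : Set.LeftInvOn Ψ Φ V := by
  intro p hp
  obtain ⟨u, hu, huX⟩ := hX.approx p hp
  refine tendsto_nhds_unique (hΨ _ _ (hΦ u p hu huX) (IsMapLimit.eventually_mem h hu huX)) ?_
  refine hu.congr' ?_
  filter_upwards [h.maps (‖p‖ + 1), huX, eventually_norm_lt hu] with n h1 h2 h3
  exact (h1 _ h2 h3).2.2.symm

end LimitMaps

section LocalSheets

variable {ι E F : Type*} [NormedAddCommGroup E] [NormedAddCommGroup F] {l : Filter ι}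

/-- Near `p`, the sets `X n` are covered by `μ` connected pieces. -/
def CoversAt (l : Filter ι) (X : ι → Set E) (p : E) (μ : ℕ) : Prop :=
  ∀ ρ > 0, ∃ ρ' > 0, ∀ᶠ n in l, ∃ A : Fin μ → Set E,
    (∀ j, IsPreconnected (A j) ∧ A j ⊆ X n ∩ Metric.ball p ρ) ∧
      X n ∩ Metric.ball p ρ' ⊆ ⋃ j, A j

/-- Near `p`, the sets `X n` have at least `μ` local components. -/
def SeparatedAt (l : Filter ι) (X : ι → Set E) (p : E) (μ : ℕ) : Prop :=
  ∃ ρ > 0, ∀ ρ' > 0, ∀ᶠ n in l, ∃ s : Fin μ → E, (∀ j, s j ∈ X n ∩ Metric.ball p ρ') ∧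
    ∀ A ⊆ X n ∩ Metric.ball p ρ, IsPreconnected A → ∀ i j, s i ∈ A → s j ∈ A → i = j

lemma CoversAt.mono {l' : Filter ι} {X : ι → Set E} {p : E} {μ : ℕ} (h : CoversAt l X p μ)
    (hl : l' ≤ l) : CoversAt l' X p μ := fun ρ hρ =>
  let ⟨ρ', h', H⟩ := h ρ hρ
  ⟨ρ', h', H.filter_mono hl⟩

lemma SeparatedAt.mono {l' : Filter ι} {X : ι → Set E} {p : E} {μ : ℕ} (h : SeparatedAt l X p μ)
    (hl : l' ≤ l) : SeparatedAt l' X p μ :=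
  let ⟨ρ, hρ, H⟩ := h
  ⟨ρ, hρ, fun ρ' h' => (H ρ' h').filter_mono hl⟩

variable {X : ι → Set E} {Y : ι → Set F} {φ : ι → E → F} {ψ : ι → F → E} {C C' : ℝ} {V : Set E}
  {W : Set F} [l.NeBot] {Φ : E → F}

lemma SeparatedAt.le_of_coversAt {p : E} {μ μ' : ℕ} (h : LipFamily l X Y φ ψ C)
    (h' : LipFamily l Y X ψ φ C') (hX : IsSetLimit l X V) (hp : p ∈ V) (hΦ : IsMapLimit l X φ Φ)
    (hs : SeparatedAt l X p μ) (hc : CoversAt l Y (Φ p) μ') : μ ≤ μ' := by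
  obtain ⟨u, hu, huX⟩ := hX.approx p hp
  obtain ⟨ρ, hρ, hs⟩ := hs
  have hC := h.pos
  have hC' := h'.pos
  obtain ⟨ρ₁, hρ₁, hc⟩ := hc (ρ / (4 * C')) (by positivity)
  have e1 : ∀ᶠ n in l, dist (u n) p < min (ρ / 4) (ρ₁ / (4 * C)) :=
    hu (Metric.ball_mem_nhds _ (by positivity))
  have e2 : ∀ᶠ n in l, dist (φ n (u n)) (Φ p) < min (ρ / (4 * C')) (ρ₁ / 4) :=
    (hΦ u p hu huX) (Metric.ball_mem_nhds _ (by positivity))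
  obtain ⟨n, huX, hupr, e1, e2, hm, hl, hm', hl', hs, hc⟩ := (huX.and <|
    (eventually_norm_lt hu).and <| e1.and <| e2.and <|
    (h.maps (‖p‖ + 1 + ρ₁ / (4 * C))).and <| (h.lip (‖p‖ + 1 + ρ₁ / (4 * C))).and <|
    (h'.maps (‖Φ p‖ + 1 + ρ / (4 * C') + ρ₁)).and <|
    (h'.lip (‖Φ p‖ + 1 + ρ / (4 * C') + ρ₁)).and <|
    (hs (ρ₁ / (4 * C)) (by positivity)).and hc).exists
  rw [lt_min_iff] at e1 e2
  obtain ⟨s, hsX, hs⟩ := hs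
  obtain ⟨A, hA, hcov⟩ := hc
  have hpos1 : 0 < ρ₁ / (4 * C) := by positivity
  have hpos2 : 0 < ρ / (4 * C') := by positivity
  have hnorm : ∀ x, x ∈ Metric.ball p (ρ₁ / (4 * C)) → ‖x‖ < ‖p‖ + 1 + ρ₁ / (4 * C) := by
    intro x hx
    rw [mem_ball_iff_norm] at hx
    have := norm_le_norm_add_norm_sub' x p
    linarith
  have hun : ‖u n‖ < ‖p‖ + 1 + ρ₁ / (4 * C) := by linarith
  have hφs : ∀ j, φ n (s j) ∈ Y n ∩ Metric.ball (Φ p) ρ₁ := by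
    intro j
    have hj := hsX j
    refine ⟨(hm _ hj.1 (hnorm _ hj.2)).1, ?_⟩
    have h1 := hl _ hj.1 (hnorm _ hj.2) _ huX hun
    have h2 : dist (s j) (u n) < ρ₁ / (2 * C) := by
      have := dist_triangle_right (s j) (u n) p
      have h3 := Metric.mem_ball.1 hj.2
      have : ρ₁ / (2 * C) = ρ₁ / (4 * C) + ρ₁ / (4 * C) := by field_simp; norm_num
      linarith [e1.2]
    have h3 : C * dist (s j) (u n) < ρ₁ / 2 := by
      calc C * dist (s j) (u n) < C * (ρ₁ / (2 * C)) := by gcongr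
        _ = ρ₁ / 2 := by field_simp
    rw [Metric.mem_ball]
    have := dist_triangle (φ n (s j)) (φ n (u n)) (Φ p)
    linarith [e2.2]
  have hex : ∀ j, ∃ k, φ n (s j) ∈ A k := fun j => by simpa using hcov (hφs j)
  choose k hk using hex
  have hyn : ∀ y, y ∈ Y n ∩ Metric.ball (Φ p) (ρ / (4 * C')) →
      ‖y‖ < ‖Φ p‖ + 1 + ρ / (4 * C') + ρ₁ := by
    rintro y ⟨-, hy⟩
    rw [mem_ball_iff_norm] at hy
    have := norm_le_norm_add_norm_sub' y (Φ p)
    linarith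
  have hkinj : Function.Injective k := by
    intro i j hij
    refine hs (ψ n '' A (k i)) ?_ ?_ i j ⟨_, hk i, (hm _ (hsX i).1 (hnorm _ (hsX i).2)).2.2⟩
      ⟨_, hij ▸ hk j, (hm _ (hsX j).1 (hnorm _ (hsX j).2)).2.2⟩
    · rintro _ ⟨y, hy, rfl⟩
      have hy' := (hA _).2 hy
      refine ⟨(hm' _ hy'.1 (hyn y hy')).1, ?_⟩
      have hφu : ‖φ n (u n)‖ < ‖Φ p‖ + 1 + ρ / (4 * C') + ρ₁ := by
        have h1 := e2.1
        rw [dist_eq_norm] at h1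
        have := norm_le_norm_add_norm_sub' (φ n (u n)) (Φ p)
        linarith
      have h1 := hl' _ hy'.1 (hyn y hy') _ (hm _ huX hun).1 hφu
      rw [(hm _ huX hun).2.2] at h1
      have h2 : dist y (φ n (u n)) < ρ / (2 * C') := by
        have := dist_triangle_right y (φ n (u n)) (Φ p)
        have h3 := Metric.mem_ball.1 hy'.2
        have : ρ / (2 * C') = ρ / (4 * C') + ρ / (4 * C') := by field_simp; norm_num
        linarith [e2.1]
      have h3 : C' * dist y (φ n (u n)) < ρ / 2 := by
        calc C' * dist y (φ n (u n)) < C' * (ρ / (2 * C')) := by gcongr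
          _ = ρ / 2 := by field_simp
      rw [Metric.mem_ball]
      have := dist_triangle (ψ n y) (u n) p
      linarith [e1.1]
    · refine (hA _).1.image _ (LipschitzOnWith.continuousOn (K := C'.toNNReal) ?_)
      refine LipschitzOnWith.of_dist_le_mul fun x hx y hy => ?_
      rw [Real.coe_toNNReal _ hC'.le]
      exact hl' _ ((hA _).2 hx).1 (hyn _ ((hA _).2 hx)) _ ((hA _).2 hy).1 (hyn _ ((hA _).2 hy))
  simpa using Fintype.card_le_of_injective k hkinj

end LocalSheets

section LipGerms

variable {E F E' F' : Type*} [NormedAddCommGroup E] [NormedAddCommGroup F] [NormedAddCommGroup E']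
  [NormedAddCommGroup F']

/-- `φ : X → Y` is defined and `C`-Lipschitz near the origin with left inverse `ψ`. -/
structure LipGerm (X : Set E) (Y : Set F) (φ : E → F) (ψ : F → E) (C : ℝ) : Prop where
  pos : 0 < C
  zero : φ 0 = 0
  ev : ∃ ε > 0, (∀ p ∈ X, ‖p‖ < ε → φ p ∈ Y ∧ ψ (φ p) = p) ∧
    ∀ p ∈ X, ‖p‖ < ε → ∀ q ∈ X, ‖q‖ < ε → dist (φ p) (φ q) ≤ C * dist p q

lemma OuterBiLipGerm.exists_lipGerm {X : Set E} {Y : Set F} (h : OuterBiLipGerm X Y)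
    (hX : 0 ∈ X) : ∃ φ ψ C C', LipGerm X Y φ ψ C ∧ LipGerm Y X ψ φ C' := by
  obtain ⟨ε, hε, δ, hδ, φ, hbij, h0, ⟨C, hC, hl⟩, c, hc, hl'⟩ := h
  have h0X : (0 : E) ∈ X ∩ Metric.closedBall 0 ε := ⟨hX, Metric.mem_closedBall_self hε.le⟩
  set ψ := Function.invFunOn φ (X ∩ Metric.closedBall 0 ε) with hψ
  have hinv : Set.InvOn ψ φ (X ∩ Metric.closedBall 0 ε) (Y ∩ Metric.closedBall 0 δ) :=
    hbij.invOn_invFunOn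
  have hmaps : Set.MapsTo ψ (Y ∩ Metric.closedBall 0 δ) (X ∩ Metric.closedBall 0 ε) :=
    hbij.surjOn.mapsTo_invFunOn
  refine ⟨φ, ψ, C, c, ⟨hC, h0, ε, hε, fun p hp hpe => ?_, fun p hp hpe q hq hqe => ?_⟩,
    ⟨hc, ?_, δ, hδ, fun p hp hpe => ?_, fun p hp hpe q hq hqe => ?_⟩⟩
  · have : p ∈ X ∩ Metric.closedBall 0 ε := ⟨hp, by simpa using hpe.le⟩
    exact ⟨(hbij.mapsTo this).1, hinv.1 this⟩
  · exact hl _ ⟨hp, by simpa using hpe.le⟩ _ ⟨hq, by simpa using hqe.le⟩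
  · have := hinv.1 h0X
    rwa [h0] at this
  · have : p ∈ Y ∩ Metric.closedBall 0 δ := ⟨hp, by simpa using hpe.le⟩
    exact ⟨(hmaps this).1, hinv.2 this⟩
  · have h1 : p ∈ Y ∩ Metric.closedBall 0 δ := ⟨hp, by simpa using hpe.le⟩
    have h2 : q ∈ Y ∩ Metric.closedBall 0 δ := ⟨hq, by simpa using hqe.le⟩
    have := hl' _ (hmaps h1) _ (hmaps h2)
    rwa [hinv.2 h1, hinv.2 h2] at this

lemma LipGerm.conj [NormedSpace ℂ E] [NormedSpace ℂ F] [NormedSpace ℂ E'] [NormedSpace ℂ F']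
    {X : Set E} {Y : Set F} {φ : E → F} {ψ : F → E} {C : ℝ} (h : LipGerm X Y φ ψ C)
    (A : E' ≃L[ℂ] E) (A' : F' ≃L[ℂ] F) :
    ∃ C', LipGerm (A ⁻¹' X) (A' ⁻¹' Y) (A'.symm ∘ φ ∘ A) (A.symm ∘ ψ ∘ A') C' := by
  obtain ⟨ε, hε, hm, hl⟩ := h.ev
  set a := ‖(A : E' →L[ℂ] E)‖ + 1 with ha
  set a' := ‖(A'.symm : F →L[ℂ] F')‖ + 1 with ha'
  have hapos : 0 < a := by positivity
  have hapos' : 0 < a' := by positivity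
  have hC := h.pos
  have hA : ∀ p, ‖A p‖ ≤ a * ‖p‖ := fun p =>
    ((A : E' →L[ℂ] E).le_opNorm p).trans (by gcongr; linarith)
  have hA' : ∀ p, ‖A'.symm p‖ ≤ a' * ‖p‖ := fun p =>
    ((A'.symm : F →L[ℂ] F').le_opNorm p).trans (by gcongr; linarith)
  have hn : ∀ p : E', ‖p‖ < ε / a → ‖A p‖ < ε := fun p hp => by
    refine (hA p).trans_lt ?_
    rwa [lt_div_iff₀' hapos] at hp
  refine ⟨a' * (C * a), by positivity, by simp [h.zero], ε / a, by positivity,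
    fun p hp hpe => ?_, fun p hp hpe q hq hqe => ?_⟩
  · have := hm _ hp (hn _ hpe)
    simp [this.1, this.2]
  · have := hl _ hp (hn _ hpe) _ hq (hn _ hqe)
    simp only [Function.comp, dist_eq_norm] at this ⊢
    rw [← map_sub]
    refine (hA' _).trans ?_
    rw [mul_assoc, mul_assoc]
    gcongr
    refine this.trans ?_
    gcongr
    rw [← map_sub]
    exact hA _

/-- The dilation of `X` by the factor `n + 1`. -/
def blowUp [NormedSpace ℂ E] (X : Set E) (n : ℕ) : Set E := {p | ((n + 1 : ℂ)⁻¹) • p ∈ X}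

/-- The conjugate of `φ` by the dilation by the factor `n + 1`. -/
noncomputable def blowUpMap [NormedSpace ℂ E] [NormedSpace ℂ F] (φ : E → F) (n : ℕ) (p : E) : F :=
  (n + 1 : ℂ) • φ ((n + 1 : ℂ)⁻¹ • p)

lemma norm_natCast_add_one (n : ℕ) : ‖(n + 1 : ℂ)‖ = n + 1 := by
  exact_mod_cast Complex.norm_natCast (n + 1)

lemma LipGerm.lipFamily [NormedSpace ℂ E] [NormedSpace ℂ F] {X : Set E} {Y : Set F} {φ : E → F}
    {ψ : F → E} {C : ℝ} (h : LipGerm X Y φ ψ C) (h0 : 0 ∈ X) :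
    LipFamily atTop (blowUp X) (blowUp Y) (blowUpMap φ) (blowUpMap ψ) C := by
  obtain ⟨ε, hε, hm, hl⟩ := h.ev
  have hn0 : ∀ n : ℕ, (n + 1 : ℂ) ≠ 0 := fun n => Nat.cast_add_one_ne_zero n
  have key : ∀ r : ℝ, ∀ᶠ n : ℕ in atTop, ∀ p : E, ‖p‖ < r → ‖((n + 1 : ℂ)⁻¹) • p‖ < ε := by
    intro r
    filter_upwards [(tendsto_natCast_atTop_atTop (R := ℝ)).eventually_gt_atTop (r / ε)] with n hn p hp
    rw [norm_smul, norm_inv, norm_natCast_add_one, inv_mul_lt_iff₀ (by positivity)]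
    rw [div_lt_iff₀ hε] at hn
    nlinarith
  have hlip : ∀ (n : ℕ) (p q : E), dist (φ ((n + 1 : ℂ)⁻¹ • p)) (φ ((n + 1 : ℂ)⁻¹ • q)) ≤
      C * dist ((n + 1 : ℂ)⁻¹ • p) ((n + 1 : ℂ)⁻¹ • q) →
      dist (blowUpMap φ n p) (blowUpMap φ n q) ≤ C * dist p q := by
    intro n p q H
    rw [blowUpMap, blowUpMap, dist_smul₀]
    rw [dist_smul₀, norm_inv] at H
    have : ‖(n + 1 : ℂ)‖ ≠ 0 := norm_ne_zero_iff.2 (hn0 n)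
    calc _ ≤ ‖(n + 1 : ℂ)‖ * (C * (‖(n + 1 : ℂ)‖⁻¹ * dist p q)) := by gcongr
      _ = _ := by field_simp
  refine ⟨h.pos, fun r => ?_, fun r => ?_⟩
  · filter_upwards [key r] with n hn p hp hpr
    have h1 := hm _ hp (hn p hpr)
    refine ⟨?_, ?_, ?_⟩
    · simp only [blowUp, blowUpMap, Set.mem_ofPred_eq, inv_smul_smul₀ (hn0 n)]
      exact h1.1
    · have := hlip n p 0 (by
        rw [smul_zero]
        exact hl _ hp (hn p hpr) _ h0 (by simpa using hε))
      have h2 : blowUpMap φ n 0 = 0 := by simp [blowUpMap, h.zero]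
      rwa [h2, dist_zero_right, dist_zero_right] at this
    · simp only [blowUpMap, inv_smul_smul₀ (hn0 n), h1.2, smul_inv_smul₀ (hn0 n)]
  · filter_upwards [key r] with n hn p hp hpr q hq hqr
    exact hlip n p q (hl _ hp (hn p hpr) _ hq (hn q hqr))

lemma LipFamily.mono {ι : Type*} {l l' : Filter ι} {X : ι → Set E} {Y : ι → Set F} {φ : ι → E → F}
    {ψ : ι → F → E} {C : ℝ} (h : LipFamily l X Y φ ψ C) (hl : l' ≤ l) :
    LipFamily l' X Y φ ψ C :=
  ⟨h.pos, fun r => (h.maps r).filter_mono hl, fun r => (h.lip r).filter_mono hl⟩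

end LipGerms

section Surfaces

/-- The roots of the family of polynomials with roots `r`, dilated by the factor `n + 1`. -/
noncomputable def blowRoots {N : ℕ} (r : ℂ × ℂ → Fin N → ℂ) (n : ℕ) (b : ℂ × ℂ) : Fin N → ℂ :=
  fun j => (n + 1) * r ((n + 1 : ℂ)⁻¹ • b) j

/-- The surface whose fibre over `b` is `Set.range (r b)` has tangent cone given by the zeros of `H`,
of reduced equation with roots `R`, and is a reduced covering over the base points in
`goodBase B` close to the origin. -/
structure SurfaceData (m N k : ℕ) (r : ℂ × ℂ → Fin N → ℂ) (H : ℂ × ℂ → Polynomial ℂ)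
    (R : ℂ × ℂ → Fin k → ℂ) (B : Set ℂ) : Prop where
  red : RedData k R B
  cont : SymContOn r Set.univ
  zero : ((0 : ℂ), (0 : ℂ × ℂ)) ∈ rootSet r Set.univ
  natDegree : ∀ b, (H b).natDegree = m
  ne_zero : ∀ b, H b ≠ 0
  isRoot : ∀ b z, (H b).IsRoot z ↔ z ∈ Set.range (R b)
  continuous_coeff : ∀ i, Continuous fun b => (H b).coeff i
  conv : ∃ c : ℕ → ℂ, (∀ n, c n ≠ 0) ∧ ∀ b₀ i, Tendsto (fun q : ℕ × (ℂ × ℂ) =>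
    (Polynomial.C (c q.1) * ∏ j, (Polynomial.X - Polynomial.C (blowRoots r q.1 q.2 j))).coeff i)
      (atTop ×ˢ 𝓝 b₀) (𝓝 ((H b₀).coeff i))
  inj : ∀ b₀ ∈ goodBase B, ∀ᶠ q : ℕ × (ℂ × ℂ) in atTop ×ˢ 𝓝 b₀,
    Function.Injective (r ((q.1 + 1 : ℂ)⁻¹ • q.2))

variable {m N k : ℕ} {r : ℂ × ℂ → Fin N → ℂ} {H : ℂ × ℂ → Polynomial ℂ}
    {R : ℂ × ℂ → Fin k → ℂ} {B : Set ℂ}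

lemma natCast_add_one_ne (n : ℕ) : (n + 1 : ℂ) ≠ 0 := Nat.cast_add_one_ne_zero n

lemma blowUp_rootSet (r : ℂ × ℂ → Fin N → ℂ) (n : ℕ) :
    blowUp (rootSet r Set.univ) n = rootSet (blowRoots r n) Set.univ := by
  ext ⟨z, b⟩
  simp only [blowUp, rootSet, Set.mem_ofPred_eq, Set.mem_univ, true_and, Prod.smul_snd,
    Prod.smul_fst, Set.mem_range, blowRoots, smul_eq_mul]
  have := natCast_add_one_ne n
  refine exists_congr fun j => ?_
  rw [eq_inv_mul_iff_mul_eq₀ this]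

lemma natDegree_C_mul_prod_le (c : ℂ) (s : Fin N → ℂ) :
    (Polynomial.C c * ∏ j, (Polynomial.X - Polynomial.C (s j))).natDegree ≤ N := by
  refine (Polynomial.natDegree_C_mul_le _ _).trans ?_
  rw [Polynomial.natDegree_prod_of_monic _ _ fun _ _ => Polynomial.monic_X_sub_C _]
  simp

open scoped Classical in
lemma card_filter_roots {c : ℂ} (hc : c ≠ 0) (s : Fin N → ℂ) (p : ℂ → Prop) :
    ((Polynomial.C c * ∏ j, (Polynomial.X - Polynomial.C (s j))).roots.filter p).card =
      Nat.card {j // p (s j)} := by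
  rw [Polynomial.roots_C_mul _ hc, roots_prod_X_sub_C', Multiset.filter_map, Multiset.card_map,
    Nat.card_eq_fintype_card, Fintype.card_subtype]
  rfl

namespace SurfaceData

lemma symCont_blowRoots (h : SurfaceData m N k r H R B) (n : ℕ) :
    SymContOn (blowRoots r n) Set.univ := by
  intro x _ ε hε
  have hn := natCast_add_one_ne n
  have hn' : 0 < ‖(n + 1 : ℂ)‖ := norm_pos_iff.2 hn
  have := (h.cont.comp (f := fun b : ℂ × ℂ => (n + 1 : ℂ)⁻¹ • b) (S := Set.univ)
    (by fun_prop) fun _ _ => trivial) x trivial (ε / ‖(n + 1 : ℂ)‖) (by positivity)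
  filter_upwards [this] with y ⟨σ, hσ⟩
  refine ⟨σ, fun j => ?_⟩
  simp only [blowRoots]
  have h1 := hσ j
  rw [lt_div_iff₀' hn'] at h1
  rwa [← smul_eq_mul, ← smul_eq_mul, dist_smul₀]

lemma eventually_card (h : SurfaceData m N k r H R B) (b₀ : ℂ × ℂ) {z₀ : ℂ} {ρ : ℝ} (hρ : 0 < ρ)
    (hz : ∀ z ∈ Metric.closedBall z₀ ρ, (H b₀).IsRoot z → z = z₀) :
    ∀ᶠ q : ℕ × (ℂ × ℂ) in atTop ×ˢ 𝓝 b₀,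
      Nat.card {j // blowRoots r q.1 q.2 j ∈ Metric.ball z₀ ρ} = (H b₀).rootMultiplicity z₀ := by
  obtain ⟨c, hc, hconv⟩ := h.conv
  have := Polynomial.eventually_card_roots_ball (T := ℕ × (ℂ × ℂ)) (l := atTop ×ˢ 𝓝 b₀)
    (P := fun q => Polynomial.C (c q.1) *
      ∏ j, (Polynomial.X - Polynomial.C (blowRoots r q.1 q.2 j)))
    (P₀ := H b₀) (N := N) (fun q => natDegree_C_mul_prod_le _ _) (hconv b₀) (h.ne_zero b₀) hρ hz
  filter_upwards [this] with q hq
  rw [← hq.2, card_filter_roots (hc _)]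

lemma exists_isolating (h : SurfaceData m N k r H R B) (b₀ : ℂ × ℂ) (z₀ : ℂ) :
    ∃ ρ₀ > 0, ∀ ρ ≤ ρ₀, ∀ z ∈ Metric.closedBall z₀ ρ, (H b₀).IsRoot z → z = z₀ := by
  have hfin : ({z | (H b₀).IsRoot z} \ {z₀}).Finite :=
    (Polynomial.finite_setOfPred_isRoot (h.ne_zero b₀)).subset Set.sdiff_subset
  have : ({z | (H b₀).IsRoot z} \ {z₀})ᶜ ∈ 𝓝 z₀ := hfin.isClosed.isOpen_compl.mem_nhds (by simp)
  obtain ⟨ρ, hρ, hs⟩ := Metric.mem_nhds_iff.1 this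
  refine ⟨ρ / 2, by positivity, fun ρ' hρ' z hz hr => ?_⟩
  by_contra hne
  exact hs (Metric.closedBall_subset_ball (by linarith) hz) ⟨hr, hne⟩

lemma isSetLimit (h : SurfaceData m N k r H R B) {l : Filter ℕ} (hl : l ≤ atTop) [l.NeBot] :
    IsSetLimit l (blowUp (rootSet r Set.univ)) (rootSet R Set.univ) := by
  have hconv := h.conv
  rw [show blowUp (rootSet r Set.univ) = fun n => rootSet (blowRoots r n) Set.univ from
    funext (blowUp_rootSet r)]
  refine ⟨?_, ?_⟩
  · rintro ⟨z₀, b₀⟩ ⟨-, hz₀⟩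
    simp only at hz₀
    have hroot := (h.isRoot b₀ z₀).2 hz₀
    have : Nonempty (Fin N) := by
      obtain ⟨-, j, -⟩ := h.zero
      exact ⟨j⟩
    have hmin : ∀ n, ∃ j, ∀ i, dist (blowRoots r n b₀ j) z₀ ≤ dist (blowRoots r n b₀ i) z₀ :=
      fun n => Finite.exists_min _
    choose j hj using hmin
    refine ⟨fun n => (blowRoots r n b₀ (j n), b₀), ?_, Eventually.of_forall fun n =>
      ⟨trivial, _, rfl⟩⟩
    refine Tendsto.prodMk_nhds ?_ tendsto_const_nhds
    refine Tendsto.mono_left ?_ hl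
    rw [Metric.tendsto_nhds]
    intro ε hε
    obtain ⟨ρ₀, hρ₀, hiso⟩ := h.exists_isolating b₀ z₀
    have h1 := h.eventually_card b₀ (ρ := min ε ρ₀) (by positivity) (hiso _ (min_le_right _ _))
    have h2 := (tendsto_id.prodMk (tendsto_const_nhds (x := b₀) (f := atTop))).eventually h1
    filter_upwards [h2] with n hn
    have : 0 < (H b₀).rootMultiplicity z₀ := (Polynomial.rootMultiplicity_pos (h.ne_zero b₀)).2 hroot
    rw [← hn] at this
    obtain ⟨⟨i, hi⟩⟩ := (Nat.card_pos_iff.1 this).1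
    exact (hj n i).trans_lt (lt_of_lt_of_le hi (min_le_left _ _))
  · rintro u ⟨z₀, b₀⟩ hu huX
    obtain ⟨c, hc, hconv⟩ := hconv
    refine ⟨trivial, (h.isRoot b₀ z₀).1 ?_⟩
    have h1 := Polynomial.tendsto_eval_of_coeff (T := ℕ × (ℂ × ℂ)) (l := atTop ×ˢ 𝓝 b₀)
      (P := fun q => Polynomial.C (c q.1) *
        ∏ j, (Polynomial.X - Polynomial.C (blowRoots r q.1 q.2 j)))
      (P₀ := H b₀) (N := max N m) (fun q => (natDegree_C_mul_prod_le _ _).trans (le_max_left _ _))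
      ((h.natDegree b₀).le.trans (le_max_right _ _)) (hconv b₀) z₀
    have h2 : Tendsto (fun n => ((n, (u n).2), (u n).1)) l ((atTop ×ˢ 𝓝 b₀) ×ˢ 𝓝 z₀) := by
      rw [nhds_prod_eq] at hu
      exact ((tendsto_id'.2 hl).prodMk (tendsto_snd.comp hu)).prodMk (tendsto_fst.comp hu)
    have h3 := h1.comp h2
    refine tendsto_nhds_unique h3 ?_
    refine tendsto_const_nhds.congr' ?_
    filter_upwards [huX] with n hn
    obtain ⟨-, i, hi⟩ := hn
    simp only [Function.comp, Polynomial.eval_mul, Polynomial.eval_prod]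
    rw [Finset.prod_eq_zero (Finset.mem_univ i) (by simp [hi]), mul_zero]

lemma exists_sheets_near (h : SurfaceData m N k r H R B) {b₀ : ℂ × ℂ} (hb₀ : b₀ ∈ goodBase B)
    {z₀ : ℂ} {ρ : ℝ} (hρ : 0 < ρ)
    (hz : ∀ z ∈ Metric.closedBall z₀ ρ, (H b₀).IsRoot z → z = z₀) :
    ∃ δ > 0, ∀ᶠ n in atTop, ∃ η : ℂ × ℂ → Fin ((H b₀).rootMultiplicity z₀) → ℂ,
      (∀ j, ContinuousOn (fun b => η b j) (Metric.closedBall b₀ δ)) ∧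
      ∀ b ∈ Metric.closedBall b₀ δ, Function.Injective (η b) ∧
        ∀ z, z ∈ Set.range (η b) ↔ z ∈ Metric.ball z₀ ρ ∧ z ∈ Set.range (blowRoots r n b) := by
  have h1 := h.eventually_card b₀ hρ hz
  have h2 := h.eventually_card b₀ (half_pos hρ) fun z hz' =>
    hz z (Metric.closedBall_subset_closedBall (by linarith) hz')
  have h3 := h.inj b₀ hb₀
  obtain ⟨s, hs, t, ht, hst⟩ := Filter.mem_prod_iff.1 (h1.and (h2.and h3))
  obtain ⟨δ, hδ, hδt⟩ := Metric.nhds_basis_closedBall.mem_iff.1 ht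
  refine ⟨δ, hδ, ?_⟩
  filter_upwards [hs] with n hn
  have hb : ∀ b ∈ Metric.closedBall b₀ δ,
      Nat.card {j // blowRoots r n b j ∈ Metric.ball z₀ ρ} = (H b₀).rootMultiplicity z₀ ∧
      Nat.card {j // blowRoots r n b j ∈ Metric.ball z₀ (ρ / 2)} = (H b₀).rootMultiplicity z₀ ∧
      Function.Injective (blowRoots r n b) := by
    intro b hb
    obtain ⟨h1, h2, h3⟩ := hst (Set.mk_mem_prod hn (hδt hb))
    exact ⟨h1, h2, fun i j hij => h3 (mul_left_cancel₀ (natCast_add_one_ne n) hij)⟩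
  obtain ⟨η, hηc, hη⟩ := (h.symCont_blowRoots n).mono (Set.subset_univ _) |>.exists_sheets
    (isCompact_closedBall b₀ δ) (convex_closedBall b₀ δ) fun b hb' => (hb b hb').2.2
  have hann : ∀ b ∈ Metric.closedBall b₀ δ, ∀ j, η b j ∈ Metric.ball z₀ ρ →
      η b j ∈ Metric.ball z₀ (ρ / 2) := by
    intro b hb' j hj
    obtain ⟨σ, hσ⟩ := hη b
    obtain ⟨c1, c2, -⟩ := hb b hb'
    have hsub : {j | blowRoots r n b j ∈ Metric.ball z₀ (ρ / 2)} ⊆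
        {j | blowRoots r n b j ∈ Metric.ball z₀ ρ} :=
      fun j hj => Metric.ball_subset_ball (by linarith) hj
    have := Set.eq_of_subset_of_ncard_le hsub (le_of_eq (c1.trans c2.symm))
    rw [hσ] at hj ⊢
    change σ j ∈ {j | blowRoots r n b j ∈ Metric.ball z₀ (ρ / 2)}
    rw [this]
    exact hj
  classical
  have hconst : ∀ b ∈ Metric.closedBall b₀ δ, ∀ j,
      (η b j ∈ Metric.ball z₀ ρ ↔ η b₀ j ∈ Metric.ball z₀ ρ) := by
    have hcl : ∀ j, ContinuousOn (fun b => decide (η b j ∈ Metric.ball z₀ ρ))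
        (Metric.closedBall b₀ δ) := by
      intro j b hb'
      refine ContinuousWithinAt.congr_of_eventuallyEq
        (f := fun _ => decide (η b j ∈ Metric.ball z₀ ρ)) continuousWithinAt_const ?_ rfl
      by_cases hj : η b j ∈ Metric.ball z₀ ρ
      · filter_upwards [(hηc j b hb').eventually (Metric.isOpen_ball.mem_nhds hj)] with c hc
        exact decide_eq_decide.2 (iff_of_true hc hj)
      · have : η b j ∈ (Metric.closedBall z₀ (ρ / 2))ᶜ := fun hmem =>
          hj (Metric.closedBall_subset_ball (by linarith) hmem)
        filter_upwards [(hηc j b hb').eventually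
          (Metric.isClosed_closedBall.isOpen_compl.mem_nhds this), self_mem_nhdsWithin] with c hc hcb
        have : η c j ∉ Metric.ball z₀ ρ := fun hmem =>
          hc (Metric.ball_subset_closedBall (hann c hcb j hmem))
        exact decide_eq_decide.2 (iff_of_false this hj)
    intro b hb' j
    have := (convex_closedBall b₀ δ).isPreconnected.constant (hcl j) hb'
      (Metric.mem_closedBall_self hδ.le)
    simpa [-Metric.mem_ball] using this
  have hcard : Nat.card {j // η b₀ j ∈ Metric.ball z₀ ρ} = (H b₀).rootMultiplicity z₀ := by
    obtain ⟨σ, hσ⟩ := hη b₀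
    rw [← (hb b₀ (Metric.mem_closedBall_self hδ.le)).1]
    exact Nat.card_congr (σ.subtypeEquiv fun j => by rw [hσ])
  let e : Fin ((H b₀).rootMultiplicity z₀) ≃ {j // η b₀ j ∈ Metric.ball z₀ ρ} :=
    (Finite.equivFinOfCardEq hcard).symm
  refine ⟨fun b j => η b (e j), fun j => hηc _, fun b hb' => ⟨?_, fun z => ?_⟩⟩
  · intro i j hij
    obtain ⟨σ, hσ⟩ := hη b
    simp only [hσ] at hij
    exact e.injective (Subtype.ext (σ.injective ((hb b hb').2.2 hij)))
  · obtain ⟨σ, hσ⟩ := hη b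
    constructor
    · rintro ⟨j, rfl⟩
      refine ⟨(hconst b hb' _).2 (e j).2, σ (e j), (hσ _).symm⟩
    · rintro ⟨hz, j, rfl⟩
      have h1 : η b (σ.symm j) = blowRoots r n b j := by rw [hσ, Equiv.apply_symm_apply]
      have h2 : η b₀ (σ.symm j) ∈ Metric.ball z₀ ρ := by
        rw [← hconst b hb', h1]
        exact hz
      exact ⟨e.symm ⟨σ.symm j, h2⟩, by simp [h1]⟩

lemma coversAt (h : SurfaceData m N k r H R B) {b₀ : ℂ × ℂ} (hb₀ : b₀ ∈ goodBase B) (z₀ : ℂ) :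
    CoversAt atTop (blowUp (rootSet r Set.univ)) (z₀, b₀) ((H b₀).rootMultiplicity z₀) := by
  intro ρ hρ
  obtain ⟨ρ₀, hρ₀, hiso⟩ := h.exists_isolating b₀ z₀
  have hρ₁ : 0 < min ρ ρ₀ := by positivity
  obtain ⟨δ, hδ, hev⟩ := h.exists_sheets_near hb₀ hρ₁ (hiso _ (min_le_right _ _))
  refine ⟨min (min ρ ρ₀) δ, by positivity, ?_⟩
  filter_upwards [hev] with n ⟨η, hηc, hη⟩
  rw [blowUp_rootSet]
  have hsub : Metric.ball b₀ (min (min ρ ρ₀) δ) ⊆ Metric.closedBall b₀ δ :=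
    (Metric.ball_subset_ball (min_le_right _ _)).trans Metric.ball_subset_closedBall
  refine ⟨fun j => (fun b => (η b j, b)) '' Metric.ball b₀ (min (min ρ ρ₀) δ), fun j => ⟨?_, ?_⟩, ?_⟩
  · exact (convex_ball _ _).isPreconnected.image _ (((hηc j).mono hsub).prodMk continuousOn_id)
  · rintro _ ⟨b, hb, rfl⟩
    have := ((hη b (hsub hb)).2 _).1 ⟨j, rfl⟩
    refine ⟨⟨trivial, this.2⟩, ?_⟩
    rw [← ball_prod_same]
    exact ⟨Metric.ball_subset_ball (min_le_left _ _) this.1, Metric.ball_subset_ball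
      ((min_le_left _ _).trans (min_le_left _ _)) hb⟩
  · rintro ⟨z, b⟩ ⟨⟨-, hz⟩, hzb⟩
    rw [← ball_prod_same] at hzb
    obtain ⟨j, hj⟩ := ((hη b (hsub hzb.2)).2 z).2 ⟨Metric.ball_subset_ball (min_le_left _ _) hzb.1, hz⟩
    exact Set.mem_iUnion.2 ⟨j, b, hzb.2, Prod.ext hj rfl⟩

lemma separatedAt (h : SurfaceData m N k r H R B) {b₀ : ℂ × ℂ} (hb₀ : b₀ ∈ goodBase B) (z₀ : ℂ) :
    SeparatedAt atTop (blowUp (rootSet r Set.univ)) (z₀, b₀) ((H b₀).rootMultiplicity z₀) := by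
  obtain ⟨ρ₀, hρ₀, hiso⟩ := h.exists_isolating b₀ z₀
  obtain ⟨δ, hδ, hev⟩ := h.exists_sheets_near hb₀ hρ₀ (hiso _ le_rfl)
  refine ⟨min ρ₀ δ, by positivity, fun ρ' hρ' => ?_⟩
  have hρ₁ : 0 < min ρ' ρ₀ := by positivity
  obtain ⟨δ', hδ', hev'⟩ := h.exists_sheets_near hb₀ hρ₁ (hiso _ (min_le_right _ _))
  filter_upwards [hev, hev'] with n ⟨η, hηc, hη⟩ ⟨η', hηc', hη'⟩
  rw [blowUp_rootSet]
  have hη' := hη' b₀ (Metric.mem_closedBall_self hδ'.le)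
  refine ⟨fun j => (η' b₀ j, b₀), fun j => ?_, fun A hA hAc i j hi hj => ?_⟩
  · have := (hη'.2 _).1 ⟨j, rfl⟩
    refine ⟨⟨trivial, this.2⟩, ?_⟩
    rw [← ball_prod_same]
    exact ⟨Metric.ball_subset_ball (min_le_left _ _) this.1, Metric.mem_ball_self hρ'⟩
  · have hb : ∀ q ∈ A, q.2 ∈ Metric.closedBall b₀ δ ∧ q.1 ∈ Set.range (η q.2) := by
      rintro ⟨z, b⟩ hq
      obtain ⟨⟨-, h1⟩, h2⟩ := hA hq
      rw [← ball_prod_same] at h2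
      have hb : b ∈ Metric.closedBall b₀ δ := Metric.ball_subset_closedBall
        (Metric.ball_subset_ball (min_le_right _ _) h2.2)
      exact ⟨hb, ((hη b hb).2 z).2 ⟨Metric.ball_subset_ball (min_le_left _ _) h2.1, h1⟩⟩
    have hch : ∀ q, ∃ j : Fin ((H b₀).rootMultiplicity z₀), q ∈ A → η q.2 j = q.1 := by
      intro q
      by_cases hq : q ∈ A
      · obtain ⟨j, hj⟩ := (hb q hq).2
        exact ⟨j, fun _ => hj⟩
      · exact ⟨i, fun h => (hq h).elim⟩
    choose lab hlab using hch
    have hcont : ContinuousOn lab A := by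
      rw [continuousOn_iff_isClosed]
      intro t _
      refine ⟨⋃ j ∈ t, {q : ℂ × ℂ × ℂ | q.2 ∈ Metric.closedBall b₀ δ ∧ η q.2 j = q.1},
        t.toFinite.isClosed_biUnion fun j _ => ?_, ?_⟩
      · have hc : ContinuousOn (fun q : ℂ × ℂ × ℂ => η q.2 j - q.1)
            (Prod.snd ⁻¹' Metric.closedBall b₀ δ) :=
          ((hηc j).comp continuousOn_snd fun _ h => h).sub continuousOn_fst
        have := hc.preimage_isClosed_of_isClosed
          (Metric.isClosed_closedBall.preimage continuous_snd) (isClosed_singleton (x := (0 : ℂ)))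
        convert this using 1
        ext q
        simp [sub_eq_zero]
      · ext q
        constructor
        · rintro ⟨h1, h2⟩
          refine ⟨Set.mem_iUnion₂.2 ⟨lab q, h1, (hb q h2).1, hlab q h2⟩, h2⟩
        · rintro ⟨h1, h2⟩
          obtain ⟨j, hj, hq, hq'⟩ := Set.mem_iUnion₂.1 h1
          refine ⟨?_, h2⟩
          have : lab q = j := (hη _ hq).1 ((hlab q h2).trans hq'.symm)
          rw [Set.mem_preimage, this]
          exact hj
    have heq := hAc.constant hcont hi hj
    have h1 := hlab _ hi
    have h2 := hlab _ hj
    rw [heq] at h1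
    exact hη'.1 (h1.symm.trans h2)

end SurfaceData

end Surfaces

section ComponentDiff

/-- A preconnected set stays preconnected after removal of a subset which does not disconnect it
locally. -/
lemma IsPreconnected.diff_of_local {X : Type*} [TopologicalSpace X] {W Z : Set X}
    (hW : IsPreconnected W) (hd : ∀ x ∈ W, ∀ U ∈ 𝓝[W] x, (U \ Z).Nonempty)
    (hl : ∀ x ∈ W, ∃ U ∈ 𝓝[W] x, U ⊆ W ∧ (∀ y ∈ U, U ∈ 𝓝[W] y) ∧ IsPreconnected (U \ Z)) :
    IsPreconnected (W \ Z) := by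
  refine isPreconnected_of_forall_pair fun x hx y hy => ?_
  obtain ⟨U, hU, V, hV, H⟩ := hW.induction₂ (fun x y => ∃ U ∈ 𝓝[W] x, ∃ V ∈ 𝓝[W] y,
    ∀ u ∈ U \ Z, ∀ v ∈ V \ Z, ∃ C ⊆ W \ Z, u ∈ C ∧ v ∈ C ∧ IsPreconnected C)
    (fun x hx => by
      obtain ⟨U, hU, hUW, hUU, hc⟩ := hl x hx
      filter_upwards [hU] with y hy
      exact ⟨U, hU, U, hUU y hy, fun u hu v hv =>
        ⟨U \ Z, Set.sdiff_subset_sdiff_left hUW, hu, hv, hc⟩⟩)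
    (fun x y z hx hy hz => by
      rintro ⟨U, hU, V, hV, H⟩ ⟨V', hV', T, hT, H'⟩
      refine ⟨U, hU, T, hT, fun u hu t ht => ?_⟩
      obtain ⟨w, ⟨hwV, hwV'⟩, hwZ⟩ := hd y hy _ (inter_mem hV hV')
      obtain ⟨C, hC, h1, h2, h3⟩ := H u hu w ⟨hwV, hwZ⟩
      obtain ⟨C', hC', h1', h2', h3'⟩ := H' w ⟨hwV', hwZ⟩ t ht
      exact ⟨C ∪ C', Set.union_subset hC hC', Or.inl h1, Or.inr h2', h3.union w h2 h1' h3'⟩)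
    (fun x y hx hy => by
      rintro ⟨U, hU, V, hV, H⟩
      refine ⟨V, hV, U, hU, fun v hv u hu => ?_⟩
      obtain ⟨C, hC, h1, h2, h3⟩ := H u hu v hv
      exact ⟨C, hC, h2, h1, h3⟩) hx.1 hy.1
  obtain ⟨C, hC, h1, h2, h3⟩ := H x ⟨mem_of_mem_nhdsWithin hx.1 hU, hx.2⟩ y
    ⟨mem_of_mem_nhdsWithin hy.1 hV, hy.2⟩
  exact ⟨C, hC, h1, h2, h3⟩

namespace RedData

variable {k : ℕ} {R : ℂ × ℂ → Fin k → ℂ} {B : Set ℂ} {p : ℂ × ℂ × ℂ}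

lemma component_diff (h : RedData k R B) {Z : Set (ℂ × ℂ × ℂ)} {T : Set (ℂ × ℂ)} (hT : IsThin T)
    (hZ : ∀ q ∈ Z, q.2 ∈ T) :
    IsPreconnected (connectedComponentIn (rootSet R (goodBase B)) p \ Z) ∧
      connectedComponentIn (rootSet R (goodBase B)) p ⊆
        closure (connectedComponentIn (rootSet R (goodBase B)) p \ Z) := by
  set W := connectedComponentIn (rootSet R (goodBase B)) p with hWdef
  have hWV : W ⊆ rootSet R (goodBase B) := connectedComponentIn_subset _ _
  have key : ∀ x ∈ W, ∃ δ > 0, ∃ s : ℂ × ℂ → ℂ, ContinuousOn s (Metric.ball x.2 δ) ∧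
      s x.2 = x.1 ∧ (∀ b ∈ Metric.ball x.2 δ, (s b, b) ∈ W) ∧ ∀ c ∈ Metric.ball x.2 δ,
        ∀ᶠ q in 𝓝[W] (s c, c), q.1 = s q.2 := by
    intro x hx
    obtain ⟨δ, hδ, hsec⟩ := h.exists_local_sections (hWV hx).1
    obtain ⟨hball, η, hηc, hη⟩ := hsec δ le_rfl
    have hx2 := Metric.mem_ball_self (x := x.2) hδ
    have hx1 : x.1 ∈ Set.range (η x.2) := by
      rw [(hη _ hx2).2]
      exact (hWV hx).2
    obtain ⟨j, hj⟩ := hx1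
    have hgr : ∀ b ∈ Metric.ball x.2 δ, (η b j, b) ∈ rootSet R (goodBase B) := fun b hb =>
      ⟨hball hb, by rw [← (hη b hb).2]; exact ⟨j, rfl⟩⟩
    refine ⟨δ, hδ, fun b => η b j, hηc j, hj, fun b hb =>
      section_mem_component (hηc j) hgr hx2 hb (by rw [hj]; exact hx), fun c hc => ?_⟩
    obtain ⟨ε, hε, hsep⟩ := exists_separation (η c)
    have h1 : ∀ᶠ b in 𝓝 c, ∀ i, dist (η b i) (η c i) < ε / 2 :=
      eventually_all.2 fun i => ((hηc i).continuousAt (Metric.isOpen_ball.mem_nhds hc))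
        (Metric.ball_mem_nhds _ (half_pos hε))
    have h2 : ∀ᶠ q : ℂ × ℂ × ℂ in 𝓝 (η c j, c),
        (∀ i, dist (η q.2 i) (η c i) < ε / 2) ∧ q.2 ∈ Metric.ball x.2 δ ∧
          dist q.1 (η c j) < ε / 2 := by
      have t1 : Tendsto (fun q : ℂ × ℂ × ℂ => q.2) (𝓝 (η c j, c)) (𝓝 c) :=
        continuous_snd.tendsto' _ _ rfl
      have t2 : Tendsto (fun q : ℂ × ℂ × ℂ => q.1) (𝓝 (η c j, c)) (𝓝 (η c j)) :=
        continuous_fst.tendsto' _ _ rfl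
      exact (t1.eventually h1).and <| (t1.eventually (Metric.isOpen_ball.mem_nhds hc)).and
        (t2.eventually (Metric.ball_mem_nhds _ (half_pos hε)))
    filter_upwards [mem_nhdsWithin_of_mem_nhds h2, self_mem_nhdsWithin] with q ⟨hq1, hq2, hq3⟩ hqW
    have : q.1 ∈ Set.range (η q.2) := by
      rw [(hη _ hq2).2]
      exact (hWV hqW).2
    obtain ⟨i, hi⟩ := this
    have : dist (η c i) (η c j) < ε := by
      have := dist_triangle (η c i) (η q.2 i) (η c j)
      have h4 := hq1 i
      rw [dist_comm] at h4
      rw [← hi] at hq3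
      linarith
    have := (hη c hc).1 (hsep i j this)
    rw [← hi, this]
  have hthin : ∀ s : ℂ × ℂ → ℂ, IsThin {b | (s b, b) ∈ Z} := fun s =>
    hT.mono fun b hb => hZ _ hb
  have hdense : ∀ x ∈ W, ∀ U ∈ 𝓝[W] x, (U \ Z).Nonempty := by
    intro x hx U hU
    obtain ⟨δ, hδ, s, hs, hsx, hsW, -⟩ := key x hx
    have hx2 := Metric.mem_ball_self (x := x.2) hδ
    have hcont : ContinuousAt s x.2 := hs.continuousAt (Metric.ball_mem_nhds _ hδ)
    have h1 : Tendsto (fun b => (s b, b)) (𝓝 x.2) (𝓝[W] x) := by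
      refine tendsto_nhdsWithin_iff.2 ⟨?_, ?_⟩
      · have h2 := hcont.prodMk continuousAt_id
        change Tendsto _ _ (𝓝 (s x.2, x.2)) at h2
        rwa [hsx] at h2
      · filter_upwards [Metric.ball_mem_nhds x.2 hδ] with b hb using hsW b hb
    have h2 := h1 hU
    obtain ⟨b, hb, hbZ⟩ := (hthin s).dense_compl.inter_nhds_nonempty h2
    exact ⟨_, hbZ, hb⟩
  refine ⟨?_, fun x hx => ?_⟩
  · refine isPreconnected_connectedComponentIn.diff_of_local hdense fun x hx => ?_
    obtain ⟨δ, hδ, s, hs, hsx, hsW, hloc⟩ := key x hx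
    have hx2 := Metric.mem_ball_self (x := x.2) hδ
    have hnb : ∀ c ∈ Metric.ball x.2 δ,
        (fun b => (s b, b)) '' Metric.ball x.2 δ ∈ 𝓝[W] (s c, c) := by
      intro c hc
      have : ∀ᶠ q : ℂ × ℂ × ℂ in 𝓝 (s c, c), q.2 ∈ Metric.ball x.2 δ :=
        continuous_snd.continuousAt.eventually (Metric.isOpen_ball.mem_nhds hc)
      filter_upwards [hloc c hc, mem_nhdsWithin_of_mem_nhds this] with q hq hq2
      exact ⟨q.2, hq2, Prod.ext hq.symm rfl⟩
    refine ⟨(fun b => (s b, b)) '' Metric.ball x.2 δ, ?_, ?_, ?_, ?_⟩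
    · have := hnb _ hx2
      rwa [hsx] at this
    · rintro _ ⟨b, hb, rfl⟩
      exact hsW b hb
    · rintro _ ⟨b, hb, rfl⟩
      exact hnb b hb
    · have h1 := (hthin s).isPreconnected_diff (convex_ball x.2 δ) Metric.isOpen_ball
      have h2 := h1.image (fun b => (s b, b))
        ((hs.mono Set.sdiff_subset).prodMk continuousOn_id)
      convert h2 using 1
      ext q
      constructor
      · rintro ⟨⟨b, hb, rfl⟩, hq⟩
        exact ⟨b, ⟨hb, hq⟩, rfl⟩
      · rintro ⟨b, ⟨hb, hq⟩, rfl⟩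
        exact ⟨⟨b, hb, rfl⟩, hq⟩
  · rw [mem_closure_iff_nhds]
    intro U hU
    obtain ⟨y, ⟨hy1, hy2⟩, hy3⟩ := hdense x hx (U ∩ W)
      (inter_mem (mem_nhdsWithin_of_mem_nhds hU) self_mem_nhdsWithin)
    exact ⟨y, hy1, hy2, hy3⟩

/-- The points of the cone over bad base points lie on finitely many lines. -/
lemma isThin_image_bad (h : RedData k R B) {Ψ : ℂ × ℂ × ℂ → ℂ × ℂ × ℂ} {C : ℝ}
    (hΨ : ∀ p ∈ rootSet R Set.univ, ∀ q ∈ rootSet R Set.univ, dist (Ψ p) (Ψ q) ≤ C * dist p q) :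
    IsThin {b | ∃ q ∈ rootSet R Set.univ, q.2 ∉ goodBase B ∧ (Ψ q).2 = b} := by
  have hBf := h.finite
  have := hBf.to_subtype
  let I := Option B × Fin k
  let v : I → ℂ × ℂ := fun i => i.1.elim (0, 1) fun β => (1, (β : ℂ))
  let F : I → ℂ → ℂ × ℂ := fun i t => (Ψ (t • (R (v i) i.2, v i))).2
  have hmem : ∀ (i : I) (t : ℂ), t • ((R (v i) i.2, v i) : ℂ × ℂ × ℂ) ∈ rootSet R Set.univ := by
    intro i t
    refine ⟨trivial, ?_⟩
    by_cases ht : t = 0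
    · subst ht
      have : R 0 i.2 = 0 := h.eq_zero (z := R 0 i.2) ⟨trivial, i.2, rfl⟩
      refine ⟨i.2, ?_⟩
      simp [this]
    · exact h.homog t ht (v i) _ ⟨i.2, rfl⟩
  have hF : ∀ i, LocallyLipschitz (F i) := by
    intro i
    refine (LipschitzWith.of_dist_le' (K := C.toNNReal * ‖((R (v i) i.2, v i) : ℂ × ℂ × ℂ)‖)
      fun t t' => ?_).locallyLipschitz
    have h1 := hΨ _ (hmem i t) _ (hmem i t')
    have h2 : dist (F i t) (F i t') ≤
        dist (Ψ (t • (R (v i) i.2, v i))) (Ψ (t' • (R (v i) i.2, v i))) := by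
      rw [Prod.dist_eq (x := Ψ _)]
      exact le_max_right _ _
    refine h2.trans (h1.trans ?_)
    rw [dist_eq_norm (t • _), ← sub_smul, norm_smul, dist_eq_norm]
    calc C * (‖t - t'‖ * ‖((R (v i) i.2, v i) : ℂ × ℂ × ℂ)‖)
        ≤ C.toNNReal * (‖t - t'‖ * ‖((R (v i) i.2, v i) : ℂ × ℂ × ℂ)‖) := by
          gcongr
          exact Real.le_coe_toNNReal C
      _ = _ := by ring
  have hcov : {b | ∃ q ∈ rootSet R Set.univ, q.2 ∉ goodBase B ∧ (Ψ q).2 = b} ⊆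
      ⋃ i, Set.range (F i) := by
    rintro _ ⟨⟨w, c⟩, ⟨-, j, hj⟩, hc, rfl⟩
    simp only at hj hc
    have hex : ∃ (o : Option B) (t : ℂ), c = t • v (o, j) := by
      by_cases h1 : c.1 = 0
      · exact ⟨none, c.2, by ext <;> simp [v, h1]⟩
      · have h2 : c.2 / c.1 ∈ B := by
          by_contra h3
          exact hc ⟨h1, h3⟩
        refine ⟨some ⟨_, h2⟩, c.1, ?_⟩
        ext
        · simp [v]
        · simp [v]
          field_simp
    obtain ⟨o, t, hct⟩ := hex
    have hvj : ∀ j', v (o, j') = v (o, j) := fun _ => rfl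
    have hw : ∃ i : Fin k, w = t * R (v (o, j)) i := by
      by_cases ht : t = 0
      · refine ⟨j, ?_⟩
        have : w = 0 := h.eq_zero (z := w) ⟨trivial, j, by rw [← hj, hct, ht, zero_smul]⟩
        rw [this, ht, zero_mul]
      · have h1 := h.homog t⁻¹ (inv_ne_zero ht) c w ⟨j, hj⟩
        rw [hct, inv_smul_smul₀ ht] at h1
        obtain ⟨i, hi⟩ := h1
        exact ⟨i, by rw [hi, mul_inv_cancel_left₀ ht]⟩
    obtain ⟨i, hi⟩ := hw
    refine Set.mem_iUnion.2 ⟨(o, i), t, ?_⟩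
    simp only [F]
    congr 2
    ext1
    · exact hi.symm
    · exact hct.symm
  have := Fintype.ofFinite I
  let e := Fintype.equivFin I
  refine ⟨_, fun i => F (e.symm i), fun i => hF _, hcov.trans ?_⟩
  exact Set.iUnion_subset fun i => Set.subset_iUnion_of_subset (e i) (by simp)

end RedData

end ComponentDiff

section Multiplicity

namespace SurfaceData

variable {m N k : ℕ} {r : ℂ × ℂ → Fin N → ℂ} {H : ℂ × ℂ → Polynomial ℂ}
    {R : ℂ × ℂ → Fin k → ℂ} {B : Set ℂ}

lemma sum_rootMultiplicity (h : SurfaceData m N k r H R B) {b : ℂ × ℂ} (hb : b ∈ goodBase B) :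
    ∑ j, (H b).rootMultiplicity (R b j) = m := by
  classical
  have hinj := h.red.inj b hb
  have h1 : (H b).roots.card = m := by
    rw [← h.natDegree b]
    exact (Polynomial.splits_iff_card_roots.1 (IsAlgClosed.splits (H b)))
  rw [← h1, ← Multiset.toFinset_sum_count_eq]
  have h2 : (H b).roots.toFinset = Finset.univ.image (R b) := by
    ext z
    rw [Multiset.mem_toFinset, Polynomial.mem_roots (h.ne_zero b), h.isRoot]
    simp
  rw [h2, Finset.sum_image fun i _ j _ hij => hinj hij]
  simp [Polynomial.count_roots]

lemma eventually_rootMultiplicity_eq (h : SurfaceData m N k r H R B) {p : ℂ × ℂ × ℂ}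
    (hp : p ∈ rootSet R (goodBase B)) : ∀ᶠ q in 𝓝[rootSet R (goodBase B)] p,
      (H q.2).rootMultiplicity q.1 = (H p.2).rootMultiplicity p.1 := by
  classical
  obtain ⟨z₀, b₀⟩ := p
  obtain ⟨hb₀, j₀, hj₀⟩ := hp
  simp only at hb₀ hj₀
  obtain ⟨ρ, hρ, hiso⟩ := h.exists_isolating b₀ z₀
  have h1 := Polynomial.eventually_card_roots_ball (T := ℂ × ℂ) (l := 𝓝 b₀) (P := H)
    (P₀ := H b₀) (N := m) (fun b => (h.natDegree b).le)
    (fun i => (h.continuous_coeff i).tendsto b₀) (h.ne_zero b₀) (half_pos hρ)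
    (hiso _ (by linarith))
  have h2 := h.red.cont b₀ trivial (ρ / 2) (half_pos hρ)
  rw [nhdsWithin_univ] at h2
  have t1 : Tendsto (fun q : ℂ × ℂ × ℂ => q.2) (𝓝 (z₀, b₀)) (𝓝 b₀) :=
    continuous_snd.tendsto' _ _ rfl
  have t2 : Tendsto (fun q : ℂ × ℂ × ℂ => q.1) (𝓝 (z₀, b₀)) (𝓝 z₀) :=
    continuous_fst.tendsto' _ _ rfl
  filter_upwards [mem_nhdsWithin_of_mem_nhds (t1.eventually (h1.and h2)),
    mem_nhdsWithin_of_mem_nhds (t2.eventually (Metric.ball_mem_nhds z₀ (half_pos hρ))),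
    self_mem_nhdsWithin] with q ⟨⟨hne, hcard⟩, σ, hσ⟩ hqz hqV
  have huniq : ∀ z, (H q.2).IsRoot z → z ∈ Metric.ball z₀ (ρ / 2) → z = R q.2 (σ j₀) := by
    intro z hz hzb
    rw [h.isRoot] at hz
    obtain ⟨i, rfl⟩ := hz
    obtain ⟨i, rfl⟩ := σ.surjective i
    have h3 : R b₀ i ∈ Metric.closedBall z₀ ρ := by
      have := dist_triangle_left (R b₀ i) z₀ (R q.2 (σ i))
      have h4 := hσ i
      rw [Metric.mem_ball] at hzb
      rw [Metric.mem_closedBall]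
      linarith
    have h4 := hiso ρ le_rfl _ h3 ((h.isRoot _ _).2 ⟨i, rfl⟩)
    rw [h.red.inj b₀ hb₀ (h4.trans hj₀.symm)]
  have hq : (H q.2).IsRoot q.1 := (h.isRoot _ _).2 hqV.2
  have hq1 := huniq _ hq hqz
  rw [← hcard, ← Polynomial.count_roots, Multiset.count_eq_card_filter_eq]
  congr 1
  refine Multiset.filter_congr fun z hz => ⟨?_, fun hzb => ?_⟩
  · rintro rfl
    exact hqz
  · rw [hq1, huniq z ((Polynomial.mem_roots hne).1 hz) hzb]

end SurfaceData

/-- Inverse Lipschitz maps between the total spaces of two tuples of roots. -/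
structure ConeMap {k k' : ℕ} (R : ℂ × ℂ → Fin k → ℂ) (R' : ℂ × ℂ → Fin k' → ℂ)
    (Φ Ψ : ℂ × ℂ × ℂ → ℂ × ℂ × ℂ) (C : ℝ) : Prop where
  maps : ∀ p ∈ rootSet R Set.univ, Φ p ∈ rootSet R' Set.univ
  left_inv : ∀ p ∈ rootSet R Set.univ, Ψ (Φ p) = p
  norm_le : ∀ p ∈ rootSet R Set.univ, ‖Φ p‖ ≤ C * ‖p‖
  lip : ∀ p ∈ rootSet R Set.univ, ∀ q ∈ rootSet R Set.univ, dist (Φ p) (Φ q) ≤ C * dist p q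

section Main

variable {k k' : ℕ} {R : ℂ × ℂ → Fin k → ℂ} {R' : ℂ × ℂ → Fin k' → ℂ} {B B' : Set ℂ}
  {Φ Ψ : ℂ × ℂ × ℂ → ℂ × ℂ × ℂ} {C C' : ℝ}

lemma ConeMap.continuousOn (f : ConeMap R R' Φ Ψ C) : ContinuousOn Φ (rootSet R Set.univ) := by
  refine LipschitzOnWith.continuousOn (K := C.toNNReal) ?_
  refine LipschitzOnWith.of_dist_le_mul fun x hx y hy => (f.lip x hx y hy).trans ?_
  gcongr
  exact Real.le_coe_toNNReal C

lemma RedData.isClosed_rootSet {m N : ℕ} {r : ℂ × ℂ → Fin N → ℂ} {H : ℂ × ℂ → Polynomial ℂ}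
    (h : SurfaceData m N k r H R B) : IsClosed (rootSet R Set.univ) := by
  rw [← isSeqClosed_iff_isClosed]
  intro u p hu hup
  have hp : (fun q : ℂ × ℂ × ℂ => (H q.2).eval q.1) p = 0 := by
    have h1 := Polynomial.tendsto_eval_of_coeff (T := ℂ × ℂ) (l := 𝓝 p.2) (P := H) (P₀ := H p.2)
      (N := m) (fun b => (h.natDegree b).le) (h.natDegree _).le
      (fun i => (h.continuous_coeff i).tendsto p.2) p.1
    have h2 : Tendsto (fun n => ((u n).2, (u n).1)) atTop (𝓝 p.2 ×ˢ 𝓝 p.1) :=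
      ((continuous_snd.tendsto p).comp hup).prodMk ((continuous_fst.tendsto p).comp hup)
    refine tendsto_nhds_unique (h1.comp h2) (tendsto_const_nhds.congr fun n => ?_)
    exact ((h.isRoot _ _).2 (hu n).2).symm
  exact ⟨trivial, (h.isRoot _ _).1 hp⟩

/-- Images of components: every component of the good part of the first cone corresponds to one
of the second. -/
lemma ConeMap.exists_component (h : RedData k R B) (h' : RedData k' R' B')
    (f : ConeMap R R' Φ Ψ C) (g : ConeMap R' R Ψ Φ C') (hcl : IsClosed (rootSet R Set.univ))
    (hcl' : IsClosed (rootSet R' Set.univ)) {p : ℂ × ℂ × ℂ} (hp : p ∈ rootSet R (goodBase B)) :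
    ∃ p₀ ∈ connectedComponentIn (rootSet R (goodBase B)) p, Φ p₀ ∈ rootSet R' (goodBase B') ∧
      Φ '' closure (connectedComponentIn (rootSet R (goodBase B)) p) =
        closure (connectedComponentIn (rootSet R' (goodBase B')) (Φ p₀)) := by
  have hGV : rootSet R (goodBase B) ⊆ rootSet R Set.univ := rootSet_mono (Set.subset_univ _)
  have hGV' : rootSet R' (goodBase B') ⊆ rootSet R' Set.univ := rootSet_mono (Set.subset_univ _)
  set W := connectedComponentIn (rootSet R (goodBase B)) p with hW
  have hWG : W ⊆ rootSet R (goodBase B) := connectedComponentIn_subset _ _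
  have hclW : closure W ⊆ rootSet R Set.univ := hcl.closure_subset_iff.2 (hWG.trans hGV)
  set Z : Set (ℂ × ℂ × ℂ) := {q | q ∈ rootSet R Set.univ ∧ (Φ q).2 ∉ goodBase B'} with hZ
  set Z' : Set (ℂ × ℂ × ℂ) := {q | q ∈ rootSet R' Set.univ ∧ (Ψ q).2 ∉ goodBase B} with hZ'
  have hT := h'.isThin_image_bad g.lip
  have hT' := h.isThin_image_bad f.lip
  obtain ⟨hc, hd⟩ := h.component_diff (p := p) (Z := Z) hT fun q hq =>
    ⟨Φ q, f.maps q hq.1, hq.2, by rw [f.left_inv q hq.1]⟩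
  have hpW : p ∈ W := mem_connectedComponentIn hp
  obtain ⟨p₀, hp₀⟩ : (W \ Z).Nonempty := by
    rw [← closure_nonempty_iff]
    exact ⟨p, hd hpW⟩
  have hgood : ∀ q ∈ W \ Z, Φ q ∈ rootSet R' (goodBase B') := by
    rintro q ⟨hq, hqZ⟩
    have hqV := hGV (hWG hq)
    exact ⟨by_contra fun hn => hqZ ⟨hqV, hn⟩, (f.maps q hqV).2⟩
  refine ⟨p₀, hp₀.1, hgood p₀ hp₀, ?_⟩
  set W' := connectedComponentIn (rootSet R' (goodBase B')) (Φ p₀) with hW'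
  have hWG' : W' ⊆ rootSet R' (goodBase B') := connectedComponentIn_subset _ _
  have hclW' : closure W' ⊆ rootSet R' Set.univ := hcl'.closure_subset_iff.2 (hWG'.trans hGV')
  obtain ⟨hc', hd'⟩ := h'.component_diff (p := Φ p₀) (Z := Z') hT' fun q hq =>
    ⟨Ψ q, g.maps q hq.1, hq.2, by rw [g.left_inv q hq.1]⟩
  have himg : Φ '' (W \ Z) ⊆ W' := by
    refine IsPreconnected.subset_connectedComponentIn ?_ ⟨p₀, hp₀, rfl⟩ ?_
    · exact hc.image _ (f.continuousOn.mono ((Set.sdiff_subset.trans hWG).trans hGV))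
    · rintro _ ⟨q, hq, rfl⟩
      exact hgood q hq
  have hp₀' : Φ p₀ ∈ W' \ Z' := by
    refine ⟨himg ⟨p₀, hp₀, rfl⟩, fun hz => hz.2 ?_⟩
    rw [f.left_inv _ (hGV (hWG hp₀.1))]
    exact (hWG hp₀.1).1
  have himg' : Ψ '' (W' \ Z') ⊆ W := by
    rw [hW, connectedComponentIn_eq hp₀.1]
    refine IsPreconnected.subset_connectedComponentIn ?_ ⟨_, hp₀', f.left_inv _ (hGV (hWG hp₀.1))⟩ ?_
    · exact hc'.image _ (g.continuousOn.mono ((Set.sdiff_subset.trans hWG').trans hGV'))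
    · rintro _ ⟨q, ⟨hq, hqZ⟩, rfl⟩
      have hqV := hGV' (hWG' hq)
      exact ⟨by_contra fun hn => hqZ ⟨hqV, hn⟩, (g.maps q hqV).2⟩
  have h1 : Φ '' closure W ⊆ closure W' := by
    have e : closure W = closure (W \ Z) :=
      (closure_minimal hd isClosed_closure).antisymm (closure_mono Set.sdiff_subset)
    rw [e]
    have := (f.continuousOn.mono (e ▸ hclW)).image_closure
    exact this.trans (closure_mono himg)
  have h2 : Ψ '' closure W' ⊆ closure W := by
    have e : closure W' = closure (W' \ Z') :=
      (closure_minimal hd' isClosed_closure).antisymm (closure_mono Set.sdiff_subset)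
    rw [e]
    have := (g.continuousOn.mono (e ▸ hclW')).image_closure
    exact this.trans (closure_mono himg')
  refine h1.antisymm fun q hq => ⟨Ψ q, h2 ⟨q, hq, rfl⟩, g.left_inv q (hclW' hq)⟩

lemma closure_component_inter {V : Set (ℂ × ℂ × ℂ)} {p : ℂ × ℂ × ℂ} (hp : p ∈ V) :
    closure (connectedComponentIn V p) ∩ V = connectedComponentIn V p := by
  refine Set.Subset.antisymm ?_ fun q hq =>
    ⟨subset_closure hq, connectedComponentIn_subset _ _ hq⟩
  exact (isPreconnected_connectedComponentIn.subset_closure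
    (Set.subset_inter subset_closure (connectedComponentIn_subset _ _))
    Set.inter_subset_left).subset_connectedComponentIn
      ⟨subset_closure (mem_connectedComponentIn hp), hp⟩ Set.inter_subset_right

lemma ConeMap.ncard_eq (h : RedData k R B) (h' : RedData k' R' B')
    (f : ConeMap R R' Φ Ψ C) (g : ConeMap R' R Ψ Φ C') (hcl : IsClosed (rootSet R Set.univ))
    (hcl' : IsClosed (rootSet R' Set.univ)) {p p' : ℂ × ℂ × ℂ}
    (hp : p ∈ rootSet R (goodBase B)) (hp' : p' ∈ rootSet R' (goodBase B'))
    (he : Φ '' closure (connectedComponentIn (rootSet R (goodBase B)) p) =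
        closure (connectedComponentIn (rootSet R' (goodBase B')) p')) {b b' : ℂ × ℂ}
    (hb : b ∈ goodBase B) (hb' : b' ∈ goodBase B') :
    {z | (z, b) ∈ connectedComponentIn (rootSet R (goodBase B)) p}.ncard =
      {z | (z, b') ∈ connectedComponentIn (rootSet R' (goodBase B')) p'}.ncard := by
  obtain ⟨d, R₁, hc, hr, hn⟩ := h.exists_coneData hp
  obtain ⟨d', R₁', hc', hr', hn'⟩ := h'.exists_coneData hp'
  rw [hn b hb, hn' b' hb']
  have hGV : rootSet R (goodBase B) ⊆ rootSet R Set.univ := rootSet_mono (Set.subset_univ _)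
  have hGV' : rootSet R' (goodBase B') ⊆ rootSet R' Set.univ := rootSet_mono (Set.subset_univ _)
  have hV : ∀ q, q ∈ Vstar R₁ ↔ q ∈ rootSet R₁ Set.univ ∧ q.2 ≠ 0 := fun q =>
    ⟨fun hq => ⟨⟨trivial, hq.2⟩, hq.1⟩, fun hq => ⟨hq.2, hq.1.2⟩⟩
  have hV' : ∀ q, q ∈ Vstar R₁' ↔ q ∈ rootSet R₁' Set.univ ∧ q.2 ≠ 0 := fun q =>
    ⟨fun hq => ⟨⟨trivial, hq.2⟩, hq.1⟩, fun hq => ⟨hq.2, hq.1.2⟩⟩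
  have hs : rootSet R₁ Set.univ ⊆ rootSet R Set.univ := by
    rw [hr]
    exact hcl.closure_subset_iff.2 ((connectedComponentIn_subset _ _).trans hGV)
  have hs' : rootSet R₁' Set.univ ⊆ rootSet R' Set.univ := by
    rw [hr']
    exact hcl'.closure_subset_iff.2 ((connectedComponentIn_subset _ _).trans hGV')
  rw [← hr, ← hr'] at he
  have hnz : ∀ q ∈ rootSet R Set.univ, (Φ q).2 = 0 → q.2 = 0 := by
    intro q hq h0
    have h1 : (Φ q).1 = 0 := h'.eq_zero (by rw [← h0]; exact f.maps q hq)
    have h2 : Φ q = 0 := Prod.ext h1 h0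
    have h3 := g.norm_le _ (f.maps q hq)
    rw [f.left_inv q hq, h2, norm_zero, mul_zero] at h3
    rw [norm_le_zero_iff.1 h3]
    rfl
  have hnz' : ∀ q ∈ rootSet R' Set.univ, (Ψ q).2 = 0 → q.2 = 0 := by
    intro q hq h0
    have h1 : (Ψ q).1 = 0 := h.eq_zero (by rw [← h0]; exact g.maps q hq)
    have h2 : Ψ q = 0 := Prod.ext h1 h0
    have h3 := f.norm_le _ (g.maps q hq)
    rw [g.left_inv q hq, h2, norm_zero, mul_zero] at h3
    rw [norm_le_zero_iff.1 h3]
    rfl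
  have hm : Set.MapsTo Φ (rootSet R₁ Set.univ) (rootSet R₁' Set.univ) := by
    rw [← he]
    exact Set.mapsTo_image _ _
  have hm' : Set.MapsTo Ψ (rootSet R₁' Set.univ) (rootSet R₁ Set.univ) := by
    rw [← he]
    rintro _ ⟨q, hq, rfl⟩
    rwa [f.left_inv q (hs hq)]
  refine hc.degree_eq_of_homeo hc' (f := Φ) (g := Ψ) ?_ ?_ ?_ ?_ ?_ ?_
  · exact f.continuousOn.mono fun q hq => hs ((hV q).1 hq).1
  · intro q hq
    rw [hV] at hq
    exact (hV' _).2 ⟨hm hq.1, fun h0 => hq.2 (hnz q (hs hq.1) h0)⟩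
  · exact g.continuousOn.mono fun q hq => hs' ((hV' q).1 hq).1
  · intro q hq
    rw [hV'] at hq
    exact (hV _).2 ⟨hm' hq.1, fun h0 => hq.2 (hnz' q (hs' hq.1) h0)⟩
  · exact fun q hq => g.left_inv q (hs' ((hV' q).1 hq).1)
  · exact fun q hq => f.left_inv q (hs ((hV q).1 hq).1)

end Main

end Multiplicity

section MultiplicityComparison

variable {m N k : ℕ} {r : ℂ × ℂ → Fin N → ℂ} {H : ℂ × ℂ → Polynomial ℂ}
    {R : ℂ × ℂ → Fin k → ℂ} {B : Set ℂ}
  {m' N' k' : ℕ} {r' : ℂ × ℂ → Fin N' → ℂ} {H' : ℂ × ℂ → Polynomial ℂ}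
    {R' : ℂ × ℂ → Fin k' → ℂ} {B' : Set ℂ}

lemma SurfaceData.rootMultiplicity_eq_of_mem_component (h : SurfaceData m N k r H R B)
    {p q : ℂ × ℂ × ℂ} (hp : p ∈ rootSet R (goodBase B))
    (hq : q ∈ connectedComponentIn (rootSet R (goodBase B)) p) :
    (H q.2).rootMultiplicity q.1 = (H p.2).rootMultiplicity p.1 := by
  refine (isPreconnected_connectedComponentIn (F := rootSet R (goodBase B)) (x := p)).constant
    (f := fun q : ℂ × ℂ × ℂ => (H q.2).rootMultiplicity q.1) (fun x hx => ?_) hq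
    (mem_connectedComponentIn hp)
  have h1 := h.eventually_rootMultiplicity_eq (connectedComponentIn_subset _ _ hx)
  exact continuousWithinAt_const.congr_of_eventuallyEq
    (nhdsWithin_mono _ (connectedComponentIn_subset _ _) h1) rfl

open scoped Classical in
lemma SurfaceData.sum_component (h : SurfaceData m N k r H R B) {p : ℂ × ℂ × ℂ}
    (hp : p ∈ rootSet R (goodBase B)) {b : ℂ × ℂ} (hb : b ∈ goodBase B) :
    ∑ j with connectedComponentIn (rootSet R (goodBase B)) (R b j, b) =
      connectedComponentIn (rootSet R (goodBase B)) p, (H b).rootMultiplicity (R b j) =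
    {z | (z, b) ∈ connectedComponentIn (rootSet R (goodBase B)) p}.ncard *
      (H p.2).rootMultiplicity p.1 := by
  have hG : ∀ j, (R b j, b) ∈ rootSet R (goodBase B) := fun j => ⟨hb, j, rfl⟩
  have hmem : ∀ j, connectedComponentIn (rootSet R (goodBase B)) (R b j, b) =
      connectedComponentIn (rootSet R (goodBase B)) p ↔
      (R b j, b) ∈ connectedComponentIn (rootSet R (goodBase B)) p := fun j =>
    ⟨fun e => e ▸ mem_connectedComponentIn (hG j), fun hj => (connectedComponentIn_eq hj).symm⟩
  have hset : {z | (z, b) ∈ connectedComponentIn (rootSet R (goodBase B)) p} =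
      ((Finset.univ.filter fun j => connectedComponentIn (rootSet R (goodBase B)) (R b j, b) =
      connectedComponentIn (rootSet R (goodBase B)) p).image (R b) : Finset ℂ) := by
    ext z
    simp only [Set.mem_ofPred_eq, Finset.coe_image, Finset.coe_filter, Finset.mem_univ, true_and,
      Set.mem_image, hmem]
    constructor
    · intro hz
      obtain ⟨-, j, hj⟩ := connectedComponentIn_subset _ _ hz
      simp only at hj
      exact ⟨j, by rwa [hj], hj⟩
    · rintro ⟨j, hj, rfl⟩
      exact hj
  rw [hset, Set.ncard_coe_finset, Finset.card_image_of_injective _ (h.red.inj b hb)]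
  refine (Finset.sum_eq_card_nsmul fun j hj => ?_).trans (smul_eq_mul _ _)
  exact h.rootMultiplicity_eq_of_mem_component hp
    (q := (R b j, b)) ((hmem j).1 (Finset.mem_filter.1 hj).2)

theorem ConeMap.multiplicity_le {Φ Ψ : ℂ × ℂ × ℂ → ℂ × ℂ × ℂ} {C C' : ℝ}
    (h : SurfaceData m N k r H R B) (h' : SurfaceData m' N' k' r' H' R' B')
    (f : ConeMap R R' Φ Ψ C) (g : ConeMap R' R Ψ Φ C')
    (hle : ∀ p ∈ rootSet R (goodBase B), Φ p ∈ rootSet R' (goodBase B') →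
      (H p.2).rootMultiplicity p.1 ≤ (H' (Φ p).2).rootMultiplicity (Φ p).1) : m ≤ m' := by
  classical
  obtain ⟨b, hb⟩ := (dense_goodBase h.red.finite).nonempty
  obtain ⟨b', hb'⟩ := (dense_goodBase h'.red.finite).nonempty
  have hcl := RedData.isClosed_rootSet h
  have hcl' := RedData.isClosed_rootSet h'
  set L : Fin k → Set (ℂ × ℂ × ℂ) := fun j =>
    connectedComponentIn (rootSet R (goodBase B)) (R b j, b) with hL
  set L' : Fin k' → Set (ℂ × ℂ × ℂ) := fun j =>
    connectedComponentIn (rootSet R' (goodBase B')) (R' b' j, b') with hL'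
  have hG : ∀ j, (R b j, b) ∈ rootSet R (goodBase B) := fun j => ⟨hb, j, rfl⟩
  have key : ∀ W, ∃ W', W ∈ Finset.univ.image L → W' ∈ Finset.univ.image L' ∧
      Φ '' closure W = closure W' ∧ ∑ j with L j = W, (H b).rootMultiplicity (R b j) ≤
        ∑ j with L' j = W', (H' b').rootMultiplicity (R' b' j) := by
    intro W
    by_cases hW : W ∈ Finset.univ.image L
    · obtain ⟨j₀, -, rfl⟩ := Finset.mem_image.1 hW
      obtain ⟨p₀, hp₀, hp₀', he⟩ := f.exists_component h.red h'.red g hcl hcl' (hG j₀)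
      have hn := f.ncard_eq h.red h'.red g hcl hcl' (hG j₀) hp₀' he hb hb'
      refine ⟨connectedComponentIn (rootSet R' (goodBase B')) (Φ p₀), fun _ => ⟨?_, he, ?_⟩⟩
      · have hfin : {z | (z, b) ∈ L j₀}.Finite := (Set.finite_range (R b)).subset fun z hz =>
          (connectedComponentIn_subset _ _ hz).2
        have h1 : {z | (z, b) ∈ L j₀}.ncard ≠ 0 := by
          exact Set.ncard_ne_zero_of_mem (mem_connectedComponentIn (hG j₀)) hfin
        have h2 := Set.nonempty_of_ncard_ne_zero (hn ▸ h1)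
        obtain ⟨z, hz⟩ := h2
        obtain ⟨-, j', hj'⟩ := connectedComponentIn_subset _ _ hz
        simp only at hj'
        subst hj'
        exact Finset.mem_image.2 ⟨j', Finset.mem_univ _, (connectedComponentIn_eq hz).symm⟩
      · have e1 := h.sum_component (hG j₀) hb
        have e2 := h'.sum_component hp₀' hb'
        rw [← hn] at e2
        refine e1.trans_le (le_trans ?_ e2.ge)
        refine Nat.mul_le_mul_left _ ?_
        rw [← h.rootMultiplicity_eq_of_mem_component (hG j₀) hp₀]
        exact hle p₀ (connectedComponentIn_subset _ _ hp₀) hp₀'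
    · exact ⟨∅, fun h => (hW h).elim⟩
  choose τ hτ using key
  have hinj : Set.InjOn τ (Finset.univ.image L : Finset _) := by
    intro W₁ h₁ W₂ h₂ h12
    have e : Φ '' closure W₁ = Φ '' closure W₂ := by
      rw [(hτ W₁ h₁).2.1, (hτ W₂ h₂).2.1, h12]
    have hs : ∀ W ∈ Finset.univ.image L, closure W ⊆ rootSet R Set.univ ∧
        closure W ∩ rootSet R (goodBase B) = W := by
      intro W hW
      obtain ⟨j, -, rfl⟩ := Finset.mem_image.1 hW
      exact ⟨hcl.closure_subset_iff.2 ((connectedComponentIn_subset _ _).trans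
        (rootSet_mono (Set.subset_univ _))), closure_component_inter (hG j)⟩
    have hI : Set.InjOn Φ (rootSet R Set.univ) := Set.LeftInvOn.injOn f.left_inv
    have e2 := (hI.image_eq_image_iff (hs W₁ h₁).1 (hs W₂ h₂).1).1 e
    rw [← (hs W₁ h₁).2, ← (hs W₂ h₂).2, e2]
  rw [← h.sum_rootMultiplicity hb, ← h'.sum_rootMultiplicity hb',
    ← Finset.sum_fiberwise_of_maps_to (g := L) (t := Finset.univ.image L)
      fun j _ => Finset.mem_image_of_mem _ (Finset.mem_univ j),
    ← Finset.sum_fiberwise_of_maps_to (g := L') (t := Finset.univ.image L')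
      fun j _ => Finset.mem_image_of_mem _ (Finset.mem_univ j)]
  calc _ ≤ ∑ W ∈ Finset.univ.image L,
        ∑ j with L' j = τ W, (H' b').rootMultiplicity (R' b' j) :=
        Finset.sum_le_sum fun W hW => (hτ W hW).2.2
    _ = ∑ W' ∈ (Finset.univ.image L).image τ,
        ∑ j with L' j = W', (H' b').rootMultiplicity (R' b' j) :=
        (Finset.sum_image (f := fun W' =>
          ∑ j with L' j = W', (H' b').rootMultiplicity (R' b' j)) hinj).symm
    _ ≤ _ := Finset.sum_le_sum_of_subset fun W' hW' => by
        obtain ⟨W, hW, rfl⟩ := Finset.mem_image.1 hW'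
        exact (hτ W hW).1

/-- The tangent cone multiplicity does not increase under bi-Lipschitz maps of germs. -/
theorem SurfaceData.multiplicity_le {φ ψ : ℂ × ℂ × ℂ → ℂ × ℂ × ℂ} {C C' : ℝ}
    (h : SurfaceData m N k r H R B) (h' : SurfaceData m' N' k' r' H' R' B')
    (hφ : LipGerm (rootSet r Set.univ) (rootSet r' Set.univ) φ ψ C)
    (hψ : LipGerm (rootSet r' Set.univ) (rootSet r Set.univ) ψ φ C') : m ≤ m' := by
  let l : Ultrafilter ℕ := hyperfilter ℕ
  have hl : (l : Filter ℕ) ≤ atTop := Nat.hyperfilter_le_atTop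
  have f := (hφ.lipFamily h.zero).mono hl
  have g := (hψ.lipFamily h'.zero).mono hl
  have hX := h.isSetLimit hl
  have hY := h'.isSetLimit hl
  obtain ⟨Φ, hΦ⟩ := f.exists_mapLimit hX
  obtain ⟨Ψ, hΨ⟩ := g.exists_mapLimit hY
  refine ConeMap.multiplicity_le (Φ := Φ) (Ψ := Ψ) (C := C) (C' := C') h h'
    ⟨hΦ.mapsTo f hX hY, hΦ.leftInvOn hΨ f hX, fun p hp => hΦ.norm_le f hX hp,
      fun p hp q hq => hΦ.dist_le f hX hp hq⟩
    ⟨hΨ.mapsTo g hY hX, hΨ.leftInvOn hΦ g hY, fun p hp => hΨ.norm_le g hY hp,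
      fun p hp q hq => hΨ.dist_le g hY hp hq⟩ fun p hp hp' => ?_
  exact SeparatedAt.le_of_coversAt f g hX (rootSet_mono (Set.subset_univ _) hp) hΦ
    ((h.separatedAt hp.1 p.1).mono hl) ((h'.coversAt hp'.1 (Φ p).1).mono hl)

end MultiplicityComparison

section PolynomialAlgebra

lemma Squarefree.map_mulEquiv {M M' : Type*} [Monoid M] [Monoid M'] (e : M ≃* M') {x : M}
    (hx : Squarefree x) : Squarefree (e x) := by
  intro y ⟨z, hz⟩
  have : IsUnit (e.symm y) := hx _ ⟨e.symm z, by simp [← map_mul, ← hz]⟩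
  simpa using this.map e

/-- A squarefree monic polynomial over an integrally closed domain of characteristic zero is
separable over the complement of a hypersurface. -/
theorem Polynomial.exists_isCoprime_map_derivative {A : Type*} [CommRing A] [IsDomain A]
    [IsIntegrallyClosed A] [CharZero A] {p : Polynomial A} (hp : p.Monic) (hsq : Squarefree p) :
    ∃ D : A, D ≠ 0 ∧ ∀ (L : Type) [Field L] (φ : A →+* L), φ D ≠ 0 → (p.map φ).Separable := by
  let K := FractionRing A
  have hinj : Function.Injective (algebraMap A K) := IsFractionRing.injective A K
  have hchar : CharZero K := charZero_of_injective_algebraMap hinj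
  have hK : Squarefree (p.map (algebraMap A K)) := by
    intro q hq
    obtain ⟨q', hq'⟩ := IsIntegrallyClosed.eq_map_mul_C_of_dvd K hp (dvd_of_mul_left_dvd hq)
    have hq0 : q ≠ 0 := ne_zero_of_dvd_ne_zero (hp.map _).ne_zero (dvd_of_mul_left_dvd hq)
    have hlc : q.leadingCoeff ≠ 0 := Polynomial.leadingCoeff_ne_zero.2 hq0
    have hqm : q'.Monic := by
      have h1 := congrArg Polynomial.leadingCoeff hq'
      rw [Polynomial.leadingCoeff_mul, Polynomial.leadingCoeff_C, mul_eq_right₀ hlc,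
        Polynomial.leadingCoeff_map_of_injective hinj] at h1
      exact hinj (h1.trans (map_one _).symm)
    have h2 : q' * q' ∣ p := by
      rw [← Polynomial.map_dvd_map _ hinj (hqm.mul hqm), Polynomial.map_mul]
      refine (mul_dvd_mul ?_ ?_).trans hq <;> exact ⟨_, hq'.symm⟩
    have h3 := (hsq q' h2).map (Polynomial.mapRingHom (algebraMap A K))
    rw [← hq']
    exact h3.mul (Polynomial.isUnit_C.2 hlc.isUnit)
  have hsep : (p.map (algebraMap A K)).Separable := PerfectField.separable_iff_squarefree.2 hK
  obtain ⟨a, b, hab⟩ := hsep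
  obtain ⟨s, hs, ha⟩ := IsLocalization.integerNormalization_spec (nonZeroDivisors A) a
  obtain ⟨t, ht, hb⟩ := IsLocalization.integerNormalization_spec (nonZeroDivisors A) b
  set a' := IsLocalization.integerNormalization (nonZeroDivisors A) a
  set b' := IsLocalization.integerNormalization (nonZeroDivisors A) b
  rw [← algebraMap_smul K, Polynomial.smul_eq_C_mul] at ha hb
  have key : Polynomial.C t * a' * p + Polynomial.C s * b' * Polynomial.derivative p =
      Polynomial.C (s * t) := by
    apply Polynomial.map_injective _ hinj
    simp only [Polynomial.map_add, Polynomial.map_mul, Polynomial.map_C, map_mul, ha, hb,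
      ← Polynomial.derivative_map]
    linear_combination (Polynomial.C (algebraMap A K s) * Polynomial.C (algebraMap A K t)) * hab
  refine ⟨s * t, mul_ne_zero (nonZeroDivisors.ne_zero hs) (nonZeroDivisors.ne_zero ht),
    fun L _ φ hφ => ?_⟩
  have key' := congrArg (Polynomial.map φ) key
  simp only [Polynomial.map_add, Polynomial.map_mul, Polynomial.map_C,
    ← Polynomial.derivative_map] at key'
  have hu : Polynomial.C (φ (s * t))⁻¹ * Polynomial.C (φ (s * t)) = 1 := by
    rw [← Polynomial.C_mul, inv_mul_cancel₀ hφ, Polynomial.C_1]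
  refine ⟨Polynomial.C (φ (s * t))⁻¹ * (Polynomial.C (φ t) * a'.map φ),
    Polynomial.C (φ (s * t))⁻¹ * (Polynomial.C (φ s) * b'.map φ), ?_⟩
  linear_combination Polynomial.C (φ (s * t))⁻¹ * key' + hu

lemma Polynomial.injective_of_separable_prod {N : ℕ} {r : Fin N → ℂ}
    (h : (∏ j, (Polynomial.X - Polynomial.C (r j))).Separable) : Function.Injective r := by
  have := Polynomial.nodup_roots h
  rw [roots_prod_X_sub_C'] at this
  exact fun i j hij => Multiset.inj_on_of_nodup_map this i (Finset.mem_univ i) j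
    (Finset.mem_univ j) hij

variable {σ : Type*}

lemma MvPolynomial.IsHomogeneous.eval_smul {p : MvPolynomial σ ℂ} {d : ℕ} (hp : p.IsHomogeneous d)
    (c : ℂ) (x : σ → ℂ) : eval (c • x) p = c ^ d * eval x p := by
  rw [eval_eq, eval_eq, Finset.mul_sum]
  refine Finset.sum_congr rfl fun i hi => ?_
  simp only [Pi.smul_apply, smul_eq_mul, mul_pow, Finset.prod_mul_distrib, Finset.prod_pow_eq_pow_sum]
  rw [hp.degree_eq_sum_deg_support hi]
  ring

lemma MvPolynomial.sum_range_homogeneousComponent {N : ℕ} (p : MvPolynomial σ ℂ)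
    (hN : p.totalDegree ≤ N) : ∑ j ∈ Finset.range (N + 1), homogeneousComponent j p = p := by
  conv_rhs => rw [← sum_homogeneousComponent p]
  symm
  refine Finset.sum_subset (Finset.range_mono (by lia)) fun j _ hj => ?_
  exact homogeneousComponent_eq_zero _ _ (by simpa using hj)

lemma tendsto_scale_pow {m j : ℕ} (h : m ≤ j) :
    Tendsto (fun n : ℕ => (n + 1 : ℂ) ^ m * ((n + 1 : ℂ)⁻¹) ^ j) atTop
      (𝓝 (if j = m then 1 else 0)) := by
  obtain ⟨e, rfl⟩ := Nat.exists_eq_add_of_le h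
  have h1 : ∀ n : ℕ, (n + 1 : ℂ) ^ m * ((n + 1 : ℂ)⁻¹) ^ (m + e) = ((n + 1 : ℂ)⁻¹) ^ e := fun n => by
    rw [pow_add, ← mul_assoc, ← mul_pow, mul_inv_cancel₀ (natCast_add_one_ne n), one_pow, one_mul]
  simp only [h1]
  have h2 : Tendsto (fun n : ℕ => (n + 1 : ℂ)⁻¹) atTop (𝓝 0) := by
    simpa using tendsto_one_div_add_atTop_nhds_zero_nat (𝕜 := ℂ)
  rcases Nat.eq_zero_or_pos e with rfl | he
  · simp
  · have := h2.pow e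
    rw [zero_pow he.ne'] at this
    simpa [he.ne'] using this

/-- Dilating a polynomial about the origin isolates its lowest homogeneous component. -/
lemma tendsto_scale_eval [Finite σ] {p : MvPolynomial σ ℂ} {d : ℕ}
    (hd : ∀ j < d, homogeneousComponent j p = 0) (x₀ : σ → ℂ) :
    Tendsto (fun q : ℕ × (σ → ℂ) => (q.1 + 1 : ℂ) ^ d * eval ((q.1 + 1 : ℂ)⁻¹ • q.2) p)
      (atTop ×ˢ 𝓝 x₀) (𝓝 (eval x₀ (homogeneousComponent d p))) := by
  set N := max p.totalDegree d
  have h1 : ∀ q : ℕ × (σ → ℂ), (q.1 + 1 : ℂ) ^ d * eval ((q.1 + 1 : ℂ)⁻¹ • q.2) p =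
      ∑ j ∈ Finset.range (N + 1), ((q.1 + 1 : ℂ) ^ d * ((q.1 + 1 : ℂ)⁻¹) ^ j) *
        eval q.2 (homogeneousComponent j p) := fun q => by
    conv_lhs => rw [← sum_range_homogeneousComponent p (le_max_left _ d)]
    rw [map_sum, Finset.mul_sum]
    refine Finset.sum_congr rfl fun j _ => ?_
    rw [(homogeneousComponent_isHomogeneous j p).eval_smul, mul_assoc]
  have h2 : eval x₀ (homogeneousComponent d p) = ∑ j ∈ Finset.range (N + 1),
      (if j = d then 1 else 0) * eval x₀ (homogeneousComponent j p) := by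
    simp [ite_mul, N]
  simp only [h1]
  rw [h2]
  refine tendsto_finsetSum _ fun j _ => ?_
  rcases lt_or_ge j d with hj | hj
  · simp [hd j hj]
  · exact ((tendsto_scale_pow hj).comp tendsto_fst).mul
      (((MvPolynomial.continuous_eval _).tendsto x₀).comp tendsto_snd)

/-- A nonzero polynomial has a nonzero homogeneous form controlling its zeros near the origin. -/
lemma exists_lowest_form [Finite σ] {p : MvPolynomial σ ℂ} (hp : p ≠ 0) :
    ∃ (d : ℕ) (l : MvPolynomial σ ℂ), l ≠ 0 ∧ l.IsHomogeneous d ∧ ∀ x₀, eval x₀ l ≠ 0 →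
      ∀ᶠ q : ℕ × (σ → ℂ) in atTop ×ˢ 𝓝 x₀, eval ((q.1 + 1 : ℂ)⁻¹ • q.2) p ≠ 0 := by
  classical
  have hex : ∃ d, homogeneousComponent d p ≠ 0 := by
    by_contra! h
    apply hp
    rw [← sum_homogeneousComponent p]
    exact Finset.sum_eq_zero fun j _ => h j
  refine ⟨Nat.find hex, _, Nat.find_spec hex, homogeneousComponent_isHomogeneous _ _,
    fun x₀ hx₀ => ?_⟩
  have := tendsto_scale_eval (p := p) (d := Nat.find hex)
    (fun j hj => not_not.1 (Nat.find_min hex hj)) x₀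
  filter_upwards [this.eventually_ne hx₀] with q hq h0
  exact hq (by rw [h0, mul_zero])

end PolynomialAlgebra

section AlgebraicSurfaces

lemma finSuccEquiv_coeff_eq_zero {n d : ℕ} {p : MvPolynomial (Fin (n + 1)) ℂ}
    (hp : p.IsHomogeneous d) {i : ℕ} (hi : d < i) : (finSuccEquiv ℂ n p).coeff i = 0 := by
  refine Polynomial.coeff_eq_zero_of_natDegree_lt (lt_of_le_of_lt ?_ hi)
  rw [natDegree_finSuccEquiv]
  exact (degreeOf_le_totalDegree p 0).trans hp.totalDegree_le

lemma finSuccEquiv_natDegree_le {n d : ℕ} {p : MvPolynomial (Fin (n + 1)) ℂ}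
    (hp : p.IsHomogeneous d) : (finSuccEquiv ℂ n p).natDegree ≤ d :=
  Polynomial.natDegree_le_iff_coeff_eq_zero.2 fun _ hi => finSuccEquiv_coeff_eq_zero hp hi

lemma finSuccEquiv_coeff_top {n d : ℕ} {p : MvPolynomial (Fin (n + 1)) ℂ}
    (hp : p.IsHomogeneous d) : (finSuccEquiv ℂ n p).coeff d =
      C (eval (Fin.cons 1 0 : Fin (n + 1) → ℂ) p) := by
  have h0 := hp.finSuccEquiv_coeff_isHomogeneous d 0 (add_zero d)
  rw [← totalDegree_zero_iff_isHomogeneous, totalDegree_eq_zero_iff_eq_C] at h0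
  have h1 : eval (0 : Fin n → ℂ) ((finSuccEquiv ℂ n p).coeff d) =
      eval (Fin.cons 1 0 : Fin (n + 1) → ℂ) p := by
    rw [eval_eq_eval_mv_eval', Polynomial.eval_eq_sum_range' (n := d + 1)
      (Nat.lt_succ_of_le (Polynomial.natDegree_map_le.trans (finSuccEquiv_natDegree_le hp))),
      Finset.sum_range_succ, Finset.sum_eq_zero, zero_add, one_pow, mul_one, Polynomial.coeff_map]
    intro i hi
    rw [Finset.mem_range] at hi
    have h2 := hp.finSuccEquiv_coeff_isHomogeneous i (d - i) (by lia)
    have h3 := h2.eval_smul 0 0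
    rw [zero_pow (by lia), zero_mul, smul_zero] at h3
    rw [Polynomial.coeff_map, h3, zero_mul]
  rw [← h1]
  conv_rhs => rw [h0, eval_C]
  exact h0

lemma exists_roots_of_squarefree_monic {p : Polynomial (MvPolynomial (Fin 2) ℂ)} (hp : p.Monic)
    (hsq : Squarefree p) {N : ℕ} (hN : p.natDegree = N) : ∃ r : (Fin 2 → ℂ) → Fin N → ℂ,
      (∀ y, p.map (eval y) = ∏ j, (Polynomial.X - Polynomial.C (r y j))) ∧
      SymContOn r Set.univ ∧ ∃ (d : ℕ) (l : MvPolynomial (Fin 2) ℂ), l ≠ 0 ∧ l.IsHomogeneous d ∧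
        ∀ x₀, eval x₀ l ≠ 0 → ∀ᶠ q : ℕ × (Fin 2 → ℂ) in atTop ×ˢ 𝓝 x₀,
          Function.Injective (r ((q.1 + 1 : ℂ)⁻¹ • q.2)) := by
  choose r hr using fun y : Fin 2 → ℂ => Polynomial.exists_eq_prod_X_sub_C (hp.map (eval y))
    ((hp.natDegree_map (eval y)).trans hN)
  refine ⟨r, hr, symContOn_roots hr fun i => ?_, ?_⟩
  · simp only [Polynomial.coeff_map]
    exact MvPolynomial.continuous_eval _
  · obtain ⟨D, hD, hsep⟩ := Polynomial.exists_isCoprime_map_derivative hp hsq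
    obtain ⟨d, l, hl, hld, hev⟩ := exists_lowest_form hD
    refine ⟨d, l, hl, hld, fun x₀ hx₀ => ?_⟩
    filter_upwards [hev x₀ hx₀] with q hq
    have := hsep ℂ (eval ((q.1 + 1 : ℂ)⁻¹ • q.2)) hq
    rw [hr] at this
    exact Polynomial.injective_of_separable_prod this

/-- A polynomial with invertible leading coefficient has the same roots as a squarefree monic one. -/
lemma exists_monic_squarefree_dvd_pow {A : Type*} [CommRing A] [IsDomain A]
    [UniqueFactorizationMonoid A] {Q : Polynomial A} (hQ : IsUnit Q.leadingCoeff) :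
    ∃ (S : Polynomial A) (n : ℕ), S.Monic ∧ Squarefree S ∧ S ∣ Q ∧ Q ∣ S ^ n := by
  have hQ0 : Q ≠ 0 := by
    rintro rfl
    simp at hQ
  obtain ⟨S, n, hS, hSQ, hQS⟩ := exists_squarefree_dvd_pow_of_ne_zero hQ0
  have hu : IsUnit S.leadingCoeff := isUnit_of_dvd_unit (Polynomial.leadingCoeff_dvd_leadingCoeff hSQ) hQ
  obtain ⟨u, hu⟩ := hu.exists_left_inv
  have hass : Associated S (Polynomial.C u * S) :=
    (associated_isUnit_mul_left_iff (Polynomial.isUnit_C.2 (IsUnit.of_mul_eq_one _ hu))).2 .rfl |>.symm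
  exact ⟨_, n, Polynomial.monic_C_mul_of_mul_leadingCoeff_eq_one hu, hass.squarefree_iff.1 hS,
    hass.dvd_iff_dvd_left.1 hSQ, (hass.pow_pow).dvd_iff_dvd_right.1 hQS⟩

/-- The linear map sending the first basis vector to `v` and the second one to itself. -/
noncomputable def baseMap (v : Fin 2 → ℂ) : ℂ × ℂ →ₗ[ℂ] (Fin 2 → ℂ) where
  toFun b := ![v 0 * b.1, v 1 * b.1 + b.2]
  map_add' a b := by
    ext i
    fin_cases i <;> simp <;> ring
  map_smul' c b := by
    ext i
    fin_cases i <;> simp <;> ring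

end AlgebraicSurfaces

section AlgebraicSurfaces

lemma continuous_baseMap (v : Fin 2 → ℂ) : Continuous (baseMap v) :=
  (baseMap v).continuous_of_finiteDimensional

lemma eval_cons_smul {n : ℕ} (c z : ℂ) (y : Fin n → ℂ) :
    (Fin.cons (c * z) (c • y) : Fin (n + 1) → ℂ) = c • (Fin.cons z y : Fin (n + 1) → ℂ) := by
  ext i
  refine Fin.cases ?_ (fun i => ?_) i <;> simp

lemma isRoot_finSuccEquiv {n d : ℕ} {p : MvPolynomial (Fin (n + 1)) ℂ} (hp : p.IsHomogeneous d)
    {c z : ℂ} {y : Fin n → ℂ} (h : ((finSuccEquiv ℂ n p).map (eval y)).IsRoot z) :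
    ((finSuccEquiv ℂ n p).map (eval (c • y))).IsRoot (c * z) := by
  rw [Polynomial.IsRoot.def, ← eval_eq_eval_mv_eval'] at h ⊢
  rw [eval_cons_smul, hp.eval_smul, h, mul_zero]

/-- Root tuples of a polynomial family with dilation invariant roots are injective as soon as they
are injective somewhere on the ray. -/
lemma injective_of_injective_smul {E : Type*} [AddCommGroup E] [Module ℂ E] {k : ℕ}
    {R : E → Fin k → ℂ} (h : ∀ l : ℂ, l ≠ 0 → ∀ b, ∀ z ∈ Set.range (R b), l * z ∈ Set.range (R (l • b)))
    {c : ℂ} (hc : c ≠ 0) {b : E} (hb : Function.Injective (R (c • b))) :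
    Function.Injective (R b) := by
  have h1 : ∀ j, ∃ i, R b i = c⁻¹ * R (c • b) j := fun j => by
    have := h c⁻¹ (inv_ne_zero hc) (c • b) _ ⟨j, rfl⟩
    rwa [inv_smul_smul₀ hc] at this
  choose σ hσ using h1
  have h2 : Function.Injective fun j => R b (σ j) := by
    intro i j hij
    simp only [hσ] at hij
    exact hb (mul_left_cancel₀ (inv_ne_zero hc) hij)
  have h3 : Function.Injective σ := fun i j hij => h2 (congrArg (R b) hij)
  exact Function.Injective.of_comp_right h2 (Finite.surjective_of_injective h3)

lemma finite_zeros_of_eval_ne_zero {l : MvPolynomial (Fin 2) ℂ} {v : Fin 2 → ℂ}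
    (hv : eval v l ≠ 0) : {t : ℂ | eval (baseMap v (1, t)) l = 0}.Finite := by
  let q : Polynomial ℂ := aeval (![Polynomial.C (v 0), Polynomial.C (v 1) + Polynomial.X]) l
  have hq : ∀ t, q.eval t = eval (baseMap v (1, t)) l := fun t => by
    have h1 : (Polynomial.evalRingHom t).comp (aeval (R := ℂ)
        ![Polynomial.C (v 0), Polynomial.C (v 1) + Polynomial.X] :
          MvPolynomial (Fin 2) ℂ →ₐ[ℂ] Polynomial ℂ).toRingHom = eval (baseMap v (1, t)) := by
      apply MvPolynomial.ringHom_ext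
      · intro r
        simp
      · intro i
        fin_cases i <;> simp [baseMap]
    exact congrFun (congrArg DFunLike.coe h1) l
  have hq0 : q ≠ 0 := by
    intro h
    apply hv
    have := hq 0
    rw [h, Polynomial.eval_zero] at this
    rw [this]
    have hv' : baseMap v (1, 0) = v := by
      ext i
      fin_cases i <;> simp [baseMap]
    rw [hv']
  refine (Polynomial.finite_setOfPred_isRoot hq0).subset fun t ht => ?_
  rw [Set.mem_ofPred_eq, Polynomial.IsRoot.def, hq]
  exact ht

lemma eval_baseMap_ne_zero {l : MvPolynomial (Fin 2) ℂ} {d : ℕ} (hl : l.IsHomogeneous d)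
    {v : Fin 2 → ℂ} {b : ℂ × ℂ}
    (hb : b ∈ goodBase {t : ℂ | eval (baseMap v (1, t)) l = 0}) : eval (baseMap v b) l ≠ 0 := by
  obtain ⟨h1, h2⟩ := hb
  have h3 : b = b.1 • ((1 : ℂ), b.2 / b.1) := by
    ext
    · simp
    · simp [mul_div_cancel₀ _ h1]
  rw [h3, map_smul, hl.eval_smul]
  exact mul_ne_zero (pow_ne_zero _ h1) h2

/-- The dilated equations, expanded along the homogeneous components of the surface. -/
lemma scaled_prod_eq {N m : ℕ} {F : ℕ → MvPolynomial (Fin 3) ℂ} (hhom : ∀ j, (F j).IsHomogeneous j)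
    {r : (Fin 2 → ℂ) → Fin N → ℂ} {a : ℂ} (hr : ∀ y, (finSuccEquiv ℂ 2
      (∑ j ∈ Finset.range (N + 1), F j)).map (eval y) =
        Polynomial.C a * ∏ j, (Polynomial.X - Polynomial.C (r y j))) (v : Fin 2 → ℂ) (n : ℕ)
    (b : ℂ × ℂ) :
    Polynomial.C (a * (n + 1 : ℂ) ^ m * ((n + 1 : ℂ)⁻¹) ^ N) *
        ∏ j, (Polynomial.X - Polynomial.C (blowRoots (fun b => r (baseMap v b)) n b j)) =
      ∑ j ∈ Finset.range (N + 1), Polynomial.C ((n + 1 : ℂ) ^ m * ((n + 1 : ℂ)⁻¹) ^ j) *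
        (finSuccEquiv ℂ 2 (F j)).map (eval (baseMap v b)) := by
  have hn := natCast_add_one_ne n
  apply Polynomial.funext
  intro z
  have h1 := congrArg (Polynomial.eval ((n + 1 : ℂ)⁻¹ * z)) (hr (baseMap v ((n + 1 : ℂ)⁻¹ • b)))
  rw [← eval_eq_eval_mv_eval', map_smul, eval_cons_smul, map_sum, Polynomial.eval_mul,
    Polynomial.eval_C, Polynomial.eval_prod] at h1
  simp only [(hhom _).eval_smul, Polynomial.eval_sub, Polynomial.eval_X, Polynomial.eval_C] at h1
  rw [Polynomial.eval_finsetSum, Polynomial.eval_mul, Polynomial.eval_C, Polynomial.eval_prod]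
  simp only [Polynomial.eval_mul, Polynomial.eval_sub, Polynomial.eval_X, Polynomial.eval_C,
    ← eval_eq_eval_mv_eval', mul_assoc, ← Finset.mul_sum, blowRoots, map_smul]
  rw [h1]
  have h2 : ∏ j, ((n + 1 : ℂ)⁻¹ * z - r ((n + 1 : ℂ)⁻¹ • baseMap v b) j) =
      ((n + 1 : ℂ)⁻¹) ^ N * ∏ j, (z - (n + 1) * r ((n + 1 : ℂ)⁻¹ • baseMap v b) j) := by
    have h3 : ((n + 1 : ℂ)⁻¹) ^ N = ∏ _j : Fin N, (n + 1 : ℂ)⁻¹ := by simp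
    rw [h3, ← Finset.prod_mul_distrib]
    refine Finset.prod_congr rfl fun j _ => ?_
    rw [mul_sub, ← mul_assoc, inv_mul_cancel₀ hn, one_mul]
  rw [h2]
  ring

end AlgebraicSurfaces

section AlgebraicSurfaces

lemma SymContOn.comp_baseMap {N : ℕ} {r : (Fin 2 → ℂ) → Fin N → ℂ} (h : SymContOn r Set.univ)
    (v : Fin 2 → ℂ) : SymContOn (fun b => r (baseMap v b)) Set.univ :=
  h.comp (f := baseMap v) (continuous_baseMap v).continuousOn fun _ _ => trivial

/-- A reduced surface in general position with respect to the first coordinate is described by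
root data, its multiplicity being the degree of the tangent cone. -/
theorem exists_surfaceData {N m : ℕ} {F : ℕ → MvPolynomial (Fin 3) ℂ}
    {f : MvPolynomial (Fin 3) ℂ} (hf : f = ∑ j ∈ Finset.range (N + 1), F j)
    (hhom : ∀ j, (F j).IsHomogeneous j) (hlow : ∀ j < m, F j = 0) (hmN : m ≤ N)
    (hN : eval (Fin.cons 1 0 : Fin 3 → ℂ) (F N) ≠ 0)
    (hm : eval (Fin.cons 1 0 : Fin 3 → ℂ) (F m) ≠ 0) (hsq : Squarefree f)
    (h0 : eval (0 : Fin 3 → ℂ) f = 0) :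
    ∃ (k : ℕ) (r : ℂ × ℂ → Fin N → ℂ) (H : ℂ × ℂ → Polynomial ℂ) (R : ℂ × ℂ → Fin k → ℂ)
      (B : Set ℂ) (v : Fin 2 → ℂ), v 0 ≠ 0 ∧ SurfaceData m N k r H R B ∧
        ∀ z b, (z, b) ∈ rootSet r Set.univ ↔
          eval (Fin.cons z (baseMap v b) : Fin 3 → ℂ) f = 0 := by
  set a := eval (Fin.cons 1 0 : Fin 3 → ℂ) (F N) with ha
  set a' := eval (Fin.cons 1 0 : Fin 3 → ℂ) (F m) with ha'
  set P := finSuccEquiv ℂ 2 f with hP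
  set Q := finSuccEquiv ℂ 2 (F m) with hQ
  have hPdeg : P.natDegree ≤ N := by
    refine Polynomial.natDegree_le_iff_coeff_eq_zero.2 fun i hi => ?_
    rw [hP, hf, map_sum, Polynomial.finsetSum_coeff]
    refine Finset.sum_eq_zero fun j hj => finSuccEquiv_coeff_eq_zero (hhom j) ?_
    rw [Finset.mem_range] at hj
    lia
  have hPtop : P.coeff N = C a := by
    rw [hP, hf, map_sum, Polynomial.finsetSum_coeff, Finset.sum_range_succ, Finset.sum_eq_zero,
      zero_add, finSuccEquiv_coeff_top (hhom N)]
    exact fun j hj => finSuccEquiv_coeff_eq_zero (hhom j) (Finset.mem_range.1 hj)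
  have hPnat : P.natDegree = N := Polynomial.natDegree_eq_of_le_of_coeff_ne_zero hPdeg
    (by rw [hPtop]; exact C_ne_zero.2 hN)
  have hQtop : Q.coeff m = C a' := finSuccEquiv_coeff_top (hhom m)
  have hQnat : Q.natDegree = m := Polynomial.natDegree_eq_of_le_of_coeff_ne_zero
    (finSuccEquiv_natDegree_le (hhom m)) (by rw [hQtop]; exact C_ne_zero.2 hm)
  have hPsq : Squarefree P := hsq.map_mulEquiv (finSuccEquiv ℂ 2).toMulEquiv
  have hainv : (C a⁻¹ * C a : MvPolynomial (Fin 2) ℂ) = 1 := by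
    rw [← C_mul, inv_mul_cancel₀ hN, C_1]
  have hPmonic : (Polynomial.C (C a⁻¹) * P).Monic := by
    refine Polynomial.monic_C_mul_of_mul_leadingCoeff_eq_one ?_
    rw [Polynomial.leadingCoeff, hPnat, hPtop, hainv]
  have hunit : IsUnit (Polynomial.C (C a⁻¹ : MvPolynomial (Fin 2) ℂ)) :=
    Polynomial.isUnit_C.2 (IsUnit.of_mul_eq_one _ hainv)
  have hPmsq : Squarefree (Polynomial.C (C a⁻¹) * P) :=
    ((associated_isUnit_mul_left_iff hunit).2 .rfl).squarefree_iff.2 hPsq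
  obtain ⟨r, hr, hrc, d, l, hl, hld, hrl⟩ := exists_roots_of_squarefree_monic hPmonic hPmsq (N := N)
    (by rw [Polynomial.natDegree_C_mul (C_ne_zero.2 (inv_ne_zero hN)), hPnat])
  obtain ⟨S, e, hS, hSsq, hSQ, hQS⟩ := exists_monic_squarefree_dvd_pow (Q := Q) (by
    rw [Polynomial.leadingCoeff, hQnat, hQtop]
    exact (IsUnit.mk0 a' hm).map C)
  obtain ⟨R, hR, hRc, d', l', hl', hld', hRl⟩ := exists_roots_of_squarefree_monic hS hSsq rfl
  have hPr : ∀ y, P.map (eval y) = Polynomial.C a * ∏ j, (Polynomial.X - Polynomial.C (r y j)) := by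
    intro y
    rw [← hr, Polynomial.map_mul, Polynomial.map_C, eval_C, ← mul_assoc, ← Polynomial.C_mul,
      mul_inv_cancel₀ hN, Polynomial.C_1, one_mul]
  have hRroot : ∀ y z, (Q.map (eval y)).IsRoot z ↔ z ∈ Set.range (R y) := by
    intro y z
    have h1 : z ∈ Set.range (R y) ↔ (S.map (eval y)).IsRoot z := by
      rw [hR, Polynomial.IsRoot.def, Polynomial.eval_prod, Finset.prod_eq_zero_iff]
      simp [sub_eq_zero, eq_comm]
    rw [h1]
    constructor
    · intro h
      have h2 := h.dvd (Polynomial.map_dvd (eval y) hQS)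
      rw [Polynomial.map_pow, Polynomial.IsRoot.def, Polynomial.eval_pow] at h2
      exact eq_zero_of_pow_eq_zero h2
    · exact fun h => h.dvd (Polynomial.map_dvd (eval y) hSQ)
  have hRhom : ∀ c : ℂ, c ≠ 0 → ∀ y, ∀ z ∈ Set.range (R y), c * z ∈ Set.range (R (c • y)) := by
    intro c _ y z hz
    rw [← hRroot] at hz ⊢
    exact isRoot_finSuccEquiv (hhom m) hz
  obtain ⟨v, hv⟩ : ∃ v : Fin 2 → ℂ, eval v (l * l' * X 0) ≠ 0 := by
    by_contra! h
    refine mul_ne_zero (mul_ne_zero hl hl') (X_ne_zero (R := ℂ) (0 : Fin 2)) (MvPolynomial.funext fun x => ?_)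
    rw [h x, map_zero]
  rw [map_mul, eval_X] at hv
  have hv0 : v 0 ≠ 0 := right_ne_zero_of_mul hv
  have hvl : eval v (l * l') ≠ 0 := left_ne_zero_of_mul hv
  set B : Set ℂ := {t : ℂ | eval (baseMap v (1, t)) (l * l') = 0} with hB
  have hgood : ∀ b ∈ goodBase B, eval (baseMap v b) l ≠ 0 ∧ eval (baseMap v b) l' ≠ 0 := by
    intro b hb
    have := eval_baseMap_ne_zero (hld.mul hld') hb
    rw [map_mul] at this
    exact ⟨left_ne_zero_of_mul this, right_ne_zero_of_mul this⟩
  have hroot : ∀ z b, (z, b) ∈ rootSet (fun b => r (baseMap v b)) Set.univ ↔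
      eval (Fin.cons z (baseMap v b) : Fin 3 → ℂ) f = 0 := by
    intro z b
    rw [eval_eq_eval_mv_eval', ← hP, hPr, Polynomial.eval_mul, Polynomial.eval_C,
      mul_eq_zero_iff_left hN, Polynomial.eval_prod, Finset.prod_eq_zero_iff]
    simp only [rootSet, Set.mem_ofPred_eq, Set.mem_univ, true_and, Set.mem_range, Finset.mem_univ,
      Polynomial.eval_sub, Polynomial.eval_X, Polynomial.eval_C, sub_eq_zero]
    exact exists_congr fun _ => eq_comm
  have hbase : ∀ b₀, Tendsto (fun q : ℕ × (ℂ × ℂ) => (q.1, baseMap v q.2)) (atTop ×ˢ 𝓝 b₀)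
      (atTop ×ˢ 𝓝 (baseMap v b₀)) := fun b₀ =>
    tendsto_id.prodMap ((continuous_baseMap v).tendsto b₀)
  refine ⟨S.natDegree, fun b => r (baseMap v b), fun b => Q.map (eval (baseMap v b)),
    fun b => R (baseMap v b), B, v, hv0, ?_, hroot⟩
  have hQb : ∀ y, (Q.map (eval y)).coeff m = a' := fun y => by
    rw [Polynomial.coeff_map, hQtop, eval_C]
  refine
    { red :=
        { cont := hRc.comp_baseMap v
          homog := fun c hc b z hz => by
            simp only [map_smul]
            exact hRhom c hc _ z hz
          finite := finite_zeros_of_eval_ne_zero hvl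
          zero_notMem := fun h => hvl ?_
          inj := fun b hb => ?_ }
      cont := hrc.comp_baseMap v
      zero := ?_
      natDegree := fun b => Polynomial.natDegree_eq_of_le_of_coeff_ne_zero
        (Polynomial.natDegree_map_le.trans hQnat.le) (by rw [hQb]; exact hm)
      ne_zero := fun b h => hm (by rw [← hQb (baseMap v b), h, Polynomial.coeff_zero])
      isRoot := fun b z => hRroot _ z
      continuous_coeff := fun i => ?_
      conv := ⟨fun n => a * (n + 1 : ℂ) ^ m * ((n + 1 : ℂ)⁻¹) ^ N, fun n => ?_, fun b₀ i => ?_⟩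
      inj := fun b₀ hb₀ => ?_ }
  · have hv' : baseMap v (1, 0) = v := by
      ext i
      fin_cases i <;> simp [baseMap]
    rw [hB, Set.mem_ofPred_eq, hv'] at h
    exact h
  · have h1 := hRl _ (hgood b hb).2
    have h2 : Tendsto (fun n : ℕ => (n, baseMap v b)) atTop (atTop ×ˢ 𝓝 (baseMap v b)) :=
      tendsto_id.prodMk tendsto_const_nhds
    obtain ⟨n, hn⟩ := (h2.eventually h1).exists
    exact injective_of_injective_smul hRhom (inv_ne_zero (natCast_add_one_ne n)) hn
  · rw [hroot, map_zero]
    convert h0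
    ext i
    refine Fin.cases ?_ (fun i => ?_) i <;> simp
  · simp only [Polynomial.coeff_map]
    exact (MvPolynomial.continuous_eval _).comp (continuous_baseMap v)
  · have := natCast_add_one_ne n
    positivity
  · have h1 := fun q : ℕ × (ℂ × ℂ) => scaled_prod_eq (m := m) hhom
      (fun y => by rw [← hf]; exact hPr y) v q.1 q.2
    simp only [h1, Polynomial.finsetSum_coeff, Polynomial.coeff_C_mul, Polynomial.coeff_map]
    have h2 : eval (baseMap v b₀) (Q.coeff i) = ∑ j ∈ Finset.range (N + 1),
        (if j = m then 1 else 0) * eval (baseMap v b₀) ((finSuccEquiv ℂ 2 (F j)).coeff i) := by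
      have : m < N + 1 := by lia
      simp [ite_mul, hQ, this]
    rw [h2]
    refine tendsto_finsetSum _ fun j _ => ?_
    rcases lt_or_ge j m with hj | hj
    · simp [hlow j hj]
    · exact ((tendsto_scale_pow hj).comp tendsto_fst).mul
        ((((MvPolynomial.continuous_eval _).comp (continuous_baseMap v)).tendsto b₀).comp
          tendsto_snd)
  · have h1 := (hbase b₀).eventually (hrl _ (hgood b₀ hb₀).1)
    simpa only [map_smul] using h1

end AlgebraicSurfaces

section GenericCoordinates

lemma homogeneousComponent_totalDegree_ne_zero {σ : Type*} {p : MvPolynomial σ ℂ} (hp : p ≠ 0) :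
    homogeneousComponent p.totalDegree p ≠ 0 := by
  obtain ⟨s, hs, hd⟩ := Finset.exists_mem_eq_sup p.support (support_nonempty.2 hp)
    fun s => s.sum fun _ e => e
  intro h
  have h1 := congrArg (coeff s) h
  have h2 : s.degree = p.totalDegree := by
    rw [totalDegree, hd]
    rfl
  rw [coeff_homogeneousComponent, if_pos h2, coeff_zero] at h1
  exact mem_support_iff.1 hs h1

/-- The linear substitution moving the first basis vector to `w`. -/
noncomputable def shearHom (w : Fin 3 → ℂ) : MvPolynomial (Fin 3) ℂ →ₐ[ℂ] MvPolynomial (Fin 3) ℂ :=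
  aeval ![C (w 0) * X 0, C (w 1) * X 0 + X 1, C (w 2) * X 0 + X 2]

/-- The linear substitution moving the first basis vector to `w`, as an automorphism. -/
noncomputable def shearEquiv (w : Fin 3 → ℂ) (hw : w 0 ≠ 0) :
    MvPolynomial (Fin 3) ℂ ≃ₐ[ℂ] MvPolynomial (Fin 3) ℂ :=
  AlgEquiv.ofAlgHom (shearHom w)
    (aeval ![C (w 0)⁻¹ * X 0, X 1 - C (w 1 * (w 0)⁻¹) * X 0, X 2 - C (w 2 * (w 0)⁻¹) * X 0])
    (by
      have h : (C (w 0)⁻¹ * C (w 0) : MvPolynomial (Fin 3) ℂ) = 1 := by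
        rw [← C_mul, inv_mul_cancel₀ hw, C_1]
      apply algHom_ext
      intro i
      fin_cases i <;> simp [shearHom, algHom_C, algebraMap_eq]
      · linear_combination X 0 * h
      · linear_combination -C (w 1) * X 0 * h
      · linear_combination -C (w 2) * X 0 * h)
    (by
      have h : (C (w 0)⁻¹ * C (w 0) : MvPolynomial (Fin 3) ℂ) = 1 := by
        rw [← C_mul, inv_mul_cancel₀ hw, C_1]
      apply algHom_ext
      intro i
      fin_cases i <;> simp [shearHom, algHom_C, algebraMap_eq]
      · linear_combination X 0 * h
      · ring
      · ring)

lemma eval_shearHom (w x : Fin 3 → ℂ) (p : MvPolynomial (Fin 3) ℂ) :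
    eval x (shearHom w p) = eval ![w 0 * x 0, w 1 * x 0 + x 1, w 2 * x 0 + x 2] p := by
  have h1 : (eval x).comp (shearHom w).toRingHom =
      eval ![w 0 * x 0, w 1 * x 0 + x 1, w 2 * x 0 + x 2] := by
    apply MvPolynomial.ringHom_ext
    · intro r
      simp [shearHom]
    · intro i
      fin_cases i <;> simp [shearHom]
  exact congrFun (congrArg DFunLike.coe h1) p

lemma isHomogeneous_shearHom {p : MvPolynomial (Fin 3) ℂ} {d : ℕ} (hp : p.IsHomogeneous d)
    (w : Fin 3 → ℂ) : (shearHom w p).IsHomogeneous d := by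
  have := hp.aeval (n := 1) (τ := Fin 3) ![C (w 0) * X 0, C (w 1) * X 0 + X 1, C (w 2) * X 0 + X 2] (by
    intro i
    fin_cases i
    · exact isHomogeneous_C_mul_X _ _
    · exact (isHomogeneous_C_mul_X _ _).add (isHomogeneous_X _ _)
    · exact (isHomogeneous_C_mul_X _ _).add (isHomogeneous_X _ _))
  rwa [one_mul] at this

/-- The linear coordinates given by `shearHom w` and `baseMap v`. -/
noncomputable def coordEquiv (w : Fin 3 → ℂ) (v : Fin 2 → ℂ) (hw : w 0 ≠ 0) (hv : v 0 ≠ 0) :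
    (ℂ × ℂ × ℂ) ≃L[ℂ] EuclideanSpace ℂ (Fin 3) :=
  LinearEquiv.toContinuousLinearEquiv
    { toFun := fun p => WithLp.toLp 2
        ![w 0 * p.1, w 1 * p.1 + v 0 * p.2.1, w 2 * p.1 + (v 1 * p.2.1 + p.2.2)]
      invFun := fun x => ((w 0)⁻¹ * x 0, (v 0)⁻¹ * (x 1 - w 1 * ((w 0)⁻¹ * x 0)),
        x 2 - w 2 * ((w 0)⁻¹ * x 0) - v 1 * ((v 0)⁻¹ * (x 1 - w 1 * ((w 0)⁻¹ * x 0))))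
      map_add' := fun p q => by
        ext i
        fin_cases i <;> simp <;> ring
      map_smul' := fun c p => by
        ext i
        fin_cases i <;> simp <;> ring
      left_inv := fun p => by
        ext
        · simp [hw]
        · simp [hw, hv]
        · simp [hw, hv]
      right_inv := fun x => by
        ext i
        fin_cases i <;> simp [hw, hv] }

/-- Every reduced surface germ in `ℂ³` is described by root data in suitable linear coordinates. -/
theorem exists_coordEquiv_surfaceData {f : MvPolynomial (Fin 3) ℂ} (hsq : Squarefree f)
    (h0 : eval (0 : Fin 3 → ℂ) f = 0) :
    ∃ (N k : ℕ) (r : ℂ × ℂ → Fin N → ℂ) (H : ℂ × ℂ → Polynomial ℂ) (R : ℂ × ℂ → Fin k → ℂ)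
      (B : Set ℂ) (A : (ℂ × ℂ × ℂ) ≃L[ℂ] EuclideanSpace ℂ (Fin 3)),
      SurfaceData (sInf {d : ℕ | homogeneousComponent d f ≠ 0}) N k r H R B ∧
        A ⁻¹' mvZeroSet f = rootSet r Set.univ := by
  have hf0 : f ≠ 0 := hsq.ne_zero
  set m := sInf {d : ℕ | homogeneousComponent d f ≠ 0} with hmdef
  set N := f.totalDegree
  have hN : homogeneousComponent N f ≠ 0 := homogeneousComponent_totalDegree_ne_zero hf0
  have hm : homogeneousComponent m f ≠ 0 :=
    Nat.sInf_mem (s := {d : ℕ | homogeneousComponent d f ≠ 0}) ⟨N, hN⟩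
  have hlow : ∀ j < m, homogeneousComponent j f = 0 := fun j hj =>
    not_not.1 (Nat.notMem_of_lt_sInf hj)
  obtain ⟨w, hw⟩ : ∃ w : Fin 3 → ℂ,
      eval w (homogeneousComponent N f * homogeneousComponent m f * X 0) ≠ 0 := by
    by_contra! h
    refine mul_ne_zero (mul_ne_zero hN hm) (X_ne_zero (R := ℂ) (0 : Fin 3))
      (MvPolynomial.funext fun x => ?_)
    rw [h x, map_zero]
  rw [map_mul, map_mul, eval_X] at hw
  have hw0 : w 0 ≠ 0 := right_ne_zero_of_mul hw
  have hwN := left_ne_zero_of_mul (left_ne_zero_of_mul hw)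
  have hwm := right_ne_zero_of_mul (left_ne_zero_of_mul hw)
  have htop : ∀ p, eval (Fin.cons 1 0 : Fin 3 → ℂ) (shearHom w p) = eval w p := by
    intro p
    rw [eval_shearHom]
    congr 2
    have h1 : (Fin.cons 1 0 : Fin 3 → ℂ) 1 = 0 := rfl
    have h2 : (Fin.cons 1 0 : Fin 3 → ℂ) 2 = 0 := rfl
    ext i
    fin_cases i <;> simp [h1, h2]
  obtain ⟨k, r, H, R, B, v, hv, hS, hroot⟩ := exists_surfaceData (N := N) (m := m)
    (F := fun j => shearHom w (homogeneousComponent j f)) (f := shearHom w f)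
    (by rw [← map_sum, sum_range_homogeneousComponent f le_rfl])
    (fun j => isHomogeneous_shearHom (homogeneousComponent_isHomogeneous j f) w)
    (fun j hj => by rw [hlow j hj, map_zero])
    (Nat.sInf_le hN) (by rwa [htop]) (by rwa [htop])
    (hsq.map_mulEquiv (shearEquiv w hw0).toMulEquiv)
    (by
      rw [eval_shearHom, ← h0]
      congr 2
      ext i
      fin_cases i <;> simp)
  refine ⟨N, k, r, H, R, B, coordEquiv w v hw0 hv, hS, ?_⟩
  ext ⟨z, b⟩
  rw [hroot, eval_shearHom]
  rfl

end GenericCoordinates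

/-- multiplicity of complex analytic surfaces in `ℂ³` is an outer
bi-Lipschitz invariant of the germ: if the germs `(V(f),0)` and `(V(g),0)` are outer
bi-Lipschitz homeomorphic then `ord₀ f = ord₀ g`. -/
theorem multiplicity_surfaces_biLipschitz_invariant
    (f g : MvPolynomial (Fin 3) ℂ)
    (hfsqf : Squarefree f) (hgsqf : Squarefree g)
    (hf0 : MvPolynomial.eval (0 : Fin 3 → ℂ) f = 0)
    (hg0 : MvPolynomial.eval (0 : Fin 3 → ℂ) g = 0)
    (hbilip : OuterBiLipGerm (mvZeroSet f) (mvZeroSet g)) :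
    sInf {d : ℕ | MvPolynomial.homogeneousComponent d f ≠ 0} =
      sInf {d : ℕ | MvPolynomial.homogeneousComponent d g ≠ 0} := by
  obtain ⟨N, k, r, H, R, B, A, hS, hA⟩ := exists_coordEquiv_surfaceData hfsqf hf0
  obtain ⟨N', k', r', H', R', B', A', hS', hA'⟩ := exists_coordEquiv_surfaceData hgsqf hg0
  obtain ⟨φ, ψ, C, C', hφ, hψ⟩ := hbilip.exists_lipGerm hf0
  obtain ⟨D, hD⟩ := hφ.conj A A'
  obtain ⟨D', hD'⟩ := hψ.conj A' A
  rw [hA, hA'] at hD hD'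
  exact le_antisymm (hS.multiplicity_le hS' hD hD') (hS'.multiplicity_le hS hD' hD)
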